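/- Let ξ = (ξ₁,ξ₂,ξ₃,ξ₄) ∈ ℝ⁴ satisfy ξ₂ξ₃ξ₄ + ξ₁ξ₃ξ₄ + ξ₁ξ₂ξ₄ + ξ₁ξ₂ξ₃ = 0, ξ₁ξ₂ξ₃ξ₄ ≠ 0, and ξᵢ + ξⱼ ≠ 0 for all i ≠ j. Then there exist constants C > 0, c > 0 and B₀ (depending only on ξ) such that for all B ≥ B₀, the number of quadruples x = (x₁,x₂,x₃,x₄) ∈ ℤ⁴ with gcd(x₁,x₂,x₃,x₄) = 1, x₂x₃x₄ + x₁x₃x₄ + x₁x₂x₄ + x₁x₂x₃ = 0, x₁x₂x₃x₄ ≠ 0, xᵢ + xⱼ ≠ 0 for all i ≠ j, |xᵢ/B − ξᵢ| ≤ C/log B for i = 1,…,4, and such that |x₁x₂x₃x₄| has at most 4 distinct prime factors, is at least c·B(log B)^{−7}. -/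

import Mathlib

section
open Complex Finset Filter Topology MeasureTheory

namespace Cayley

/-- sum of a nonprincipal character over a full block of consecutive integers vanishes -/
lemma block_sum_zero {q : ℕ} [NeZero q] {χ : DirichletCharacter ℂ q} (hχ : χ ≠ 1) (n : ℕ) :
    ∑ i ∈ range q, χ ((n + i : ℕ) : ZMod q) = 0 := by
  have h1 : ∑ a : ZMod q, χ a = 0 := MulChar.sum_eq_zero_of_ne_one hχ
  rw [← h1]
  refine Finset.sum_bij (fun i _ => ((n + i : ℕ) : ZMod q)) (fun _ _ => mem_univ _) ?_ ?_ ?_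
  · intro i hi j hj h
    rw [mem_range] at hi hj
    have : (i : ZMod q) = (j : ZMod q) := by push_cast at h; exact add_left_cancel h
    rw [ZMod.natCast_eq_natCast_iff'] at this
    rwa [Nat.mod_eq_of_lt hi, Nat.mod_eq_of_lt hj] at this
  · intro b _
    refine ⟨(b - (n : ZMod q)).val, mem_range.2 (ZMod.val_lt _), ?_⟩
    push_cast
    rw [ZMod.natCast_zmod_val]; ring
  · intros; rfl

lemma initsum_bound {q : ℕ} [NeZero q] {χ : DirichletCharacter ℂ q} (hχ : χ ≠ 1) (n : ℕ) :
    ‖∑ i ∈ range n, χ (i : ZMod q)‖ ≤ q := by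
  induction n using Nat.strong_induction_on with
  | _ n ih =>
    rcases lt_or_ge n q with h | h
    · calc ‖∑ i ∈ range n, χ (i : ZMod q)‖ ≤ ∑ i ∈ range n, (1 : ℝ) :=
            norm_sum_le_of_le _ fun i _ => DirichletCharacter.norm_le_one χ _
        _ = n := by simp
        _ ≤ q := by exact_mod_cast h.le
    · obtain ⟨m, rfl⟩ := Nat.exists_eq_add_of_le' h
      rw [Finset.sum_range_add, block_sum_zero hχ, add_zero]
      exact ih m (by have := NeZero.pos q; omega)

/-- General continuation lemma: integral representation of a tail Dirichlet series. -/
lemma tail_repr (f : ℕ → ℂ) (κ : ℂ) (N : ℕ) (hN : 1 ≤ N) (K : ℝ)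
    (hf0 : ∀ n ≤ N, f n = 0) (hf1 : ∀ n, ‖f n‖ ≤ 1)
    (hb : ∀ u : ℝ, N ≤ u → ‖∑ k ∈ Icc 1 ⌊u⌋₊, f k - κ * (u - N)‖ ≤ K)
    (Φ w v : ℂ → ℂ) (hΦ : Differentiable ℂ Φ) (hw : Differentiable ℂ w) (hv : Differentiable ℂ v)
    (hΦw : ∀ s : ℂ, 1 < s.re → Φ s = w s * LSeries f s)
    (hvw : ∀ s : ℂ, 1 < s.re → v s = w s * (κ * ((N : ℂ) ^ (1 - s) / (s - 1))))
    (s : ℂ) (hs : 0 < s.re) :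
    Φ s - v s = w s * (s * ∫ u in Set.Ioi (N : ℝ),
      (∑ k ∈ Icc 1 ⌊u⌋₊, f k - κ * (u - N)) * (u : ℂ) ^ (-(s + 1))) := by
  have hN0 : (0 : ℝ) < N := by exact_mod_cast hN
  have hN1 : (1 : ℝ) ≤ N := by exact_mod_cast hN
  set E : ℝ → ℂ := fun u => ∑ k ∈ Icc 1 ⌊u⌋₊, f k - κ * (u - N) with hE
  have hEm : Measurable E := by
    have h1 : Measurable (fun u : ℝ => ∑ k ∈ Icc 1 ⌊u⌋₊, f k) :=
      (measurable_from_nat (f := fun n : ℕ => ∑ k ∈ Icc 1 n, f k)).comp Nat.measurable_floor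
    fun_prop
  -- mellin form
  set G : ℝ → ℂ := Set.indicator (Set.Ioi (N : ℝ)) E with hG
  have hGm : Measurable G := hEm.indicator measurableSet_Ioi
  have hK0 : 0 ≤ K := (norm_nonneg _).trans (hb N le_rfl)
  have hGb : ∀ u, ‖G u‖ ≤ K := by
    intro u
    by_cases hu : u ∈ Set.Ioi (N : ℝ)
    · rw [hG, Set.indicator_of_mem hu]; exact hb u (le_of_lt hu)
    · rw [hG, Set.indicator_of_notMem hu]; simpa using hK0
  have hmel : ∀ z : ℂ, mellin G (-z) = ∫ u in Set.Ioi (N : ℝ), E u * (u : ℂ) ^ (-(z + 1)) := by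
    intro z
    rw [mellin]
    have : ∀ u : ℝ, (u : ℂ) ^ (-z - 1) • G u =
        Set.indicator (Set.Ioi (N : ℝ)) (fun u : ℝ => E u * (u : ℂ) ^ (-(z + 1))) u := by
      intro u
      by_cases hu : u ∈ Set.Ioi (N : ℝ)
      · rw [hG, Set.indicator_of_mem hu, Set.indicator_of_mem hu, smul_eq_mul, mul_comm]
        congr 2; ring
      · rw [hG, Set.indicator_of_notMem hu, Set.indicator_of_notMem hu, smul_zero]
    simp_rw [this]
    rw [setIntegral_indicator measurableSet_Ioi]
    congr 2
    rw [Set.inter_eq_right]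
    exact Set.Ioi_subset_Ioi hN0.le
  have hloc : LocallyIntegrableOn G (Set.Ioi 0) := by
    apply LocallyIntegrable.locallyIntegrableOn
    intro x
    refine ⟨Metric.ball x 1, Metric.ball_mem_nhds x one_pos, ?_⟩
    exact Measure.integrableOn_of_bounded (M := K) (measure_ball_lt_top.ne)
      hGm.aestronglyMeasurable (Eventually.of_forall hGb)
  have hmd : ∀ z : ℂ, 0 < z.re → DifferentiableAt ℂ (fun z => mellin G (-z)) z := by
    intro z hz
    have h := mellin_differentiableAt_of_isBigO_rpow (f := G) (a := 0) (b := -z.re - 1) (s := -z)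
      hloc ?_ (by simpa using hz) ?_ (by simp)
    · exact h.comp z differentiableAt_id.neg
    · refine Asymptotics.IsBigO.of_bound K (Eventually.of_forall fun u => ?_)
      simpa using hGb u
    · have : G =ᶠ[𝓝[>] 0] fun _ => 0 := by
        have : Set.Iio (N : ℝ) ∈ 𝓝[>] (0 : ℝ) := mem_nhdsWithin_of_mem_nhds (Iio_mem_nhds hN0)
        filter_upwards [this] with u hu
        rw [hG, Set.indicator_of_notMem]
        simpa using (le_of_lt hu)
      exact this.trans_isBigO (Asymptotics.isBigO_zero _ _)
  -- equality for Re > 1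
  have key : ∀ z : ℂ, 1 < z.re → Φ z - v z = w z * (z * mellin G (-z)) := by
    intro z hz
    have hz0 : z ≠ 0 := by rintro rfl; simp at hz; linarith
    have hz1 : z - 1 ≠ 0 := by
      intro h
      rw [sub_eq_zero] at h; rw [h] at hz; simp at hz
    have hsum : LSeriesSummable f z := LSeriesSummable_of_bounded_of_one_lt_re
      (m := 1) (fun n _ => hf1 n) hz
    have hO : (fun n ↦ ∑ k ∈ Icc 1 n, f k) =O[atTop] fun n : ℕ ↦ (n : ℝ) ^ (1 : ℝ) := by
      refine Asymptotics.IsBigO.of_bound 1 (Eventually.of_forall fun n => ?_)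
      calc ‖∑ k ∈ Icc 1 n, f k‖ ≤ ∑ k ∈ Icc 1 n, (1 : ℝ) := norm_sum_le_of_le _ fun i _ => hf1 i
        _ = n := by simp
        _ ≤ 1 * ‖(n : ℝ) ^ (1 : ℝ)‖ := by simp
    have h1 := LSeries_eq_mul_integral f zero_le_one hz hsum hO
    have hA0 : ∀ u : ℝ, u ≤ N → ∑ k ∈ Icc 1 ⌊u⌋₊, f k = 0 := by
      intro u hu
      refine Finset.sum_eq_zero fun k hk => hf0 k ?_
      have := (mem_Icc.1 hk).2
      exact this.trans (Nat.floor_le_of_le hu)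
    have h2 : ∫ t in Set.Ioi (1 : ℝ), (∑ k ∈ Icc 1 ⌊t⌋₊, f k) * (t : ℂ) ^ (-(z + 1))
        = ∫ t in Set.Ioi (N : ℝ), (∑ k ∈ Icc 1 ⌊t⌋₊, f k) * (t : ℂ) ^ (-(z + 1)) := by
      apply setIntegral_eq_of_subset_of_forall_sdiff_eq_zero measurableSet_Ioi
        (Set.Ioi_subset_Ioi hN1)
      intro x hx
      have : x ≤ N := by simpa using hx.2
      rw [hA0 x this, zero_mul]
    have hzre : (-(z+1)).re < -1 := by simp; linarith
    have hi1 : IntegrableOn (fun t : ℝ => (t : ℂ) ^ (-(z + 1))) (Set.Ioi (N : ℝ)) :=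
      integrableOn_Ioi_cpow_of_lt hzre hN0
    have hi2 : IntegrableOn (fun t : ℝ => (t : ℂ) ^ (-z)) (Set.Ioi (N : ℝ)) :=
      integrableOn_Ioi_cpow_of_lt (by simpa using hz) hN0
    have hiE : IntegrableOn (fun t : ℝ => E t * (t : ℂ) ^ (-(z + 1))) (Set.Ioi (N : ℝ)) := by
      refine Integrable.bdd_mul (c := K) hi1 hEm.aestronglyMeasurable ?_
      filter_upwards [ae_restrict_mem measurableSet_Ioi] with u hu
      exact hb u (le_of_lt hu)
    have h3 : ∫ t in Set.Ioi (N : ℝ), (∑ k ∈ Icc 1 ⌊t⌋₊, f k) * (t : ℂ) ^ (-(z + 1))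
        = (∫ t in Set.Ioi (N : ℝ), E t * (t : ℂ) ^ (-(z + 1))) +
          ∫ t in Set.Ioi (N : ℝ), (κ * (t : ℂ) ^ (-z) - κ * N * (t : ℂ) ^ (-(z + 1))) := by
      have hi3 : IntegrableOn (fun t : ℝ => κ * (t : ℂ) ^ (-z) - κ * N * (t : ℂ) ^ (-(z + 1)))
        (Set.Ioi (N : ℝ)) := (hi2.const_mul κ).sub (hi1.const_mul (κ * N))
      rw [← integral_add hiE hi3]
      refine setIntegral_congr_fun measurableSet_Ioi fun t ht => ?_
      have ht0 : (t : ℂ) ≠ 0 := by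
        have : (0 : ℝ) < t := hN0.trans ht
        exact_mod_cast this.ne'
      have : (t : ℂ) ^ (-z) = (t : ℂ) ^ (-(z + 1)) * t := by
        rw [show -z = -(z+1) + 1 by ring, cpow_add _ _ ht0, cpow_one]
      simp only [hE, this]
      ring
    have h4 : ∫ t in Set.Ioi (N : ℝ), (κ * (t : ℂ) ^ (-z) - κ * N * (t : ℂ) ^ (-(z + 1)))
        = κ * ((N : ℂ) ^ (1 - z) / (z - 1)) / z := by
      rw [integral_sub (hi2.const_mul κ) (hi1.const_mul (κ * N)), integral_const_mul,
        integral_const_mul, integral_Ioi_cpow_of_lt (by simpa using hz) hN0,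
        integral_Ioi_cpow_of_lt hzre hN0]
      have hNc : (N : ℂ) ≠ 0 := by exact_mod_cast hN0.ne'
      have e1 : (((N : ℝ) : ℂ)) ^ (-z + 1) = (N : ℂ) ^ (1 - z) := by
        rw [show -z + 1 = 1 - z by ring]; norm_cast
      have e2 : (((N : ℝ) : ℂ)) ^ (-(z + 1) + 1) = (N : ℂ) ^ (1 - z) / N := by
        rw [show -(z + 1) + 1 = (1 - z) - 1 by ring, cpow_sub _ _ (by exact_mod_cast hN0.ne'), cpow_one]
        norm_cast
      rw [e1, e2]
      have e3 : -z + 1 ≠ 0 := by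
        intro h; apply hz1; rw [← neg_eq_zero, ← h]; ring
      have e4 : -(z + 1) + 1 ≠ 0 := by
        intro h; apply hz0; rw [← neg_eq_zero, ← h]; ring
      field_simp
      ring
    rw [hΦw z hz, hvw z hz, h1, h2, h3, h4, hmel]
    field_simp
    ring
  have hop : IsOpen {z : ℂ | 0 < z.re} := isOpen_lt continuous_const continuous_re
  have hL : AnalyticOnNhd ℂ (fun z => Φ z - v z) {z : ℂ | 0 < z.re} :=
    (hΦ.sub hv).differentiableOn.analyticOnNhd hop
  have hR : AnalyticOnNhd ℂ (fun z => w z * (z * mellin G (-z))) {z : ℂ | 0 < z.re} := by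
    apply DifferentiableOn.analyticOnNhd _ hop
    intro z hz
    exact ((hw z).mul (differentiableAt_id.mul (hmd z hz))).differentiableWithinAt
  have hpre : IsPreconnected {z : ℂ | 0 < z.re} :=
    (convex_halfSpace_re_gt 0).isPreconnected
  have heq := hL.eqOn_of_preconnected_of_eventuallyEq hR hpre (z₀ := 2) (by simp) (by
    have : {z : ℂ | 1 < z.re} ∈ 𝓝 (2 : ℂ) :=
      (isOpen_lt continuous_const continuous_re).mem_nhds (by simp)
    filter_upwards [this] with z hz using key z hz)
  have := heq (show s ∈ {z : ℂ | 0 < z.re} from hs)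
  simp only at this
  rw [this, hmel]

lemma tail_int_bound (E : ℝ → ℂ) (N : ℕ) (hN : 1 ≤ N) (K : ℝ)
    (hb : ∀ u : ℝ, N ≤ u → ‖E u‖ ≤ K) (s : ℂ) (hs : 0 < s.re) :
    ‖∫ u in Set.Ioi (N : ℝ), E u * (u : ℂ) ^ (-(s + 1))‖ ≤ K * ((N : ℝ) ^ (-s.re) / s.re) := by
  have hN0 : (0 : ℝ) < N := by exact_mod_cast hN
  have h1 : ∫ u in Set.Ioi (N : ℝ), K * u ^ (-(s.re + 1)) = K * ((N : ℝ) ^ (-s.re) / s.re) := by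
    rw [integral_const_mul, integral_Ioi_rpow_of_lt (by linarith) hN0]
    congr 1
    rw [show -(s.re + 1) + 1 = -s.re by ring, neg_div_neg_eq]
  rw [← h1]
  apply norm_integral_le_of_norm_le
  · exact (integrableOn_Ioi_rpow_of_lt (by linarith) hN0).const_mul K
  · filter_upwards [ae_restrict_mem measurableSet_Ioi] with u hu
    have hu0 : (0 : ℝ) < u := hN0.trans hu
    rw [norm_mul, norm_cpow_eq_rpow_re_of_pos hu0]
    simp only [neg_re, add_re, one_re]
    gcongr
    exact hb u (le_of_lt hu)

end Cayley
end

section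
open Complex Finset Filter Topology MeasureTheory

namespace Cayley

lemma block_sum {q : ℕ} [NeZero q] (χ : DirichletCharacter ℂ q) (n : ℕ) :
    ∑ i ∈ range q, χ ((n + i : ℕ) : ZMod q) = ∑ a : ZMod q, χ a := by
  refine Finset.sum_bij (fun i _ => ((n + i : ℕ) : ZMod q)) (fun _ _ => mem_univ _) ?_ ?_ ?_
  · intro i hi j hj h
    rw [mem_range] at hi hj
    have : (i : ZMod q) = (j : ZMod q) := by push_cast at h; exact add_left_cancel h
    rw [ZMod.natCast_eq_natCast_iff'] at this
    rwa [Nat.mod_eq_of_lt hi, Nat.mod_eq_of_lt hj] at this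
  · intro b _
    refine ⟨(b - (n : ZMod q)).val, mem_range.2 (ZMod.val_lt _), ?_⟩
    push_cast
    rw [ZMod.natCast_zmod_val]; ring
  · intros; rfl

/-- mean value of a character -/
noncomputable def kap {q : ℕ} [NeZero q] (χ : DirichletCharacter ℂ q) : ℂ := (∑ a : ZMod q, χ a) / q

lemma kap_norm {q : ℕ} [NeZero q] (χ : DirichletCharacter ℂ q) : ‖kap χ‖ ≤ 1 := by
  have hq : (0 : ℝ) < q := by exact_mod_cast NeZero.pos q
  rw [kap, norm_div, div_le_one (by simpa using hq)]
  calc ‖∑ a : ZMod q, χ a‖ ≤ ∑ a : ZMod q, (1 : ℝ) :=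
        norm_sum_le_of_le _ fun i _ => DirichletCharacter.norm_le_one χ _
    _ = ‖(q : ℂ)‖ := by simp [ZMod.card]

lemma kap_zero {q : ℕ} [NeZero q] {χ : DirichletCharacter ℂ q} (hχ : χ ≠ 1) : kap χ = 0 := by
  rw [kap, MulChar.sum_eq_zero_of_ne_one hχ, zero_div]

lemma initsum_bound' {q : ℕ} [NeZero q] (χ : DirichletCharacter ℂ q) (n : ℕ) :
    ‖∑ i ∈ range n, χ (i : ZMod q) - kap χ * n‖ ≤ 2 * q := by
  induction n using Nat.strong_induction_on with
  | _ n ih =>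
    rcases lt_or_ge n q with h | h
    · calc ‖∑ i ∈ range n, χ (i : ZMod q) - kap χ * n‖
          = ‖∑ i ∈ range n, (χ (i : ZMod q) - kap χ)‖ := by
            rw [Finset.sum_sub_distrib]; simp [mul_comm]
        _ ≤ ∑ i ∈ range n, (2 : ℝ) :=
            norm_sum_le_of_le _ fun i _ => (norm_sub_le _ _).trans (by
              have := DirichletCharacter.norm_le_one χ (i : ZMod q)
              have := kap_norm χ
              linarith)
        _ = 2 * n := by simp [mul_comm]
        _ ≤ 2 * q := by have : (n : ℝ) ≤ q := by exact_mod_cast h.le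
                        linarith
    · obtain ⟨m, rfl⟩ := Nat.exists_eq_add_of_le' h
      have hq : (q : ℂ) ≠ 0 := by exact_mod_cast NeZero.ne q
      have h1 := ih m (by have := NeZero.pos q; omega)
      have : kap χ * q = ∑ a : ZMod q, χ a := by rw [kap]; field_simp
      rw [Finset.sum_range_add, block_sum, ← this]
      push_cast
      convert h1 using 2
      ring

/-- truncated character -/
noncomputable def ftail {q : ℕ} (χ : DirichletCharacter ℂ q) (N : ℕ) (n : ℕ) : ℂ :=
  if n ≤ N then 0 else χ (n : ZMod q)

lemma ftail_bound {q : ℕ} [NeZero q] (χ : DirichletCharacter ℂ q) (N : ℕ) (u : ℝ) (hu : (N:ℝ) ≤ u) :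
    ‖∑ k ∈ Icc 1 ⌊u⌋₊, ftail χ N k - kap χ * (u - N)‖ ≤ 5 * q := by
  have hNu : N ≤ ⌊u⌋₊ := Nat.le_floor hu
  have hu0 : 0 ≤ u := (Nat.cast_nonneg N).trans hu
  have h1 : ∑ k ∈ Icc 1 ⌊u⌋₊, ftail χ N k
      = ∑ i ∈ range (⌊u⌋₊ + 1), χ (i : ZMod q) - ∑ i ∈ range (N + 1), χ (i : ZMod q) := by
    rw [eq_sub_iff_add_eq]
    have e1 : ∑ k ∈ Icc 1 ⌊u⌋₊, ftail χ N k = ∑ i ∈ range (⌊u⌋₊ + 1), ftail χ N i := by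
      rw [Finset.sum_range_eq_add_Ico _ (Nat.succ_pos _)]
      simp only [ftail, zero_le, if_true, zero_add]
      rfl
    have e2 : ∑ i ∈ range (N + 1), χ (i : ZMod q)
        = ∑ i ∈ range (⌊u⌋₊ + 1), if i ≤ N then χ (i : ZMod q) else 0 := by
      rw [← Finset.sum_filter]
      congr 1
      ext i; simp; omega
    rw [e1, e2, ← Finset.sum_add_distrib]
    refine Finset.sum_congr rfl fun i _ => ?_
    by_cases h : i ≤ N <;> simp [ftail, h]
  have h2 := initsum_bound' χ (⌊u⌋₊ + 1)
  have h3 := initsum_bound' χ (N + 1)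
  have h4 : ‖kap χ * ((⌊u⌋₊ : ℂ) - u)‖ ≤ 1 := by
    rw [norm_mul]
    have : ‖((⌊u⌋₊ : ℂ) - u)‖ ≤ 1 := by
      have : ((⌊u⌋₊ : ℂ) - u) = (((⌊u⌋₊ : ℝ) - u : ℝ) : ℂ) := by push_cast; rfl
      rw [this, norm_real, Real.norm_eq_abs, abs_le]
      constructor <;> linarith [Nat.floor_le hu0, Nat.lt_floor_add_one u]
    exact mul_le_one₀ (kap_norm χ) (norm_nonneg _) this
  have hq : (1 : ℝ) ≤ q := by exact_mod_cast NeZero.one_le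
  rw [h1]
  have : ∑ i ∈ range (⌊u⌋₊ + 1), χ (i : ZMod q) - ∑ i ∈ range (N + 1), χ (i : ZMod q)
      - kap χ * (u - N) = (∑ i ∈ range (⌊u⌋₊ + 1), χ (i : ZMod q) - kap χ * ((⌊u⌋₊ + 1 : ℕ) : ℂ))
      - (∑ i ∈ range (N + 1), χ (i : ZMod q) - kap χ * ((N + 1 : ℕ) : ℂ))
      + kap χ * ((⌊u⌋₊ : ℂ) - u) := by push_cast; ring
  rw [this]
  refine (norm_add_le _ _).trans ((add_le_add (norm_sub_le _ _) le_rfl).trans ?_)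
  linarith

/-- partial Dirichlet sum -/
noncomputable def psum {q : ℕ} (χ : DirichletCharacter ℂ q) (N : ℕ) (s : ℂ) : ℂ :=
  ∑ n ∈ Icc 1 N, χ (n : ZMod q) * (n : ℂ) ^ (-s)

lemma psum_diff {q : ℕ} (χ : DirichletCharacter ℂ q) (N : ℕ) : Differentiable ℂ (psum χ N) := by
  unfold psum
  refine Differentiable.fun_sum fun n hn => ?_
  have : (n : ℂ) ≠ 0 := by have := (mem_Icc.1 hn).1; exact_mod_cast (by omega : n ≠ 0)
  exact (differentiable_id.neg.const_cpow (Or.inl this)).const_mul _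

lemma LSeries_ftail {q : ℕ} [NeZero q] (χ : DirichletCharacter ℂ q) (N : ℕ) (s : ℂ) (hs : 1 < s.re) :
    LSeries (ftail χ N) s = DirichletCharacter.LFunction χ s - psum χ N s := by
  rw [DirichletCharacter.LFunction_eq_LSeries χ hs]
  have hsum : LSeriesSummable (fun n : ℕ => χ (n : ZMod q)) s := LSeriesSummable_of_bounded_of_one_lt_re
      (m := 1) (fun n _ => DirichletCharacter.norm_le_one χ _) hs
  have h1 : psum χ N s = ∑ n ∈ range (N + 1), LSeries.term (fun n : ℕ => χ (n : ZMod q)) s n := by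
    rw [Finset.sum_range_eq_add_Ico _ (Nat.succ_pos _), LSeries.term_zero, zero_add, psum]
    refine Finset.sum_congr rfl fun n hn => ?_
    have : n ≠ 0 := by have := (mem_Icc.1 hn).1; omega
    rw [LSeries.term_of_ne_zero this, cpow_neg, div_eq_mul_inv]
  have h2 : HasSum (fun n => if n ∈ range (N+1) then LSeries.term (fun n : ℕ => χ (n : ZMod q)) s n else 0)
      (psum χ N s) := by
    rw [h1]
    convert hasSum_sum_of_ne_finset_zero (s := range (N+1)) (f := fun n => if n ∈ range (N+1) then LSeries.term (fun n : ℕ => χ (n : ZMod q)) s n else 0) ?_ using 1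
    · exact Finset.sum_congr rfl fun n hn => by simp only [hn, if_true]
    · intro b hb; simp only [hb, if_false]
    · infer_instance
  have h3 := hsum.hasSum.sub h2
  rw [LSeries, ← LSeries.eq_1] at *
  rw [← h3.tsum_eq, LSeries]
  congr 1; ext n
  by_cases hn0 : n = 0
  · subst hn0; simp
  · rw [LSeries.term_of_ne_zero hn0, LSeries.term_of_ne_zero hn0]
    by_cases h : n ≤ N
    · simp [ftail, h]
    · simp [ftail, h]

lemma ftail_zero {q : ℕ} (χ : DirichletCharacter ℂ q) (N n : ℕ) (h : n ≤ N) : ftail χ N n = 0 := by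
  simp [ftail, h]

lemma ftail_norm {q : ℕ} (χ : DirichletCharacter ℂ q) (N n : ℕ) : ‖ftail χ N n‖ ≤ 1 := by
  unfold ftail; split_ifs
  · simp
  · exact DirichletCharacter.norm_le_one χ _

lemma L_approx {q : ℕ} [NeZero q] {χ : DirichletCharacter ℂ q} (hχ : χ ≠ 1) (N : ℕ) (hN : 1 ≤ N)
    (s : ℂ) (hs : 0 < s.re) :
    ‖DirichletCharacter.LFunction χ s - psum χ N s‖ ≤ ‖s‖ * (5 * q * ((N : ℝ) ^ (-s.re) / s.re)) := by
  have h := tail_repr (ftail χ N) (kap χ) N hN (5 * q) (ftail_zero χ N) (ftail_norm χ N)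
    (ftail_bound χ N) (fun s => DirichletCharacter.LFunction χ s - psum χ N s) (fun _ => 1) (fun _ => 0)
    ((DirichletCharacter.differentiable_LFunction hχ).sub (psum_diff χ N))
    (by fun_prop) (by fun_prop) (fun s hs => by rw [LSeries_ftail χ N s hs, one_mul])
    (fun s hs => by rw [kap_zero hχ]; ring) s hs
  rw [sub_zero, one_mul] at h
  rw [h, norm_mul]
  gcongr
  exact tail_int_bound _ N hN _ (ftail_bound χ N) s hs

lemma triv_approx {q : ℕ} [NeZero q] (N : ℕ) (hN : 1 ≤ N)
    (s : ℂ) (hs : 0 < s.re) :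
    ‖DirichletCharacter.LFunctionTrivChar₁ q s - (s - 1) * psum (1 : DirichletCharacter ℂ q) N s
      - kap (1 : DirichletCharacter ℂ q) * (N : ℂ) ^ (1 - s)‖
      ≤ ‖s - 1‖ * (‖s‖ * (5 * q * ((N : ℝ) ^ (-s.re) / s.re))) := by
  have hNc : (N : ℂ) ≠ 0 := by exact_mod_cast (by omega : N ≠ 0)
  set χ : DirichletCharacter ℂ q := 1
  have h := tail_repr (ftail χ N) (kap χ) N hN (5 * q) (ftail_zero χ N) (ftail_norm χ N)
    (ftail_bound χ N) (fun s => DirichletCharacter.LFunctionTrivChar₁ q s - (s - 1) * psum χ N s)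
    (fun s => s - 1) (fun s => kap χ * (N : ℂ) ^ (1 - s))
    ((DirichletCharacter.differentiable_LFunctionTrivChar₁ q).sub
      ((differentiable_id.sub_const 1).mul (psum_diff χ N)))
    (by fun_prop) (((differentiable_id.const_sub 1).const_cpow (Or.inl hNc)).const_mul _)
    (fun s hs => by
      have : s ≠ 1 := by rintro rfl; simp at hs
      rw [LSeries_ftail χ N s hs, DirichletCharacter.LFunctionTrivChar₁, Function.update_of_ne this]
      simp only [DirichletCharacter.LFunctionTrivChar, χ]; ring)
    (fun s hs => by
      have : s - 1 ≠ 0 := by intro h; rw [sub_eq_zero] at h; subst h; simp at hs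
      field_simp) s hs
  rw [h, norm_mul, norm_mul]
  gcongr
  exact tail_int_bound _ N hN _ (ftail_bound χ N) s hs

end Cayley
end

section
open Complex Finset Filter Topology MeasureTheory

namespace Cayley

lemma sum_rpow_bound (ε : ℝ) (hε : 0 < ε) (hε1 : ε ≤ 1) : ∃ C : ℝ, 0 < C ∧ ∀ R : ℝ, 1 ≤ R → ∀ σ : ℝ, 1 - ε / 4 ≤ σ →
    ∑ n ∈ Icc 1 ⌈R⌉₊, (n : ℝ) ^ (-σ) ≤ C * R ^ ε := by
  refine ⟨2 * (1 + 4 / ε), by positivity, fun R hR σ hσ => ?_⟩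
  set N := ⌈R⌉₊
  have hN1 : 1 ≤ N := Nat.one_le_ceil_iff.2 (by linarith)
  have hNr : (1 : ℝ) ≤ N := by exact_mod_cast hN1
  have hN2 : (N : ℝ) ≤ 2 * R := by linarith [Nat.ceil_lt_add_one (a := R) (by linarith)]
  have h1 : ∑ n ∈ Icc 1 N, (n : ℝ) ^ (-σ) ≤ ∑ n ∈ Icc 1 N, (N : ℝ) ^ (ε / 4) * (n : ℝ)⁻¹ := by
    refine Finset.sum_le_sum fun n hn => ?_
    have hn1 : (1 : ℝ) ≤ n := by exact_mod_cast (mem_Icc.1 hn).1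
    have hnN : (n : ℝ) ≤ N := by exact_mod_cast (mem_Icc.1 hn).2
    calc (n : ℝ) ^ (-σ) ≤ (n : ℝ) ^ (ε / 4 + (-1)) :=
          Real.rpow_le_rpow_of_exponent_le hn1 (by linarith)
      _ = (n : ℝ) ^ (ε / 4) * (n : ℝ)⁻¹ := by
          rw [Real.rpow_add (by linarith), Real.rpow_neg_one]
      _ ≤ _ := by gcongr
  have h2 : ∑ n ∈ Icc 1 N, (n : ℝ)⁻¹ ≤ 1 + Real.log N := by
    have := harmonic_le_one_add_log N
    rw [harmonic_eq_sum_Icc] at this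
    push_cast at this
    exact this
  have h3 : Real.log N ≤ (N : ℝ) ^ (ε / 4) / (ε / 4) :=
    Real.log_le_rpow_div (by linarith) (by positivity)
  have h4 : (1 : ℝ) ≤ (N : ℝ) ^ (ε / 4) := Real.one_le_rpow hNr (by positivity)
  rw [← Finset.mul_sum] at h1
  calc ∑ n ∈ Icc 1 N, (n : ℝ) ^ (-σ) ≤ (N : ℝ) ^ (ε / 4) * (1 + Real.log N) := h1.trans (by gcongr)
    _ ≤ (N : ℝ) ^ (ε / 4) * ((N : ℝ) ^ (ε / 4) * (1 + 4 / ε)) := by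
        gcongr
        calc 1 + Real.log N ≤ (N : ℝ) ^ (ε / 4) + (N : ℝ) ^ (ε / 4) / (ε / 4) := by linarith
          _ = _ := by field_simp
    _ = (N : ℝ) ^ (ε / 2) * (1 + 4 / ε) := by
        rw [← mul_assoc, ← Real.rpow_add (by linarith)]; ring_nf
    _ ≤ (2 * R) ^ ε * (1 + 4 / ε) := by
        gcongr
        calc (N : ℝ) ^ (ε / 2) ≤ (N : ℝ) ^ ε := Real.rpow_le_rpow_of_exponent_le hNr (by linarith)
          _ ≤ _ := by gcongr
    _ = 2 ^ ε * ((1 + 4 / ε) * R ^ ε) := by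
        rw [Real.mul_rpow (by norm_num) (by linarith)]; ring
    _ ≤ 2 ^ (1 : ℝ) * ((1 + 4 / ε) * R ^ ε) := by
        gcongr
        norm_num
    _ = _ := by rw [Real.rpow_one]; ring

lemma psum_bound {q : ℕ} (χ : DirichletCharacter ℂ q) (N : ℕ) (s : ℂ) :
    ‖psum χ N s‖ ≤ ∑ n ∈ Icc 1 N, (n : ℝ) ^ (-s.re) := by
  refine norm_sum_le_of_le _ fun n hn => ?_
  have hn1 : 0 < n := (mem_Icc.1 hn).1
  rw [norm_mul, ← ofReal_natCast, norm_cpow_eq_rpow_re_of_pos (by exact_mod_cast hn1), neg_re]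
  exact mul_le_of_le_one_left (by positivity) (DirichletCharacter.norm_le_one χ _)

/-- common estimate for the error term -/
lemma err_bound (ε : ℝ) (hε : 0 < ε) (hε1 : ε ≤ 1) {q : ℕ} [NeZero q] (s : ℂ) (h1 : 1 - ε / 4 ≤ s.re)
    (h3 : s.re ≤ 4) : ‖s‖ * (5 * q * (((⌈(q * (2 + |s.im|) : ℝ)⌉₊ : ℕ) : ℝ) ^ (-s.re) / s.re))
      ≤ 20 * (q * (2 + |s.im|)) ^ ε := by
  have hq : (1 : ℝ) ≤ q := by exact_mod_cast NeZero.one_le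
  set R : ℝ := q * (2 + |s.im|) with hRdef
  have ht := abs_nonneg s.im
  have hR : 1 ≤ R := by nlinarith
  have hNR : R ≤ (⌈R⌉₊ : ℝ) := Nat.le_ceil R
  have hns : ‖s‖ ≤ 2 * (2 + |s.im|) := by
    refine (norm_le_abs_re_add_abs_im s).trans ?_
    rw [abs_of_nonneg (by linarith)]; linarith
  have hpow : ((⌈R⌉₊ : ℕ) : ℝ) ^ (-s.re) ≤ R ^ (-s.re) :=
    Real.rpow_le_rpow_of_nonpos (by linarith) hNR (by linarith)
  have hsre : 1 / 2 ≤ s.re := by linarith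
  calc ‖s‖ * (5 * q * (((⌈R⌉₊ : ℕ) : ℝ) ^ (-s.re) / s.re))
      ≤ (2 * (2 + |s.im|)) * (5 * q * (R ^ (-s.re) / (1 / 2))) := by gcongr
    _ = 20 * (R ^ (1 : ℝ) * R ^ (-s.re)) := by rw [Real.rpow_one, hRdef]; ring
    _ = 20 * R ^ (1 + -s.re) := by rw [Real.rpow_add (by linarith)]
    _ ≤ 20 * R ^ ε := by
        gcongr 20 * ?_
        exact Real.rpow_le_rpow_of_exponent_le hR (by linarith)

lemma L_bound (ε : ℝ) (hε : 0 < ε) (hε1 : ε ≤ 1) : ∃ C : ℝ, 0 < C ∧ ∀ (q : ℕ) [NeZero q]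
    (χ : DirichletCharacter ℂ q), χ ≠ 1 → ∀ s : ℂ, 1 - ε / 4 ≤ s.re → s.re ≤ 4 →
    ‖DirichletCharacter.LFunction χ s‖ ≤ C * (q * (2 + |s.im|)) ^ ε := by
  obtain ⟨C, hC, h⟩ := sum_rpow_bound ε hε hε1
  refine ⟨C + 20, by positivity, fun q _ χ hχ s h1 h3 => ?_⟩
  have hq : (1 : ℝ) ≤ q := by exact_mod_cast NeZero.one_le
  have ht := abs_nonneg s.im
  have hR : 1 ≤ (q * (2 + |s.im|) : ℝ) := by nlinarith
  have e1 := L_approx hχ ⌈(q * (2 + |s.im|) : ℝ)⌉₊ (Nat.one_le_ceil_iff.2 (by linarith)) s (by linarith)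
  have e2 := err_bound ε hε hε1 (q := q) s h1 h3
  have e3 := (psum_bound χ ⌈(q * (2 + |s.im|) : ℝ)⌉₊ s).trans (h _ hR s.re h1)
  have := norm_add_le (DirichletCharacter.LFunction χ s - psum χ ⌈(q * (2 + |s.im|) : ℝ)⌉₊ s)
    (psum χ ⌈(q * (2 + |s.im|) : ℝ)⌉₊ s)
  rw [sub_add_cancel] at this
  linarith

lemma triv_bound (ε : ℝ) (hε : 0 < ε) (hε1 : ε ≤ 1) : ∃ C : ℝ, 0 < C ∧ ∀ (q : ℕ) [NeZero q]
    (s : ℂ), 1 - ε / 4 ≤ s.re → s.re ≤ 4 →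
    ‖DirichletCharacter.LFunctionTrivChar₁ q s‖ ≤ C * (1 + ‖s - 1‖) * (q * (2 + |s.im|)) ^ ε := by
  obtain ⟨C, hC, h⟩ := sum_rpow_bound ε hε hε1
  refine ⟨C + 20 + 2, by positivity, fun q _ s h1 h3 => ?_⟩
  have hq : (1 : ℝ) ≤ q := by exact_mod_cast NeZero.one_le
  have ht := abs_nonneg s.im
  have hR : 1 ≤ (q * (2 + |s.im|) : ℝ) := by nlinarith
  have e1 := triv_approx (q := q) ⌈(q * (2 + |s.im|) : ℝ)⌉₊ (Nat.one_le_ceil_iff.2 (by linarith)) s (by linarith)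
  have e2 := err_bound ε hε hε1 (q := q) s h1 h3
  have e3 := (psum_bound (1 : DirichletCharacter ℂ q) ⌈(q * (2 + |s.im|) : ℝ)⌉₊ s).trans (h _ hR s.re h1)
  set R : ℝ := q * (2 + |s.im|)
  have hN1 : (1 : ℝ) ≤ (⌈R⌉₊ : ℝ) := hR.trans (Nat.le_ceil R)
  have e4 : ‖kap (1 : DirichletCharacter ℂ q) * ((⌈R⌉₊ : ℕ) : ℂ) ^ (1 - s)‖ ≤ 2 * R ^ ε := by
    rw [norm_mul, ← ofReal_natCast, norm_cpow_eq_rpow_re_of_pos (by linarith)]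
    refine (mul_le_of_le_one_left (by positivity) (kap_norm _)).trans ?_
    calc ((⌈R⌉₊ : ℕ) : ℝ) ^ (1 - s).re ≤ ((⌈R⌉₊ : ℕ) : ℝ) ^ ε :=
          Real.rpow_le_rpow_of_exponent_le hN1 (by simp; linarith)
      _ ≤ (2 * R) ^ ε := by
          gcongr
          linarith [Nat.ceil_lt_add_one (a := R) (by linarith)]
      _ = 2 ^ ε * R ^ ε := Real.mul_rpow (by norm_num) (by linarith)
      _ ≤ 2 ^ (1 : ℝ) * R ^ ε := by
          gcongr
          norm_num
      _ = _ := by rw [Real.rpow_one]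
  have hRe : 0 ≤ R ^ ε := by positivity
  have e5 : ‖DirichletCharacter.LFunctionTrivChar₁ q s‖ ≤ ‖s - 1‖ * (20 * R ^ ε) + ‖s - 1‖ * (C * R ^ ε) + 2 * R ^ ε := by
    calc ‖DirichletCharacter.LFunctionTrivChar₁ q s‖
        = ‖(DirichletCharacter.LFunctionTrivChar₁ q s - (s - 1) * psum (1 : DirichletCharacter ℂ q) ⌈R⌉₊ s
      - kap (1 : DirichletCharacter ℂ q) * ((⌈R⌉₊ : ℕ) : ℂ) ^ (1 - s)) +
        (s - 1) * psum (1 : DirichletCharacter ℂ q) ⌈R⌉₊ s + kap (1 : DirichletCharacter ℂ q) * ((⌈R⌉₊ : ℕ) : ℂ) ^ (1 - s)‖ := by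
          congr 1; ring
      _ ≤ _ := norm_add₃_le
      _ ≤ _ := by
        refine add_le_add (add_le_add (e1.trans ?_) ?_) e4
        · gcongr
        · rw [norm_mul]; gcongr
  refine e5.trans ?_
  have := norm_nonneg (s - 1)
  nlinarith [mul_nonneg this hRe, mul_nonneg hC.le hRe]

end Cayley
end

section
open Complex Finset Filter Topology MeasureTheory ArithmeticFunction

namespace Cayley
open scoped ComplexOrder
open DirichletCharacter

/-- arithmetic function of a character -/
noncomputable def Xf {q : ℕ} (χ : DirichletCharacter ℂ q) : ArithmeticFunction ℂ :=
  toArithmeticFunction (χ ·)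

lemma Xf_apply {q : ℕ} (χ : DirichletCharacter ℂ q) {n : ℕ} (hn : n ≠ 0) : Xf χ n = χ (n : ZMod q) := by
  simp [Xf, toArithmeticFunction, hn]

noncomputable def a4 {q : ℕ} (χ ψ : DirichletCharacter ℂ q) : ArithmeticFunction ℂ :=
  zetaMul χ * (Xf ψ * Xf (χ * ψ))

lemma a4_comm {q : ℕ} (χ ψ : DirichletCharacter ℂ q) : a4 χ ψ = a4 ψ χ := by
  unfold a4 zetaMul
  rw [mul_comm ψ χ]
  change ((zeta : ArithmeticFunction ℂ) * Xf χ) * _ = ((zeta : ArithmeticFunction ℂ) * Xf ψ) * _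
  ring

lemma a4_mult {q : ℕ} (χ ψ : DirichletCharacter ℂ q) : (a4 χ ψ).IsMultiplicative := by
  unfold a4
  exact (isMultiplicative_zetaMul χ).mul ((isMultiplicative_toArithmeticFunction ψ).mul
    (isMultiplicative_toArithmeticFunction (χ * ψ)))

lemma Xmul_apply {q : ℕ} (χ ψ : DirichletCharacter ℂ q) {n : ℕ} (hn : n ≠ 0) :
    (Xf ψ * Xf (χ * ψ)) n = ψ (n : ZMod q) * zetaMul χ n := by
  rw [zetaMul, ArithmeticFunction.mul_apply, ArithmeticFunction.mul_apply, Finset.mul_sum]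
  refine Finset.sum_congr rfl fun x hx => ?_
  obtain ⟨h1, h2⟩ := Nat.mem_divisorsAntidiagonal.1 hx
  have hx1 : x.1 ≠ 0 := by rintro h; rw [h] at h1; simp at h1; omega
  have hx2 : x.2 ≠ 0 := by rintro h; rw [h] at h1; simp at h1; omega
  rw [Xf_apply _ hx1, Xf_apply _ hx2, ← h1]
  change _ = _ * ((zeta : ArithmeticFunction ℂ) x.1 * Xf χ x.2)
  rw [Xf_apply _ hx2, natCoe_apply, zeta_apply_ne hx1]
  push_cast
  rw [MulChar.mul_apply, map_mul]
  ring

lemma zetaMul_neg {q : ℕ} (χ : DirichletCharacter ℂ q) {p : ℕ} (hp : p.Prime) (h : χ (p : ZMod q) = -1) (k : ℕ) :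
    zetaMul χ (p ^ k) = if Even k then 1 else 0 := by
  change ((zeta : ArithmeticFunction ℂ) * Xf χ) (p ^ k) = _
  rw [coe_zeta_mul_apply, Nat.sum_divisors_prime_pow hp]
  have : ∀ j ∈ range (k + 1), Xf χ (p ^ j) = (-1) ^ j := fun j _ => by
    rw [Xf_apply _ (pow_ne_zero _ hp.ne_zero)]; push_cast; rw [map_pow, h]
  rw [Finset.sum_congr rfl this, neg_one_geom_sum]
  simp only [Nat.even_add_one]
  by_cases hk : Even k <;> simp [hk]

lemma a4_pp {q : ℕ} {χ ψ : DirichletCharacter ℂ q} (hχ : χ ^ 2 = 1) (hψ : ψ ^ 2 = 1) {p : ℕ} (hp : p.Prime)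
    (k : ℕ) : 0 ≤ a4 χ ψ (p ^ k) := by
  have hquad := MulChar.isQuadratic_iff_sq_eq_one.mpr hψ p
  by_cases h : ψ (p : ZMod q) = -1
  · rw [a4_comm, a4, ArithmeticFunction.mul_apply]
    refine Finset.sum_nonneg fun x hx => ?_
    obtain ⟨h1, h2⟩ := Nat.mem_divisorsAntidiagonal.1 hx
    obtain ⟨j, hj, hj'⟩ := (Nat.dvd_prime_pow hp).1 (Dvd.intro_left _ h1)
    have hx2 : x.2 ≠ 0 := by rw [hj']; exact pow_ne_zero _ hp.ne_zero
    rw [Xmul_apply _ _ hx2, hj', zetaMul_neg ψ hp h]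
    refine mul_nonneg (zetaMul_nonneg hψ _) ?_
    split_ifs with he
    · obtain ⟨i, rfl⟩ := he
      rw [mul_one]
      push_cast
      rw [map_pow]
      rcases MulChar.isQuadratic_iff_sq_eq_one.mpr hχ p with h | h | h <;> rw [h]
      · exact pow_nonneg le_rfl _
      · simp
      · rw [Even.neg_one_pow ⟨i, rfl⟩]; simp
    · simp
  · rw [a4, ArithmeticFunction.mul_apply]
    refine Finset.sum_nonneg fun x hx => ?_
    obtain ⟨h1, h2⟩ := Nat.mem_divisorsAntidiagonal.1 hx
    obtain ⟨j, hj, hj'⟩ := (Nat.dvd_prime_pow hp).1 (Dvd.intro_left _ h1)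
    have hx2 : x.2 ≠ 0 := by rw [hj']; exact pow_ne_zero _ hp.ne_zero
    rw [Xmul_apply _ _ hx2]
    refine mul_nonneg (zetaMul_nonneg hχ _) (mul_nonneg ?_ (zetaMul_nonneg hχ _))
    rw [hj']; push_cast; rw [map_pow]
    rcases hquad with h' | h' | h'
    · rw [h']; exact pow_nonneg le_rfl _
    · rw [h']; simp
    · exact absurd h' h

lemma a4_nonneg {q : ℕ} {χ ψ : DirichletCharacter ℂ q} (hχ : χ ^ 2 = 1) (hψ : ψ ^ 2 = 1) (n : ℕ) :
    0 ≤ a4 χ ψ n := by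
  rcases eq_or_ne n 0 with rfl | hn
  · simp only [ArithmeticFunction.map_zero, le_refl]
  · rw [(a4_mult χ ψ).multiplicative_factorization _ hn]
    exact Finset.prod_nonneg
        fun p hp ↦ a4_pp hχ hψ (Nat.prime_of_mem_primeFactors hp) _

lemma Xf_summable {q : ℕ} (χ : DirichletCharacter ℂ q) {s : ℂ} (hs : 1 < s.re) : LSeriesSummable (Xf χ) s :=
  LSeriesSummable_of_bounded_of_one_lt_re (m := 1) (fun n hn ↦ by
    rw [Xf_apply _ hn]; exact norm_le_one χ _) hs

lemma Xf_LSeries {q : ℕ} [NeZero q] (χ : DirichletCharacter ℂ q) {s : ℂ} (hs : 1 < s.re) :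
    LSeries (Xf χ) s = LFunction χ s := by
  rw [χ.LFunction_eq_LSeries hs]
  exact LSeries_congr (fun h => Xf_apply χ h) s

lemma a4_summable {q : ℕ} (χ ψ : DirichletCharacter ℂ q) {s : ℂ} (hs : 1 < s.re) :
    LSeriesSummable (a4 χ ψ) s :=
  LSeriesSummable_mul (LSeriesSummable_zetaMul χ hs)
    (LSeriesSummable_mul (Xf_summable ψ hs) (Xf_summable (χ * ψ) hs))

lemma a4_LSeries {q : ℕ} [NeZero q] (χ ψ : DirichletCharacter ℂ q) {s : ℂ} (hs : 1 < s.re) :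
    LSeries (a4 χ ψ) s = riemannZeta s * (LFunction χ s * LFunction ψ s * LFunction (χ * ψ) s) := by
  rw [a4, LSeries_mul' (LSeriesSummable_zetaMul χ hs)
    (LSeriesSummable_mul (Xf_summable ψ hs) (Xf_summable (χ * ψ) hs)),
    LSeries_mul' (Xf_summable ψ hs) (Xf_summable (χ * ψ) hs), Xf_LSeries _ hs, Xf_LSeries _ hs]
  have hz : LSeriesSummable (zeta : ArithmeticFunction ℂ) s :=
    LSeriesSummable_of_bounded_of_one_lt_re (m := 1) (fun n hn ↦ by
      rw [natCoe_apply, zeta_apply_ne hn]; simp) hs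
  have hz2 : LSeries (zeta : ArithmeticFunction ℂ) s = riemannZeta s := by
    rw [← LSeries_zeta_eq_riemannZeta hs]
    exact LSeries_congr (fun _ => by rw [natCoe_apply]) s
  have : LSeries (zetaMul χ) s = riemannZeta s * LFunction χ s := by
    change LSeries ⇑((zeta : ArithmeticFunction ℂ) * Xf χ) s = _
    rw [LSeries_mul' hz (Xf_summable χ hs), hz2, Xf_LSeries _ hs]
  rw [this]; ring

lemma a4_absc {q : ℕ} (χ ψ : DirichletCharacter ℂ q) {x : ℝ} (hx : 1 < x) :
    LSeries.abscissaOfAbsConv (a4 χ ψ) < x := by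
  refine lt_of_le_of_lt (LSeries.abscissaOfAbsConv_le_of_forall_lt_LSeriesSummable (x := 1) fun y hy => ?_)
    (by exact_mod_cast hx)
  exact a4_summable χ ψ (by simpa using hy)

lemma a4_two {q : ℕ} {χ ψ : DirichletCharacter ℂ q} (hχ : χ ^ 2 = 1) (hψ : ψ ^ 2 = 1) :
    1 ≤ (LSeries (a4 χ ψ) 2).re := by
  have h := (a4_summable χ ψ (s := 2) (by simp)).hasSum
  have h2 := hasSum_re h
  rw [LSeries]
  have h1 : (LSeries.term (a4 χ ψ) 2 1).re = 1 := by
    rw [LSeries.term_of_ne_zero one_ne_zero, (a4_mult χ ψ).1]; simp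
  rw [← h1]
  refine le_hasSum h2 1 fun n _ => ?_
  have := LSeries.term_nonneg (a4_nonneg hχ hψ n) 2
  exact (Complex.le_def.1 this).1

end Cayley
end

section
open Complex Finset Filter Topology MeasureTheory ArithmeticFunction

namespace Cayley
open scoped ComplexOrder Nat
open DirichletCharacter

lemma iterDeriv_inv_sub (k : ℕ) : iteratedDeriv k (fun s : ℂ => (s - 1)⁻¹) 2 = (-1) ^ k * (k ! : ℂ) := by
  have h := congrFun (iteratedDeriv_comp_sub_const k (fun s : ℂ => s⁻¹) (1 : ℂ)) 2
  rw [h, iteratedDeriv_eq_iterate]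
  have := iter_deriv_inv k ((2 : ℂ) - 1)
  change deriv^[k] Inv.inv _ = _
  rw [this]
  norm_num

lemma est_general {a : ℕ → ℂ} (ha : 0 ≤ a) (habs : LSeries.abscissaOfAbsConv a < (2 : ℝ))
    (ha2 : 1 ≤ (LSeries a 2).re) (Z : ℂ → ℂ) (hZ : Differentiable ℂ Z) (lam : ℂ)
    (hZa : ∀ s : ℂ, 1 < s.re → Z s = LSeries a s - lam * (s - 1)⁻¹) (M : ℝ)
    (hM : ∀ z ∈ Metric.sphere (2 : ℂ) (5 / 4), ‖Z z‖ ≤ M) (s : ℝ) (hs : 15 / 16 ≤ s) (hs1 : s < 1)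
    (m : ℕ) (hm : 1 ≤ m) :
    1 - lam.re * (((2 - s) ^ m - 1) / (1 - s)) - M * (17 / 20) ^ m * (20 / 3) ≤ (Z s).re := by
  have hM0 : 0 ≤ M := by
    refine (norm_nonneg _).trans (hM (2 + (5/4 : ℝ)) ?_)
    rw [mem_sphere_iff_norm, add_sub_cancel_left, norm_real]; norm_num
  set y : ℝ := 2 - s with hy
  -- Taylor terms
  set T : ℕ → ℂ := fun n => (n ! : ℂ)⁻¹ • ((s : ℂ) - 2) ^ n • iteratedDeriv n Z 2 with hT
  have hsum : HasSum T (Z s) := hasSum_taylorSeries_of_entire hZ 2 s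
  have hder : ∀ k, iteratedDeriv k Z 2 = iteratedDeriv k (LSeries a) 2 - lam * ((-1) ^ k * (k ! : ℂ)) := by
    intro k
    have he : Z =ᶠ[𝓝 (2 : ℂ)] fun s => LSeries a s - lam * (s - 1)⁻¹ := by
      have : {z : ℂ | 1 < z.re} ∈ 𝓝 (2 : ℂ) :=
        (isOpen_lt continuous_const continuous_re).mem_nhds (by simp)
      filter_upwards [this] with z hz using hZa z hz
    rw [he.iteratedDeriv_eq k]
    have hA : AnalyticAt ℂ (LSeries a) 2 :=
      LSeries_analyticOnNhd a 2 (by simpa using habs)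
    have hB : AnalyticAt ℂ (fun s : ℂ => lam * (s - 1)⁻¹) 2 := by
      refine analyticAt_const.mul ((analyticAt_id.sub analyticAt_const).inv ?_)
      norm_num
    rw [iteratedDeriv_fun_sub hA.contDiffAt hB.contDiffAt, iteratedDeriv_const_mul_field,
      iterDeriv_inv_sub]
  have hTre : ∀ k, (T k).re = y ^ k * (((k ! : ℝ))⁻¹ * ((-1) ^ k * iteratedDeriv k (LSeries a) 2).re - lam.re) := by
    intro k
    have hk : (k ! : ℂ) ≠ 0 := by exact_mod_cast Nat.factorial_ne_zero k
    have h1 : T k = ((y ^ k : ℝ) : ℂ) * ((((k ! : ℝ))⁻¹ : ℝ) * ((-1) ^ k * iteratedDeriv k (LSeries a) 2) - lam) := by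
      simp only [hT, hder, smul_eq_mul]
      have : ((s : ℂ) - 2) ^ k = (-1) ^ k * (y : ℂ) ^ k := by
        rw [← mul_pow]; congr 1; rw [hy]; push_cast; ring
      rw [this]
      push_cast
      have h2 : ((-1 : ℂ) ^ k) * (-1) ^ k = 1 := by rw [← mul_pow]; simp
      field_simp
      linear_combination (-((y:ℂ)^k * lam * (k ! : ℂ))) * h2
    rw [h1, re_ofReal_mul, sub_re, re_ofReal_mul]
  have hα : ∀ k, 0 ≤ ((k ! : ℝ))⁻¹ * ((-1) ^ k * iteratedDeriv k (LSeries a) 2).re := by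
    intro k
    have := LSeries.iteratedDeriv_alternating ha habs k
    have h2 := (Complex.le_def.1 this).1
    simp only [ofReal_ofNat] at h2
    exact mul_nonneg (by positivity) h2
  have hα0 : 1 ≤ ((0 ! : ℝ))⁻¹ * ((-1) ^ 0 * iteratedDeriv 0 (LSeries a) 2).re := by
    simpa using ha2
  have hTn : ∀ k, ‖T k‖ ≤ M * (17 / 20) ^ k := by
    intro k
    have h1 := norm_iteratedDeriv_le_of_forall_mem_sphere_norm_le k (by norm_num : (0:ℝ) < 5/4)
      hZ.diffContOnCl hM
    have hk : (0 : ℝ) < (k ! : ℝ) := by exact_mod_cast Nat.factorial_pos k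
    have h2 : ‖(s : ℂ) - 2‖ ≤ 17 / 16 := by
      have : (s : ℂ) - 2 = ((s - 2 : ℝ) : ℂ) := by push_cast; rfl
      rw [this, norm_real, Real.norm_eq_abs, abs_le]; constructor <;> linarith
    calc ‖T k‖ = ((k ! : ℝ))⁻¹ * (‖(s : ℂ) - 2‖ ^ k * ‖iteratedDeriv k Z 2‖) := by
          simp only [hT, norm_smul, norm_inv, Complex.norm_natCast, norm_pow]
      _ ≤ ((k ! : ℝ))⁻¹ * ((17 / 16) ^ k * (k ! * M / (5 / 4) ^ k)) := by gcongr
      _ = M * ((17 / 16) ^ k / (5 / 4) ^ k) := by field_simp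
      _ = _ := by rw [← div_pow]; norm_num
  have hre := hasSum_re hsum
  have hsplit := hre.summable.sum_add_tsum_nat_add m
  rw [hre.tsum_eq] at hsplit
  have htail : ∀ k, ‖(T (k + m)).re‖ ≤ M * (17 / 20) ^ m * (17 / 20) ^ k := fun k =>
    (abs_re_le_norm _).trans ((hTn _).trans (by rw [pow_add]; exact le_of_eq (by ring)))
  have hg : HasSum (fun k : ℕ => M * (17 / 20) ^ m * (17 / 20 : ℝ) ^ k) (M * (17 / 20) ^ m * (20 / 3)) := by
    have := (hasSum_geometric_of_lt_one (r := (17 / 20 : ℝ)) (by norm_num) (by norm_num)).mul_left (M * (17 / 20) ^ m)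
    rwa [show (1 - 17/20 : ℝ)⁻¹ = 20/3 by norm_num] at this
  have htl := tsum_of_norm_bounded hg htail
  have htl' := (abs_le.1 htl).1
  have hmain : 1 - lam.re * ((y ^ m - 1) / (1 - s)) ≤ ∑ k ∈ range m, (T k).re := by
    have hgs : ∑ k ∈ range m, y ^ k = (y ^ m - 1) / (1 - s) := by
      rw [geom_sum_eq (by rw [hy]; linarith)]; congr 1; rw [hy]; ring
    rw [← hgs, Finset.mul_sum]
    simp_rw [hTre, mul_sub]
    rw [Finset.sum_sub_distrib]
    have h1 : 1 ≤ ∑ k ∈ range m, y ^ k * (((k ! : ℝ))⁻¹ * ((-1) ^ k * iteratedDeriv k (LSeries a) 2).re) := by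
      refine le_trans ?_ (Finset.single_le_sum (f := fun k => y ^ k * (((k ! : ℝ))⁻¹ * ((-1) ^ k * iteratedDeriv k (LSeries a) 2).re)) (fun k _ => mul_nonneg (pow_nonneg (by rw [hy]; linarith) _) (hα k)) (mem_range.2 hm))
      simpa using ha2
    have h2 : ∑ k ∈ range m, lam.re * y ^ k = ∑ k ∈ range m, y ^ k * lam.re :=
      Finset.sum_congr rfl fun k _ => mul_comm _ _
    linarith
  change _ ≤ (reCLM (Z s))
  have h9 : (fun i => (reCLM (T i))) = fun i => (T i).re := rfl
  simp only [reCLM_apply] at hsplit ⊢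
  linarith

/-- `h = (s-1) ζ(s)` -/
noncomputable abbrev hz : ℂ → ℂ := LFunctionTrivChar₁ 1

lemma hz_one : hz 1 = 1 := by simp [hz, LFunctionTrivChar₁]

lemma hz_ne {s : ℂ} (hs : s ≠ 1) : hz s = (s - 1) * riemannZeta s := by
  simp [hz, LFunctionTrivChar₁, hs]

lemma estermann : ∃ c : ℝ, 0 < c ∧ ∀ (q : ℕ) [NeZero q] (χ ψ : DirichletCharacter ℂ q), χ ^ 2 = 1 → ψ ^ 2 = 1 →
    χ ≠ 1 → ψ ≠ 1 → χ * ψ ≠ 1 → ∀ s : ℝ, 15 / 16 ≤ s → s < 1 →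
    (riemannZeta s * (LFunction χ s * LFunction ψ s * LFunction (χ * ψ) s)).re ≤ 0 →
    c * (1 - s) * (q : ℝ) ^ (-(30 * (1 - s))) ≤ ‖LFunction χ 1 * LFunction ψ 1 * LFunction (χ * ψ) 1‖ := by
  obtain ⟨C1, hC1, hL⟩ := L_bound 1 one_pos le_rfl
  obtain ⟨C2, hC2, hT⟩ := triv_bound 1 one_pos le_rfl
  set C0 : ℝ := 4 * (C2 * (1 + 3) * 4 * (C1 * 4) ^ 3 + (C1 * 4) ^ 3) + 1 with hC0
  have hC0p : 1 ≤ C0 := by rw [hC0]; have : 0 ≤ 4 * (C2 * (1 + 3) * 4 * (C1 * 4) ^ 3 + (C1 * 4) ^ 3) := by positivity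
                           linarith
  have hlg : 0 ≤ Real.log (14 * C0) := Real.log_nonneg (by linarith)
  refine ⟨1 / 2 * Real.exp (-(10 * Real.log (14 * C0) + 1)), by positivity, ?_⟩
  intro q _ χ ψ hχ2 hψ2 hχ hψ hχψ s hs hs1 hF
  have hq : (1 : ℝ) ≤ q := by exact_mod_cast NeZero.one_le
  set P : ℂ → ℂ := fun s => LFunction χ s * LFunction ψ s * LFunction (χ * ψ) s with hP
  have hPd : Differentiable ℂ P := ((differentiable_LFunction hχ).mul (differentiable_LFunction hψ)).mul
    (differentiable_LFunction hχψ)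
  have hGd : Differentiable ℂ (fun s => hz s * P s) := (differentiable_LFunctionTrivChar₁ 1).mul hPd
  set Z : ℂ → ℂ := dslope (fun s => hz s * P s) 1 with hZ
  have hZd : Differentiable ℂ Z := by
    rw [← differentiableOn_univ]
    exact (differentiableOn_dslope univ_mem).2 hGd.differentiableOn
  have hZe : ∀ s : ℂ, s ≠ 1 → Z s = riemannZeta s * P s - P 1 * (s - 1)⁻¹ := by
    intro s hs
    have : s - 1 ≠ 0 := sub_ne_zero.2 hs
    rw [hZ, dslope_of_ne _ hs, slope_def_field, hz_one, hz_ne hs]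
    field_simp
  have hPb : ∀ z : ℂ, 3 / 4 ≤ z.re → z.re ≤ 4 → |z.im| ≤ 2 → ‖P z‖ ≤ (C1 * 4) ^ 3 * q ^ 3 := by
    intro z h1 h3 h4
    have e : ∀ θ : DirichletCharacter ℂ q, θ ≠ 1 → ‖LFunction θ z‖ ≤ C1 * 4 * q := by
      intro θ hθ
      refine (hL q θ hθ z (by linarith) h3).trans ?_
      rw [Real.rpow_one]
      nlinarith [mul_nonneg hC1.le (by linarith : (0:ℝ) ≤ q)]
    rw [hP]; simp only [norm_mul]
    calc ‖LFunction χ z‖ * ‖LFunction ψ z‖ * ‖LFunction (χ * ψ) z‖ ≤ (C1 * 4 * q) * (C1 * 4 * q) * (C1 * 4 * q) := by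
          gcongr
          · exact e _ hχ
          · exact e _ hψ
          · exact e _ hχψ
      _ = _ := by ring
  have hMb : ∀ z ∈ Metric.sphere (2 : ℂ) (5 / 4), ‖Z z‖ ≤ C0 * q ^ 3 := by
    intro z hz'
    rw [mem_sphere_iff_norm] at hz'
    have hre := abs_re_le_norm (z - 2)
    have him := abs_im_le_norm (z - 2)
    rw [hz'] at hre him
    simp only [sub_re, sub_im, re_ofNat, im_ofNat, sub_zero] at hre him
    rw [abs_le] at hre
    have hz1 : 1 / 4 ≤ ‖z - 1‖ := by
      have := norm_sub_norm_le (z - 2) (z - 1 - (z - 2) - (z - 2) - 1 + (z-2) - (z - 1))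
      have h3 := norm_sub_le_norm_add (z - 2) 1
      have h4 : ‖z - 2 + 1‖ = ‖z - 1‖ := by congr 1; ring
      rw [h4, hz', norm_one] at h3
      linarith
    have hz3 : ‖z - 1‖ ≤ 3 := by
      have : z - 1 = (z - 2) + 1 := by ring
      rw [this]
      refine (norm_add_le _ _).trans ?_
      rw [hz', norm_one]; norm_num
    have hzne : z ≠ 1 := by rintro rfl; simp at hz1; linarith
    have e1 := hPb z (by linarith) (by linarith) (by linarith)
    have e2 := hPb 1 (by norm_num) (by norm_num) (by norm_num)
    have e3 : ‖hz z‖ ≤ C2 * (1 + 3) * 4 := by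
      refine (hT 1 z (by linarith) (by linarith)).trans ?_
      rw [Real.rpow_one]
      have : ((1 : ℕ) : ℝ) * (2 + |z.im|) ≤ 4 := by push_cast; linarith
      gcongr
    rw [hZ, dslope_of_ne _ hzne, slope_def_field, hz_one, one_mul, norm_div]
    rw [div_le_iff₀ (by linarith)]
    have hC0' : 4 * (C2 * (1 + 3) * 4 * ((C1 * 4) ^ 3 * q ^ 3) + (C1 * 4) ^ 3 * q ^ 3) ≤ C0 * q ^ 3 := by
      rw [hC0]; nlinarith [pow_pos (by linarith : (0:ℝ) < q) 3]
    calc ‖hz z * P z - P 1‖ ≤ ‖hz z‖ * ‖P z‖ + ‖P 1‖ := by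
          rw [← norm_mul]; exact norm_sub_le _ _
      _ ≤ C2 * (1 + 3) * 4 * ((C1 * 4) ^ 3 * q ^ 3) + (C1 * 4) ^ 3 * q ^ 3 := by gcongr
      _ ≤ C0 * q ^ 3 * (1 / 4) := by linarith
      _ ≤ _ := by gcongr
  set M : ℝ := C0 * q ^ 3 with hMdef
  have hM1 : 1 ≤ M := one_le_mul_of_one_le_of_one_le hC0p (one_le_pow₀ hq)
  set m : ℕ := ⌈10 * Real.log (14 * M)⌉₊ with hm
  have hlogM : 0 < Real.log (14 * M) := Real.log_pos (by linarith)
  have hm1 : 1 ≤ m := Nat.one_le_ceil_iff.2 (by linarith)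
  have hmge : 10 * Real.log (14 * M) ≤ m := Nat.le_ceil _
  have hmle : (m : ℝ) ≤ 10 * Real.log (14 * M) + 1 := (Nat.ceil_lt_add_one (by linarith)).le
  have hg := est_general (a := a4 χ ψ) (fun n => a4_nonneg hχ2 hψ2 n) (a4_absc χ ψ (by norm_num)) (a4_two hχ2 hψ2)
    Z hZd (P 1) (fun z hz' => by
      rw [hZe z (by rintro rfl; simp at hz'), a4_LSeries χ ψ hz']) M hMb s hs hs1 m hm1
  have hpow : M * (17 / 20 : ℝ) ^ m * (20 / 3) ≤ 1 / 2 := by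
    have h1 : (17 / 20 : ℝ) ≤ Real.exp (-(1 / 10)) := by
      have := Real.add_one_le_exp (-(1/10 : ℝ)); linarith
    have h2 : (17 / 20 : ℝ) ^ m ≤ Real.exp (-(1 / 10)) ^ m := by gcongr
    rw [← Real.exp_nat_mul] at h2
    have h3 : Real.exp (m * -(1 / 10)) ≤ Real.exp (-Real.log (14 * M)) := by
      apply Real.exp_le_exp.2; linarith
    rw [Real.exp_neg, Real.exp_log (by linarith)] at h3
    calc M * (17 / 20 : ℝ) ^ m * (20 / 3) ≤ M * (14 * M)⁻¹ * (20 / 3) := by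
          gcongr; exact h2.trans h3
      _ ≤ 1 / 2 := by
          have : M ≠ 0 := by linarith
          field_simp; norm_num
  rw [hZe s (by exact_mod_cast hs1.ne), sub_re] at hg
  have hre1 : (P 1 * ((s : ℂ) - 1)⁻¹).re = - ((P 1).re / (1 - s)) := by
    have : ((s : ℂ) - 1)⁻¹ = (((s - 1)⁻¹ : ℝ) : ℂ) := by push_cast; rfl
    rw [this, re_mul_ofReal, ← neg_sub 1 s, inv_neg]; field_simp
  rw [hre1] at hg
  have h1s : 0 < 1 - s := by linarith
  have hkey : 1 / 2 ≤ (P 1).re * ((2 - s) ^ m / (1 - s)) := by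
    have : (P 1).re * (((2 - s) ^ m - 1) / (1 - s)) = (P 1).re * ((2 - s) ^ m / (1 - s)) - (P 1).re / (1 - s) := by
      field_simp
    linarith
  have hy : (2 - s) ^ m ≤ Real.exp ((1 - s) * m) := by
    rw [mul_comm, Real.exp_nat_mul]
    gcongr
    · linarith
    · have := Real.add_one_le_exp (1 - s); linarith
  have hy2 : Real.exp ((1 - s) * m) ≤ Real.exp (10 * Real.log (14 * C0) + 1) * (q : ℝ) ^ (30 * (1 - s)) := by
    rw [Real.rpow_def_of_pos (by linarith), ← Real.exp_add]
    apply Real.exp_le_exp.2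
    have hl : Real.log (14 * M) = Real.log (14 * C0) + 3 * Real.log q := by
      rw [hMdef, ← mul_assoc, Real.log_mul (by linarith) (by positivity), Real.log_pow]; push_cast; ring
    calc (1 - s) * m ≤ (1 - s) * (10 * Real.log (14 * M) + 1) := by gcongr
      _ = (1 - s) * (10 * Real.log (14 * C0) + 1) + Real.log q * (30 * (1 - s)) := by rw [hl]; ring
      _ ≤ _ := by
        gcongr
        exact mul_le_of_le_one_left (by linarith) (by linarith)
  have hlam : (P 1).re ≤ ‖P 1‖ := re_le_norm _
  set E := Real.exp (10 * Real.log (14 * C0) + 1) with hE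
  set W := (q : ℝ) ^ (30 * (1 - s)) with hW
  have hEp : 0 < E := Real.exp_pos _
  have hWp : 0 < W := by positivity
  rw [Real.exp_neg, Real.rpow_neg (by linarith)]
  have h5 : 1 / 2 ≤ ‖P 1‖ * (E * W / (1 - s)) := by
    refine hkey.trans ?_
    have h2s : 0 ≤ (2 - s) ^ m / (1 - s) := div_nonneg (pow_nonneg (by linarith) _) h1s.le
    calc (P 1).re * ((2 - s) ^ m / (1 - s)) ≤ ‖P 1‖ * ((2 - s) ^ m / (1 - s)) := by gcongr
      _ ≤ _ := by gcongr; exact hy.trans hy2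
  change 1 / 2 * E⁻¹ * (1 - s) * W⁻¹ ≤ ‖P 1‖
  calc 1 / 2 * E⁻¹ * (1 - s) * W⁻¹ ≤ (‖P 1‖ * (E * W / (1 - s))) * E⁻¹ * (1 - s) * W⁻¹ := by gcongr
    _ = ‖P 1‖ := by field_simp

end Cayley
end

section
open Complex Finset Filter Topology MeasureTheory ArithmeticFunction

namespace Cayley
open DirichletCharacter

lemma prod_one_sub_inv (S : Finset ℕ) : (∀ p ∈ S, 2 ≤ p) → 1 / ((S.card : ℝ) + 1) ≤ ∏ p ∈ S, (1 - 1 / (p : ℝ)) := by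
  induction S using Finset.induction_on_max with
  | empty => intro _; simp
  | insert a S hmax ih =>
    intro h
    have ha : a ∉ S := fun h => lt_irrefl _ (hmax a h)
    have hc : S.card + 2 ≤ a := by
      have hs : S ⊆ Finset.Ico 2 a := fun p hp => Finset.mem_Ico.2 ⟨h p (Finset.mem_insert_of_mem hp), hmax p hp⟩
      have := Finset.card_le_card hs
      rw [Nat.card_Ico] at this
      have := h a (Finset.mem_insert_self _ _)
      omega
    rw [Finset.prod_insert ha, Finset.card_insert_of_notMem ha]
    have ih' := ih (fun p hp => h p (Finset.mem_insert_of_mem hp))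
    have hc' : (S.card : ℝ) + 2 ≤ a := by exact_mod_cast hc
    have hS : (0 : ℝ) ≤ S.card := Nat.cast_nonneg _
    have h1 : (1 : ℝ) - 1 / (S.card + 2) ≤ 1 - 1 / a := by gcongr
    have h0 : (0 : ℝ) ≤ 1 - 1 / (S.card + 2) := by
      rw [sub_nonneg, div_le_one (by positivity)]; linarith
    calc 1 / (((S.card + 1 : ℕ) : ℝ) + 1) = (1 - 1 / (S.card + 2)) * (1 / ((S.card : ℝ) + 1)) := by
          push_cast; field_simp; ring
      _ ≤ _ := by
          apply mul_le_mul h1 ih' (by positivity) (h0.trans h1)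

lemma two_pow_card_primeFactors {q : ℕ} (hq : q ≠ 0) : 2 ^ q.primeFactors.card ≤ q := by
  calc 2 ^ q.primeFactors.card ≤ ∏ p ∈ q.primeFactors, p :=
        Finset.pow_card_le_prod _ _ _ (fun p hp => (Nat.prime_of_mem_primeFactors hp).two_le)
    _ ≤ q := Nat.le_of_dvd (Nat.pos_of_ne_zero hq) (Nat.prod_primeFactors_dvd q)

/-- `∏_{p | q} (1 - 1/p) ≥ c q^{-ε}` -/
lemma prod_eps (ε : ℝ) (hε : 0 < ε) : ∃ c : ℝ, 0 < c ∧ ∀ q : ℕ, q ≠ 0 →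
    c * (q : ℝ) ^ (-ε) ≤ ∏ p ∈ q.primeFactors, (1 - 1 / (p : ℝ)) := by
  refine ⟨(1 / (ε * Real.log 2) + 1)⁻¹, by have := Real.log_pos one_lt_two; positivity, fun q hq => ?_⟩
  have hl2 := Real.log_pos one_lt_two
  refine le_trans ?_ (prod_one_sub_inv _ fun p hp => (Nat.prime_of_mem_primeFactors hp).two_le)
  have hq1 : (1 : ℝ) ≤ q := by exact_mod_cast Nat.one_le_iff_ne_zero.2 hq
  have h1 : (q.primeFactors.card : ℝ) * Real.log 2 ≤ Real.log q := by
    rw [← Real.log_pow]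
    apply Real.log_le_log (by positivity)
    exact_mod_cast two_pow_card_primeFactors hq
  have h2 := Real.log_le_rpow_div (Nat.cast_nonneg q) hε
  have h3 : (1 : ℝ) ≤ (q : ℝ) ^ ε := Real.one_le_rpow hq1 hε.le
  have h4 : (q.primeFactors.card : ℝ) + 1 ≤ (1 / (ε * Real.log 2) + 1) * (q : ℝ) ^ ε := by
    have : (q.primeFactors.card : ℝ) ≤ 1 / (ε * Real.log 2) * (q : ℝ) ^ ε := by
      rw [← le_div_iff₀ hl2] at h1
      refine h1.trans ?_
      rw [div_le_iff₀ hl2]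
      refine h2.trans (le_of_eq ?_)
      field_simp
    linarith
  rw [Real.rpow_neg (by linarith), ← mul_inv, ← one_div]
  exact one_div_le_one_div_of_le (by positivity) h4

lemma real_val {q : ℕ} {χ : DirichletCharacter ℂ q} (hχ : χ ^ 2 = 1) (a : ZMod q) : (starRingEnd ℂ) (χ a) = χ a := by
  by_cases ha : IsUnit a
  · have h := congrArg (fun f => f a) hχ
    simp only [MulChar.pow_apply' _ two_ne_zero, MulChar.one_apply ha] at h
    rcases sq_eq_one_iff.1 h with h | h <;> simp [h]
  · simp [MulChar.map_nonunit _ ha]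

lemma psum_real {q : ℕ} {χ : DirichletCharacter ℂ q} (hχ : χ ^ 2 = 1) (N : ℕ) (s : ℝ) :
    (starRingEnd ℂ) (psum χ N s) = psum χ N s := by
  unfold psum
  rw [map_sum]
  refine Finset.sum_congr rfl fun n _ => ?_
  rw [map_mul, real_val hχ]
  congr 1
  have : (n : ℂ) ^ (-(s : ℂ)) = (((n : ℝ) ^ (-s) : ℝ) : ℂ) := by
    rw [Complex.ofReal_cpow (Nat.cast_nonneg n)]; push_cast; rfl
  rw [this, Complex.conj_ofReal]

lemma psum_tendsto {q : ℕ} [NeZero q] {χ : DirichletCharacter ℂ q} (hχ : χ ≠ 1) (s : ℂ) (hs : 0 < s.re) :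
    Tendsto (fun N => psum χ N s) atTop (𝓝 (LFunction χ s)) := by
  rw [tendsto_iff_norm_sub_tendsto_zero]
  have h : Tendsto (fun N : ℕ => ‖s‖ * (5 * q * ((N : ℝ) ^ (-s.re) / s.re))) atTop (𝓝 (‖s‖ * (5 * q * (0 / s.re)))) := by
    refine Tendsto.const_mul _ (Tendsto.const_mul _ (Tendsto.div_const ?_ _))
    exact (tendsto_rpow_neg_atTop hs).comp tendsto_natCast_atTop_atTop
  rw [zero_div, mul_zero, mul_zero] at h
  refine tendsto_of_tendsto_of_tendsto_of_le_of_le' tendsto_const_nhds h (Eventually.of_forall fun _ => norm_nonneg _) ?_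
  filter_upwards [eventually_ge_atTop 1] with N hN
  rw [norm_sub_rev]
  exact L_approx hχ N hN s hs

lemma L_real {q : ℕ} [NeZero q] {χ : DirichletCharacter ℂ q} (hχ : χ ≠ 1) (h2 : χ ^ 2 = 1) (s : ℝ) (hs : 0 < s) :
    LFunction χ s = ((LFunction χ s).re : ℂ) := by
  have h := psum_tendsto hχ s (by simpa using hs)
  have h' := (Complex.continuous_conj.tendsto _).comp h
  have : (fun N => psum χ N (s : ℂ)) = (starRingEnd ℂ) ∘ fun N => psum χ N (s : ℂ) := by
    ext N; exact (psum_real h2 N s).symm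
  rw [← this] at h'
  exact (Complex.conj_eq_iff_re.1 (tendsto_nhds_unique h' h)).symm

lemma L_two_pos {q : ℕ} [NeZero q] (χ : DirichletCharacter ℂ q) : 0 < (LFunction χ 2).re := by
  have hq := LFunction_eq_LSeries χ (s := 2) (by norm_num)
  rw [hq]
  have hs : LSeriesSummable (fun n => χ (n : ZMod q)) 2 := LSeriesSummable_of_one_lt_re χ (by norm_num)
  have hs' : Summable (fun n => LSeries.term (fun n => χ (n : ZMod q)) 2 n) := hs
  unfold LSeries
  rw [← hs'.sum_add_tsum_nat_add 2]
  have h1 : ∑ i ∈ Finset.range 2, LSeries.term (fun n => χ (n : ZMod q)) 2 i = 1 := by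
    simp [Finset.sum_range_succ, LSeries.term]
  rw [h1, add_re, one_re]
  have hz := hasSum_zeta_two
  have hg := (hasSum_nat_add_iff' 2).2 hz
  have hb : ‖∑' i, LSeries.term (fun n => χ (n : ZMod q)) 2 (i + 2)‖ ≤ Real.pi ^ 2 / 6 - ∑ i ∈ Finset.range 2, 1 / (i : ℝ) ^ 2 := by
    refine tsum_of_norm_bounded hg fun i => ?_
    rw [LSeries.term_of_ne_zero (by omega), norm_div]
    have e : ‖(((i + 2 : ℕ) : ℂ)) ^ (2 : ℂ)‖ = ((i + 2 : ℕ) : ℝ) ^ 2 := by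
      rw [show (2 : ℂ) = ((2 : ℕ) : ℂ) by norm_num, cpow_natCast, norm_pow, Complex.norm_natCast]
    rw [e]
    gcongr
    exact χ.norm_le_one _
  have hpi : Real.pi ^ 2 < 12 := by
    have := Real.pi_lt_d2; have := Real.pi_pos; nlinarith
  have : ∑ i ∈ Finset.range 2, 1 / (i : ℝ) ^ 2 = 1 := by simp [Finset.sum_range_succ]
  rw [this] at hb
  have h3 := (abs_le.1 ((abs_re_le_norm _).trans hb)).1
  linarith

lemma L_pos {q : ℕ} [NeZero q] {χ : DirichletCharacter ℂ q} (hχ : χ ≠ 1) (h2 : χ ^ 2 = 1) (s : ℝ) (hs : 0 < s) (hs1 : s < 1)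
    (hne : ∀ t : ℝ, s ≤ t → t < 1 → LFunction χ t ≠ 0) : 0 < (LFunction χ s).re := by
  by_contra hcon
  push Not at hcon
  have hc : Continuous (fun t : ℝ => (LFunction χ t).re) :=
    Complex.continuous_re.comp ((differentiable_LFunction hχ).continuous.comp Complex.continuous_ofReal)
  have h2p := L_two_pos χ
  have := intermediate_value_Icc (f := fun t : ℝ => (LFunction χ t).re) (by linarith : s ≤ 2) hc.continuousOn
  obtain ⟨t, ht, ht0⟩ := this (Set.mem_Icc.2 ⟨hcon, by have := h2p.le; simpa using this⟩ : (0 : ℝ) ∈ _)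
  have ht0' : LFunction χ t = 0 := by
    rw [L_real hχ h2 t (hs.trans_le ht.1)]; exact_mod_cast ht0
  rcases lt_or_ge t 1 with h | h
  · exact hne t ht.1 h ht0'
  · exact LFunction_ne_zero_of_one_le_re χ (.inl hχ) (by simpa using h) ht0'

/-- the change of level factors -/
lemma fac_upper {q1 q2 : ℕ} (h1 : q1 ≠ 0) (h2 : q2 ≠ 0) (χ : DirichletCharacter ℂ q2) :
    ‖∏ p ∈ (q1 * q2).primeFactors, (1 - χ p * (p : ℂ) ^ (-1 : ℂ))‖ ≤ 2 ^ q1.primeFactors.card := by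
  rw [norm_prod, Nat.primeFactors_mul h1 h2, ← Finset.union_sdiff_self_eq_union, Finset.prod_union Finset.disjoint_sdiff]
  have e2 : ∏ p ∈ q2.primeFactors \ q1.primeFactors, ‖1 - χ p * (p : ℂ) ^ (-1 : ℂ)‖ = 1 := by
    refine Finset.prod_eq_one fun p hp => ?_
    have hp2 := (Finset.mem_sdiff.1 hp).1
    have : χ (p : ZMod q2) = 0 := by
      apply MulChar.map_nonunit
      rw [ZMod.isUnit_prime_iff_not_dvd (Nat.prime_of_mem_primeFactors hp2)]
      exact not_not.2 (Nat.dvd_of_mem_primeFactors hp2)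
    simp [this]
  rw [e2, mul_one]
  rw [← Finset.prod_const]
  refine Finset.prod_le_prod (fun p _ => norm_nonneg _) fun p hp => ?_
  have hp1 : (1 : ℝ) ≤ p := by exact_mod_cast (Nat.prime_of_mem_primeFactors hp).one_lt.le
  calc ‖1 - χ p * (p : ℂ) ^ (-1 : ℂ)‖ ≤ ‖(1 : ℂ)‖ + ‖χ p * (p : ℂ) ^ (-1 : ℂ)‖ := norm_sub_le _ _
    _ ≤ 1 + 1 * 1 := by
      rw [norm_one, norm_mul]
      gcongr
      · exact χ.norm_le_one _
      · rw [cpow_neg_one, norm_inv, Complex.norm_natCast]; exact inv_le_one_of_one_le₀ hp1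
    _ = 2 := by norm_num

lemma fac_lower {q1 q2 : ℕ} (h1 : q1 ≠ 0) (h2 : q2 ≠ 0) (χ : DirichletCharacter ℂ q1) :
    ∏ p ∈ q2.primeFactors, (1 - 1 / (p : ℝ)) ≤ ‖∏ p ∈ (q1 * q2).primeFactors, (1 - χ p * (p : ℂ) ^ (-1 : ℂ))‖ := by
  rw [norm_prod, Nat.primeFactors_mul h1 h2, ← Finset.sdiff_union_self_eq_union, Finset.prod_union Finset.sdiff_disjoint]
  have e2 : ∏ p ∈ q1.primeFactors \ q2.primeFactors, ‖1 - χ p * (p : ℂ) ^ (-1 : ℂ)‖ = 1 := by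
    refine Finset.prod_eq_one fun p hp => ?_
    have hp2 := (Finset.mem_sdiff.1 hp).1
    have : χ (p : ZMod q1) = 0 := by
      apply MulChar.map_nonunit
      rw [ZMod.isUnit_prime_iff_not_dvd (Nat.prime_of_mem_primeFactors hp2)]
      exact not_not.2 (Nat.dvd_of_mem_primeFactors hp2)
    simp [this]
  rw [e2, one_mul]
  refine Finset.prod_le_prod (fun p hp => ?_) fun p hp => ?_
  · have hp1 : (1 : ℝ) ≤ p := by exact_mod_cast (Nat.prime_of_mem_primeFactors hp).one_lt.le
    rw [sub_nonneg, div_le_one (by linarith)]; exact hp1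
  · calc 1 - 1 / (p : ℝ) ≤ ‖(1 : ℂ)‖ - ‖χ p * (p : ℂ) ^ (-1 : ℂ)‖ := by
          rw [norm_one, norm_mul, cpow_neg_one, norm_inv, Complex.norm_natCast, one_div]
          gcongr
          exact mul_le_of_le_one_left (by positivity) (χ.norm_le_one _)
      _ ≤ _ := norm_sub_norm_le _ _

lemma siegel_core (ε : ℝ) (hε : 0 < ε) (hε1 : ε ≤ 1) {q1 : ℕ} [NeZero q1] (χ1 : DirichletCharacter ℂ q1)
    (h1 : χ1 ≠ 1) (h12 : χ1 ^ 2 = 1) (s : ℝ) (hs : 15 / 16 ≤ s) (hs1 : s < 1) (hsε : 30 * (1 - s) ≤ ε / 4)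
    (H : ∀ (q : ℕ) [NeZero q] (hd : q1 ∣ q) (ψ : DirichletCharacter ℂ q), ψ ≠ 1 → ψ ^ 2 = 1 → changeLevel hd χ1 * ψ ≠ 1 →
      (riemannZeta s * (LFunction (changeLevel hd χ1) s * LFunction ψ s * LFunction (changeLevel hd χ1 * ψ) s)).re ≤ 0) :
    ∃ c : ℝ, 0 < c ∧ ∀ (q : ℕ) [NeZero q] (χ : DirichletCharacter ℂ q), χ ≠ 1 → χ ^ 2 = 1 →
      c * (q : ℝ) ^ (-ε) ≤ ‖LFunction χ 1‖ := by
  obtain ⟨c0, hc0, hE⟩ := estermann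
  obtain ⟨C1, hC1, hL⟩ := L_bound (ε / 8) (by linarith) (by linarith)
  obtain ⟨c2, hc2, hP⟩ := prod_eps ε hε
  have hq1 : (1 : ℝ) ≤ q1 := by exact_mod_cast NeZero.one_le
  have hq10 : q1 ≠ 0 := NeZero.ne q1
  set D : ℝ := 2 ^ q1.primeFactors.card with hD
  have hDp : 0 < D := by positivity
  have hL1 : 0 < ‖LFunction χ1 1‖ := norm_pos_iff.2 (LFunction_apply_one_ne_zero h1)
  set K : ℝ := c0 * (1 - s) * (q1 : ℝ) ^ (-ε) / (4 * C1 ^ 2 * D) with hK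
  have hKp : 0 < K := by
    have : 0 < 1 - s := by linarith
    positivity
  refine ⟨min K (‖LFunction χ1 1‖ * c2 / D), by positivity, fun q _ χ hχ hχ2 => ?_⟩
  have hq : (1 : ℝ) ≤ q := by exact_mod_cast NeZero.one_le
  have hq0 : q ≠ 0 := NeZero.ne q
  have hqp : 0 < (q : ℝ) ^ (-ε) := by positivity
  have hd1 : q1 ∣ q1 * q := Dvd.intro _ rfl
  have hd2 : q ∣ q1 * q := Dvd.intro_left _ rfl
  have : NeZero (q1 * q) := ⟨mul_ne_zero hq10 hq0⟩
  set ψ1 := changeLevel hd1 χ1 with hψ1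
  set ψ2 := changeLevel hd2 χ with hψ2
  have n1 : ψ1 ≠ 1 := fun h => h1 ((changeLevel_eq_one_iff hd1).1 h)
  have n2 : ψ2 ≠ 1 := fun h => hχ ((changeLevel_eq_one_iff hd2).1 h)
  have s1 : ψ1 ^ 2 = 1 := by rw [hψ1, ← map_pow, h12, map_one]
  have s2 : ψ2 ^ 2 = 1 := by rw [hψ2, ← map_pow, hχ2, map_one]
  have e1 := LFunction_changeLevel hd1 χ1 (s := 1) (.inl h1)
  have e2 := LFunction_changeLevel hd2 χ (s := 1) (.inl hχ)
  rw [← hψ1] at e1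
  rw [← hψ2] at e2
  have u2 : ‖LFunction ψ2 1‖ ≤ ‖LFunction χ 1‖ * D := by
    rw [e2, norm_mul]; gcongr; exact fac_upper hq10 hq0 χ
  by_cases h : ψ1 * ψ2 = 1
  · have heq : ψ1 = ψ2 := by
      have := congrArg (· * ψ2) h
      simp only [mul_assoc, ← sq, s2, mul_one, one_mul] at this
      exact this
    have l1 : ‖LFunction χ1 1‖ * (c2 * (q : ℝ) ^ (-ε)) ≤ ‖LFunction ψ1 1‖ := by
      rw [e1, norm_mul]; gcongr; exact (hP q hq0).trans (fac_lower hq10 hq0 χ1)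
    rw [heq] at l1
    have l2 := l1.trans u2
    calc min K (‖LFunction χ1 1‖ * c2 / D) * (q : ℝ) ^ (-ε) ≤ (‖LFunction χ1 1‖ * c2 / D) * (q : ℝ) ^ (-ε) := by
          gcongr; exact min_le_right _ _
      _ = ‖LFunction χ1 1‖ * (c2 * (q : ℝ) ^ (-ε)) / D := by ring
      _ ≤ ‖LFunction χ 1‖ := by rw [div_le_iff₀ hDp]; exact l2
  · have hF := hE (q1 * q) ψ1 ψ2 s1 s2 n1 n2 h s hs hs1 (H _ hd1 ψ2 n2 s2 h)
    set Q : ℝ := ((q1 * q : ℕ) : ℝ) with hQ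
    have hQe : Q = (q1 : ℝ) * q := by rw [hQ]; push_cast; ring
    have hQ1 : 1 ≤ Q := by rw [hQe]; nlinarith
    have b1 := hL _ ψ1 n1 1 (by simp; linarith) (by norm_num)
    have b3 := hL _ (ψ1 * ψ2) h 1 (by simp; linarith) (by norm_num)
    have hb : C1 * (Q * (2 + |(1 : ℂ).im|)) ^ (ε / 8) ≤ C1 * (2 * Q ^ (ε / 8)) := by
      have h2 : (2 : ℝ) ^ (ε / 8) ≤ 2 := by
        calc (2 : ℝ) ^ (ε / 8) ≤ 2 ^ (1 : ℝ) := Real.rpow_le_rpow_of_exponent_le (by norm_num) (by linarith)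
          _ = 2 := Real.rpow_one 2
      rw [Complex.one_im, abs_zero, add_zero, Real.mul_rpow (by linarith) (by norm_num), mul_comm (Q ^ _)]
      gcongr
    have b1' := b1.trans hb
    have b3' := b3.trans hb
    rw [norm_mul, norm_mul] at hF
    have hF2 : c0 * (1 - s) * Q ^ (-(30 * (1 - s))) ≤ (C1 * (2 * Q ^ (ε / 8))) * (‖LFunction χ 1‖ * D) * (C1 * (2 * Q ^ (ε / 8))) := by
      refine hF.trans ?_
      gcongr
    have hexp : Q ^ (-ε) ≤ Q ^ (-(30 * (1 - s))) * (Q ^ (ε / 8) * Q ^ (ε / 8))⁻¹ := by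
      rw [← Real.rpow_add (by linarith), ← Real.rpow_neg (by linarith), ← Real.rpow_add (by linarith)]
      exact Real.rpow_le_rpow_of_exponent_le hQ1 (by linarith)
    have hQe2 : Q ^ (-ε) = (q1 : ℝ) ^ (-ε) * (q : ℝ) ^ (-ε) := by
      rw [hQe, Real.mul_rpow (by linarith) (by linarith)]
    have hQp : 0 < Q ^ (ε / 8) := by positivity
    have h1s : 0 < 1 - s := by linarith
    calc min K (‖LFunction χ1 1‖ * c2 / D) * (q : ℝ) ^ (-ε) ≤ K * (q : ℝ) ^ (-ε) := by
          gcongr; exact min_le_left _ _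
      _ = c0 * (1 - s) * Q ^ (-ε) / (4 * C1 ^ 2 * D) := by rw [hQe2, hK]; ring
      _ ≤ c0 * (1 - s) * (Q ^ (-(30 * (1 - s))) * (Q ^ (ε / 8) * Q ^ (ε / 8))⁻¹) / (4 * C1 ^ 2 * D) := by gcongr
      _ = (c0 * (1 - s) * Q ^ (-(30 * (1 - s)))) * (Q ^ (ε / 8) * Q ^ (ε / 8))⁻¹ / (4 * C1 ^ 2 * D) := by ring
      _ ≤ ((C1 * (2 * Q ^ (ε / 8))) * (‖LFunction χ 1‖ * D) * (C1 * (2 * Q ^ (ε / 8)))) * (Q ^ (ε / 8) * Q ^ (ε / 8))⁻¹ / (4 * C1 ^ 2 * D) := by gcongr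
      _ = ‖LFunction χ 1‖ := by field_simp; ring

lemma exists_real_char : ∃ χ : DirichletCharacter ℂ 4, χ ≠ 1 ∧ χ ^ 2 = 1 := by
  refine ⟨ZMod.χ₄.ringHomComp (Int.castRingHom ℂ), ?_, ?_⟩
  · intro h
    have := congrArg (fun f => f (3 : ZMod 4)) h
    have hu : IsUnit (3 : ZMod 4) := by decide
    simp only [MulChar.ringHomComp_apply, MulChar.one_apply hu] at this
    have h3 : ZMod.χ₄ 3 = -1 := by decide
    rw [h3] at this
    norm_num at this
  · exact (ZMod.isQuadratic_χ₄.comp _).sq_eq_one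

theorem siegel1 (ε : ℝ) (hε : 0 < ε) (hε1 : ε ≤ 1) : ∃ c : ℝ, 0 < c ∧ ∀ (q : ℕ) [NeZero q] (χ : DirichletCharacter ℂ q), χ ≠ 1 → χ ^ 2 = 1 →
      c * (q : ℝ) ^ (-ε) ≤ ‖LFunction χ 1‖ := by
  set a : ℝ := 1 - ε / 120 with ha
  have ha1 : a < 1 := by linarith
  have ha2 : 15 / 16 < a := by linarith
  by_cases hcase : ∃ (q1 : ℕ) (_ : NeZero q1) (χ1 : DirichletCharacter ℂ q1) (s : ℝ), χ1 ≠ 1 ∧ χ1 ^ 2 = 1 ∧ a ≤ s ∧ s < 1 ∧ LFunction χ1 s = 0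
  · obtain ⟨q1, _, χ1, s, h1, h2, h3, h4, h5⟩ := hcase
    refine siegel_core ε hε hε1 χ1 h1 h2 s (by linarith) h4 (by linarith) ?_
    intro q _ hd ψ _ _ _
    rw [LFunction_changeLevel hd χ1 (.inl h1), h5]
    simp
  · push Not at hcase
    obtain ⟨χ1, h1, h2⟩ := exists_real_char
    have hev : ∀ᶠ s : ℝ in 𝓝[<] 1, 0 < (hz s).re ∧ a ≤ s ∧ s < 1 := by
      have hcont : Continuous (fun s : ℝ => (hz s).re) :=
        Complex.continuous_re.comp ((differentiable_LFunctionTrivChar₁ 1).continuous.comp Complex.continuous_ofReal)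
      have t1 : ∀ᶠ s : ℝ in 𝓝 1, 0 < (hz s).re := hcont.continuousAt.eventually_const_lt (by simp [hz_one])
      filter_upwards [t1.filter_mono nhdsWithin_le_nhds, (eventually_ge_nhds ha1).filter_mono nhdsWithin_le_nhds, self_mem_nhdsWithin] with s x y z
      exact ⟨x, y, z⟩
    obtain ⟨s, hs0, hs1, hs2⟩ := hev.exists
    refine siegel_core ε hε hε1 χ1 h1 h2 s (by linarith) hs2 (by linarith) ?_
    intro q _ hd ψ hψ hψ2 hn
    have n1 : changeLevel hd χ1 ≠ 1 := fun h => h1 ((changeLevel_eq_one_iff hd).1 h)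
    have m1 : (changeLevel hd χ1) ^ 2 = 1 := by rw [← map_pow, h2, map_one]
    have m2 : (changeLevel hd χ1 * ψ) ^ 2 = 1 := by rw [mul_pow, m1, hψ2, one_mul]
    have hs0' : 0 < s := by linarith
    have p1 := L_pos n1 m1 s hs0' hs2 (fun t ht ht1 => hcase q _ _ t n1 m1 (hs1.trans ht) ht1)
    have p2 := L_pos hψ hψ2 s hs0' hs2 (fun t ht ht1 => hcase q _ _ t hψ hψ2 (hs1.trans ht) ht1)
    have p3 := L_pos hn m2 s hs0' hs2 (fun t ht ht1 => hcase q _ _ t hn m2 (hs1.trans ht) ht1)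
    rw [L_real n1 m1 s hs0', L_real hψ hψ2 s hs0', L_real hn m2 s hs0', ← ofReal_mul, ← ofReal_mul, re_mul_ofReal]
    apply mul_nonpos_of_nonpos_of_nonneg _ (by positivity)
    rw [hz_ne (by exact_mod_cast hs2.ne)] at hs0
    have : ((s : ℂ) - 1) = ((s - 1 : ℝ) : ℂ) := by push_cast; rfl
    rw [this, re_ofReal_mul] at hs0
    nlinarith

end Cayley
end

section
open Complex Finset Filter Topology MeasureTheory ArithmeticFunction

namespace Cayley
open DirichletCharacter

lemma C_core (A : ℝ) (hA : 1 ≤ A) (g : ℝ → ℂ) (x0 : ℝ) (h0 : 0 ≤ x0) (h01 : x0 ≤ 1)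
    (h1 : ∀ x, x0 ≤ x → 0 < x → x ≤ 1 → 1 ≤ (A / x) ^ 3 * ‖g x‖ ^ 4 * A)
    (h2 : ∀ x, x0 ≤ x → x ≤ 1 → ‖g x - g x0‖ ≤ A * (x - x0)) : 1 / (16 * A ^ 7) ≤ ‖g x0‖ := by
  have hA0 : 0 < A := by linarith
  set z : ℝ := 1 / (2 * A ^ 2) with hz
  have hzp : 0 < z := by positivity
  have hz1 : z ≤ 1 := by
    rw [hz, div_le_one (by positivity)]; nlinarith
  have key : ∀ x, x0 ≤ x → z ^ 4 ≤ x → x ≤ 1 → 1 / (8 * A ^ 7) ≤ ‖g x‖ := by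
    intro x hx hzx hx1
    have hxp : 0 < x := lt_of_lt_of_le (by positivity) hzx
    have h := h1 x hx hxp hx1
    have h3 : x ^ 3 / A ^ 4 ≤ ‖g x‖ ^ 4 := by
      rw [div_le_iff₀ (by positivity)]
      rw [div_pow] at h
      have : A ^ 3 / x ^ 3 * ‖g x‖ ^ 4 * A = ‖g x‖ ^ 4 * A ^ 4 / x ^ 3 := by ring
      rw [this, le_div_iff₀ (by positivity)] at h
      linarith
    have h4 : (z ^ 3 / A) ^ 4 ≤ ‖g x‖ ^ 4 := by
      refine le_trans ?_ h3
      rw [div_pow, ← pow_mul, show 3 * 4 = 4 * 3 by norm_num, pow_mul]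
      gcongr
    have h5 := le_of_pow_le_pow_left₀ (by norm_num) (norm_nonneg _) h4
    refine le_trans (le_of_eq ?_) h5
    rw [hz]; field_simp; norm_num
  rcases le_total (z ^ 4) x0 with h | h
  · refine le_trans ?_ (key x0 le_rfl h h01)
    apply one_div_le_one_div_of_le (by positivity)
    have : 0 < A ^ 7 := by positivity
    linarith
  · have hz41 : z ^ 4 ≤ 1 := pow_le_one₀ hzp.le hz1
    have k1 := key (z ^ 4) h le_rfl hz41
    have k2 := h2 (z ^ 4) h hz41
    have k3 : A * (z ^ 4 - x0) ≤ A * z ^ 4 := by gcongr; linarith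
    have k4 : A * z ^ 4 = 1 / (16 * A ^ 7) := by rw [hz]; field_simp; norm_num
    have k5 : 1 / (8 * A ^ 7) = 1 / (16 * A ^ 7) + 1 / (16 * A ^ 7) := by field_simp; norm_num
    have k6 := norm_sub_norm_le (g (z ^ 4)) (g x0)
    linarith

/-- The family of functions: nontrivial `L`-functions, and `(s-1)ζ(s)/(s+1)`. -/
def Fam (Q : ℝ) (f : ℂ → ℂ) : Prop :=
  (∃ (n : ℕ) (_ : NeZero n) (χ : DirichletCharacter ℂ n), χ ≠ 1 ∧ Q = n ∧ f = LFunction χ) ∨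
    (Q = 1 ∧ f = fun s => hz s / (s + 1))

lemma fam_one {Q : ℝ} {f : ℂ → ℂ} (h : Fam Q f) : 1 ≤ Q := by
  rcases h with ⟨n, _, χ, -, rfl, -⟩ | ⟨rfl, -⟩
  · exact_mod_cast NeZero.one_le
  · exact le_rfl

lemma add_one_ne {s : ℂ} (hs : 0 < s.re) : s + 1 ≠ 0 := by
  intro h; have := congrArg re h; simp at this; linarith

lemma fam_diff {Q : ℝ} {f : ℂ → ℂ} (h : Fam Q f) {s : ℂ} (hs : 0 < s.re) : DifferentiableAt ℂ f s := by
  rcases h with ⟨n, _, χ, hχ, rfl, rfl⟩ | ⟨rfl, rfl⟩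
  · exact differentiable_LFunction hχ s
  · exact (differentiable_LFunctionTrivChar₁ 1 s).div (differentiableAt_id.add_const 1) (add_one_ne hs)

lemma two_mul_rpow {N ε : ℝ} (hN : 0 ≤ N) (hε1 : ε ≤ 1) : (2 * N) ^ ε ≤ 2 * N ^ ε := by
  rw [Real.mul_rpow (by norm_num) hN]
  gcongr
  calc (2 : ℝ) ^ ε ≤ 2 ^ (1 : ℝ) := Real.rpow_le_rpow_of_exponent_le (by norm_num) hε1
    _ = 2 := Real.rpow_one 2

lemma fam_ub (ε : ℝ) (hε : 0 < ε) (hε1 : ε ≤ 1) : ∃ C : ℝ, 0 < C ∧ ∀ (Q : ℝ) (f : ℂ → ℂ), Fam Q f → ∀ s : ℂ,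
    1 - ε / 4 ≤ s.re → s.re ≤ 4 → ‖f s‖ ≤ C * (Q * (2 + |s.im|)) ^ ε := by
  obtain ⟨C1, hC1, h1⟩ := L_bound ε hε hε1
  obtain ⟨C2, hC2, h2⟩ := triv_bound ε hε hε1
  refine ⟨C1 + 4 * C2, by positivity, fun Q f hf s hs hs4 => ?_⟩
  rcases hf with ⟨n, _, χ, hχ, rfl, rfl⟩ | ⟨rfl, rfl⟩
  · refine (h1 n χ hχ s hs hs4).trans ?_
    gcongr; linarith
  · have hre : (1 : ℝ) ≤ ‖s + 1‖ := by
      have := re_le_norm (s + 1); simp at this; linarith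
    have hn : 1 + ‖s - 1‖ ≤ 4 * ‖s + 1‖ := by
      have : ‖s - 1‖ ≤ ‖s + 1‖ + 2 := by
        calc ‖s - 1‖ = ‖(s + 1) - 2‖ := by ring_nf
          _ ≤ ‖s + 1‖ + ‖(2 : ℂ)‖ := norm_sub_le _ _
          _ = _ := by norm_num
      linarith
    have := h2 1 s hs hs4
    rw [norm_div, div_le_iff₀ (by linarith)]
    refine this.trans ?_
    rw [Nat.cast_one]
    calc C2 * (1 + ‖s - 1‖) * (1 * (2 + |s.im|)) ^ ε ≤ C2 * (4 * ‖s + 1‖) * (1 * (2 + |s.im|)) ^ ε := by gcongr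
      _ = (4 * C2) * (1 * (2 + |s.im|)) ^ ε * ‖s + 1‖ := by ring
      _ ≤ _ := by gcongr; linarith

lemma fam_deriv (ε : ℝ) (hε : 0 < ε) (hε1 : ε ≤ 1) : ∃ C : ℝ, 0 < C ∧ ∀ (Q : ℝ) (f : ℂ → ℂ), Fam Q f → ∀ s : ℂ,
    1 - ε / 8 ≤ s.re → s.re ≤ 3 → ‖deriv f s‖ ≤ C * (Q * (2 + |s.im|)) ^ ε := by
  obtain ⟨C, hC, h⟩ := fam_ub ε hε hε1
  refine ⟨C * 2 / (ε / 8), by positivity, fun Q f hf s hs hs3 => ?_⟩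
  have hQ := fam_one hf
  have hR : 0 < ε / 8 := by positivity
  have := Complex.norm_deriv_le_of_forall_mem_sphere_norm_le (f := f) (c := s) (C := C * 2 * (Q * (2 + |s.im|)) ^ ε) hR ?_ ?_
  · refine this.trans (le_of_eq (by ring))
  · apply DifferentiableOn.diffContOnCl
    intro z hz
    rw [closure_ball _ hR.ne', mem_closedBall_iff_norm] at hz
    have h1 := (abs_le.1 ((abs_re_le_norm (z - s)).trans hz)).1
    rw [sub_re] at h1
    exact (fam_diff hf (by linarith)).differentiableWithinAt
  · intro z hz
    rw [mem_sphere_iff_norm] at hz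
    have h1 := (abs_le.1 ((abs_re_le_norm (z - s)).trans hz.le))
    have h2 := (abs_im_le_norm (z - s)).trans hz.le
    rw [sub_re] at h1
    rw [sub_im] at h2
    refine (h Q f hf z (by linarith) (by linarith)).trans ?_
    rw [mul_assoc]
    gcongr
    refine le_trans ?_ (two_mul_rpow (by positivity) hε1)
    apply Real.rpow_le_rpow (by positivity) _ hε.le
    have h3 : |z.im| ≤ |s.im| + 1 := by
      have := abs_sub_abs_le_abs_sub z.im s.im; linarith
    have := abs_nonneg s.im
    nlinarith

lemma fam_lip (ε : ℝ) (hε : 0 < ε) (hε1 : ε ≤ 1) : ∃ C : ℝ, 0 < C ∧ ∀ (Q : ℝ) (f : ℂ → ℂ), Fam Q f → ∀ (T : ℝ) (z w : ℂ),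
    1 - ε / 8 ≤ z.re → z.re ≤ 3 → |z.im| ≤ T → 1 - ε / 8 ≤ w.re → w.re ≤ 3 → |w.im| ≤ T →
    ‖f z - f w‖ ≤ C * (Q * (2 + T)) ^ ε * ‖z - w‖ := by
  obtain ⟨C, hC, h⟩ := fam_deriv ε hε hε1
  refine ⟨C, hC, fun Q f hf T z w hz1 hz2 hz3 hw1 hw2 hw3 => ?_⟩
  have hQ := fam_one hf
  have hconv : Convex ℝ {s : ℂ | (1 - ε / 8 ≤ s.re ∧ s.re ≤ 3) ∧ (-T ≤ s.im ∧ s.im ≤ T)} := by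
    refine Convex.inter (Convex.inter (convex_halfSpace_re_ge _) (convex_halfSpace_re_le _)) (Convex.inter (convex_halfSpace_im_ge _) (convex_halfSpace_im_le _))
  refine Convex.norm_image_sub_le_of_norm_deriv_le (𝕜 := ℂ) (f := f) (C := C * (Q * (2 + T)) ^ ε) (fun x hx => fam_diff hf (by have := hx.1.1; linarith)) (fun x hx => ?_) hconv
    ⟨⟨hw1, hw2⟩, abs_le.1 hw3⟩ ⟨⟨hz1, hz2⟩, abs_le.1 hz3⟩
  refine (h Q f hf x hx.1.1 hx.1.2).trans ?_
  have : |x.im| ≤ T := abs_le.2 hx.2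
  gcongr

end Cayley
end

section
open Complex Finset Filter Topology MeasureTheory ArithmeticFunction

namespace Cayley
open DirichletCharacter

lemma trivL (ε : ℝ) (hε : 0 < ε) (hε1 : ε ≤ 1) : ∃ C : ℝ, 0 < C ∧ ∀ (q : ℕ) [NeZero q] (w : ℂ), 1 ≤ w.re → w.re ≤ 4 → w ≠ 1 →
    ‖LFunctionTrivChar q w‖ ≤ C * (1 + 1 / ‖w - 1‖) * (q * (2 + |w.im|)) ^ ε := by
  obtain ⟨C, hC, h⟩ := triv_bound ε hε hε1
  refine ⟨C, hC, fun q _ w h1 h4 hw => ?_⟩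
  have := h q w (by linarith) h4
  have hn : 0 < ‖w - 1‖ := norm_pos_iff.2 (sub_ne_zero.2 hw)
  rw [show LFunctionTrivChar₁ q w = (w - 1) * LFunctionTrivChar q w by simp [LFunctionTrivChar₁, hw], norm_mul] at this
  rw [← mul_le_mul_iff_of_pos_left hn]
  refine this.trans (le_of_eq ?_)
  field_simp
  ring

lemma lb_L (ε : ℝ) (hε : 0 < ε) (hε1 : ε ≤ 1) : ∃ c : ℝ, 0 < c ∧ ∀ (q : ℕ) [NeZero q] (χ : DirichletCharacter ℂ q), χ ≠ 1 → ∀ s : ℂ,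
    1 ≤ s.re → s.re ≤ 2 → c * (q * (2 + |s.im|)) ^ (-(21 * ε)) ≤ ‖LFunction χ s‖ := by
  obtain ⟨Ct, hCt, ht⟩ := trivL ε hε hε1
  obtain ⟨Cu, hCu, hu⟩ := fam_ub ε hε hε1
  obtain ⟨Cl, hCl, hl⟩ := fam_lip ε hε hε1
  obtain ⟨c1, hc1, hS⟩ := siegel1 ε hε hε1
  set K : ℝ := 1 + 2 * Cu + 2 * Ct * (1 + 2 * Cl / c1) + Cl with hK
  have hKp : 0 < K := by positivity
  refine ⟨min (c1 / 2) (1 / (16 * K ^ 7)), by positivity, fun q _ χ hχ s hs1 hs2 => ?_⟩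
  have hq : (1 : ℝ) ≤ q := by exact_mod_cast NeZero.one_le
  have hfam : Fam q (LFunction χ) := Or.inl ⟨q, inferInstance, χ, hχ, rfl, rfl⟩
  set t := s.im with htdef
  have ht0 := abs_nonneg t
  set N : ℝ := q * (2 + |t|) with hN
  have hqN : (q : ℝ) ≤ N := by rw [hN]; nlinarith
  have hN1 : 1 ≤ N := hq.trans hqN
  have hN2 : 2 * (q : ℝ) ≤ N := by rw [hN]; nlinarith
  set W := N ^ ε with hW
  have hW1 : 1 ≤ W := Real.one_le_rpow hN1 hε.le
  have hW21 : N ^ (-(21 * ε)) = (W ^ 21)⁻¹ := by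
    rw [hW, ← Real.rpow_natCast, ← Real.rpow_mul (by linarith), ← Real.rpow_neg (by linarith)]
    congr 1; push_cast; ring
  rw [hW21]
  by_cases hcase : χ ^ 2 = 1 ∧ ‖s - 1‖ ≤ c1 / (2 * Cl * W ^ 2)
  · obtain ⟨hsq, hsr⟩ := hcase
    have h1 := hS q χ hχ hsq
    have h2 := hl _ _ hfam |t| s 1 (by linarith) (by linarith) le_rfl (by simp; linarith) (by norm_num) (by simp [ht0])
    rw [← hN, ← hW] at h2
    have h3 : c1 * W⁻¹ ≤ ‖LFunction χ 1‖ := by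
      refine le_trans ?_ h1
      rw [Real.rpow_neg (by linarith)]
      gcongr
      exact Real.rpow_le_rpow (by linarith) hqN hε.le
    have h4 : Cl * W * ‖s - 1‖ ≤ c1 / 2 * W⁻¹ := by
      calc Cl * W * ‖s - 1‖ ≤ Cl * W * (c1 / (2 * Cl * W ^ 2)) := by gcongr
        _ = _ := by field_simp
    have h5 := norm_sub_norm_le (LFunction χ 1) (LFunction χ s)
    rw [norm_sub_rev] at h5
    have h6 : (W ^ 21)⁻¹ ≤ W⁻¹ := by
      apply inv_anti₀ (by linarith); exact le_self_pow₀ hW1 (by norm_num)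
    calc min (c1 / 2) (1 / (16 * K ^ 7)) * (W ^ 21)⁻¹ ≤ c1 / 2 * W⁻¹ := by
          gcongr; exact min_le_left _ _
      _ ≤ _ := by linarith
  · set A : ℝ := K * W ^ 3 with hA
    have hKW : ∀ a j, 0 ≤ a → a ≤ K → j ≤ 3 → a * W ^ j ≤ A := by
      intro a j ha0 ha hj
      rw [hA]; gcongr
    have hK1 : 1 ≤ K := by
      rw [hK]; have : 0 ≤ 2 * Cu + 2 * Ct * (1 + 2 * Cl / c1) + Cl := by positivity
      linarith
    have hA1 : 1 ≤ A := by have := hKW 1 0 (by norm_num) hK1 (by norm_num); simpa using this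
    have hpos : 0 ≤ 2 * Ct * (2 * Cl / c1) := by positivity
    have key := C_core A hA1 (fun x => LFunction χ (1 + x + I * t)) (s.re - 1) (by linarith) (by linarith) ?_ ?_
    · have e : (1 : ℂ) + ((s.re - 1 : ℝ) : ℂ) + I * t = s := by
        apply Complex.ext <;> simp [htdef]
      simp only [e] at key
      refine le_trans ?_ key
      calc min (c1 / 2) (1 / (16 * K ^ 7)) * (W ^ 21)⁻¹ ≤ 1 / (16 * K ^ 7) * (W ^ 21)⁻¹ := by
            gcongr; exact min_le_right _ _
        _ = _ := by rw [hA, mul_pow, ← pow_mul]; field_simp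
    · intro x hx hx0 hx1
      have h := norm_LFunction_product_ge_one χ hx0 t
      rw [norm_mul, norm_mul, norm_pow, norm_pow] at h
      refine h.le.trans ?_
      gcongr
      · have b := ht q (1 + x) (by simp; linarith) (by simp; linarith) (by simp; linarith)
        refine b.trans ?_
        have e1 : ‖(1 : ℂ) + x - 1‖ = x := by
          rw [add_sub_cancel_left, norm_real, Real.norm_eq_abs, abs_of_pos hx0]
        have e2 : (1 + (x : ℂ)).im = 0 := by simp
        rw [e1, e2, abs_zero, add_zero, le_div_iff₀ hx0]
        have b2 : ((q : ℝ) * 2) ^ ε ≤ W := Real.rpow_le_rpow (by positivity) (by linarith) hε.le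
        calc Ct * (1 + 1 / x) * ((q : ℝ) * 2) ^ ε * x = Ct * (1 + x) * ((q : ℝ) * 2) ^ ε := by field_simp; ring
          _ ≤ Ct * (1 + 1) * W := by gcongr
          _ = (2 * Ct) * W ^ 1 := by ring
          _ ≤ A := hKW _ _ (by positivity) (by rw [hK]; linarith) (by norm_num)
      · have him : ((1 : ℂ) + x + 2 * I * t).im = 2 * t := by simp
        have hre : ((1 : ℂ) + x + 2 * I * t).re = 1 + x := by simp
        have hpw : ((q : ℝ) * (2 + |2 * t|)) ^ ε ≤ 2 * W := by
          refine le_trans ?_ (two_mul_rpow (by linarith) hε1)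
          apply Real.rpow_le_rpow (by positivity) _ hε.le
          rw [abs_mul, abs_of_pos (by norm_num : (0 : ℝ) < 2), hN]
          nlinarith
        by_cases hsq : χ ^ 2 = 1
        · have hr : c1 / (2 * Cl * W ^ 2) < ‖s - 1‖ := by
            by_contra hcon; exact hcase ⟨hsq, not_lt.1 hcon⟩
          have hrp : 0 < c1 / (2 * Cl * W ^ 2) := by positivity
          have hw : ‖s - 1‖ ≤ ‖(1 : ℂ) + x + 2 * I * t - 1‖ := by
            rw [← sq_le_sq₀ (norm_nonneg _) (norm_nonneg _), ← Complex.normSq_eq_norm_sq, ← Complex.normSq_eq_norm_sq,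
              normSq_apply, normSq_apply]
            simp only [sub_re, sub_im, hre, him, one_re, one_im, ← htdef]
            nlinarith [sq_nonneg t]
          have hwp : 0 < ‖(1 : ℂ) + x + 2 * I * t - 1‖ := hrp.trans (hr.trans_le hw)
          have b := ht q (1 + x + 2 * I * t) (by rw [hre]; linarith) (by rw [hre]; linarith) (sub_ne_zero.1 (norm_pos_iff.1 hwp))
          rw [him] at b
          rw [hsq]
          have hinv : 1 / ‖(1 : ℂ) + x + 2 * I * t - 1‖ ≤ 2 * Cl / c1 * W ^ 2 := by
            calc _ ≤ 1 / (c1 / (2 * Cl * W ^ 2)) := one_div_le_one_div_of_le hrp (hr.le.trans hw)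
              _ = _ := by field_simp
          have hW2 : 1 ≤ W ^ 2 := one_le_pow₀ hW1
          calc _ ≤ Ct * (1 + 1 / ‖(1 : ℂ) + x + 2 * I * t - 1‖) * ((q : ℝ) * (2 + |2 * t|)) ^ ε := b
            _ ≤ Ct * (W ^ 2 + 2 * Cl / c1 * W ^ 2) * (2 * W) := by gcongr
            _ = (2 * Ct * (1 + 2 * Cl / c1)) * W ^ 3 := by ring
            _ ≤ A := hKW _ _ (by positivity) (by rw [hK]; linarith) le_rfl
        · have hfam2 : Fam q (LFunction (χ ^ 2)) := Or.inl ⟨q, inferInstance, χ ^ 2, hsq, rfl, rfl⟩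
          have b := hu _ _ hfam2 (1 + x + 2 * I * t) (by rw [hre]; linarith) (by rw [hre]; linarith)
          rw [him] at b
          calc _ ≤ Cu * ((q : ℝ) * (2 + |2 * t|)) ^ ε := b
            _ ≤ Cu * (2 * W) := by gcongr
            _ = (2 * Cu) * W ^ 1 := by ring
            _ ≤ A := hKW _ _ (by positivity) (by rw [hK]; nlinarith [mul_pos hCt hCl]) (by norm_num)
    · intro x hx hx1
      have him : ∀ y : ℝ, ((1 : ℂ) + y + I * t).im = t := fun y => by simp
      have hre : ∀ y : ℝ, ((1 : ℂ) + y + I * t).re = 1 + y := fun y => by simp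
      have b := hl _ _ hfam |t| (1 + x + I * t) (1 + (s.re - 1 : ℝ) + I * t) (by rw [hre]; linarith) (by rw [hre]; linarith)
        (by rw [him]) (by rw [hre]; linarith) (by rw [hre]; linarith) (by rw [him])
      have e : ‖((1 : ℂ) + x + I * t) - (1 + (s.re - 1 : ℝ) + I * t)‖ = x - (s.re - 1) := by
        rw [show ((1 : ℂ) + x + I * t) - (1 + (s.re - 1 : ℝ) + I * t) = ((x - (s.re - 1) : ℝ) : ℂ) by push_cast; ring, norm_real,
          Real.norm_eq_abs, abs_of_nonneg (by linarith)]
      rw [e, ← hN, ← hW] at b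
      refine b.trans ?_
      apply mul_le_mul_of_nonneg_right _ (by linarith)
      calc Cl * W = Cl * W ^ 1 := by ring
        _ ≤ A := hKW _ _ hCl.le (by rw [hK]; have : 0 ≤ 1 + 2 * Cu + 2 * Ct * (1 + 2 * Cl / c1) := by positivity
                                    linarith) (by norm_num)

lemma zeta_ne (x : ℝ) (hx : 0 < x) : ∀ w : ℂ, 1 ≤ w.re → hz w ≠ 0 := by
  intro w hw
  by_cases h1 : w = 1
  · rw [h1, hz_one]; exact one_ne_zero
  · rw [hz_ne h1]; exact mul_ne_zero (sub_ne_zero.2 h1) (riemannZeta_ne_zero_of_one_le_re hw)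

lemma lb_zeta (ε : ℝ) (hε : 0 < ε) (hε1 : ε ≤ 1) : ∃ c : ℝ, 0 < c ∧ ∀ s : ℂ,
    1 ≤ s.re → s.re ≤ 2 → c * (2 + |s.im|) ^ (-(21 * ε)) ≤ ‖hz s / (s + 1)‖ := by
  obtain ⟨Ct, hCt, ht⟩ := trivL ε hε hε1
  obtain ⟨Cl, hCl, hl⟩ := fam_lip ε hε hε1
  have hfam : Fam 1 (fun s => hz s / (s + 1)) := Or.inr ⟨rfl, rfl⟩
  -- compact part
  have hcpt : IsCompact (Set.Icc (1 : ℝ) 2 ×ℂ Set.Icc (-1 : ℝ) 1) := isCompact_Icc.reProdIm isCompact_Icc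
  have hcont : ContinuousOn (fun s : ℂ => ‖hz s / (s + 1)‖) (Set.Icc (1 : ℝ) 2 ×ℂ Set.Icc (-1 : ℝ) 1) := by
    intro s hs
    have h0 : 0 < s.re := by have := (Complex.mem_reProdIm.1 hs).1.1; linarith
    exact ((fam_diff hfam h0).continuousAt.norm).continuousWithinAt
  obtain ⟨s0, hs0, hmin⟩ := hcpt.exists_isMinOn ⟨1, by simp [Complex.mem_reProdIm]⟩ hcont
  set m := ‖hz s0 / (s0 + 1)‖ with hm
  have hs0re := (Complex.mem_reProdIm.1 hs0).1.1
  have hmp : 0 < m := norm_pos_iff.2 (div_ne_zero (zeta_ne 1 one_pos s0 hs0re) (add_one_ne (by linarith)))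
  set K : ℝ := 1 + 4 * Ct * 3 ^ 4 + Cl with hK
  have hKp : 0 < K := by positivity
  refine ⟨min m (1 / (16 * K ^ 7)), by positivity, fun s hs1 hs2 => ?_⟩
  set t := s.im with htdef
  have ht0 := abs_nonneg t
  set N : ℝ := 2 + |t| with hN
  have hN1 : 1 ≤ N := by linarith
  set W := N ^ ε with hW
  have hW1 : 1 ≤ W := Real.one_le_rpow hN1 hε.le
  have hW21 : N ^ (-(21 * ε)) = (W ^ 21)⁻¹ := by
    rw [hW, ← Real.rpow_natCast, ← Real.rpow_mul (by linarith), ← Real.rpow_neg (by linarith)]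
    congr 1; push_cast; ring
  rw [hW21]
  rcases le_total |t| 1 with htc | htc
  · have h1 : m ≤ ‖hz s / (s + 1)‖ := hmin (Complex.mem_reProdIm.2 ⟨⟨hs1, hs2⟩, abs_le.1 htc⟩)
    refine le_trans ?_ h1
    calc _ ≤ m * 1 := by
          gcongr
          · exact min_le_left _ _
          · exact inv_le_one_of_one_le₀ (one_le_pow₀ hW1)
      _ = m := mul_one m
  · set A : ℝ := K * W ^ 3 with hA
    have hKW : ∀ a j, 0 ≤ a → a ≤ K → j ≤ 3 → a * W ^ j ≤ A := by
      intro a j ha0 ha hj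
      rw [hA]; gcongr
    have hK1 : 1 ≤ K := by
      rw [hK]; have : 0 ≤ 4 * Ct * 3 ^ 4 + Cl := by positivity
      linarith
    have hA1 : 1 ≤ A := by have := hKW 1 0 (by norm_num) hK1 (by norm_num); simpa using this
    have key := C_core A hA1 (fun x => hz (1 + x + I * t) / (1 + x + I * t + 1)) (s.re - 1) (by linarith) (by linarith) ?_ ?_
    · have e : (1 : ℂ) + ((s.re - 1 : ℝ) : ℂ) + I * t = s := by
        apply Complex.ext <;> simp [htdef]
      simp only [e] at key
      refine le_trans ?_ key
      calc min m (1 / (16 * K ^ 7)) * (W ^ 21)⁻¹ ≤ 1 / (16 * K ^ 7) * (W ^ 21)⁻¹ := by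
            gcongr; exact min_le_right _ _
        _ = _ := by rw [hA, mul_pow, ← pow_mul]; field_simp
    · intro x hx hx0 hx1
      have h := norm_LFunction_product_ge_one (1 : DirichletCharacter ℂ 1) hx0 t
      rw [norm_mul, norm_mul, norm_pow, norm_pow] at h
      -- triv estimate at 1+x
      have b1 : ‖LFunctionTrivChar 1 (1 + x)‖ ≤ A / x := by
        have b := ht 1 (1 + x) (by simp; linarith) (by simp; linarith) (by simp; linarith)
        refine b.trans ?_
        have e1 : ‖(1 : ℂ) + x - 1‖ = x := by
          rw [add_sub_cancel_left, norm_real, Real.norm_eq_abs, abs_of_pos hx0]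
        have e2 : (1 + (x : ℂ)).im = 0 := by simp
        rw [e1, e2, abs_zero, add_zero, le_div_iff₀ hx0]
        have b2 : (((1 : ℕ) : ℝ) * 2) ^ ε ≤ W := Real.rpow_le_rpow (by positivity) (by rw [Nat.cast_one]; linarith) hε.le
        calc Ct * (1 + 1 / x) * (((1 : ℕ) : ℝ) * 2) ^ ε * x = Ct * (1 + x) * (((1 : ℕ) : ℝ) * 2) ^ ε := by field_simp; ring
          _ ≤ Ct * (1 + 1) * W := by gcongr
          _ = (2 * Ct) * W ^ 1 := by ring
          _ ≤ A := hKW _ _ (by positivity) (by rw [hK]; linarith) (by norm_num)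
      have hnorm : ∀ τ : ℝ, 1 ≤ |τ| → 1 ≤ ‖(1 : ℂ) + x + I * τ - 1‖ := by
        intro τ hτ
        refine hτ.trans ?_
        have := abs_im_le_norm ((1 : ℂ) + x + I * τ - 1)
        simpa using this
      have b4 : ‖LFunction (1 : DirichletCharacter ℂ 1) (1 + x + I * t)‖ ≤ 3 * ‖hz (1 + x + I * t) / (1 + x + I * t + 1)‖ := by
        set w : ℂ := 1 + x + I * t with hw
        have hw1 : 1 ≤ ‖w - 1‖ := hnorm t htc
        have hwn : w ≠ 1 := fun h => by rw [h] at hw1; simp at hw1; linarith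
        have hw0 : 0 < w.re := by simp [hw]; linarith
        rw [LFunction_modOne_eq, hz_ne hwn, norm_div, norm_mul]
        have hp : 0 < ‖w + 1‖ := norm_pos_iff.2 (add_one_ne hw0)
        have h3 : ‖w + 1‖ ≤ 3 * ‖w - 1‖ := by
          calc ‖w + 1‖ = ‖(w - 1) + 2‖ := by ring_nf
            _ ≤ ‖w - 1‖ + ‖(2 : ℂ)‖ := norm_add_le _ _
            _ ≤ _ := by norm_num; linarith
        rw [← mul_div_assoc, le_div_iff₀ hp]
        calc ‖riemannZeta w‖ * ‖w + 1‖ ≤ ‖riemannZeta w‖ * (3 * ‖w - 1‖) := by gcongr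
          _ = _ := by ring
      have b5 : ‖LFunction ((1 : DirichletCharacter ℂ 1) ^ 2) (1 + x + 2 * I * t)‖ ≤ 4 * Ct * W := by
        rw [one_pow]
        have e3 : (1 : ℂ) + x + 2 * I * t = 1 + x + I * ((2 * t : ℝ) : ℂ) := by push_cast; ring
        have hn2 : 1 ≤ |2 * t| := by rw [abs_mul, abs_of_pos (by norm_num : (0 : ℝ) < 2)]; linarith
        rw [e3]
        set w : ℂ := 1 + x + I * ((2 * t : ℝ) : ℂ) with hw
        have hw1 : 1 ≤ ‖w - 1‖ := hnorm _ hn2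
        have hwn : w ≠ 1 := fun h => by rw [h] at hw1; simp at hw1; linarith
        have him : w.im = 2 * t := by simp [hw]
        have hre : w.re = 1 + x := by simp [hw]
        have b := ht 1 w (by rw [hre]; linarith) (by rw [hre]; linarith) hwn
        rw [him] at b
        have hpw : (((1 : ℕ) : ℝ) * (2 + |2 * t|)) ^ ε ≤ 2 * W := by
          refine le_trans ?_ (two_mul_rpow (by linarith) hε1)
          apply Real.rpow_le_rpow (by positivity) _ hε.le
          rw [abs_mul, abs_of_pos (by norm_num : (0 : ℝ) < 2), hN, Nat.cast_one]
          linarith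
        calc _ ≤ Ct * (1 + 1 / ‖w - 1‖) * (((1 : ℕ) : ℝ) * (2 + |2 * t|)) ^ ε := b
          _ ≤ Ct * (1 + 1) * (2 * W) := by
            gcongr; exact (div_le_one (by linarith)).2 hw1
          _ = 4 * Ct * W := by ring
      calc (1 : ℝ) ≤ _ := h
        _ ≤ (A / x) ^ 3 * (3 * ‖hz (1 + x + I * t) / (1 + x + I * t + 1)‖) ^ 4 * (4 * Ct * W) := by
          gcongr
        _ = (A / x) ^ 3 * ‖hz (1 + x + I * t) / (1 + x + I * t + 1)‖ ^ 4 * ((4 * Ct * 3 ^ 4) * W ^ 1) := by ring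
        _ ≤ _ := by
          apply mul_le_mul_of_nonneg_left _ (by positivity)
          exact hKW _ _ (by positivity) (by rw [hK]; linarith) (by norm_num)
    · intro x hx hx1
      have him : ∀ y : ℝ, ((1 : ℂ) + y + I * t).im = t := fun y => by simp
      have hre : ∀ y : ℝ, ((1 : ℂ) + y + I * t).re = 1 + y := fun y => by simp
      have b := hl _ _ hfam |t| (1 + x + I * t) (1 + (s.re - 1 : ℝ) + I * t) (by rw [hre]; linarith) (by rw [hre]; linarith)
        (by rw [him]) (by rw [hre]; linarith) (by rw [hre]; linarith) (by rw [him])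
      have e : ‖((1 : ℂ) + x + I * t) - (1 + (s.re - 1 : ℝ) + I * t)‖ = x - (s.re - 1) := by
        rw [show ((1 : ℂ) + x + I * t) - (1 + (s.re - 1 : ℝ) + I * t) = ((x - (s.re - 1) : ℝ) : ℂ) by push_cast; ring, norm_real,
          Real.norm_eq_abs, abs_of_nonneg (by linarith)]
      rw [e, one_mul, ← hN, ← hW] at b
      refine b.trans ?_
      apply mul_le_mul_of_nonneg_right _ (by linarith)
      calc Cl * W = Cl * W ^ 1 := by ring
        _ ≤ A := hKW _ _ hCl.le (by rw [hK]; have : 0 ≤ 1 + 4 * Ct * 3 ^ 4 := by positivity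
                                    linarith) (by norm_num)

lemma fam_lb (ε : ℝ) (hε : 0 < ε) (hε1 : ε ≤ 1) : ∃ c : ℝ, 0 < c ∧ ∀ (Q : ℝ) (f : ℂ → ℂ), Fam Q f → ∀ s : ℂ,
    1 ≤ s.re → s.re ≤ 2 → c * (Q * (2 + |s.im|)) ^ (-ε) ≤ ‖f s‖ := by
  obtain ⟨c1, hc1, h1⟩ := lb_L (ε / 21) (by positivity) (by linarith)
  obtain ⟨c2, hc2, h2⟩ := lb_zeta (ε / 21) (by positivity) (by linarith)
  rw [show 21 * (ε / 21) = ε by ring] at *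
  refine ⟨min c1 c2, by positivity, fun Q f hf s hs hs2 => ?_⟩
  have hQ := fam_one hf
  have hp : 0 ≤ (Q * (2 + |s.im|)) ^ (-ε) := by positivity
  rcases hf with ⟨n, _, χ, hχ, rfl, rfl⟩ | ⟨rfl, rfl⟩
  · exact (mul_le_mul_of_nonneg_right (min_le_left _ _) hp).trans (h1 n χ hχ s hs hs2)
  · refine (mul_le_mul_of_nonneg_right (min_le_right _ _) hp).trans ?_
    rw [one_mul]; exact h2 s hs hs2

end Cayley
end

section
open Complex Finset Filter Topology MeasureTheory ArithmeticFunction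

namespace Cayley
open DirichletCharacter

lemma cauchy_wrap (k : ℕ) {f : ℂ → ℂ} {s : ℂ} {R M : ℝ} (hR : 0 < R)
    (hd : ∀ z, ‖z - s‖ ≤ R → DifferentiableAt ℂ f z) (hM : ∀ z, ‖z - s‖ ≤ R → ‖f z‖ ≤ M) :
    ‖iteratedDeriv k f s‖ ≤ k.factorial * M / R ^ k := by
  refine Complex.norm_iteratedDeriv_le_of_forall_mem_sphere_norm_le k hR ?_ fun z hz => hM z ?_
  · apply DifferentiableOn.diffContOnCl
    intro z hz
    rw [closure_ball _ hR.ne', mem_closedBall_iff_norm] at hz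
    exact (hd z hz).differentiableWithinAt
  · rw [mem_sphere_iff_norm] at hz; exact hz.le

lemma fam_logderiv (k : ℕ) (ε : ℝ) (hε : 0 < ε) (hε1 : ε ≤ 1) : ∃ C : ℝ, 0 < C ∧ ∀ (Q : ℝ) (f : ℂ → ℂ), Fam Q f → ∀ s : ℂ,
    1 ≤ s.re → s.re ≤ 2 → ‖iteratedDeriv k (fun z => deriv f z / f z) s‖ ≤ C * (Q * (2 + |s.im|)) ^ ε := by
  set e : ℝ := ε / (2 * k + 2) with he
  have hep : 0 < e := by positivity
  have he1 : e ≤ 1 := by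
    rw [he, div_le_one (by positivity)]; have : (0 : ℝ) ≤ k := Nat.cast_nonneg k
    linarith
  obtain ⟨Cl, hCl, hl⟩ := fam_lip e hep he1
  obtain ⟨Cd, hCd, hD⟩ := fam_deriv e hep he1
  obtain ⟨c, hc, hlb⟩ := fam_lb e hep he1
  set c' : ℝ := min (e / 8) (c / (4 * Cl)) with hc'
  have hc'p : 0 < c' := by positivity
  refine ⟨k.factorial * (4 * Cd / c) / c' ^ k, by positivity, fun Q f hf s hs hs2 => ?_⟩
  have hQ := fam_one hf
  have ht0 := abs_nonneg s.im
  set N : ℝ := Q * (2 + |s.im|) with hN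
  have hN1 : 1 ≤ N := by rw [hN]; nlinarith
  set W := N ^ e with hW
  have hW1 : 1 ≤ W := Real.one_le_rpow hN1 hep.le
  have hWε : N ^ ε = W ^ 2 * (W ^ 2) ^ k := by
    rw [hW, ← pow_mul, ← pow_add, ← Real.rpow_natCast, ← Real.rpow_mul (by linarith)]
    congr 1; rw [he]; push_cast; field_simp; ring
  set R := c' / W ^ 2 with hR
  have hRp : 0 < R := by positivity
  have hRc : R ≤ c' := div_le_self hc'p.le (one_le_pow₀ hW1)
  have hR8 : R ≤ e / 8 := hRc.trans (min_le_left _ _)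
  have hbig : (Q * (2 + (|s.im| + 1))) ^ e ≤ 2 * W := by
    refine le_trans ?_ (two_mul_rpow (by linarith) he1)
    apply Real.rpow_le_rpow (by positivity) _ hep.le
    rw [hN]; nlinarith
  have hpt : ∀ z, ‖z - s‖ ≤ R → (1 - e / 8 ≤ z.re ∧ z.re ≤ 3 ∧ |z.im| ≤ |s.im| + 1) := by
    intro z hz
    have h1 := (abs_le.1 ((abs_re_le_norm (z - s)).trans hz))
    have h2 := (abs_im_le_norm (z - s)).trans hz
    rw [sub_re] at h1
    rw [sub_im] at h2
    have := abs_sub_abs_le_abs_sub z.im s.im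
    exact ⟨by linarith, by linarith, by linarith⟩
  have hlow : ∀ z, ‖z - s‖ ≤ R → c / 2 * W⁻¹ ≤ ‖f z‖ := by
    intro z hz
    obtain ⟨a1, a2, a3⟩ := hpt z hz
    have b := hl Q f hf (|s.im| + 1) z s a1 a2 a3 (by linarith) (by linarith) (by linarith)
    have b2 : Cl * (Q * (2 + (|s.im| + 1))) ^ e * ‖z - s‖ ≤ c / 2 * W⁻¹ := by
      calc _ ≤ Cl * (2 * W) * R := by gcongr
        _ = 2 * Cl * c' * W⁻¹ := by rw [hR]; field_simp
        _ ≤ 2 * Cl * (c / (4 * Cl)) * W⁻¹ := by gcongr; exact min_le_right _ _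
        _ = _ := by field_simp; norm_num
    have b3 := hlb Q f hf s hs hs2
    rw [← hN, Real.rpow_neg (by linarith), ← hW] at b3
    have b4 := norm_sub_norm_le (f s) (f z)
    rw [norm_sub_rev] at b4
    have : c / 2 * W⁻¹ = c * W⁻¹ - c / 2 * W⁻¹ := by ring
    linarith
  have hopen : IsOpen {z : ℂ | 0 < z.re} := isOpen_lt continuous_const continuous_re
  have hdd : DifferentiableOn ℂ (deriv f) {z : ℂ | 0 < z.re} :=
    DifferentiableOn.deriv (fun z hz => (fam_diff hf hz).differentiableWithinAt) hopen
  have hWi : 0 < c / 2 * W⁻¹ := by positivity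
  have key := cauchy_wrap k (f := fun z => deriv f z / f z) (s := s) (R := R) (M := 4 * Cd / c * W ^ 2) hRp ?_ ?_
  · refine key.trans (le_of_eq ?_)
    rw [hWε, hR, div_pow]; field_simp
  · intro z hz
    have h0 : 0 < z.re := by have := (hpt z hz).1; linarith
    refine (hdd.differentiableAt (hopen.mem_nhds h0)).div (fam_diff hf h0) ?_
    exact norm_pos_iff.1 (hWi.trans_le (hlow z hz))
  · intro z hz
    obtain ⟨a1, a2, a3⟩ := hpt z hz
    have hdz := hD Q f hf z a1 a2
    rw [norm_div, div_le_iff₀ (hWi.trans_le (hlow z hz))]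
    calc ‖deriv f z‖ ≤ Cd * (Q * (2 + |z.im|)) ^ e := hdz
      _ ≤ Cd * (Q * (2 + (|s.im| + 1))) ^ e := by gcongr
      _ ≤ Cd * (2 * W) := by gcongr
      _ = 4 * Cd / c * W ^ 2 * (c / 2 * W⁻¹) := by field_simp; norm_num
      _ ≤ _ := by gcongr; exact hlow z hz

/-- auxiliary entire part for zeta -/
noncomputable def gz (s : ℂ) : ℂ := 1 / (s + 1) + dslope hz 1 s

lemma gz_diff {s : ℂ} (hs : 0 < s.re) : DifferentiableAt ℂ gz s := by
  unfold gz
  refine DifferentiableAt.add ?_ ?_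
  · exact (differentiableAt_const _).div (differentiableAt_id.add_const 1) (add_one_ne hs)
  · have : DifferentiableOn ℂ (dslope hz 1) Set.univ :=
      (Complex.differentiableOn_dslope (Filter.univ_mem)).2 (differentiable_LFunctionTrivChar₁ 1).differentiableOn
    exact (this s trivial).differentiableAt Filter.univ_mem

lemma gz_bound (ε : ℝ) (hε : 0 < ε) (hε1 : ε ≤ 1) : ∃ C : ℝ, 0 < C ∧ ∀ s : ℂ, 1 - ε / 4 ≤ s.re → s.re ≤ 4 →
    ‖gz s‖ ≤ C * (2 + |s.im|) ^ ε := by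
  obtain ⟨C2, hC2, h2⟩ := triv_bound ε hε hε1
  have hcpt : IsCompact (Metric.closedBall (1 : ℂ) 1) := isCompact_closedBall _ _
  have hdc : Continuous (dslope hz 1) := by
    have : DifferentiableOn ℂ (dslope hz 1) Set.univ :=
      (Complex.differentiableOn_dslope (Filter.univ_mem)).2 (differentiable_LFunctionTrivChar₁ 1).differentiableOn
    exact (differentiableOn_univ.1 this).continuous
  obtain ⟨M, hM⟩ := hcpt.exists_bound_of_continuousOn (f := dslope hz 1) hdc.continuousOn
  refine ⟨1 + |M| + (2 * C2 + 1), by positivity, fun s hs hs4 => ?_⟩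
  have hre : (1 : ℝ) ≤ ‖s + 1‖ := by
    have := re_le_norm (s + 1); simp at this; linarith
  have hN : 1 ≤ (2 + |s.im|) ^ ε := Real.one_le_rpow (by have := abs_nonneg s.im; linarith) hε.le
  have b1 : ‖1 / (s + 1)‖ ≤ 1 * (2 + |s.im|) ^ ε := by
    rw [norm_div, norm_one, one_mul]; exact ((div_le_one (by linarith)).2 hre).trans hN
  have b2 : ‖dslope hz 1 s‖ ≤ (|M| + (2 * C2 + 1)) * (2 + |s.im|) ^ ε := by
    by_cases h : ‖s - 1‖ ≤ 1
    · have := hM s (mem_closedBall_iff_norm.2 h)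
      calc _ ≤ |M| * 1 := by rw [mul_one]; exact this.trans (le_abs_self M)
        _ ≤ _ := by gcongr; linarith
    · push Not at h
      have hs1 : s ≠ 1 := fun h' => by rw [h'] at h; simp at h; linarith
      rw [dslope_of_ne _ hs1, slope_def_field, norm_div, hz_one, div_le_iff₀ (by linarith)]
      have b := h2 1 s hs hs4
      rw [Nat.cast_one, one_mul] at b
      calc ‖hz s - 1‖ ≤ ‖hz s‖ + ‖(1 : ℂ)‖ := norm_sub_le _ _
        _ ≤ C2 * (1 + ‖s - 1‖) * (2 + |s.im|) ^ ε + (2 + |s.im|) ^ ε * ‖s - 1‖ := by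
            rw [norm_one]; gcongr; nlinarith
        _ ≤ C2 * (‖s - 1‖ + ‖s - 1‖) * (2 + |s.im|) ^ ε + (2 + |s.im|) ^ ε * ‖s - 1‖ := by gcongr
        _ = (0 + (2 * C2 + 1)) * (2 + |s.im|) ^ ε * ‖s - 1‖ := by ring
        _ ≤ _ := by gcongr; exact abs_nonneg M
  calc ‖gz s‖ ≤ _ := norm_add_le _ _
    _ ≤ _ := add_le_add b1 b2
    _ = _ := by ring

lemma gz_deriv (k : ℕ) (ε : ℝ) (hε : 0 < ε) (hε1 : ε ≤ 1) : ∃ C : ℝ, 0 < C ∧ ∀ s : ℂ, 1 ≤ s.re → s.re ≤ 2 →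
    ‖iteratedDeriv k gz s‖ ≤ C * (2 + |s.im|) ^ ε := by
  obtain ⟨C, hC, h⟩ := gz_bound ε hε hε1
  refine ⟨k.factorial * (C * 2) / (ε / 8) ^ k, by positivity, fun s hs hs2 => ?_⟩
  have hpt : ∀ z, ‖z - s‖ ≤ ε / 8 → (1 - ε / 4 ≤ z.re ∧ z.re ≤ 4 ∧ |z.im| ≤ |s.im| + 1) := by
    intro z hz
    have h1 := (abs_le.1 ((abs_re_le_norm (z - s)).trans hz))
    have h2 := (abs_im_le_norm (z - s)).trans hz
    rw [sub_re] at h1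
    rw [sub_im] at h2
    have := abs_sub_abs_le_abs_sub z.im s.im
    exact ⟨by linarith, by linarith, by linarith⟩
  have key := cauchy_wrap k (f := gz) (s := s) (R := ε / 8) (M := C * 2 * (2 + |s.im|) ^ ε) (by positivity) ?_ ?_
  · exact key.trans (le_of_eq (by ring))
  · intro z hz; exact gz_diff (by have := (hpt z hz).1; linarith)
  · intro z hz
    obtain ⟨a1, a2, a3⟩ := hpt z hz
    refine (h z a1 a2).trans ?_
    rw [mul_assoc]; gcongr
    refine le_trans ?_ (two_mul_rpow (by positivity) hε1)
    apply Real.rpow_le_rpow (by positivity) _ hε.le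
    have := abs_nonneg s.im
    linarith

/-- The family of coefficient sequences -/
def Dfam (Q : ℝ) (a : ℕ → ℂ) : Prop :=
  (∃ (n : ℕ) (_ : NeZero n) (χ : DirichletCharacter ℂ n), χ ≠ 1 ∧ Q = n ∧ a = fun m : ℕ => χ (m : ZMod n) * (vonMangoldt m : ℂ)) ∨
    (Q = 1 ∧ a = fun m : ℕ => (vonMangoldt m : ℂ) - 1)

lemma dfam_one {Q : ℝ} {a : ℕ → ℂ} (h : Dfam Q a) : 1 ≤ Q := by
  rcases h with ⟨n, _, χ, -, rfl, -⟩ | ⟨rfl, -⟩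
  · exact_mod_cast NeZero.one_le
  · exact le_rfl

lemma dfam_summable {Q : ℝ} {a : ℕ → ℂ} (h : Dfam Q a) {s : ℂ} (hs : 1 < s.re) : LSeriesSummable a s := by
  rcases h with ⟨n, _, χ, hχ, rfl, rfl⟩ | ⟨rfl, rfl⟩
  · exact LSeriesSummable_twist_vonMangoldt χ hs
  · exact (LSeriesSummable_vonMangoldt hs).sub (LSeriesSummable_one_iff.2 hs)

lemma dfam_absc {Q : ℝ} {a : ℕ → ℂ} (h : Dfam Q a) {s : ℂ} (hs : 1 < s.re) : LSeries.abscissaOfAbsConv a < s.re := by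
  refine lt_of_le_of_lt (LSeries.abscissaOfAbsConv_le_of_forall_lt_LSeriesSummable (x := 1) fun y hy => ?_) (by exact_mod_cast hs)
  exact dfam_summable h (by simpa using hy)

lemma dfam_fun {Q : ℝ} {a : ℕ → ℂ} (h : Dfam Q a) : ∃ f, Fam Q f ∧
    ((∀ s : ℂ, 1 < s.re → LSeries a s = - (deriv f s / f s)) ∨ (Q = 1 ∧ ∀ s : ℂ, 1 < s.re → LSeries a s = - (deriv f s / f s) - gz s)) := by
  rcases h with ⟨n, i, χ, hχ, rfl, rfl⟩ | ⟨rfl, rfl⟩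
  · refine ⟨LFunction χ, Or.inl ⟨n, i, χ, hχ, rfl, rfl⟩, Or.inl fun s hs => ?_⟩
    have := LSeries_twist_vonMangoldt_eq χ hs
    rw [← neg_div, deriv_LFunction_eq_deriv_LSeries χ hs, LFunction_eq_LSeries χ hs]
    exact this
  · refine ⟨_, Or.inr ⟨rfl, rfl⟩, Or.inr ⟨rfl, fun s hs => ?_⟩⟩
    have hs1 : s ≠ 1 := fun h => by rw [h] at hs; simp at hs
    have hsm : s - 1 ≠ 0 := sub_ne_zero.2 hs1
    have hz0 := riemannZeta_ne_zero_of_one_le_re hs.le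
    have hsp : s + 1 ≠ 0 := add_one_ne (by linarith)
    have e1 : LSeries (fun m : ℕ => (vonMangoldt m : ℂ) - 1) s = - deriv riemannZeta s / riemannZeta s - riemannZeta s := by
      rw [← LSeries_vonMangoldt_eq_deriv_riemannZeta_div hs, ← LSeries_one_eq_riemannZeta hs,
        ← LSeries_sub (LSeriesSummable_vonMangoldt hs) (LSeriesSummable_one_iff.2 hs)]
      rfl
    rw [e1]
    have hev : (fun s => hz s / (s + 1)) =ᶠ[𝓝 s] fun s => (s - 1) * riemannZeta s / (s + 1) := by
      filter_upwards [isOpen_ne.mem_nhds hs1] with w hw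
      rw [hz_ne hw]
    have hdz : DifferentiableAt ℂ riemannZeta s := differentiableAt_riemannZeta hs1
    have hd1 : HasDerivAt (fun s => (s - 1) * riemannZeta s / (s + 1))
        (((1 * riemannZeta s + (s - 1) * deriv riemannZeta s) * (s + 1) - (s - 1) * riemannZeta s * 1) / (s + 1) ^ 2) s :=
      (((hasDerivAt_id s).sub_const 1).mul hdz.hasDerivAt).div ((hasDerivAt_id s).add_const 1) hsp
    rw [hev.deriv_eq, hd1.deriv, gz, dslope_of_ne _ hs1, slope_def_field, hz_one, hz_ne hs1]
    field_simp
    ring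

lemma dfam_bound (k : ℕ) (ε : ℝ) (hε : 0 < ε) (hε1 : ε ≤ 1) : ∃ C : ℝ, 0 < C ∧ ∀ (Q : ℝ) (a : ℕ → ℂ), Dfam Q a → ∀ s : ℂ,
    1 < s.re → s.re ≤ 2 → ‖LSeries (LSeries.logMul^[k] a) s‖ ≤ C * (Q * (2 + |s.im|)) ^ ε := by
  obtain ⟨C1, hC1, h1⟩ := fam_logderiv k ε hε hε1
  obtain ⟨C2, hC2, h2⟩ := gz_deriv k ε hε hε1
  refine ⟨C1 + C2, by positivity, fun Q a ha s hs hs2 => ?_⟩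
  have hQ := dfam_one ha
  have e := LSeries_iteratedDeriv k (dfam_absc ha hs)
  have e' : ‖LSeries (LSeries.logMul^[k] a) s‖ = ‖iteratedDeriv k (LSeries a) s‖ := by
    rw [e, norm_mul, norm_pow, norm_neg, norm_one, one_pow, one_mul]
  rw [e']
  have hopen : IsOpen {z : ℂ | 1 < z.re} := isOpen_lt continuous_const continuous_re
  have hopen0 : IsOpen {z : ℂ | 0 < z.re} := isOpen_lt continuous_const continuous_re
  obtain ⟨f, hf, hfe | ⟨hQ1, hfe⟩⟩ := dfam_fun ha
  · have hev : LSeries a =ᶠ[𝓝 s] fun z => - (deriv f z / f z) := by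
      filter_upwards [hopen.mem_nhds hs] with z hz using hfe z hz
    rw [hev.iteratedDeriv_eq, iteratedDeriv_fun_neg, norm_neg]
    refine (h1 Q f hf s hs.le hs2).trans ?_
    gcongr; linarith
  · have hev : LSeries a =ᶠ[𝓝 s] fun z => - (deriv f z / f z) - gz z := by
      filter_upwards [hopen.mem_nhds hs] with z hz using hfe z hz
    have hdd : DifferentiableOn ℂ (deriv f) {z : ℂ | 0 < z.re} :=
      DifferentiableOn.deriv (fun z hz => (fam_diff hf hz).differentiableWithinAt) hopen0
    have hfne : ∀ z : ℂ, 1 < z.re → z.re < 3 → True := fun _ _ _ => trivial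
    obtain ⟨c, hc, hlb⟩ := fam_lb ε hε hε1
    have hne : ∀ z : ℂ, 1 < z.re → z.re ≤ 2 → f z ≠ 0 := fun z hz hz2 =>
      norm_pos_iff.1 (lt_of_lt_of_le (by have := abs_nonneg z.im; positivity) (hlb Q f hf z hz.le hz2))
    have hA1 : ContDiffAt ℂ k (fun z => deriv f z / f z) s := by
      have ho : IsOpen {z : ℂ | 0 < z.re ∧ f z ≠ 0} := by
        have hc : ContinuousOn f {z : ℂ | 0 < z.re} := fun z hz => (fam_diff hf hz).continuousAt.continuousWithinAt
        have := hc.isOpen_inter_preimage hopen0 (isOpen_ne (x := (0 : ℂ)))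
        exact this
      have hdf : DifferentiableOn ℂ (fun z => deriv f z / f z) {z : ℂ | 0 < z.re ∧ f z ≠ 0} := fun z hz =>
        ((hdd.differentiableAt (hopen0.mem_nhds hz.1)).div (fam_diff hf hz.1) hz.2).differentiableWithinAt
      exact (hdf.contDiffOn ho).contDiffAt (ho.mem_nhds ⟨by linarith, hne s hs hs2⟩)
    have hA2 : ContDiffAt ℂ k gz s := by
      have hdf : DifferentiableOn ℂ gz {z : ℂ | 0 < z.re} := fun z hz => (gz_diff hz).differentiableWithinAt
      exact (hdf.contDiffOn hopen0).contDiffAt (hopen0.mem_nhds (by change 0 < s.re; linarith))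
    rw [hev.iteratedDeriv_eq, iteratedDeriv_fun_sub hA1.neg hA2, iteratedDeriv_fun_neg]
    have b2 := h2 s hs.le hs2
    calc _ ≤ ‖-iteratedDeriv k (fun z => deriv f z / f z) s‖ + ‖iteratedDeriv k gz s‖ := norm_sub_le _ _
      _ ≤ C1 * (Q * (2 + |s.im|)) ^ ε + C2 * (2 + |s.im|) ^ ε := by
        rw [norm_neg]; exact add_le_add (h1 Q f hf s hs.le hs2) b2
      _ = (C1 + C2) * (Q * (2 + |s.im|)) ^ ε := by rw [hQ1, one_mul]; ring

end Cayley
end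

section
open Complex Finset Filter Topology MeasureTheory ArithmeticFunction

namespace Cayley
open DirichletCharacter

noncomputable def hat (u : ℝ) : ℂ := ((max (1 - u) 0 : ℝ) : ℂ)

noncomputable def ker (s : ℂ) : ℂ := 1 / (s * (s + 1))

lemma ker_norm {s : ℂ} (hs : 1 ≤ s.re) : ‖ker s‖ ≤ (1 + s.im ^ 2)⁻¹ := by
  have h0 : (0:ℝ) < 1 + s.im ^ 2 := by positivity
  have h1 : Real.sqrt (1 + s.im ^ 2) ≤ ‖s‖ := by
    rw [Complex.norm_def]; apply Real.sqrt_le_sqrt; rw [Complex.normSq_apply]; nlinarith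
  have h2 : Real.sqrt (1 + s.im ^ 2) ≤ ‖s + 1‖ := by
    rw [Complex.norm_def]; apply Real.sqrt_le_sqrt; rw [Complex.normSq_apply]; simp; nlinarith
  unfold ker
  rw [norm_div, norm_one, norm_mul, ← one_div]
  apply one_div_le_one_div_of_le h0
  calc 1 + s.im ^ 2 = Real.sqrt (1 + s.im ^ 2) * Real.sqrt (1 + s.im ^ 2) := (Real.mul_self_sqrt h0.le).symm
    _ ≤ _ := by gcongr

lemma hat_mellin {s : ℂ} (hs : 1 ≤ s.re) : HasMellin hat s (ker s) := by
  have h1 := hasMellin_one_Ioc (s := s) (by linarith)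
  have h2 := hasMellin_cpow_Ioc 1 (s := s) (by simp; linarith)
  have h3 := hasMellin_sub h1.1 h2.1
  have e : Set.EqOn (fun t : ℝ => (t:ℂ) ^ (s - 1) • hat t)
    (fun t : ℝ => (t:ℂ) ^ (s - 1) • (Set.indicator (Set.Ioc 0 1) (fun _ => 1 : ℝ → ℂ) t - Set.indicator (Set.Ioc 0 1) (fun t => (t:ℂ) ^ (1:ℂ) : ℝ → ℂ) t)) (Set.Ioi 0) := by
    intro t ht
    simp only [hat]
    congr 1
    have ht' : 0 < t := ht
    by_cases h : t ≤ 1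
    · rw [Set.indicator_of_mem (show t ∈ Set.Ioc (0:ℝ) 1 from ⟨ht, h⟩), Set.indicator_of_mem (show t ∈ Set.Ioc (0:ℝ) 1 from ⟨ht, h⟩), max_eq_left (by linarith)]
      simp
    · rw [Set.indicator_of_notMem (fun h' => h h'.2), Set.indicator_of_notMem (fun h' => h h'.2), max_eq_right (by linarith)]
      simp
  refine ⟨?_, ?_⟩
  · exact (integrableOn_congr_fun e measurableSet_Ioi).2 h3.1
  · have : mellin hat s = _ := (setIntegral_congr_fun measurableSet_Ioi e).trans h3.2
    rw [this, h1.2, h2.2, ker]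
    have : s ≠ 0 := by rintro rfl; simp at hs; linarith
    have : s + 1 ≠ 0 := by intro h; have := congrArg re h; simp at this; linarith
    field_simp; ring

lemma ker_cont (σ : ℝ) (hσ : 1 ≤ σ) : Continuous fun y : ℝ => ker (σ + y * I) := by
  unfold ker
  refine Continuous.div (by fun_prop) (by fun_prop) ?_
  intro y
  apply mul_ne_zero
  · intro h; have := congrArg re h; simp at this; linarith
  · intro h; have := congrArg re h; simp at this; linarith

lemma ker_int (σ : ℝ) (hσ : 1 ≤ σ) : Integrable fun y : ℝ => ker (σ + y * I) := by
  refine integrable_inv_one_add_sq.mono' (ker_cont σ hσ).aestronglyMeasurable (Eventually.of_forall fun y => ?_)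
  have := ker_norm (s := σ + y * I) (by simpa using hσ)
  simpa using this

lemma hat_inv (σ : ℝ) (hσ : 1 ≤ σ) {u : ℝ} (hu : 0 < u) :
    ∫ y : ℝ, (u : ℂ) ^ (-(σ + y * I)) * ker (σ + y * I) = 2 * Real.pi * hat u := by
  have e : (fun y : ℝ => mellin hat (σ + y * I)) = fun y : ℝ => ker (σ + y * I) := by
    ext y; exact (hat_mellin (by simpa using hσ)).2
  have h := mellinInv_mellin_eq σ hat hu (hat_mellin (by simpa using hσ)).1
    (by unfold VerticalIntegrable; rw [e]; exact ker_int σ hσ) (by unfold hat; fun_prop)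
  rw [← h, mellinInv]
  have e' : ∀ y : ℝ, mellin hat (σ + y * I) = ker (σ + y * I) := fun y => congrFun e y
  simp_rw [e', smul_eq_mul]
  rw [Complex.real_smul]
  push_cast
  have : (Real.pi : ℂ) ≠ 0 := by exact_mod_cast Real.pi_ne_zero
  simp_rw [mul_comm _ I]
  field_simp

lemma hat_zero {u : ℝ} (hu : 1 ≤ u) : hat u = 0 := by
  unfold hat; rw [max_eq_right (by linarith)]; simp

lemma perron (b : ℕ → ℂ) (σ : ℝ) (hσ : 1 ≤ σ) (hb : LSeriesSummable b σ) (x : ℝ) (hx : 0 < x) :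
    ∑ n ∈ Finset.Icc 1 ⌊x⌋₊, b n * (1 - n / x) =
     (1 / (2 * Real.pi)) * ∫ y : ℝ, LSeries b (σ + y * I) * ((x:ℂ) ^ (σ + y * I : ℂ) * ker (σ + y * I)) := by
  have hpi : (Real.pi : ℂ) ≠ 0 := by exact_mod_cast Real.pi_ne_zero
  have hxc : (x : ℂ) ≠ 0 := by exact_mod_cast hx.ne'
  set F : ℕ → ℝ → ℂ := fun n y => LSeries.term b (σ + y * I) n * ((x:ℂ) ^ (σ + y * I : ℂ) * ker (σ + y * I)) with hF
  have hFn : ∀ n y, n ≠ 0 → F n y = b n * (((n / x : ℝ):ℂ) ^ (-(σ + y * I) : ℂ) * ker (σ + y * I)) := by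
    intro n y hn
    have hn0 : (0:ℝ) < n := by positivity
    simp only [hF, LSeries.term_of_ne_zero hn]
    rw [show (n / x : ℝ) = (n:ℝ) * x⁻¹ from div_eq_mul_inv _ _, ofReal_mul, mul_cpow_ofReal_nonneg (by positivity) (by positivity), cpow_neg, ofReal_inv,
      inv_cpow _ _ (by rw [arg_ofReal_of_nonneg hx.le]; exact Real.pi_ne_zero.symm), cpow_neg, inv_inv]
    simp; ring
  have hterm : ∀ n y, ‖F n y‖ ≤ ‖LSeries.term b σ n‖ * x ^ σ * (1 + y ^ 2)⁻¹ := by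
    intro n y
    simp only [hF]
    rw [norm_mul, norm_mul, norm_cpow_eq_rpow_re_of_pos hx, mul_assoc]
    have h1 : ‖LSeries.term b (σ + y * I) n‖ = ‖LSeries.term b σ n‖ := by
      rw [LSeries.norm_term_eq, LSeries.norm_term_eq]; simp
    have h2 := ker_norm (s := σ + y * I) (by simpa using hσ)
    rw [h1]
    simp at h2 ⊢
    gcongr
  have hFint : ∀ n, Integrable (F n) := by
    intro n
    rcases eq_or_ne n 0 with rfl | hn
    · simp [hF]
    refine (integrable_inv_one_add_sq.const_mul (‖LSeries.term b σ n‖ * x ^ σ)).mono' ?_ (Eventually.of_forall fun y => hterm n y)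
    have : F n = fun y : ℝ => b n * (((n / x : ℝ):ℂ) ^ (-(σ + y * I) : ℂ) * ker (σ + y * I)) := by
      ext y; exact hFn n y hn
    rw [this]
    have hne : ((n / x : ℝ):ℂ) ≠ 0 := by
      have : (0:ℝ) < n := by positivity
      have : 0 < n / x := by positivity
      exact_mod_cast this.ne'
    refine Continuous.aestronglyMeasurable ?_
    have := ker_cont σ hσ
    refine continuous_const.mul (Continuous.mul ?_ this)
    refine Continuous.const_cpow (by fun_prop) (Or.inl hne)
  have hval : ∀ n, ∫ y, F n y = if n ∈ Finset.Icc 1 ⌊x⌋₊ then 2 * Real.pi * (b n * (1 - n / x)) else 0 := by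
    intro n
    rcases eq_or_ne n 0 with rfl | hn
    · simp [hF]
    have hn0 : (0:ℝ) < n := by positivity
    have : F n = fun y : ℝ => b n * (((n / x : ℝ):ℂ) ^ (-(σ + y * I) : ℂ) * ker (σ + y * I)) := by
      ext y; exact hFn n y hn
    rw [this, integral_const_mul, hat_inv σ hσ (by positivity)]
    split_ifs with h
    · rw [Finset.mem_Icc] at h
      have : (n:ℝ) ≤ x := (Nat.le_floor_iff hx.le).1 h.2
      rw [hat, max_eq_left (by rw [sub_nonneg]; exact (div_le_one hx).2 this)]
      push_cast; ring
    · rw [hat_zero]; simp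
      rw [one_le_div hx]
      by_contra hc
      push Not at hc
      exact h (Finset.mem_Icc.2 ⟨Nat.one_le_iff_ne_zero.2 hn, Nat.le_floor hc.le⟩)
  have hsum : Summable fun n => ∫ y, ‖F n y‖ := by
    refine Summable.of_nonneg_of_le (fun n => integral_nonneg fun y => norm_nonneg _)
      (g := fun n => ∫ y, ‖F n y‖) (f := fun n => ‖LSeries.term b σ n‖ * (x ^ σ * ∫ y : ℝ, (1 + y ^ 2)⁻¹)) ?_ ?_
    · intro n
      rw [← mul_assoc, ← integral_const_mul]
      exact integral_mono (hFint n).norm (integrable_inv_one_add_sq.const_mul _) (hterm n)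
    · exact hb.norm.mul_right _
  have key := hasSum_integral_of_summable_integral_norm hFint hsum
  have e2 : (fun y => ∑' n, F n y) = fun y : ℝ => LSeries b (σ + y * I) * ((x:ℂ) ^ (σ + y * I : ℂ) * ker (σ + y * I)) := by
    ext y; simp only [hF]; rw [tsum_mul_right]; rfl
  rw [e2] at key
  rw [← key.tsum_eq]
  simp_rw [hval]
  rw [tsum_eq_sum (s := Finset.Icc 1 ⌊x⌋₊) (fun n hn => if_neg hn), Finset.mul_sum]
  refine Finset.sum_congr rfl fun n hn => ?_
  rw [if_pos hn]
  field_simp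

end Cayley
end

section
open Complex Finset Filter Topology MeasureTheory ArithmeticFunction

namespace Cayley
open DirichletCharacter

lemma abel_le (f : ℕ → ℝ) (g : ℕ → ℂ) (T : ℝ) (M N : ℕ) (hMN : M < N) (hf0 : 0 ≤ f N)
    (anti : ∀ n, M < n → n < N → f (n + 1) ≤ f n)
    (hT : ∀ j, M ≤ j → j ≤ N → ‖∑ n ∈ Finset.Ioc M j, g n‖ ≤ T) :
    ‖∑ n ∈ Finset.Ioc M N, (f n : ℂ) * g n‖ ≤ T * f (M + 1) := by
  have key : ∀ j, M + 1 ≤ j → j ≤ N → ‖∑ n ∈ Finset.Ioc M j, (f n : ℂ) * g n - f j * ∑ n ∈ Finset.Ioc M j, g n‖ ≤ T * (f (M + 1) - f j) := by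
    intro j hj
    induction j, hj using Nat.le_induction with
    | base => intro _; simp [Nat.Ioc_succ_singleton]
    | succ j hj ih =>
      intro hjN
      have ih := ih (by omega)
      rw [Finset.sum_Ioc_succ_top (by omega), Finset.sum_Ioc_succ_top (by omega)]
      have e : ∑ n ∈ Finset.Ioc M j, (f n : ℂ) * g n + (f (j+1) : ℂ) * g (j+1) - f (j+1) * (∑ n ∈ Finset.Ioc M j, g n + g (j+1))
        = (∑ n ∈ Finset.Ioc M j, (f n : ℂ) * g n - f j * ∑ n ∈ Finset.Ioc M j, g n) + ((f j - f (j+1) : ℝ) : ℂ) * ∑ n ∈ Finset.Ioc M j, g n := by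
        push_cast; ring
      rw [e]
      refine (norm_add_le _ _).trans ?_
      rw [norm_mul, norm_real, Real.norm_eq_abs, abs_of_nonneg (by linarith [anti j (by omega) (by omega)])]
      have h2 := hT j (by omega) (by omega)
      have h3 := anti j (by omega) (by omega)
      nlinarith [mul_le_mul_of_nonneg_left h2 (sub_nonneg.2 h3)]
  have h1 := key N hMN le_rfl
  have h2 := hT N hMN.le le_rfl
  have e : ∑ n ∈ Finset.Ioc M N, (f n : ℂ) * g n = (∑ n ∈ Finset.Ioc M N, (f n : ℂ) * g n - f N * ∑ n ∈ Finset.Ioc M N, g n) + (f N : ℂ) * ∑ n ∈ Finset.Ioc M N, g n := by ring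
  rw [e]
  refine (norm_add_le _ _).trans ?_
  rw [norm_mul, norm_real, Real.norm_eq_abs, abs_of_nonneg hf0]
  nlinarith [mul_le_mul_of_nonneg_left h2 hf0]

lemma logMul_iter (k : ℕ) (a : ℕ → ℂ) (n : ℕ) : LSeries.logMul^[k] a n = ((Real.log n : ℝ) : ℂ) ^ k * a n := by
  induction k with
  | zero => simp
  | succ k ih =>
    rw [Function.iterate_succ_apply', LSeries.logMul, ih, pow_succ]
    rw [← Complex.natCast_log]; ring

lemma dfam_norm {Q : ℝ} {a : ℕ → ℂ} (h : Dfam Q a) (n : ℕ) (hn : 1 ≤ n) : ‖a n‖ ≤ Real.log n + 1 := by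
  have h0 : (0:ℝ) ≤ vonMangoldt n := vonMangoldt_nonneg
  have h1 : (vonMangoldt n : ℝ) ≤ Real.log n := vonMangoldt_le_log
  rcases h with ⟨q, hq, χ, hχ, rfl, rfl⟩ | ⟨rfl, rfl⟩
  · simp only [norm_mul, norm_real, Real.norm_eq_abs, abs_of_nonneg h0]
    nlinarith [χ.norm_le_one (n : ZMod q), norm_nonneg (χ (n : ZMod q))]
  · simp only
    refine (norm_sub_le _ _).trans ?_
    rw [norm_real, Real.norm_eq_abs, abs_of_nonneg h0, norm_one]; linarith

lemma two_add_rpow (t : ℝ) (ε : ℝ) (hε2 : ε ≤ 1 / 2) :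
    (2 + |t|) ^ ε * (1 + t ^ 2)⁻¹ ≤ 2 * (1 + ‖t‖ ^ 2) ^ (-(3/2 : ℝ) / 2) := by
  have h0 : (0:ℝ) < 1 + t ^ 2 := by positivity
  have h1 : (2 + |t|) ^ ε ≤ (2 + |t|) ^ (1/2 : ℝ) :=
    Real.rpow_le_rpow_of_exponent_le (by linarith [abs_nonneg t]) hε2
  have h2 : (2 + |t|) ^ (1/2 : ℝ) ≤ 2 * (1 + t ^ 2) ^ (1/4 : ℝ) := by
    have : 2 + |t| ≤ 4 * (1 + t ^ 2) ^ (1/2 : ℝ) := by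
      rw [← Real.sqrt_eq_rpow]
      have := Real.le_sqrt (x := (2 + |t|)/4) (y := 1 + t ^ 2) (by positivity)
      have h := (this h0.le).2 (by nlinarith [sq_abs t, sq_nonneg (|t| - 1), sq_nonneg (|t|)])
      linarith
    calc (2 + |t|) ^ (1/2 : ℝ) ≤ (4 * (1 + t ^ 2) ^ (1/2 : ℝ)) ^ (1/2 : ℝ) := by
          apply Real.rpow_le_rpow (by positivity) this (by norm_num)
      _ = _ := by
        rw [Real.mul_rpow (by norm_num) (by positivity), ← Real.rpow_mul h0.le]
        rw [show (4:ℝ) = 2 ^ (2:ℝ) by norm_num, ← Real.rpow_mul (by norm_num)]; norm_num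
  have h3 : (1 + ‖t‖ ^ 2) ^ (-(3/2 : ℝ) / 2) = (1 + t ^ 2) ^ (1/4 : ℝ) * (1 + t ^ 2)⁻¹ := by
    rw [Real.norm_eq_abs, sq_abs, ← Real.rpow_neg_one, ← Real.rpow_add h0]; norm_num
  rw [h3, ← mul_assoc]
  gcongr
  linarith

lemma smooth_bound (k : ℕ) (ε : ℝ) (hε : 0 < ε) (hε2 : ε ≤ 1 / 2) : ∃ C : ℝ, 0 < C ∧ ∀ (Q : ℝ) (a : ℕ → ℂ), Dfam Q a →
    ∀ N : ℕ, 3 ≤ N → ‖∑ n ∈ Finset.Icc 1 N, (LSeries.logMul^[k] a n) * ((N:ℂ) - n)‖ ≤ C * Q ^ ε * N ^ 2 := by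
  obtain ⟨C, hC, H⟩ := dfam_bound k ε hε (by linarith)
  have hJ : Integrable (fun t : ℝ => 2 * (1 + ‖t‖ ^ 2) ^ (-(3/2 : ℝ) / 2)) :=
    (integrable_rpow_neg_one_add_norm_sq (by simp; norm_num)).const_mul 2
  set J : ℝ := ∫ t : ℝ, 2 * (1 + ‖t‖ ^ 2) ^ (-(3/2 : ℝ) / 2) with hJd
  have hJ0 : 0 ≤ J := integral_nonneg fun t => by positivity
  refine ⟨C * Real.exp 1 * J + 1, by positivity, fun Q a ha N hN => ?_⟩
  have hQ := dfam_one ha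
  have hN3 : (3:ℝ) ≤ N := by exact_mod_cast hN
  have hN0 : (0:ℝ) < N := by linarith
  have hlog : 1 ≤ Real.log N := by
    rw [Real.le_log_iff_exp_le hN0]
    linarith [Real.exp_one_lt_d9]
  set σ : ℝ := 1 + 1 / Real.log N with hσ
  have hl0 : 0 < 1 / Real.log N := by positivity
  have hl1 : 1 / Real.log N ≤ 1 := by rw [div_le_one (by linarith)]; exact hlog
  have hxs : (N:ℝ) ^ σ = Real.exp 1 * N := by
    rw [hσ, Real.rpow_add hN0, Real.rpow_one, Real.rpow_def_of_pos hN0, mul_one_div_cancel (by linarith)]; ring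
  have hp := perron (LSeries.logMul^[k] a) σ (by linarith)
    (by
      apply LSeriesSummable_of_abscissaOfAbsConv_lt_re
      rw [LSeries.absicssaOfAbsConv_logPowMul]
      apply dfam_absc ha
      simp; linarith) N hN0
  rw [Nat.floor_natCast] at hp
  have e : ∑ n ∈ Finset.Icc 1 N, (LSeries.logMul^[k] a n) * ((N:ℂ) - n) = N * ∑ n ∈ Finset.Icc 1 N, (LSeries.logMul^[k] a n) * (1 - (n:ℂ) / ((N:ℝ):ℂ)) := by
    rw [Finset.mul_sum]
    refine Finset.sum_congr rfl fun n _ => ?_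
    have : (N:ℂ) ≠ 0 := by exact_mod_cast hN0.ne'
    push_cast
    field_simp
  rw [e, hp, norm_mul, norm_mul]
  have hb : ‖∫ y : ℝ, LSeries (LSeries.logMul^[k] a) (σ + y * I) * (((N:ℝ):ℂ) ^ (σ + y * I : ℂ) * ker (σ + y * I))‖ ≤
      C * Q ^ ε * (Real.exp 1 * N) * J := by
    rw [hJd, ← integral_const_mul]
    refine norm_integral_le_of_norm_le (hJ.const_mul _) (Eventually.of_forall fun y => ?_)
    have h1 := H Q a ha (σ + y * I) (by simp; linarith) (by simp; linarith)
    have h2 := ker_norm (s := σ + y * I) (by simp; linarith)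
    have h3 := two_add_rpow y ε hε2
    rw [norm_mul, norm_mul, norm_cpow_eq_rpow_re_of_pos hN0]
    simp only [add_re, ofReal_re, mul_re, I_re, mul_zero, ofReal_im, I_im, mul_one, sub_zero, add_zero, add_im, mul_im, zero_add, sub_self] at h1 h2 ⊢
    rw [hxs]
    rw [Real.mul_rpow (by linarith) (by positivity)] at h1
    calc _ ≤ (C * (Q ^ ε * (2 + |y|) ^ ε)) * (Real.exp 1 * N * (1 + y ^ 2)⁻¹) := by gcongr
      _ = C * Q ^ ε * (Real.exp 1 * N) * ((2 + |y|) ^ ε * (1 + y ^ 2)⁻¹) := by ring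
      _ ≤ _ := by gcongr
  have hpi : ‖(1 / (2 * Real.pi) : ℂ)‖ ≤ 1 := by
    rw [show (1 / (2 * Real.pi) : ℂ) = ((1 / (2 * Real.pi) : ℝ) : ℂ) by push_cast; rfl, norm_real, Real.norm_eq_abs, abs_of_pos (by positivity)]
    rw [div_le_one (by positivity)]; linarith [Real.pi_gt_three]
  have hQe : 0 < Q ^ ε := by positivity
  rw [norm_natCast]
  calc _ ≤ N * (1 * (C * Q ^ ε * (Real.exp 1 * N) * J)) := by gcongr
    _ = (C * Real.exp 1 * J) * Q ^ ε * N ^ 2 := by ring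
    _ ≤ _ := by gcongr; linarith

end Cayley
end

section
open Complex Finset Filter Topology MeasureTheory ArithmeticFunction

namespace Cayley
open DirichletCharacter

lemma unsmooth (b : ℕ → ℂ) (N H : ℕ) (hH : 1 ≤ H) (K M : ℝ) 
    (h1 : ‖∑ n ∈ Finset.Icc 1 N, b n * ((N:ℂ) - n)‖ ≤ K)
    (h2 : ‖∑ n ∈ Finset.Icc 1 (N + H), b n * (((N + H : ℕ):ℂ) - n)‖ ≤ K)
    (hM : ∀ n, 1 ≤ n → n ≤ N + H → ‖b n‖ ≤ M) :
    ‖∑ n ∈ Finset.Icc 1 N, b n‖ ≤ 2 * K / H + H * M := by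
  have hH0 : (0:ℝ) < H := by exact_mod_cast hH
  have hM0 : 0 ≤ M := (norm_nonneg _).trans (hM 1 le_rfl (by omega))
  have e : (H:ℂ) * ∑ n ∈ Finset.Icc 1 N, b n = ∑ n ∈ Finset.Icc 1 (N + H), b n * (((N + H : ℕ):ℂ) - n) - ∑ n ∈ Finset.Icc 1 N, b n * ((N:ℂ) - n)
     - ∑ n ∈ Finset.Ioc N (N + H), b n * (((N + H : ℕ):ℂ) - n) := by
    have : Finset.Icc 1 (N + H) = Finset.Icc 1 N ∪ Finset.Ioc N (N + H) := by
      ext n; simp only [Finset.mem_Icc, Finset.mem_union, Finset.mem_Ioc]; omega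
    rw [this, Finset.sum_union (by
      rw [Finset.disjoint_left]; intro n; simp only [Finset.mem_Icc, Finset.mem_Ioc]; omega)]
    rw [Finset.mul_sum, add_sub_right_comm, add_sub_assoc, sub_self, add_zero, ← Finset.sum_sub_distrib]
    refine Finset.sum_congr rfl fun n _ => ?_
    push_cast; ring
  have h3 : ‖∑ n ∈ Finset.Ioc N (N + H), b n * (((N + H : ℕ):ℂ) - n)‖ ≤ H * (M * H) := by
    refine (norm_sum_le _ _).trans ?_
    have : ∀ n ∈ Finset.Ioc N (N + H), ‖b n * (((N + H : ℕ):ℂ) - n)‖ ≤ M * H := by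
      intro n hn
      rw [Finset.mem_Ioc] at hn
      rw [norm_mul]
      have : ‖((N + H : ℕ):ℂ) - n‖ ≤ H := by
        rw [← Nat.cast_sub hn.2, norm_natCast]; exact_mod_cast (by omega)
      gcongr
      exact hM n (by omega) hn.2
    refine (Finset.sum_le_sum this).trans ?_
    simp
  have h4 : H * ‖∑ n ∈ Finset.Icc 1 N, b n‖ ≤ K + K + H * (M * H) := by
    have := congrArg norm e
    rw [norm_mul, norm_natCast] at this
    rw [this]
    refine (norm_sub_le _ _).trans (add_le_add ((norm_sub_le _ _).trans (add_le_add h2 h1)) h3)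
  have : ‖∑ n ∈ Finset.Icc 1 N, b n‖ ≤ (K + K + H * (M * H)) / H := by
    rw [le_div_iff₀ hH0]; linarith
  refine this.trans (le_of_eq ?_)
  field_simp; ring

lemma log_pow_le (m : ℕ) : ∃ C : ℝ, 1 ≤ C ∧ ∀ x : ℝ, 1 ≤ x → Real.log x ^ m ≤ C * Real.sqrt x := by
  refine ⟨(2 * m + 1) ^ m, one_le_pow₀ (by linarith [Nat.cast_nonneg (α := ℝ) m]), fun x hx => ?_⟩
  have hx0 : 0 < x := by linarith
  have hl := Real.log_nonneg hx
  rcases Nat.eq_zero_or_pos m with rfl | hm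
  · simp [Real.one_le_sqrt.2 hx]
  have hm0 : (0:ℝ) < m := by exact_mod_cast hm
  have h := Real.log_le_rpow_div hx0.le (ε := 1 / (2 * m)) (by positivity)
  have : Real.log x ^ m ≤ (x ^ (1 / (2 * m) : ℝ) / (1 / (2 * m))) ^ m := by gcongr
  refine this.trans ?_
  rw [div_pow, ← Real.rpow_natCast (x ^ _), ← Real.rpow_mul hx0.le, Real.sqrt_eq_rpow,
    show (1 / (2 * (m:ℝ)) * m) = 1 / 2 by field_simp, div_eq_mul_inv, mul_comm]
  gcongr
  rw [← inv_pow]; simp only [one_div, inv_inv]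
  gcongr; linarith

/-- bound for log-weighted sums -/
lemma wsum_bound (m : ℕ) (ε : ℝ) (hε : 0 < ε) (hε2 : ε ≤ 1 / 2) : ∃ C : ℝ, 0 < C ∧ ∀ (Q : ℝ) (a : ℕ → ℂ), Dfam Q a →
    ∀ N : ℕ, 3 ≤ N → ‖∑ n ∈ Finset.Icc 1 N, ((Real.log n : ℝ) : ℂ) ^ (2 * m) * a n‖ ≤ C * Q ^ ε * N * Real.log N ^ (m + 1) := by
  obtain ⟨C, hC, H⟩ := smooth_bound (2 * m) ε hε hε2
  obtain ⟨D, hD, HD⟩ := log_pow_le m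
  refine ⟨8 * C + (D + 1) * (3 * 2 ^ (2 * m)), by positivity, fun Q a ha N hN => ?_⟩
  have hQ := dfam_one ha
  have hQe : 1 ≤ Q ^ ε := Real.one_le_rpow hQ hε.le
  have hN3 : (3:ℝ) ≤ N := by exact_mod_cast hN
  have hN0 : (0:ℝ) < N := by linarith
  have hlog : 1 ≤ Real.log N := by
    rw [Real.le_log_iff_exp_le hN0]
    linarith [Real.exp_one_lt_d9]
  set ℓ := Real.log N with hℓ
  have hℓm : 1 ≤ ℓ ^ m := one_le_pow₀ hlog
  set h : ℕ := ⌈(N:ℝ) / ℓ ^ m⌉₊ with hh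
  have hh1 : (N:ℝ) / ℓ ^ m ≤ h := Nat.le_ceil _
  have hh0 : 1 ≤ h := Nat.ceil_pos.2 (by positivity)
  have hhN : h ≤ N := by
    rw [hh, Nat.ceil_le]; exact div_le_self hN0.le hℓm
  have hh2 : (h:ℝ) ≤ (D + 1) * N / ℓ ^ m := by
    have h1 : (h:ℝ) < N / ℓ ^ m + 1 := Nat.ceil_lt_add_one (by positivity)
    have h2 := HD N (by linarith)
    have h3 : Real.sqrt N ≤ N := by rw [Real.sqrt_le_left hN0.le]; nlinarith
    have h4 : 1 ≤ D * N / ℓ ^ m := by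
      rw [le_div_iff₀ (by positivity), one_mul]
      exact h2.trans (by gcongr)
    calc (h:ℝ) ≤ N / ℓ ^ m + D * N / ℓ ^ m := by linarith
      _ = _ := by ring
  have hb : ∀ n, LSeries.logMul^[2*m] a n = ((Real.log n : ℝ) : ℂ) ^ (2 * m) * a n := logMul_iter (2 * m) a
  have hlog2 : Real.log (N + h : ℕ) ≤ 2 * ℓ := by
    have : ((N + h : ℕ) : ℝ) ≤ N ^ 2 := by
      have : (h:ℝ) ≤ N := by exact_mod_cast hhN
      push_cast; nlinarith
    calc _ ≤ Real.log ((N:ℝ) ^ 2) := Real.log_le_log (by positivity) this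
      _ = 2 * ℓ := by rw [Real.log_pow]; push_cast; rfl
  have key := unsmooth (fun n => ((Real.log n : ℝ) : ℂ) ^ (2 * m) * a n) N h hh0 (C * Q ^ ε * (4 * N ^ 2)) (3 * 2 ^ (2 * m) * ℓ ^ (2 * m + 1))
    (by
      have := H Q a ha N hN
      simp_rw [hb] at this
      refine this.trans ?_
      gcongr; nlinarith)
    (by
      have := H Q a ha (N + h) (by omega)
      simp_rw [hb] at this
      refine this.trans ?_
      gcongr
      have : (h:ℝ) ≤ N := by exact_mod_cast hhN
      push_cast; nlinarith [Nat.cast_nonneg (α := ℝ) h])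
    (by
      intro n hn hn2
      have h0 : 0 ≤ Real.log n := Real.log_natCast_nonneg n
      have h1 : Real.log n ≤ 2 * ℓ := (Real.log_le_log (by exact_mod_cast hn) (by exact_mod_cast hn2)).trans hlog2
      have h2 := dfam_norm ha n hn
      rw [norm_mul, norm_pow, norm_real, Real.norm_eq_abs, abs_of_nonneg h0]
      calc _ ≤ (2 * ℓ) ^ (2 * m) * (3 * ℓ) := by gcongr; linarith
        _ = _ := by ring)
  refine key.trans ?_
  have hh00 : (0:ℝ) < N / ℓ ^ m := by positivity
  have i1 : 2 * (C * Q ^ ε * (4 * N ^ 2)) / h ≤ 8 * C * Q ^ ε * N * ℓ ^ (m + 1) := by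
    calc _ ≤ 2 * (C * Q ^ ε * (4 * N ^ 2)) / (N / ℓ ^ m) := by gcongr
      _ = 8 * C * Q ^ ε * N * ℓ ^ m := by field_simp; ring
      _ ≤ _ := by
        have : ℓ ^ m ≤ ℓ ^ (m + 1) := pow_le_pow_right₀ hlog (by omega)
        gcongr
  have i2 : h * (3 * 2 ^ (2 * m) * ℓ ^ (2 * m + 1)) ≤ (D + 1) * (3 * 2 ^ (2 * m)) * Q ^ ε * N * ℓ ^ (m + 1) := by
    calc _ ≤ ((D + 1) * N / ℓ ^ m) * (3 * 2 ^ (2 * m) * ℓ ^ (2 * m + 1)) := by gcongr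
      _ = (D + 1) * (3 * 2 ^ (2 * m)) * 1 * N * ℓ ^ (m + 1) := by
        rw [show 2 * m + 1 = m + (m + 1) by ring, pow_add]; field_simp
      _ ≤ _ := by gcongr
  linarith

/-- Siegel-Walfisz type theorem (both for nontrivial characters and the PNT). -/
theorem siegel_walfisz (A : ℕ) : ∃ C : ℝ, 0 < C ∧ ∀ (Q : ℝ) (a : ℕ → ℂ), Dfam Q a →
    ∀ N : ℕ, 2 ≤ N → Q ≤ Real.log N ^ A → ‖∑ n ∈ Finset.Icc 1 N, a n‖ ≤ C * N / Real.log N ^ A := by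
  set m := A + 2 with hm
  obtain ⟨K, hK, HK⟩ := wsum_bound m (1 / (A + 2)) (by positivity) (by
    rw [div_le_div_iff₀ (by positivity) (by norm_num)]; linarith [Nat.cast_nonneg (α := ℝ) A])
  obtain ⟨D, hD, HD⟩ := log_pow_le (A + 1)
  refine ⟨4 * 3 ^ A + 2 * D + 2 * K * 4 ^ m, by positivity, fun Q a ha N hN hQA => ?_⟩
  have hN2 : (2:ℝ) ≤ N := by exact_mod_cast hN
  have hN0 : (0:ℝ) < N := by linarith
  have hl0 : 0 < Real.log N := Real.log_pos (by linarith)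
  have triv : ∀ M : ℕ, M ≤ N → ‖∑ n ∈ Finset.Icc 1 M, a n‖ ≤ M * (Real.log N + 1) := by
    intro M hM
    refine (norm_sum_le _ _).trans ?_
    have : ∀ n ∈ Finset.Icc 1 M, ‖a n‖ ≤ Real.log N + 1 := by
      intro n hn
      rw [Finset.mem_Icc] at hn
      refine (dfam_norm ha n hn.1).trans ?_
      have := Real.log_le_log (x := n) (y := N) (by exact_mod_cast hn.1) (by exact_mod_cast hn.2.trans hM)
      linarith
    refine (Finset.sum_le_sum this).trans ?_
    rw [Finset.sum_const, Nat.card_Icc, nsmul_eq_mul]; simp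
  by_cases hN16 : N < 16
  · have hl3 : Real.log N ≤ 3 := by
      have : Real.log N ≤ Real.log (2 ^ 4) := Real.log_le_log hN0 (by norm_num; exact_mod_cast hN16.le)
      rw [Real.log_pow] at this
      have := Real.log_two_lt_d9
      push_cast at *
      linarith
    refine (triv N le_rfl).trans ?_
    rw [le_div_iff₀ (by positivity)]
    calc N * (Real.log N + 1) * Real.log N ^ A ≤ N * 4 * 3 ^ A := by gcongr; linarith
      _ = (4 * 3 ^ A) * N := by ring
      _ ≤ _ := by gcongr; nlinarith [show 0 ≤ 2 * K * 4 ^ m by positivity]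
  push Not at hN16
  have hN16' : (16:ℝ) ≤ N := by exact_mod_cast hN16
  set ℓ := Real.log N with hℓ
  have hl1 : 1 ≤ ℓ := by
    rw [hℓ, Real.le_log_iff_exp_le hN0]
    linarith [Real.exp_one_lt_d9]
  set M := Nat.sqrt N with hM
  have hM4 : 4 ≤ M := by rw [hM, Nat.le_sqrt]; omega
  have hMN : M < N := Nat.sqrt_lt_self (by omega)
  have hMs : (M:ℝ) ≤ Real.sqrt N := Real.nat_sqrt_le_real_sqrt
  have hMl : ℓ / 2 ≤ Real.log (M + 1 : ℕ) := by
    rw [hℓ, ← Real.log_sqrt hN0.le]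
    apply Real.log_le_log (by positivity)
    push_cast
    exact (Real.real_sqrt_lt_nat_sqrt_succ).le
  have hQε : Q ^ (1 / (A + 2) : ℝ) ≤ ℓ := by
    have hQ0 : 0 ≤ Q := by linarith [dfam_one ha]
    calc Q ^ (1 / (A + 2) : ℝ) ≤ (ℓ ^ A) ^ (1 / (A + 2) : ℝ) := by gcongr
      _ = ℓ ^ ((A:ℝ) * (1 / (A + 2))) := by rw [← Real.rpow_natCast, ← Real.rpow_mul hl0.le]
      _ ≤ ℓ ^ (1:ℝ) := by
        apply Real.rpow_le_rpow_of_exponent_le hl1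
        rw [mul_one_div, div_le_one (by positivity)]; linarith
      _ = ℓ := Real.rpow_one _
  set T : ℝ := 2 * (K * N * ℓ ^ (m + 2)) with hT
  have hBj : ∀ j, 3 ≤ j → j ≤ N → ‖∑ n ∈ Finset.Icc 1 j, ((Real.log n : ℝ) : ℂ) ^ (2 * m) * a n‖ ≤ K * N * ℓ ^ (m + 2) := by
    intro j hj hjN
    refine (HK Q a ha j hj).trans ?_
    have h1 : Real.log j ≤ ℓ := Real.log_le_log (by positivity) (by exact_mod_cast hjN)
    have h2 : 0 ≤ Real.log j := Real.log_natCast_nonneg j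
    have h3 : (j:ℝ) ≤ N := by exact_mod_cast hjN
    calc _ ≤ K * ℓ * N * ℓ ^ (m + 1) := by gcongr
      _ = _ := by ring
  have split : ∀ (g : ℕ → ℂ) j, M ≤ j → ∑ n ∈ Finset.Ioc M j, g n = ∑ n ∈ Finset.Icc 1 j, g n - ∑ n ∈ Finset.Icc 1 M, g n := by
    intro g j hj
    have : Finset.Icc 1 j = Finset.Icc 1 M ∪ Finset.Ioc M j := by
      ext n; simp only [Finset.mem_Icc, Finset.mem_union, Finset.mem_Ioc]; omega
    rw [this, Finset.sum_union (by
      rw [Finset.disjoint_left]; intro n; simp only [Finset.mem_Icc, Finset.mem_Ioc]; omega)]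
    ring
  have hlogpos : ∀ n : ℕ, M < n → 0 < Real.log n := fun n hn => Real.log_pos (by
    have : (4:ℝ) < n := by exact_mod_cast lt_of_le_of_lt hM4 hn
    linarith)
  have habel := abel_le (fun n => 1 / Real.log n ^ (2 * m)) (fun n => ((Real.log n : ℝ) : ℂ) ^ (2 * m) * a n) T M N hMN
    (by positivity)
    (by
      intro n hn _
      have := hlogpos n hn
      apply one_div_le_one_div_of_le (by positivity)
      gcongr
      · exact_mod_cast (by omega)
      · omega)
    (by
      intro j hj hjN
      rw [split _ j hj]
      refine (norm_sub_le _ _).trans ?_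
      have := hBj j (by omega) hjN
      have := hBj M (by omega) hMN.le
      rw [hT]; linarith)
  have e1 : ∑ n ∈ Finset.Ioc M N, ((1 / Real.log n ^ (2 * m) : ℝ) : ℂ) * (((Real.log n : ℝ) : ℂ) ^ (2 * m) * a n) = ∑ n ∈ Finset.Ioc M N, a n := by
    refine Finset.sum_congr rfl fun n hn => ?_
    rw [Finset.mem_Ioc] at hn
    have : ((Real.log n : ℝ) : ℂ) ≠ 0 := by exact_mod_cast (hlogpos n hn.1).ne'
    push_cast at this ⊢
    field_simp
  rw [e1] at habel
  have e2 : ∑ n ∈ Finset.Icc 1 N, a n = ∑ n ∈ Finset.Icc 1 M, a n + ∑ n ∈ Finset.Ioc M N, a n := by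
    rw [split a N hMN.le]; ring
  have i1 : ‖∑ n ∈ Finset.Icc 1 M, a n‖ ≤ 2 * D * N / ℓ ^ A := by
    refine (triv M hMN.le).trans ?_
    rw [le_div_iff₀ (by positivity)]
    have h1 := HD N (by linarith)
    calc M * (ℓ + 1) * ℓ ^ A ≤ Real.sqrt N * (2 * ℓ) * ℓ ^ A := by gcongr; linarith
      _ = 2 * Real.sqrt N * ℓ ^ (A + 1) := by ring
      _ ≤ 2 * Real.sqrt N * (D * Real.sqrt N) := by gcongr
      _ = 2 * D * (Real.sqrt N * Real.sqrt N) := by ring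
      _ = _ := by rw [Real.mul_self_sqrt hN0.le]
  have i2 : T * (1 / Real.log (M + 1 : ℕ) ^ (2 * m)) ≤ 2 * K * 4 ^ m * N / ℓ ^ A := by
    calc T * (1 / Real.log (M + 1 : ℕ) ^ (2 * m)) ≤ T * (1 / (ℓ / 2) ^ (2 * m)) := by gcongr
      _ = 2 * K * 4 ^ m * N / ℓ ^ A := by
        rw [hT, div_pow, hm, pow_mul 2 2]
        rw [show 2 * (A + 2) = A + (A + 2 + 2) by ring, pow_add]
        norm_num
        field_simp
        ring
  rw [e2]
  refine (norm_add_le _ _).trans ((add_le_add i1 (habel.trans i2)).trans ?_)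
  rw [← add_div]
  gcongr
  nlinarith [show (0:ℝ) ≤ 4 * 3 ^ A * N by positivity]

end Cayley
end

section
open Complex Finset Filter Topology MeasureTheory ArithmeticFunction

namespace Cayley

noncomputable def ee (x : ℝ) : ℂ := cexp (I * ((2 * Real.pi * x : ℝ) : ℂ))
noncomputable def nn (x : ℝ) : ℝ := |x - round x|

lemma ee_add (x y : ℝ) : ee (x + y) = ee x * ee y := by
  unfold ee; rw [← Complex.exp_add]; congr 1; push_cast; ring

lemma ee_norm (x : ℝ) : ‖ee x‖ = 1 := by
  unfold ee; rw [mul_comm, norm_exp_ofReal_mul_I]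

lemma ee_int (n : ℤ) : ee n = 1 := by
  unfold ee; rw [Complex.exp_eq_one_iff]; exact ⟨n, by push_cast; ring⟩

lemma ee_zero : ee 0 = 1 := by simpa using ee_int 0

lemma ee_natmul (x : ℝ) (n : ℕ) : ee (n * x) = ee x ^ n := by
  unfold ee; rw [← Complex.exp_nat_mul]; congr 1; push_cast; ring

lemma ee_neg (x : ℝ) : ee (-x) = (starRingEnd ℂ) (ee x) := by
  unfold ee; rw [← Complex.exp_conj]; congr 1; rw [map_mul, conj_I, conj_ofReal]; push_cast; ring

lemma ee_sub_one_le (x : ℝ) : ‖ee x - 1‖ ≤ 2 * Real.pi * |x| := by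
  unfold ee
  refine (Real.norm_exp_I_mul_ofReal_sub_one_le).trans ?_
  rw [Real.norm_eq_abs, abs_mul, abs_of_pos (by positivity)]

lemma nn_nonneg (x : ℝ) : 0 ≤ nn x := abs_nonneg _
lemma nn_le (x : ℝ) : nn x ≤ 1 / 2 := abs_sub_round x

lemma ee_sub_one_ge (x : ℝ) : 4 * nn x ≤ ‖ee x - 1‖ := by
  have e : ee x = ee (x - round x) := by
    have : x = (x - round x) + (round x : ℤ) := by ring
    conv_lhs => rw [this, ee_add, ee_int, mul_one]
  rw [e]
  unfold ee
  rw [Complex.norm_exp_I_mul_ofReal_sub_one]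
  set t := x - round x with ht
  have h1 : |t| ≤ 1 / 2 := abs_sub_round x
  rw [show 2 * Real.pi * t / 2 = Real.pi * t by ring, norm_mul, Real.norm_eq_abs, Real.norm_eq_abs]
  have h2 : |Real.sin (Real.pi * t)| = |Real.sin (Real.pi * |t|)| := by
    rcases abs_choice t with h | h
    · rw [h]
    · rw [h, mul_neg, Real.sin_neg, abs_neg]
  have h3 := Real.mul_le_sin (x := Real.pi * |t|) (by positivity) (by nlinarith [Real.pi_pos])
  have h4 : 2 / Real.pi * (Real.pi * |t|) = 2 * |t| := by have := Real.pi_ne_zero; field_simp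
  rw [h4] at h3
  rw [h2]
  have := le_abs_self (Real.sin (Real.pi * |t|))
  unfold nn
  rw [abs_of_pos (show (0:ℝ) < 2 by norm_num)]
  linarith

noncomputable def mn (Y θ : ℝ) : ℝ := if nn θ = 0 then Y else min Y (1 / (2 * nn θ))

lemma mn_le (Y θ : ℝ) : mn Y θ ≤ Y := by unfold mn; split_ifs; exact le_rfl; exact min_le_left _ _
lemma mn_mul (Y θ : ℝ) : mn Y θ * (2 * nn θ) ≤ 1 := by
  unfold mn; split_ifs with h
  · rw [h]; simp
  · have h0 : 0 < nn θ := lt_of_le_of_ne (nn_nonneg θ) (Ne.symm h)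
    calc _ ≤ (1 / (2 * nn θ)) * (2 * nn θ) := by gcongr; exact min_le_right _ _
      _ = 1 := by field_simp
lemma mn_nonneg {Y : ℝ} (hY : 0 ≤ Y) (θ : ℝ) : 0 ≤ mn Y θ := by
  unfold mn; split_ifs; exact hY; exact le_min hY (by have := nn_nonneg θ; positivity)
lemma mn_mono {Y Z : ℝ} (h : Y ≤ Z) (θ : ℝ) : mn Y θ ≤ mn Z θ := by
  unfold mn; split_ifs; exact h; exact min_le_min h le_rfl

lemma geom_bound (θ : ℝ) (M N : ℕ) : ‖∑ m ∈ Finset.Ioc M N, ee (m * θ)‖ ≤ mn (N - M : ℕ) θ := by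
  have h1 : ‖∑ m ∈ Finset.Ioc M N, ee (m * θ)‖ ≤ (N - M : ℕ) := by
    refine (norm_sum_le _ _).trans ?_
    simp_rw [ee_norm]
    simp
  unfold mn
  split_ifs with h
  · exact h1
  refine le_min h1 ?_
  have h0 : 0 < nn θ := lt_of_le_of_ne (nn_nonneg θ) (Ne.symm h)
  rcases le_or_gt N M with hMN | hMN
  · rw [Finset.Ioc_eq_empty (by omega)]; simp; exact h0.le
  have h2 := ee_sub_one_ge θ
  have hne : ee θ - 1 ≠ 0 := by intro hc; rw [hc, norm_zero] at h2; linarith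
  have e : (∑ m ∈ Finset.Ioc M N, ee (m * θ)) * (ee θ - 1) = ee θ ^ (N + 1) - ee θ ^ (M + 1) := by
    simp_rw [ee_natmul]
    have : Finset.Ioc M N = Finset.Ico (M + 1) (N + 1) := by ext; simp only [Finset.mem_Ioc, Finset.mem_Ico]; omega
    rw [this, geom_sum_Ico_mul _ (by omega)]
  have h3 : ‖∑ m ∈ Finset.Ioc M N, ee (m * θ)‖ * ‖ee θ - 1‖ ≤ 2 := by
    rw [← norm_mul, e]
    refine (norm_sub_le _ _).trans ?_
    rw [norm_pow, norm_pow, ee_norm]; norm_num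
  rw [le_div_iff₀ (by positivity)]
  have := mul_le_mul_of_nonneg_left h2 (norm_nonneg (∑ m ∈ Finset.Ioc M N, ee (m * θ)))
  linarith

/-- Rational approximation hypothesis. -/
def Appr (α : ℝ) (a : ℤ) (q : ℕ) : Prop := 1 ≤ q ∧ IsCoprime a (q:ℤ) ∧ |α - a / q| ≤ 1 / (q:ℝ) ^ 2

lemma spacing {α : ℝ} {a : ℤ} {q : ℕ} (h : Appr α a q) (k : ℤ) (hk : k ≠ 0) (hk2 : 2 * |k| ≤ q) (z : ℤ) :
    1 / (2 * (q:ℝ)) ≤ |α * k - z| := by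
  obtain ⟨hq, hc, ha⟩ := h
  have hq0 : (0:ℝ) < q := by exact_mod_cast hq
  have hne : a * k - z * q ≠ 0 := by
    intro h0
    have hd : (q:ℤ) ∣ k := by
      refine hc.symm.dvd_of_dvd_mul_left ⟨z, by linarith⟩
    have := Int.le_of_dvd (abs_pos.2 hk) ((dvd_abs _ _).2 hd)
    have := abs_pos.2 hk
    omega
  have h1 : (1:ℝ) ≤ |(a:ℝ) * k - z * q| := by exact_mod_cast Int.one_le_abs hne
  have h2 : 1 / (q:ℝ) ≤ |(a:ℝ) / q * k - z| := by
    rw [show (a:ℝ) / q * k - z = (a * k - z * q) / q by field_simp, abs_div, abs_of_pos hq0]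
    gcongr
  have h3 : |(α - a / q) * k| ≤ 1 / (2 * q) := by
    rw [abs_mul]
    have : (2:ℝ) * |(k:ℝ)| ≤ q := by exact_mod_cast hk2
    calc |α - a / q| * |(k:ℝ)| ≤ 1 / (q:ℝ) ^ 2 * (q / 2) := by gcongr; linarith
      _ = _ := by field_simp
  have h4 : (a:ℝ) / q * k - z = (α * k - z) - (α - a / q) * k := by ring
  rw [h4] at h2
  have h5 := abs_sub (α * k - z) ((α - a / q) * k)
  have h6 : 1 / (q:ℝ) = 1 / (2 * q) + 1 / (2 * q) := by field_simp; norm_num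
  linarith

lemma harm (n : ℕ) (Z : ℝ) (hZ : 1 ≤ Z) (hn : (n:ℝ) ≤ Z) : ∑ i ∈ Finset.Icc 1 n, (1:ℝ) / i ≤ 1 + Real.log Z := by
  have h := harmonic_le_one_add_log n
  rw [harmonic_eq_sum_Icc] at h
  push_cast at h
  simp only [one_div]
  refine h.trans ?_
  rcases Nat.eq_zero_or_pos n with rfl | hn0
  · simp [Real.log_nonneg hZ]
  · have := Real.log_le_log (x := n) (by exact_mod_cast hn0) hn
    linarith

lemma min_sum {α : ℝ} {a : ℤ} {q : ℕ} (h : Appr α a q) (X Z : ℝ) (hX : 0 ≤ X) (hZ : 1 ≤ Z) (D : ℕ) (hD : (D:ℝ) ≤ Z) (hqZ : (q:ℝ) ≤ Z) :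
    ∑ d ∈ Finset.Icc 1 D, mn (X / d) (α * d) ≤ (1 + Real.log Z) * (4 * X / q + 4 * D + 2 * q) := by
  have h' := h
  obtain ⟨hq, hc, ha⟩ := h'
  have hq0 : (0:ℝ) < q := by exact_mod_cast hq
  set b := q / 2 + 1 with hb
  have hb0 : 0 < b := by omega
  have hbq : (q:ℝ) / 2 ≤ b := by
    have : q ≤ 2 * b := by omega
    have : (q:ℝ) ≤ 2 * b := by exact_mod_cast this
    linarith
  set r : ℕ → ℝ := fun d => α * d - round (α * d) with hr
  set φ : ℕ → ℕ × Bool × ℕ := fun d => (d / b, decide (r d < 0), ⌊2 * q * |r d|⌋₊) with hφ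
  set F : ℕ × Bool × ℕ → ℝ := fun p => if p.2.2 = 0 then (if p.1 = 0 then 0 else X / (p.1 * b)) else q / p.2.2 with hF
  have hF0 : ∀ p, 0 ≤ F p := by intro p; simp only [hF]; split_ifs <;> positivity
  have hinj : Set.InjOn φ (Finset.Icc 1 D : Finset ℕ) := by
    intro d _ d' _ hdd
    by_contra hne
    simp only [hφ, Prod.mk.injEq] at hdd
    obtain ⟨e1, e2, e3⟩ := hdd
    have m1 := Nat.div_add_mod d b
    have m2 := Nat.div_add_mod d' b
    have m3 := Nat.mod_lt d hb0
    have m4 := Nat.mod_lt d' hb0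
    have hk : ((d:ℤ) - d') ≠ 0 := by omega
    have hk2 : 2 * |(d:ℤ) - d'| ≤ q := by
      rw [e1] at m1
      have : |(d:ℤ) - d'| ≤ (q / 2 : ℕ) := by rw [abs_le]; constructor <;> omega
      omega
    have hs := spacing h ((d:ℤ) - d') hk hk2 (round (α * d) - round (α * d'))
    have hs' : α * ((d:ℤ) - d' : ℤ) - ((round (α * d) - round (α * d') : ℤ):ℝ) = r d - r d' := by
      simp only [hr]; push_cast; ring
    rw [hs'] at hs
    have habs : |r d - r d'| = abs (|r d| - |r d'|) := by
      by_cases hs1 : r d < 0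
      · have hs2 : r d' < 0 := by simpa [hs1] using e2
        rw [abs_of_neg hs1, abs_of_neg hs2, ← abs_neg]; congr 1; ring
      · have hs2 : ¬ r d' < 0 := by simpa [hs1] using e2
        push Not at hs1 hs2
        rw [abs_of_nonneg hs1, abs_of_nonneg hs2]
    have f1 := Nat.floor_le (a := 2 * q * |r d|) (by positivity)
    have f2 := Nat.lt_floor_add_one (2 * q * |r d|)
    have f3 := Nat.floor_le (a := 2 * q * |r d'|) (by positivity)
    have f4 := Nat.lt_floor_add_one (2 * q * |r d'|)
    rw [e3] at f1 f2
    have : abs (2 * q * |r d| - 2 * q * |r d'|) < 1 := by rw [abs_lt]; constructor <;> linarith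
    rw [← mul_sub, abs_mul, abs_of_pos (by positivity), ← habs] at this
    rw [div_le_iff₀ (by positivity)] at hs
    linarith
  have hval : ∀ d ∈ Finset.Icc 1 D, mn (X / d) (α * d) ≤ F (φ d) := by
    intro d hd
    rw [Finset.mem_Icc] at hd
    have hd0 : (0:ℝ) < d := by exact_mod_cast hd.1
    have hrn : nn (α * d) = |r d| := rfl
    simp only [hF, hφ]
    split_ifs with c1 c2
    · exfalso
      have : d < b := (Nat.div_eq_zero_iff.1 c2).resolve_left (by omega)
      have hs := spacing h (d:ℤ) (by omega) (by rw [abs_of_nonneg (by positivity)]; omega) (round (α * d))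
      have hs' : 1 / (2 * (q:ℝ)) ≤ |r d| := by simpa [hr] using hs
      rw [div_le_iff₀ (by positivity)] at hs'
      rw [Nat.floor_eq_zero] at c1
      linarith
    · refine (mn_le _ _).trans ?_
      have : (d / b) * b ≤ d := Nat.div_mul_le_self d b
      have h2 : (((d / b : ℕ) : ℝ) * b) ≤ d := by exact_mod_cast this
      have h3 : (0:ℝ) < (d / b : ℕ) := by exact_mod_cast Nat.pos_of_ne_zero c2
      gcongr
    · have h1 := mn_mul (X / d) (α * d)
      rw [hrn] at h1
      have f1 := Nat.floor_le (a := 2 * q * |r d|) (by positivity)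
      have h2 : (0:ℝ) < (⌊2 * q * |r d|⌋₊ : ℕ) := by exact_mod_cast Nat.pos_of_ne_zero c1
      rw [le_div_iff₀ h2]
      have h3 := mul_le_mul_of_nonneg_left f1 (mn_nonneg (Y := X / d) (by positivity) (α * d))
      nlinarith
  have hsub : (Finset.Icc 1 D).image φ ⊆ Finset.range (D / b + 1) ×ˢ (Finset.univ ×ˢ Finset.range (q + 1)) := by
    intro p hp
    rw [Finset.mem_image] at hp
    obtain ⟨d, hd, rfl⟩ := hp
    rw [Finset.mem_Icc] at hd
    simp only [hφ, Finset.mem_product, Finset.mem_range, Finset.mem_univ, true_and]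
    constructor
    · have := Nat.div_le_div_right (c := b) hd.2; omega
    · rw [Nat.lt_succ_iff]
      apply Nat.floor_le_of_le
      have : |r d| ≤ 1 / 2 := abs_sub_round _
      nlinarith
  have hs1 : ∑ d ∈ Finset.Icc 1 D, mn (X / d) (α * d) ≤ ∑ p ∈ Finset.range (D / b + 1) ×ˢ ((Finset.univ : Finset Bool) ×ˢ Finset.range (q + 1)), F p := by
    refine (Finset.sum_le_sum hval).trans ?_
    rw [← Finset.sum_image hinj]
    exact Finset.sum_le_sum_of_subset_of_nonneg hsub fun p _ _ => hF0 p
  refine hs1.trans ?_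
  rw [Finset.sum_product]
  have hin : ∀ i : ℕ, ∑ p ∈ (Finset.univ : Finset Bool) ×ˢ Finset.range (q + 1), F (i, p) = 2 * ((if i = 0 then 0 else X / (i * b)) + q * ∑ n ∈ Finset.Icc 1 q, (1:ℝ) / n) := by
    intro i
    rw [Finset.sum_product]
    have : ∀ s : Bool, ∑ n ∈ Finset.range (q + 1), F (i, s, n) = (if i = 0 then 0 else X / (i * b)) + q * ∑ n ∈ Finset.Icc 1 q, (1:ℝ) / n := by
      intro s
      rw [Finset.sum_range_succ', add_comm]
      congr 1
      · rw [Finset.mul_sum, ← Finset.Ico_add_one_right_eq_Icc, Finset.sum_Ico_eq_sum_range]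
        refine Finset.sum_congr (by simp) fun n _ => ?_
        simp only [hF]
        rw [if_neg (by omega)]
        push_cast; rw [add_comm (1:ℝ)]; ring
    rw [Fintype.sum_bool]
    exact (congrArg₂ (· + ·) (this true) (this false)).trans (two_mul _).symm
  simp_rw [hin]
  rw [← Finset.mul_sum, Finset.sum_add_distrib, Finset.sum_range_succ' (fun i : ℕ => if i = 0 then (0:ℝ) else X / (i * b))]
  simp only [if_true, add_zero, Nat.add_eq_zero_iff, one_ne_zero, and_false, if_false]
  have hH1 : ∑ i ∈ Finset.range (D / b), X / (((i + 1 : ℕ) : ℝ) * b) ≤ X / b * (1 + Real.log Z) := by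
    have hdb : ((D / b : ℕ) : ℝ) ≤ Z := le_trans (by exact_mod_cast Nat.div_le_self D b) hD
    refine le_trans (le_of_eq ?_) (mul_le_mul_of_nonneg_left (harm (D / b) Z hZ hdb) (by positivity))
    rw [Finset.mul_sum, ← Finset.Ico_add_one_right_eq_Icc, Finset.sum_Ico_eq_sum_range]
    refine Finset.sum_congr (by simp) fun n _ => ?_
    push_cast; rw [add_comm (1:ℝ)]; field_simp
  have hH2 := harm q Z hZ hqZ
  have hl : 0 ≤ 1 + Real.log Z := by linarith [Real.log_nonneg hZ]
  rw [Finset.sum_const, Finset.card_range, nsmul_eq_mul]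
  have hDb : ((D / b + 1 : ℕ) : ℝ) * q ≤ 2 * D + q := by
    have h1 : ((D / b : ℕ) : ℝ) * b ≤ D := by exact_mod_cast Nat.div_mul_le_self D b
    have h2 : (0:ℝ) ≤ (D / b : ℕ) := by positivity
    push_cast
    nlinarith
  have hXb : X / b ≤ 2 * X / q := by
    rw [div_le_div_iff₀ (by positivity) hq0]; nlinarith
  calc _ ≤ 2 * (X / b * (1 + Real.log Z) + (((D / b + 1 : ℕ) : ℝ) * q) * (1 + Real.log Z)) := by
        have : ((D / b + 1 : ℕ) : ℝ) * (q * ∑ n ∈ Finset.Icc 1 q, (1:ℝ) / n) ≤ (((D / b + 1 : ℕ) : ℝ) * q) * (1 + Real.log Z) := by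
          rw [← mul_assoc]; gcongr
        linarith
    _ ≤ 2 * (2 * X / q * (1 + Real.log Z) + (2 * D + q) * (1 + Real.log Z)) := by gcongr
    _ = _ := by ring

end Cayley
end

section
open Complex Finset Filter Topology MeasureTheory ArithmeticFunction

namespace Cayley

lemma abel_gen (f g : ℕ → ℂ) (T : ℝ) (M N : ℕ) (hMN : M < N)
    (hT : ∀ j, M ≤ j → j ≤ N → ‖∑ n ∈ Finset.Ioc M j, g n‖ ≤ T) :
    ‖∑ n ∈ Finset.Ioc M N, f n * g n‖ ≤ T * (‖f N‖ + ∑ n ∈ Finset.Ico (M + 1) N, ‖f (n + 1) - f n‖) := by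
  have key : ∀ j, M + 1 ≤ j → j ≤ N → ‖∑ n ∈ Finset.Ioc M j, f n * g n - f j * ∑ n ∈ Finset.Ioc M j, g n‖ ≤ T * ∑ n ∈ Finset.Ico (M + 1) j, ‖f (n + 1) - f n‖ := by
    intro j hj
    induction j, hj using Nat.le_induction with
    | base => intro _; simp [Nat.Ioc_succ_singleton]
    | succ j hj ih =>
      intro hjN
      have ih := ih (by omega)
      rw [Finset.sum_Ioc_succ_top (by omega), Finset.sum_Ioc_succ_top (by omega), Finset.sum_Ico_succ_top (by omega)]
      have e : ∑ n ∈ Finset.Ioc M j, f n * g n + f (j+1) * g (j+1) - f (j+1) * (∑ n ∈ Finset.Ioc M j, g n + g (j+1))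
        = (∑ n ∈ Finset.Ioc M j, f n * g n - f j * ∑ n ∈ Finset.Ioc M j, g n) - (f (j+1) - f j) * ∑ n ∈ Finset.Ioc M j, g n := by
        ring
      rw [e]
      refine (norm_sub_le _ _).trans ?_
      rw [norm_mul]
      have h2 := hT j (by omega) (by omega)
      nlinarith [mul_le_mul_of_nonneg_left h2 (norm_nonneg (f (j+1) - f j))]
  have h1 := key N hMN le_rfl
  have h2 := hT N hMN.le le_rfl
  have e : ∑ n ∈ Finset.Ioc M N, f n * g n = (∑ n ∈ Finset.Ioc M N, f n * g n - f N * ∑ n ∈ Finset.Ioc M N, g n) + f N * ∑ n ∈ Finset.Ioc M N, g n := by ring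
  rw [e]
  refine (norm_add_le _ _).trans ?_
  rw [norm_mul]
  nlinarith [mul_le_mul_of_nonneg_left h2 (norm_nonneg (f N))]

lemma abel_mono (f : ℕ → ℝ) (g : ℕ → ℂ) (T : ℝ) (M N : ℕ) (h0 : ∀ n, 0 ≤ f n) 
    (hm : ∀ n, M < n → f n ≤ f (n + 1))
    (hT : ∀ j, M ≤ j → j ≤ N → ‖∑ n ∈ Finset.Ioc M j, g n‖ ≤ T) (hT0 : 0 ≤ T) :
    ‖∑ n ∈ Finset.Ioc M N, (f n : ℂ) * g n‖ ≤ 2 * f N * T := by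
  rcases le_or_gt N M with h | h
  · rw [Finset.Ioc_eq_empty (by omega)]; simp; have := h0 N; positivity
  refine (abel_gen (fun n => (f n : ℂ)) g T M N h hT).trans ?_
  have e : ∑ n ∈ Finset.Ico (M + 1) N, ‖(f (n + 1) : ℂ) - f n‖ = f N - f (M + 1) := by
    rw [← Finset.sum_Ico_sub _ (by omega : M + 1 ≤ N)]
    refine Finset.sum_congr rfl fun n hn => ?_
    rw [Finset.mem_Ico] at hn
    rw [← ofReal_sub, norm_real, Real.norm_eq_abs, abs_of_nonneg (by linarith [hm n (by omega)])]
  rw [e, norm_real, Real.norm_eq_abs, abs_of_nonneg (h0 N)]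
  nlinarith [h0 (M + 1)]

lemma conv_sum (f g : ArithmeticFunction ℝ) (h : ℕ → ℂ) (N : ℕ) :
    ∑ n ∈ Ioc 0 N, (((f * g) n : ℝ) : ℂ) * h n = ∑ m ∈ Ioc 0 N, (f m : ℂ) * ∑ k ∈ Ioc 0 (N / m), (g k : ℂ) * h (m * k) := by
  trans ∑ n ∈ Ioc 0 N, ∑ x ∈ Ioc 0 N ×ˢ Ioc 0 N with x.1 * x.2 = n, (f x.1 : ℂ) * (g x.2 * h (x.1 * x.2))
  · refine sum_congr rfl fun n hn => ?_
    simp only [mem_Ioc] at hn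
    rw [ArithmeticFunction.mul_apply, Nat.divisorsAntidiagonal_eq_prod_filter_of_le hn.1.ne' hn.2, ofReal_sum, sum_mul]
    refine sum_congr rfl fun x hx => ?_
    rw [mem_filter] at hx
    rw [hx.2]; push_cast; ring
  · simp_rw [sum_filter]
    rw [sum_comm, sum_product]
    refine sum_congr rfl fun m hm => ?_
    rw [mul_sum]
    rw [mem_Ioc] at hm
    have : ∀ k ∈ Ioc 0 N, (∑ n ∈ Ioc 0 N, if (m, k).1 * (m, k).2 = n then (f (m,k).1 : ℂ) * (g (m,k).2 * h ((m,k).1 * (m,k).2)) else 0) =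
      if k ≤ N / m then (f m : ℂ) * (g k * h (m * k)) else 0 := by
      intro k hk
      rw [mem_Ioc] at hk
      rw [Finset.sum_ite_eq]
      have : m * k ∈ Ioc 0 N ↔ k ≤ N / m := by
        rw [mem_Ioc, Nat.le_div_iff_mul_le hm.1, mul_comm]
        constructor
        · exact fun h => h.2
        · exact fun h => ⟨Nat.mul_pos hk.1 hm.1, h⟩
      simp only [this]
    rw [sum_congr rfl this, ← sum_filter]
    refine sum_congr ?_ fun _ _ => rfl
    ext k
    simp only [mem_filter, mem_Ioc]
    have := Nat.div_le_self N m
    omega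

noncomputable def muT (V : ℕ) : ArithmeticFunction ℝ := ⟨fun n => if n ≤ V then ((ArithmeticFunction.moebius n : ℤ) : ℝ) else 0, by simp⟩
noncomputable def laT (V : ℕ) : ArithmeticFunction ℝ := ⟨fun n => if n ≤ V then vonMangoldt n else 0, by simp⟩

lemma vaughan_id (V : ℕ) : (vonMangoldt : ArithmeticFunction ℝ) = laT V + muT V * ArithmeticFunction.log - (muT V * laT V) * (zeta : ArithmeticFunction ℝ)
    + (((moebius : ArithmeticFunction ℝ) - muT V) * (zeta : ArithmeticFunction ℝ)) * (vonMangoldt - laT V) := by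
  have h1 : ((moebius : ArithmeticFunction ℝ) * (zeta : ArithmeticFunction ℝ)) = 1 := coe_moebius_mul_coe_zeta
  have h2 : (vonMangoldt : ArithmeticFunction ℝ) * (zeta : ArithmeticFunction ℝ) = ArithmeticFunction.log := vonMangoldt_mul_zeta
  linear_combination (-(vonMangoldt - laT V)) * h1 + muT V * h2

lemma muT_abs (V n : ℕ) : |muT V n| ≤ if n ≤ V then 1 else 0 := by
  simp only [muT, coe_mk]
  split_ifs
  · exact_mod_cast abs_moebius_le_one
  · simp

lemma laT_nonneg (V n : ℕ) : 0 ≤ laT V n := by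
  simp only [laT, coe_mk]; split_ifs; exact vonMangoldt_nonneg; exact le_rfl

lemma laT_le (V n : ℕ) : laT V n ≤ vonMangoldt n := by
  simp only [laT, coe_mk]; split_ifs; exact le_rfl; exact vonMangoldt_nonneg

lemma laT_zero {V n : ℕ} (h : V < n) : laT V n = 0 := by
  simp only [laT, coe_mk]; rw [if_neg (by omega)]

lemma conv_abs (V n : ℕ) : |(muT V * laT V) n| ≤ Real.log n := by
  rw [ArithmeticFunction.mul_apply, ← vonMangoldt_sum, Nat.sum_divisorsAntidiagonal' (fun a b => muT V a * laT V b)]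
  refine (Finset.abs_sum_le_sum_abs _ _).trans (Finset.sum_le_sum fun i _ => ?_)
  rw [abs_mul, abs_of_nonneg (laT_nonneg V i)]
  have h1 : |muT V (n / i)| ≤ 1 := (muT_abs V _).trans (by split_ifs <;> norm_num)
  nlinarith [laT_le V i, laT_nonneg V i, abs_nonneg (muT V (n / i))]

lemma conv_zero {V n : ℕ} (h : V * V < n) : (muT V * laT V) n = 0 := by
  rw [ArithmeticFunction.mul_apply]
  refine Finset.sum_eq_zero fun p hp => ?_
  rw [Nat.mem_divisorsAntidiagonal] at hp
  by_cases h1 : p.1 ≤ V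
  · by_cases h2 : p.2 ≤ V
    · exfalso
      have := Nat.mul_le_mul h1 h2
      omega
    · rw [laT_zero (by omega), mul_zero]
  · have := muT_abs V p.1
    rw [if_neg h1] at this
    rw [abs_nonpos_iff.1 this, zero_mul]

/-- Type I sums -/
lemma type1 {α : ℝ} {a : ℤ} {q : ℕ} (h : Appr α a q) (Z : ℝ) (hZ : 1 ≤ Z) (N D : ℕ) (hN : (N:ℝ) ≤ Z) (hqZ : (q:ℝ) ≤ Z)
    (c f : ℕ → ℝ) (hc : ∀ d, 1 ≤ d → d ≤ N → |c d| ≤ 1 + Real.log Z) (hc0 : ∀ d, D < d → c d = 0)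
    (f0 : ∀ n, 0 ≤ f n) (fm : ∀ n, 0 < n → f n ≤ f (n + 1)) (fb : ∀ n, n ≤ N → f n ≤ 1 + Real.log Z) :
    ‖∑ d ∈ Ioc 0 N, (c d : ℂ) * ∑ m ∈ Ioc 0 (N / d), (f m : ℂ) * ee ((d * m : ℕ) * α)‖ ≤
     2 * (1 + Real.log Z) ^ 3 * (4 * Z / q + 4 * D + 2 * q) := by
  set ℓ := 1 + Real.log Z with hℓ
  have hl1 : 1 ≤ ℓ := by linarith [Real.log_nonneg hZ]
  have hin : ∀ d ∈ Ioc 0 N, ‖∑ m ∈ Ioc 0 (N / d), (f m : ℂ) * ee ((d * m : ℕ) * α)‖ ≤ 2 * ℓ * mn (Z / d) (α * d) := by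
    intro d hd
    rw [mem_Ioc] at hd
    have hd0 : (0:ℝ) < d := by exact_mod_cast hd.1
    have hm0 : 0 ≤ mn (Z / d) (α * d) := mn_nonneg (by positivity) _
    have e : ∀ m : ℕ, ee ((d * m : ℕ) * α) = ee (m * (α * d)) := fun m => by congr 1; push_cast; ring
    simp_rw [e]
    refine (abel_mono f (fun m => ee (m * (α * d))) (mn (Z / d) (α * d)) 0 (N / d) f0 fm ?_ hm0).trans ?_
    · intro j _ hj
      refine (geom_bound _ _ _).trans (mn_mono ?_ _)
      have h1 : j * d ≤ N := (Nat.le_div_iff_mul_le hd.1).1 hj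
      have h2 : (j:ℝ) * d ≤ N := by exact_mod_cast h1
      rw [Nat.sub_zero, le_div_iff₀ hd0]; linarith
    · have := fb (N / d) (Nat.div_le_self N d)
      gcongr
  refine (norm_sum_le _ _).trans ?_
  have h2 : ∀ d ∈ Ioc 0 N, ‖(c d : ℂ) * ∑ m ∈ Ioc 0 (N / d), (f m : ℂ) * ee ((d * m : ℕ) * α)‖ ≤
     if d ≤ D then 2 * ℓ ^ 2 * mn (Z / d) (α * d) else 0 := by
    intro d hd
    have hd' := hd
    rw [mem_Ioc] at hd
    rw [norm_mul, norm_real, Real.norm_eq_abs]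
    split_ifs with hD
    · have h1 := hc d hd.1 hd.2
      calc _ ≤ ℓ * (2 * ℓ * mn (Z / d) (α * d)) := by gcongr; exact hin d hd'
        _ = _ := by ring
    · rw [hc0 d (by omega)]; simp
  refine (Finset.sum_le_sum h2).trans ?_
  rw [← Finset.sum_filter]
  have h3 : ∑ d ∈ (Ioc 0 N).filter (· ≤ D), 2 * ℓ ^ 2 * mn (Z / d) (α * d) ≤ ∑ d ∈ Icc 1 (min N D), 2 * ℓ ^ 2 * mn (Z / d) (α * d) := by
    refine Finset.sum_le_sum_of_subset_of_nonneg ?_ fun d _ _ => ?_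
    · intro d; simp only [mem_filter, mem_Ioc, mem_Icc]; omega
    · have := mn_nonneg (Y := Z / d) (by positivity) (α * d); positivity
  refine h3.trans ?_
  rw [← Finset.mul_sum]
  have h4 := min_sum h Z Z (by linarith) hZ (min N D) (le_trans (by exact_mod_cast min_le_left N D) hN) hqZ
  have h5 : ((min N D : ℕ) : ℝ) ≤ D := by exact_mod_cast min_le_right N D
  calc _ ≤ 2 * ℓ ^ 2 * (ℓ * (4 * Z / q + 4 * (min N D : ℕ) + 2 * q)) := by gcongr
    _ ≤ 2 * ℓ ^ 2 * (ℓ * (4 * Z / q + 4 * D + 2 * q)) := by gcongr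
    _ = _ := by ring

lemma tau_sum (Z : ℝ) (hZ : 1 ≤ Z) (N : ℕ) (hN : (N:ℝ) ≤ Z) :
    ∑ m ∈ Icc 1 N, ((m.divisors.card : ℝ)) ^ 2 / m ≤ (1 + Real.log Z) ^ 4 := by
  set ℓ := 1 + Real.log Z with hℓ
  have hl1 : 1 ≤ ℓ := by linarith [Real.log_nonneg hZ]
  have gen : ∀ (f : ArithmeticFunction ℝ), (∀ n, 0 ≤ f n) → (∀ m n, f (m * n) ≤ f m * f n) →
      ∑ m ∈ Ioc 0 N, (m.divisors.card : ℝ) * f m ≤ (∑ m ∈ Ioc 0 N, f m) ^ 2 := by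
    intro f f0 fm
    have h1 : ∑ m ∈ Ioc 0 N, (m.divisors.card : ℝ) * f m ≤ ∑ m ∈ Ioc 0 N, (f * f) m := by
      refine Finset.sum_le_sum fun m _ => ?_
      rw [ArithmeticFunction.mul_apply, ← nsmul_eq_mul, Nat.sum_divisorsAntidiagonal (fun a b => f a * f b)]
      refine Finset.card_nsmul_le_sum _ _ _ fun d hd => ?_
      have := fm d (m / d)
      rwa [Nat.mul_div_cancel' (Nat.dvd_of_mem_divisors hd)] at this
    refine h1.trans ?_
    rw [sum_Ioc_mul_eq_sum_sum, sq, Finset.sum_mul]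
    refine Finset.sum_le_sum fun n _ => mul_le_mul_of_nonneg_left ?_ (f0 n)
    refine Finset.sum_le_sum_of_subset_of_nonneg ?_ fun i _ _ => f0 i
    exact Finset.Ioc_subset_Ioc_right (Nat.div_le_self N n)
  have g1 := gen ⟨fun n => 1 / n, by simp⟩ (fun n => by simp) (fun m n => by
    simp only [coe_mk]; push_cast; rw [one_div_mul_one_div])
  have g2 := gen ⟨fun n => (n.divisors.card : ℝ) / n, by simp⟩ (fun n => by simp only [coe_mk]; positivity) (fun m n => by
    simp only [coe_mk]; push_cast; rw [div_mul_div_comm]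
    gcongr
    rw [Nat.divisors_mul]; exact_mod_cast Finset.card_mul_le)
  simp only [coe_mk] at g1 g2
  have e : Icc 1 N = Ioc 0 N := by ext; simp only [mem_Icc, mem_Ioc]; omega
  have h0 := harm N Z hZ hN
  rw [e] at h0 ⊢
  have hnn : 0 ≤ ∑ i ∈ Ioc 0 N, (1:ℝ) / i := Finset.sum_nonneg fun i _ => by positivity
  have hnn2 : 0 ≤ ∑ m ∈ Ioc 0 N, (m.divisors.card : ℝ) / m := Finset.sum_nonneg fun i _ => by positivity
  have h2 : ∑ m ∈ Ioc 0 N, (m.divisors.card : ℝ) / m ≤ ℓ ^ 2 := by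
    refine le_trans (le_of_eq ?_) (g1.trans (by gcongr))
    exact Finset.sum_congr rfl fun m _ => by ring
  calc _ = ∑ m ∈ Ioc 0 N, (m.divisors.card : ℝ) * ((m.divisors.card : ℝ) / m) := Finset.sum_congr rfl fun m _ => by ring
    _ ≤ (∑ m ∈ Ioc 0 N, (m.divisors.card : ℝ) / m) ^ 2 := g2
    _ ≤ (ℓ ^ 2) ^ 2 := pow_le_pow_left₀ hnn2 h2 2
    _ = _ := by ring

end Cayley
end

section
open Complex Finset Filter Topology MeasureTheory ArithmeticFunction

namespace Cayley

lemma cond_sum {V N k k' : ℕ} (hk : 0 < k) (hkk : k' ≤ k) (F : ℕ → ℂ) :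
    ∑ m ∈ Ioc V N, (if m * k ≤ N then if m * k' ≤ N then F m else 0 else 0) = ∑ m ∈ Ioc V (N / k), F m := by
  rw [← sum_filter, ← sum_filter, filter_filter]
  refine sum_congr ?_ fun _ _ => rfl
  ext m
  simp only [mem_filter, mem_Ioc, Nat.le_div_iff_mul_le hk]
  constructor
  · rintro ⟨⟨h1, h2⟩, h3, h4⟩; exact ⟨h1, h3⟩
  · rintro ⟨h1, h2⟩
    have : m * k' ≤ m * k := Nat.mul_le_mul_left m hkk
    have : m * 1 ≤ m * k := Nat.mul_le_mul_left m hk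
    exact ⟨⟨h1, by omega⟩, h2, by omega⟩

lemma wsum_le (V N k : ℕ) (hk : 0 < k) (θ : ℝ) :
    ‖∑ m ∈ Ioc V (N / k), (m : ℂ) * ee (m * θ)‖ ≤ if V * k ≤ N then 2 * ((N:ℝ) / k) * mn ((N:ℝ) / k) θ else 0 := by
  have hk0 : (0:ℝ) < k := by exact_mod_cast hk
  split_ifs with hV
  · have h0 : 0 ≤ mn ((N:ℝ) / k) θ := mn_nonneg (by positivity) _
    have := abel_mono (fun m => (m:ℝ)) (fun m => ee (m * θ)) (mn ((N:ℝ) / k) θ) V (N / k) (fun n => by positivity)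
      (fun n _ => by push_cast; linarith) (fun j hj hjN => (geom_bound _ _ _).trans (mn_mono (by
        have : j * k ≤ N := (Nat.le_div_iff_mul_le hk).1 hjN
        have h1 : ((j - V : ℕ) : ℝ) ≤ j := by exact_mod_cast Nat.sub_le j V
        refine h1.trans ?_
        rw [le_div_iff₀ hk0]; exact_mod_cast this) _)) h0
    simp only [ofReal_natCast] at this
    refine this.trans ?_
    have : ((N / k : ℕ) : ℝ) ≤ (N:ℝ) / k := Nat.cast_div_le
    gcongr
  · rw [Finset.Ioc_eq_empty]; simp
    intro h
    have := (Nat.le_div_iff_mul_le hk).1 h.le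
    exact hV this

lemma inner_sum {α : ℝ} {a : ℤ} {q : ℕ} (h : Appr α a q) (Z : ℝ) (hZ : 1 ≤ Z) (N : ℕ) (hN : (N:ℝ) ≤ Z) (hqZ : (q:ℝ) ≤ Z)
    (k : ℕ) (hk : 0 < k) (hkN : k ≤ N) :
    ∑ k' ∈ Ioc 0 k, mn ((N:ℝ) / k) (α * ((k - k' : ℕ) : ℝ)) ≤ (N:ℝ) / k + (1 + Real.log Z) * (4 * N / q + 4 * k + 2 * q) := by
  have e : ∑ k' ∈ Ioc 0 k, mn ((N:ℝ) / k) (α * ((k - k' : ℕ) : ℝ)) = ∑ j ∈ range k, mn ((N:ℝ) / k) (α * (j : ℝ)) := by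
    refine Finset.sum_nbij' (fun k' => k - k') (fun j => k - j) ?_ ?_ ?_ ?_ ?_
    · intro i hi; simp only [mem_Ioc, mem_range] at *; omega
    · intro i hi; simp only [mem_Ioc, mem_range] at *; omega
    · intro i hi; simp only [mem_Ioc, mem_range] at *; omega
    · intro i hi; simp only [mem_Ioc, mem_range] at *; omega
    · intro i hi; rfl
  rw [e]
  have hm := min_sum h N Z (by positivity) hZ k (le_trans (by exact_mod_cast hkN) hN) hqZ
  obtain ⟨j, rfl⟩ : ∃ j, k = j + 1 := ⟨k - 1, by omega⟩
  rw [Finset.sum_range_succ', add_comm]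
  refine add_le_add (mn_le _ _) (le_trans ?_ hm)
  have : ∑ i ∈ range j, mn ((N:ℝ) / (j + 1 : ℕ)) (α * ((i + 1 : ℕ) : ℝ)) ≤ ∑ d ∈ Icc 1 j, mn ((N:ℝ) / d) (α * d) := by
    rw [← Finset.Ico_add_one_right_eq_Icc, Finset.sum_Ico_eq_sum_range]
    refine (Finset.sum_le_sum fun i hi => ?_).trans (le_of_eq (Finset.sum_congr (by simp) fun i _ => by rw [add_comm 1 i]))
    rw [mem_range] at hi
    apply mn_mono
    gcongr
  refine this.trans (Finset.sum_le_sum_of_subset_of_nonneg (Finset.Icc_subset_Icc_right (by omega)) fun d _ _ => mn_nonneg (by positivity) _)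

lemma af_sub (f g : ArithmeticFunction ℝ) (n : ℕ) : (f - g) n = f n - g n := by
  rw [sub_eq_add_neg, sub_eq_add_neg]; rfl

set_option maxHeartbeats 1000000 in
/-- weighted second moment of the inner sums -/
lemma second_moment {α : ℝ} {a : ℤ} {q : ℕ} (h : Appr α a q) (Z : ℝ) (hZ : 1 ≤ Z) (N V : ℕ) (hV : 1 ≤ V) (hN : (N:ℝ) ≤ Z) (hqZ : (q:ℝ) ≤ Z)
    (b : ℕ → ℝ) (hb : ∀ k, 1 ≤ k → k ≤ N → |b k| ≤ 1 + Real.log Z) (hb0 : ∀ k, k ≤ V → b k = 0) :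
    ∑ m ∈ Ioc V N, (m:ℝ) * ‖∑ k ∈ Ioc 0 (N / m), (b k : ℂ) * ee ((m * k : ℕ) * α)‖ ^ 2 ≤
      20 * (1 + Real.log Z) ^ 4 * (Z ^ 2 / V + Z ^ 2 / q + Z * q) := by
  set ℓ := 1 + Real.log Z with hℓ
  have hl1 : 1 ≤ ℓ := by linarith [Real.log_nonneg hZ]
  have hV0 : (0:ℝ) < V := by exact_mod_cast hV
  have hq0 : (0:ℝ) < q := by exact_mod_cast h.1
  set W : ℕ → ℕ → ℂ := fun k k' => ∑ m ∈ Ioc V N, (if m * k ≤ N then if m * k' ≤ N then (m:ℂ) * ee (m * (((k:ℝ) - k') * α)) else 0 else 0) with hW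
  have hexp : ((∑ m ∈ Ioc V N, (m:ℝ) * ‖∑ k ∈ Ioc 0 (N / m), (b k : ℂ) * ee ((m * k : ℕ) * α)‖ ^ 2 : ℝ) : ℂ) =
      ∑ k ∈ Ioc 0 N, ∑ k' ∈ Ioc 0 N, (b k : ℂ) * b k' * W k k' := by
    simp only [hW]
    simp_rw [mul_sum]
    rw [ofReal_sum]
    have : ∑ k ∈ Ioc 0 N, ∑ k' ∈ Ioc 0 N, ∑ m ∈ Ioc V N, (b k : ℂ) * b k' * (if m * k ≤ N then if m * k' ≤ N then (m:ℂ) * ee (m * (((k:ℝ) - k') * α)) else 0 else 0)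
      = ∑ m ∈ Ioc V N, ∑ k ∈ Ioc 0 N, ∑ k' ∈ Ioc 0 N, (b k : ℂ) * b k' * (if m * k ≤ N then if m * k' ≤ N then (m:ℂ) * ee (m * (((k:ℝ) - k') * α)) else 0 else 0) := by
      rw [Finset.sum_comm]
      rw [Finset.sum_congr rfl fun k' _ => Finset.sum_comm]
      rw [Finset.sum_comm]
      exact Finset.sum_congr rfl fun m _ => Finset.sum_comm
    rw [this]
    refine Finset.sum_congr rfl fun m hm => ?_
    rw [mem_Ioc] at hm
    have hT : ∑ k ∈ Ioc 0 (N / m), (b k : ℂ) * ee ((m * k : ℕ) * α) = ∑ k ∈ Ioc 0 N, if m * k ≤ N then (b k : ℂ) * ee ((m * k : ℕ) * α) else 0 := by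
      rw [← sum_filter]
      refine sum_congr ?_ fun _ _ => rfl
      ext k
      simp only [mem_filter, mem_Ioc, Nat.le_div_iff_mul_le (by omega : 0 < m)]
      constructor
      · rintro ⟨h1, h2⟩
        have : k * 1 ≤ k * m := Nat.mul_le_mul_left k (by omega)
        exact ⟨⟨h1, by omega⟩, by linarith⟩
      · rintro ⟨⟨h1, _⟩, h2⟩; exact ⟨h1, by linarith⟩
    rw [ofReal_mul, ofReal_pow, ← Complex.mul_conj', hT, map_sum, Finset.sum_mul_sum, Finset.mul_sum]
    refine Finset.sum_congr rfl fun k _ => ?_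
    rw [Finset.mul_sum]
    refine Finset.sum_congr rfl fun k' _ => ?_
    by_cases c1 : m * k ≤ N
    · by_cases c2 : m * k' ≤ N
      · simp only [c1, c2, if_true]
        rw [map_mul, conj_ofReal, ← ee_neg]
        have : ee (m * (((k:ℝ) - k') * α)) = ee ((m * k : ℕ) * α) * ee (-((m * k' : ℕ) * α)) := by
          rw [← ee_add]; congr 1; push_cast; ring
        rw [this]; push_cast; ring
      · simp [c1, c2]
    · simp [c1]
  set G : ℕ → ℕ → ℝ := fun k k' => if k' ≤ k ∧ V < k ∧ V * k ≤ N then ℓ ^ 2 * (2 * ((N:ℝ) / k) * mn ((N:ℝ) / k) (α * ((k - k' : ℕ) : ℝ))) else 0 with hG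
  have hG0 : ∀ k k', 0 ≤ G k k' := by
    intro k k'; simp only [hG]
    have := mn_nonneg (Y := (N:ℝ) / k) (by positivity) (α * ((k - k' : ℕ) : ℝ))
    split_ifs <;> positivity
  have hWconj : ∀ k k', ‖W k k'‖ = ‖W k' k‖ := by
    intro k k'
    have : W k' k = (starRingEnd ℂ) (W k k') := by
      simp only [hW]
      rw [map_sum]
      refine Finset.sum_congr rfl fun m _ => ?_
      by_cases c1 : m * k ≤ N
      · by_cases c2 : m * k' ≤ N
        · simp only [c1, c2, if_true]
          rw [map_mul, ← ee_neg, map_natCast]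
          congr 2; ring
        · simp [c1, c2]
      · simp [c1]
    rw [this, RCLike.norm_conj]
  have hb2 : ∀ k k', k ∈ Ioc 0 N → k' ∈ Ioc 0 N → k' ≤ k → ‖(b k : ℂ) * b k' * W k k'‖ ≤ G k k' := by
    intro k k' hk hk' hkk
    rw [mem_Ioc] at hk hk'
    rw [norm_mul, norm_mul, norm_real, norm_real, Real.norm_eq_abs, Real.norm_eq_abs]
    by_cases c : V < k
    · have h1 := wsum_le V N k hk.1 (((k:ℝ) - k') * α)
      have e : W k k' = ∑ m ∈ Ioc V (N / k), (m : ℂ) * ee (m * (((k:ℝ) - k') * α)) := cond_sum hk.1 hkk _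
      rw [← e] at h1
      have e2 : ((k:ℝ) - k') * α = α * ((k - k' : ℕ) : ℝ) := by rw [Nat.cast_sub hkk]; ring
      rw [e2] at h1
      simp only [hG, hkk, c, true_and]
      split_ifs with c2
      · rw [if_pos c2] at h1
        have h3 := hb k hk.1 hk.2
        have h4 := hb k' hk'.1 hk'.2
        have := mn_nonneg (Y := (N:ℝ) / k) (by positivity) (α * ((k - k' : ℕ) : ℝ))
        calc _ ≤ ℓ * ℓ * (2 * ((N:ℝ) / k) * mn ((N:ℝ) / k) (α * ((k - k' : ℕ) : ℝ))) := by gcongr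
          _ = _ := by ring
      · rw [if_neg c2] at h1
        rw [le_antisymm h1 (norm_nonneg _), mul_zero]
    · rw [hb0 k (by omega)]; simp [hG0]
  have hb3 : ∀ k ∈ Ioc 0 N, ∀ k' ∈ Ioc 0 N, ‖(b k : ℂ) * b k' * W k k'‖ ≤ G k k' + G k' k := by
    intro k hk k' hk'
    rcases le_total k' k with hkk | hkk
    · linarith [hb2 k k' hk hk' hkk, hG0 k' k]
    · have := hb2 k' k hk' hk hkk
      have e : ‖(b k : ℂ) * b k' * W k k'‖ = ‖(b k' : ℂ) * b k * W k' k‖ := by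
        rw [norm_mul, norm_mul (_ * _), hWconj k k', mul_comm (b k : ℂ)]
      rw [e]; linarith [hG0 k k']
  have hN0 : (0:ℝ) ≤ N := by positivity
  have hrow : ∀ k ∈ Ioc 0 N, ∑ k' ∈ Ioc 0 N, G k k' ≤ (1 / (k:ℝ)) * (10 * ℓ ^ 3 * (Z ^ 2 / V + Z ^ 2 / q + Z * q)) := by
    intro k hk
    rw [mem_Ioc] at hk
    have hk0 : (0:ℝ) < k := by exact_mod_cast hk.1
    by_cases c : V < k ∧ V * k ≤ N
    · have e : ∑ k' ∈ Ioc 0 N, G k k' = ∑ k' ∈ Ioc 0 k, ℓ ^ 2 * (2 * ((N:ℝ) / k) * mn ((N:ℝ) / k) (α * ((k - k' : ℕ) : ℝ))) := by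
        simp only [hG, c, and_true]
        rw [← sum_filter]
        refine sum_congr ?_ fun _ _ => rfl
        ext k'; simp only [mem_filter, mem_Ioc]; omega
      rw [e, ← Finset.mul_sum, ← Finset.mul_sum]
      have hin := inner_sum h Z hZ N hN hqZ k hk.1 hk.2
      have c1 : (V:ℝ) ≤ k := by exact_mod_cast c.1.le
      have c2 : (V:ℝ) * k ≤ N := by exact_mod_cast c.2
      have hA : (N:ℝ) / k ≤ Z / V := by
        calc (N:ℝ) / k ≤ N / V := by gcongr
          _ ≤ Z / V := by gcongr
      have hB : (k:ℝ) ≤ Z / V := by rw [le_div_iff₀ hV0]; linarith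
      have hC : (N:ℝ) / q ≤ Z / q := by gcongr
      have hZ0 : 0 ≤ Z / V := by positivity
      have hZq : 0 ≤ Z / q := by positivity
      have hin2 : (N:ℝ) / k + ℓ * (4 * N / q + 4 * k + 2 * q) ≤ 5 * ℓ * (Z / V + Z / q + q) := by
        have h1 : (N:ℝ) / k ≤ ℓ * (Z / V) := hA.trans (by nlinarith)
        have h2 : ℓ * (4 * N / q + 4 * k + 2 * q) ≤ ℓ * (4 * (Z / q) + 4 * (Z / V) + 5 * q) := by
          rw [mul_div_assoc]; gcongr; linarith
        nlinarith [mul_nonneg (by linarith : 0 ≤ ℓ) hZq]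
      calc _ ≤ ℓ ^ 2 * (2 * ((N:ℝ) / k) * (5 * ℓ * (Z / V + Z / q + q))) := by gcongr; exact hin.trans hin2
        _ ≤ ℓ ^ 2 * (2 * (Z / k) * (5 * ℓ * (Z / V + Z / q + q))) := by gcongr
        _ = _ := by field_simp; ring
    · have e : ∑ k' ∈ Ioc 0 N, G k k' = 0 := by
        refine Finset.sum_eq_zero fun k' _ => ?_
        simp only [hG]; rw [if_neg]; tauto
      rw [e]; positivity
  have hfin : ∑ k ∈ Ioc 0 N, ∑ k' ∈ Ioc 0 N, G k k' ≤ 10 * ℓ ^ 4 * (Z ^ 2 / V + Z ^ 2 / q + Z * q) := by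
    refine (Finset.sum_le_sum hrow).trans ?_
    rw [← Finset.sum_mul]
    have e : Icc 1 N = Ioc 0 N := by ext; simp only [mem_Icc, mem_Ioc]; omega
    have h0 := harm N Z hZ hN
    rw [e] at h0
    calc _ ≤ ℓ * (10 * ℓ ^ 3 * (Z ^ 2 / V + Z ^ 2 / q + Z * q)) := by gcongr
      _ = _ := by ring
  have hnn : (0:ℝ) ≤ ∑ m ∈ Ioc V N, (m:ℝ) * ‖∑ k ∈ Ioc 0 (N / m), (b k : ℂ) * ee ((m * k : ℕ) * α)‖ ^ 2 :=
    Finset.sum_nonneg fun m _ => by positivity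
  have hnorm := congrArg norm hexp
  rw [norm_real, Real.norm_eq_abs, abs_of_nonneg hnn] at hnorm
  rw [hnorm]
  refine (norm_sum_le _ _).trans ?_
  calc _ ≤ ∑ k ∈ Ioc 0 N, ∑ k' ∈ Ioc 0 N, (G k k' + G k' k) :=
        Finset.sum_le_sum fun k hk => (norm_sum_le _ _).trans (Finset.sum_le_sum fun k' hk' => hb3 k hk k' hk')
    _ = ∑ k ∈ Ioc 0 N, ∑ k' ∈ Ioc 0 N, G k k' + ∑ k ∈ Ioc 0 N, ∑ k' ∈ Ioc 0 N, G k k' := by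
        simp_rw [Finset.sum_add_distrib]
        congr 1
        exact Finset.sum_comm
    _ ≤ _ := by linarith

lemma type2 {α : ℝ} {a : ℤ} {q : ℕ} (h : Appr α a q) (Z : ℝ) (hZ : 1 ≤ Z) (N V : ℕ) (hV : 1 ≤ V) (hN : (N:ℝ) ≤ Z) (hqZ : (q:ℝ) ≤ Z)
    (c b : ℕ → ℝ) (hc : ∀ m, |c m| ≤ m.divisors.card) (hc0 : ∀ m, m ≤ V → c m = 0)
    (hb : ∀ k, 1 ≤ k → k ≤ N → |b k| ≤ 1 + Real.log Z) (hb0 : ∀ k, k ≤ V → b k = 0) :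
    ‖∑ m ∈ Ioc 0 N, (c m : ℂ) * ∑ k ∈ Ioc 0 (N / m), (b k : ℂ) * ee ((m * k : ℕ) * α)‖ ^ 2 ≤
      20 * (1 + Real.log Z) ^ 8 * (Z ^ 2 / V + Z ^ 2 / q + Z * q) := by
  have hsm := second_moment h Z hZ N V hV hN hqZ b hb hb0
  set ℓ := 1 + Real.log Z with hℓ
  set T : ℕ → ℂ := fun m => ∑ k ∈ Ioc 0 (N / m), (b k : ℂ) * ee ((m * k : ℕ) * α) with hT
  have e1 : ∑ m ∈ Ioc 0 N, (c m : ℂ) * T m = ∑ m ∈ Ioc V N, (c m : ℂ) * T m := by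
    symm
    refine Finset.sum_subset (Finset.Ioc_subset_Ioc_left (by omega)) fun m hm hm' => ?_
    rw [mem_Ioc] at hm hm'
    rw [hc0 m (by omega)]; simp
  have h1 : ‖∑ m ∈ Ioc 0 N, (c m : ℂ) * T m‖ ≤ ∑ m ∈ Ioc V N, (|c m| / Real.sqrt m) * (Real.sqrt m * ‖T m‖) := by
    rw [e1]
    refine (norm_sum_le _ _).trans (le_of_eq (Finset.sum_congr rfl fun m hm => ?_))
    rw [mem_Ioc] at hm
    have : 0 < Real.sqrt m := Real.sqrt_pos.2 (by exact_mod_cast (by omega : 0 < m))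
    rw [norm_mul, norm_real, Real.norm_eq_abs]; field_simp
  have h2 := Finset.sum_mul_sq_le_sq_mul_sq (Ioc V N) (fun m : ℕ => |c m| / Real.sqrt m) (fun m => Real.sqrt m * ‖T m‖)
  have h3 : ∑ m ∈ Ioc V N, (|c m| / Real.sqrt m) ^ 2 ≤ ℓ ^ 4 := by
    refine le_trans ?_ (tau_sum Z hZ N hN)
    refine le_trans (Finset.sum_le_sum fun m hm => ?_) (Finset.sum_le_sum_of_subset_of_nonneg (s := Ioc V N) (t := Icc 1 N) ?_ fun m _ _ => by positivity)
    · rw [div_pow, Real.sq_sqrt (by positivity)]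
      have := hc m
      gcongr
    · intro m; simp only [mem_Ioc, mem_Icc]; omega
  have h4 : ∑ m ∈ Ioc V N, (Real.sqrt m * ‖T m‖) ^ 2 ≤ 20 * ℓ ^ 4 * (Z ^ 2 / V + Z ^ 2 / q + Z * q) := by
    refine le_trans (le_of_eq (Finset.sum_congr rfl fun m _ => ?_)) hsm
    rw [mul_pow, Real.sq_sqrt (by positivity)]
  calc _ ≤ (∑ m ∈ Ioc V N, (|c m| / Real.sqrt m) * (Real.sqrt m * ‖T m‖)) ^ 2 := by gcongr
    _ ≤ _ := h2
    _ ≤ ℓ ^ 4 * (20 * ℓ ^ 4 * (Z ^ 2 / V + Z ^ 2 / q + Z * q)) := by gcongr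
    _ = _ := by ring

theorem vaughan {α : ℝ} {a : ℤ} {q : ℕ} (h : Appr α a q) (Z : ℝ) (hZ : 1 ≤ Z) (N V : ℕ) (hV : 1 ≤ V) (hN : (N:ℝ) ≤ Z) (hqZ : (q:ℝ) ≤ Z) :
    ‖∑ n ∈ Ioc 0 N, (vonMangoldt n : ℂ) * ee (n * α)‖ ≤
      25 * (1 + Real.log Z) ^ 4 * (Z / Real.sqrt V + Z / Real.sqrt q + Real.sqrt (Z * q) + V ^ 2) := by
  have hq1 : (1:ℝ) ≤ q := by exact_mod_cast h.1
  have hV1 : (1:ℝ) ≤ V := by exact_mod_cast hV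
  set ℓ := 1 + Real.log Z with hℓ
  have hl1 : 1 ≤ ℓ := by linarith [Real.log_nonneg hZ]
  have hlog : ∀ n : ℕ, n ≤ N → Real.log n ≤ ℓ := by
    intro n hn
    rcases Nat.eq_zero_or_pos n with rfl | h0
    · simp; linarith
    · have : (n:ℝ) ≤ Z := le_trans (by exact_mod_cast hn) hN
      have := Real.log_le_log (by exact_mod_cast h0) this
      linarith
  set s1 := ∑ n ∈ Ioc 0 N, (laT V n : ℂ) * ee (n * α) with hs1
  set s2 := ∑ n ∈ Ioc 0 N, (((muT V * ArithmeticFunction.log) n : ℝ) : ℂ) * ee (n * α) with hs2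
  set s3 := ∑ n ∈ Ioc 0 N, ((((muT V * laT V) * (zeta : ArithmeticFunction ℝ)) n : ℝ) : ℂ) * ee (n * α) with hs3
  set s4 := ∑ n ∈ Ioc 0 N, (((((moebius : ArithmeticFunction ℝ) - muT V) * (zeta : ArithmeticFunction ℝ)) * (vonMangoldt - laT V)) n : ℂ) * ee (n * α) with hs4
  have hid : ∑ n ∈ Ioc 0 N, (vonMangoldt n : ℂ) * ee (n * α) = s1 + s2 - s3 + s4 := by
    rw [hs1, hs2, hs3, hs4, ← sum_add_distrib, ← sum_sub_distrib, ← sum_add_distrib]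
    refine sum_congr rfl fun n _ => ?_
    have := congrArg (fun f : ArithmeticFunction ℝ => ((f n : ℝ) : ℂ)) (vaughan_id V)
    simp only [ArithmeticFunction.add_apply, af_sub] at this
    rw [this]; push_cast; ring
  have b1 : ‖s1‖ ≤ V * ℓ := by
    refine (norm_sum_le _ _).trans ?_
    have : ∀ n ∈ Ioc 0 N, ‖(laT V n : ℂ) * ee (n * α)‖ ≤ if n ≤ V then ℓ else 0 := by
      intro n hn
      rw [mem_Ioc] at hn
      rw [norm_mul, ee_norm, mul_one, norm_real, Real.norm_eq_abs, abs_of_nonneg (laT_nonneg V n)]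
      split_ifs with c
      · exact (laT_le V n).trans (vonMangoldt_le_log.trans (hlog n hn.2))
      · rw [laT_zero (by omega)]
    refine (sum_le_sum this).trans ?_
    rw [← sum_filter, sum_const, nsmul_eq_mul]
    have : ((Ioc 0 N).filter (· ≤ V)).card ≤ V := by
      refine (card_le_card (t := Ioc 0 V) ?_).trans (by simp)
      intro n; simp only [mem_filter, mem_Ioc]; omega
    gcongr
  have b2 : ‖s2‖ ≤ 2 * ℓ ^ 3 * (4 * Z / q + 4 * V + 2 * q) := by
    rw [hs2, conv_sum _ _ (fun n => ee (n * α))]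
    refine type1 h Z hZ N V hN hqZ (fun d => muT V d) (fun n => ArithmeticFunction.log n) ?_ ?_ ?_ ?_ ?_
    · intro d _ _; exact (muT_abs V d).trans (by split_ifs <;> linarith)
    · intro d hd
      have := muT_abs V d
      rw [if_neg (by omega)] at this
      exact abs_nonpos_iff.1 this
    · intro n; rw [log_apply]; exact Real.log_natCast_nonneg n
    · intro n hn; rw [log_apply, log_apply]; gcongr; omega
    · intro n hn; rw [log_apply]; exact hlog n hn
  have b3 : ‖s3‖ ≤ 2 * ℓ ^ 3 * (4 * Z / q + 4 * (V * V : ℕ) + 2 * q) := by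
    rw [hs3, conv_sum _ _ (fun n => ee (n * α))]
    have := type1 h Z hZ N (V * V) hN hqZ (fun d => (muT V * laT V) d) (fun n => 1) (fun d hd hdN => (conv_abs V d).trans (hlog d hdN))
      (fun d hd => conv_zero hd) (fun n => zero_le_one) (fun n _ => le_rfl) (fun n _ => hl1)
    refine le_trans (le_of_eq ?_) this
    congr 1
    refine sum_congr rfl fun d _ => ?_
    congr 1
    refine sum_congr rfl fun m hm => ?_
    rw [mem_Ioc] at hm
    simp [natCoe_apply, zeta_apply, hm.1.ne']
  have b4 : ‖s4‖ ^ 2 ≤ 20 * ℓ ^ 8 * (Z ^ 2 / V + Z ^ 2 / q + Z * q) := by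
    rw [hs4, conv_sum _ _ (fun n => ee (n * α))]
    have hmu : ∀ n : ℕ, |((moebius : ArithmeticFunction ℝ) - muT V) n| ≤ if n ≤ V then 0 else 1 := by
      intro n
      rw [af_sub]
      simp only [muT, coe_mk, intCoe_apply]
      split_ifs
      · simp
      · simp only [sub_zero]; exact_mod_cast abs_moebius_le_one
    refine type2 h Z hZ N V hV hN hqZ (fun m => (((moebius : ArithmeticFunction ℝ) - muT V) * (zeta : ArithmeticFunction ℝ)) m) (fun n => (vonMangoldt - laT V) n) ?_ ?_ ?_ ?_
    · intro m
      simp only [coe_mul_zeta_apply]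
      refine (abs_sum_le_sum_abs _ _).trans ?_
      refine (sum_le_sum (g := fun _ => (1:ℝ)) fun n _ => (hmu n).trans (by split_ifs <;> norm_num)).trans ?_
      simp
    · intro m hm
      simp only [coe_mul_zeta_apply]
      refine sum_eq_zero fun d hd => ?_
      have h1 := hmu d
      have : d ≤ V := (Nat.divisor_le hd).trans hm
      rw [if_pos this] at h1
      exact abs_nonpos_iff.1 h1
    · intro k hk hkN
      simp only [af_sub]
      rw [abs_of_nonneg (by linarith [laT_le V k])]
      have := hlog k hkN
      linarith [laT_nonneg V k, vonMangoldt_le_log (n := k)]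
    · intro k hk
      simp only [af_sub]
      simp only [laT, coe_mk, if_pos hk, sub_self]
  set x1 := Z / Real.sqrt V with hx1
  set x2 := Z / Real.sqrt q with hx2
  set x3 := Real.sqrt (Z * q) with hx3
  have p1 : 0 ≤ x1 := by positivity
  have p2 : 0 ≤ x2 := by positivity
  have p3 : 0 ≤ x3 := by positivity
  have b4' : ‖s4‖ ≤ 5 * ℓ ^ 4 * (x1 + x2 + x3) := by
    refine abs_le_of_sq_le_sq' ?_ (by positivity) |>.2
    refine b4.trans ?_
    have q1 : Z ^ 2 / V = x1 ^ 2 := by rw [hx1, div_pow, Real.sq_sqrt (by positivity)]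
    have q2 : Z ^ 2 / q = x2 ^ 2 := by rw [hx2, div_pow, Real.sq_sqrt (by positivity)]
    have q3 : Z * q = x3 ^ 2 := by rw [hx3, Real.sq_sqrt (by positivity)]
    rw [q1, q2, q3]
    have p8 : 0 ≤ ℓ ^ 8 := by positivity
    have p12 := mul_nonneg p1 p2
    have p13 := mul_nonneg p1 p3
    have p23 := mul_nonneg p2 p3
    calc 20 * ℓ ^ 8 * (x1 ^ 2 + x2 ^ 2 + x3 ^ 2) ≤ 25 * ℓ ^ 8 * (x1 + x2 + x3) ^ 2 := by
          refine mul_le_mul (by linarith) ?_ (by positivity) (by linarith)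
          have : (x1 + x2 + x3) ^ 2 = x1 ^ 2 + x2 ^ 2 + x3 ^ 2 + 2 * (x1 * x2) + 2 * (x1 * x3) + 2 * (x2 * x3) := by ring
          linarith
      _ = _ := by ring
  have r1 : Z / q ≤ x2 := by
    rw [hx2]; gcongr
    rw [Real.sqrt_le_left (by linarith)]; nlinarith
  have r2 : (q:ℝ) ≤ x3 := by
    rw [hx3]; apply Real.le_sqrt_of_sq_le; nlinarith
  have l3 : ℓ ^ 3 ≤ ℓ ^ 4 := pow_le_pow_right₀ hl1 (by norm_num)
  have l1 : ℓ ≤ ℓ ^ 4 := le_self_pow₀ hl1 (by norm_num)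
  have v1 : (V:ℝ) ≤ V ^ 2 := by nlinarith
  have b1' : ‖s1‖ ≤ ℓ ^ 4 * V ^ 2 := b1.trans (by rw [mul_comm]; gcongr)
  have b2' : ‖s2‖ ≤ ℓ ^ 4 * (8 * x2 + 8 * V ^ 2 + 4 * x3) := by
    refine b2.trans ?_
    calc _ ≤ 2 * ℓ ^ 4 * (4 * x2 + 4 * V ^ 2 + 2 * x3) := by rw [mul_div_assoc]; gcongr
      _ = _ := by ring
  have b3' : ‖s3‖ ≤ ℓ ^ 4 * (8 * x2 + 8 * V ^ 2 + 4 * x3) := by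
    refine b3.trans ?_
    calc _ ≤ 2 * ℓ ^ 4 * (4 * x2 + 4 * V ^ 2 + 2 * x3) := by rw [mul_div_assoc]; push_cast; rw [← sq]; gcongr
      _ = _ := by ring
  rw [hid]
  have hl4 : 0 ≤ ℓ ^ 4 := by positivity
  calc _ ≤ ‖s1‖ + ‖s2‖ + ‖s3‖ + ‖s4‖ := by
        refine (norm_add_le _ _).trans ?_
        gcongr
        refine (norm_sub_le _ _).trans ?_
        gcongr
        exact norm_add_le _ _
    _ ≤ ℓ ^ 4 * (V ^ 2 + (8 * x2 + 8 * V ^ 2 + 4 * x3) + (8 * x2 + 8 * V ^ 2 + 4 * x3) + 5 * (x1 + x2 + x3)) := by linarith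
    _ ≤ ℓ ^ 4 * (25 * (x1 + x2 + x3 + V ^ 2)) := by
        refine mul_le_mul_of_nonneg_left ?_ hl4
        have := sq_nonneg (V:ℝ)
        linarith
    _ = _ := by ring

end Cayley
end

section
open Complex Finset Filter Topology MeasureTheory ArithmeticFunction

namespace Cayley

/-! ### Ramanujan sums and primes in progressions twisted by additive characters -/

lemma ram_sum_all (n : ℕ) (hn : 0 < n) : ∑ z ∈ Polynomial.nthRootsFinset n (1:ℂ), z = if n = 1 then 1 else 0 := by
  have hζ := Complex.isPrimitiveRoot_exp n hn.ne'
  have : NeZero n := ⟨hn.ne'⟩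
  have e : ∑ z ∈ Polynomial.nthRootsFinset n (1:ℂ), z = ∑ i ∈ range n, (cexp (2 * Real.pi * I / n)) ^ i := by
    symm
    refine Finset.sum_bij (fun i _ => (cexp (2 * Real.pi * I / n)) ^ i) ?_ ?_ ?_ ?_
    · intro i _
      rw [Polynomial.mem_nthRootsFinset hn, ← pow_mul, Nat.mul_comm i n, pow_mul, hζ.pow_eq_one, one_pow]
    · intro i hi j hj h
      exact hζ.pow_inj (mem_range.1 hi) (mem_range.1 hj) h
    · intro z hz
      rw [Polynomial.mem_nthRootsFinset hn] at hz
      obtain ⟨i, hi, h⟩ := hζ.eq_pow_of_pow_eq_one hz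
      exact ⟨i, mem_range.2 hi, h⟩
    · intro i _; rfl
  rw [e]
  split_ifs with h
  · subst h; simp
  · exact hζ.geom_sum_eq_zero (by omega)

lemma ram_sum_prim (n : ℕ) (hn : 0 < n) : ∑ z ∈ primitiveRoots n ℂ, z = (moebius n : ℂ) := by
  have h := (sum_eq_iff_sum_mul_moebius_eq (R := ℂ) (f := fun n => ∑ z ∈ primitiveRoots n ℂ, z)
    (g := fun n => if n = 1 then 1 else 0)).1 (fun n hn => by
      rw [← ram_sum_all n hn, IsPrimitiveRoot.nthRoots_one_eq_biUnion_primitiveRoots, Finset.sum_biUnion]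
      intro a _ b _ hab
      exact IsPrimitiveRoot.disjoint hab) n hn
  rw [← h, Finset.sum_eq_single (n, 1)]
  · simp
  · rintro ⟨a, b⟩ hab hne
    rw [Nat.mem_divisorsAntidiagonal] at hab
    have : b ≠ 1 := by rintro rfl; apply hne; simp at hab; rw [hab.1]
    simp [this]
  · intro h; simp at h; omega

lemma ram_sum {q : ℕ} (hq : 0 < q) {ζ : ℂ} (h : IsPrimitiveRoot ζ q) :
    ∑ b ∈ (range q).filter (q.Coprime), ζ ^ b = (moebius q : ℂ) := by
  have : NeZero q := ⟨hq.ne'⟩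
  rw [← ram_sum_prim q hq]
  refine Finset.sum_bij (fun i _ => ζ ^ i) ?_ ?_ ?_ ?_
  · intro i hi
    rw [mem_filter] at hi
    rw [mem_primitiveRoots hq]
    exact h.pow_of_coprime i hi.2.symm
  · intro i hi j hj H
    rw [mem_filter, mem_range] at hi hj
    exact h.pow_inj hi.1 hj.1 H
  · intro z hz
    rw [mem_primitiveRoots hq] at hz
    obtain ⟨i, hi, hc, e⟩ := h.isPrimitiveRoot_iff.1 hz
    exact ⟨i, by rw [mem_filter, mem_range]; exact ⟨hi, hc.symm⟩, e⟩
  · intro i _; rfl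

noncomputable def GG {q : ℕ} (ζ : ℂ) (χ : DirichletCharacter ℂ q) : ℂ :=
  ∑ b ∈ (range q).filter (q.Coprime), ζ ^ b * χ ((b : ZMod q)⁻¹)

lemma GG_norm {q : ℕ} [NeZero q] {ζ : ℂ} (h : IsPrimitiveRoot ζ q) (χ : DirichletCharacter ℂ q) : ‖GG ζ χ‖ ≤ q.totient := by
  refine (norm_sum_le _ _).trans ?_
  rw [Nat.totient_eq_card_coprime]
  refine (Finset.sum_le_sum (g := fun _ => (1:ℝ)) fun b _ => ?_).trans (by simp)
  rw [norm_mul, norm_pow, h.norm'_eq_one (NeZero.ne q), one_pow, one_mul]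
  exact χ.norm_le_one _

lemma GG_one {q : ℕ} [NeZero q] {ζ : ℂ} (h : IsPrimitiveRoot ζ q) : GG ζ (1 : DirichletCharacter ℂ q) = (moebius q : ℂ) := by
  rw [← ram_sum (NeZero.pos q) h, GG]
  refine Finset.sum_congr rfl fun b hb => ?_
  rw [mem_filter] at hb
  have : IsUnit ((b : ZMod q)⁻¹) := by
    obtain ⟨u, hu⟩ := (ZMod.isUnit_iff_coprime b q).2 hb.2.symm
    rw [← hu, ZMod.inv_coe_unit]; exact Units.isUnit _
  rw [MulChar.one_apply this, mul_one]

lemma char_expand {q : ℕ} [NeZero q] {ζ : ℂ} (h : IsPrimitiveRoot ζ q) (n : ℕ) :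
    (1 / (q.totient : ℂ)) * ∑ χ : DirichletCharacter ℂ q, GG ζ χ * χ (n : ZMod q) = if n.Coprime q then ζ ^ n else 0 := by
  have hq : 0 < q := NeZero.pos q
  have hφ : (q.totient : ℂ) ≠ 0 := by exact_mod_cast (Nat.totient_pos.2 hq).ne'
  split_ifs with hc
  · have e : ∑ χ : DirichletCharacter ℂ q, GG ζ χ * χ (n : ZMod q) =
        ∑ b ∈ (range q).filter (q.Coprime), ζ ^ b * ∑ χ : DirichletCharacter ℂ q, χ ((b : ZMod q)⁻¹) * χ (n : ZMod q) := by
      simp only [GG, Finset.sum_mul, Finset.mul_sum]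
      rw [Finset.sum_comm]
      simp only [mul_assoc]
    rw [e, Finset.sum_eq_single (n % q)]
    · rw [DirichletCharacter.sum_char_inv_mul_char_eq ℂ ((ZMod.isUnit_iff_coprime _ q).2 (by
        rw [Nat.Coprime, ← Nat.gcd_rec, Nat.gcd_comm]; exact hc)), if_pos (by simp)]
      rw [← pow_mod_orderOf ζ n, ← h.eq_orderOf]
      field_simp
    · intro b hb hne
      rw [mem_filter, mem_range] at hb
      rw [DirichletCharacter.sum_char_inv_mul_char_eq ℂ ((ZMod.isUnit_iff_coprime _ q).2 hb.2.symm), if_neg, mul_zero]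
      intro hE
      rw [ZMod.natCast_eq_natCast_iff'] at hE
      exact hne (by rw [← hE, Nat.mod_eq_of_lt hb.1])
    · intro hn
      exfalso; apply hn
      rw [mem_filter, mem_range]
      refine ⟨Nat.mod_lt _ hq, ?_⟩
      rw [Nat.Coprime, Nat.gcd_comm, ← Nat.gcd_rec, Nat.gcd_comm]; exact hc
  · rw [Finset.sum_eq_zero, mul_zero]
    intro χ _
    rw [χ.map_nonunit (by rwa [ZMod.isUnit_iff_coprime]), mul_zero]

lemma noncop_bound (q N : ℕ) (hq : 0 < q) (hN : 1 ≤ N) :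
    ∑ n ∈ (Icc 1 N).filter (fun n => ¬ n.Coprime q), vonMangoldt n ≤ q + 2 * Real.sqrt N * Real.log N := by
  rw [← Finset.sum_filter_add_sum_filter_not _ (fun n => n.Prime)]
  apply add_le_add
  · have hs : ((Icc 1 N).filter (fun n => ¬ n.Coprime q)).filter (fun n => n.Prime) ⊆ q.primeFactors := by
      intro p hp
      simp only [mem_filter, mem_Icc] at hp
      rw [Nat.mem_primeFactors]
      refine ⟨hp.2, ?_, hq.ne'⟩
      by_contra hd
      exact hp.1.2 ((Nat.Prime.coprime_iff_not_dvd hp.2).2 hd)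
    refine (Finset.sum_le_sum_of_subset_of_nonneg hs fun _ _ _ => vonMangoldt_nonneg).trans ?_
    have : ∑ p ∈ q.primeFactors, vonMangoldt p = Real.log (∏ p ∈ q.primeFactors, p : ℕ) := by
      push_cast
      rw [Real.log_prod (fun p hp => by have := (Nat.prime_of_mem_primeFactors hp).pos; positivity)]
      exact Finset.sum_congr rfl fun p hp => vonMangoldt_apply_prime (Nat.prime_of_mem_primeFactors hp)
    rw [this]
    have h1 : ((∏ p ∈ q.primeFactors, p : ℕ) : ℝ) ≤ q := by exact_mod_cast Nat.le_of_dvd hq (Nat.prod_primeFactors_dvd q)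
    refine (Real.log_le_self (by positivity)).trans h1
  · have h1 : (1:ℝ) ≤ N := by exact_mod_cast hN
    have h2 := Chebyshev.psi_sub_theta_le h1
    rw [Chebyshev.psi_sub_theta_eq_sum_not_prime, Nat.floor_natCast] at h2
    refine le_trans (Finset.sum_le_sum_of_subset_of_nonneg ?_ fun _ _ _ => vonMangoldt_nonneg) h2
    intro n; simp only [mem_filter, mem_Icc, mem_Ioc]; rintro ⟨⟨h1, _⟩, h3⟩; exact ⟨by omega, h3⟩

theorem sw_ap (A : ℕ) (hA : 1 ≤ A) : ∃ C : ℝ, 0 < C ∧ ∀ (q N : ℕ) (ζ : ℂ), 1 ≤ q → IsPrimitiveRoot ζ q → 2 ≤ N → (q:ℝ) ≤ Real.log N ^ A →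
    ‖∑ n ∈ Icc 1 N, ((vonMangoldt n : ℂ) * ζ ^ n - (moebius q : ℂ) / (q.totient : ℂ))‖ ≤ C * N / Real.log N ^ A := by
  obtain ⟨C, hC, H⟩ := siegel_walfisz (2 * A)
  obtain ⟨K, hK, HK⟩ := log_pow_le (2 * A)
  obtain ⟨K', hK', HK'⟩ := log_pow_le (A + 1)
  refine ⟨2 * C + 2 * K + 4 * K', by positivity, ?_⟩
  intro q N ζ hq hζ hN hqN
  have : NeZero q := ⟨by omega⟩
  have hN1 : (1:ℝ) ≤ N := by exact_mod_cast (by omega : 1 ≤ N)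
  have hq1 : (1:ℝ) ≤ q := by exact_mod_cast hq
  have hlog : 1 ≤ Real.log N := by
    by_contra hl
    have := pow_lt_one₀ (Real.log_nonneg hN1) (not_le.1 hl) (by omega : A ≠ 0)
    linarith
  set l := Real.log N with hl
  have hlA : 1 ≤ l ^ A := one_le_pow₀ hlog
  have hl2 : l ^ (2 * A) = l ^ A * l ^ A := by rw [← pow_add]; congr 1; ring
  have hφ : (0:ℝ) < q.totient := by exact_mod_cast Nat.totient_pos.2 hq
  have hφ1 : (1:ℝ) ≤ q.totient := by exact_mod_cast Nat.totient_pos.2 hq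
  have hφq : (q.totient:ℝ) ≤ q := by exact_mod_cast Nat.totient_le q
  set Nc := ∑ n ∈ (Icc 1 N).filter (fun n => ¬ n.Coprime q), vonMangoldt n with hNc
  set ps : DirichletCharacter ℂ q → ℂ := fun χ => ∑ n ∈ Icc 1 N, χ (n : ZMod q) * (vonMangoldt n : ℂ) with hps
  set E := C * N / l ^ (2 * A) with hE
  have hE0 : 0 ≤ E := by positivity
  have b1 : ∀ χ : DirichletCharacter ℂ q, χ ≠ 1 → ‖ps χ‖ ≤ E := fun χ hχ =>
    H q _ (Or.inl ⟨q, inferInstance, χ, hχ, rfl, rfl⟩) N hN (hqN.trans (pow_le_pow_right₀ hlog (by omega)))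
  have b2 : ‖∑ n ∈ Icc 1 N, ((vonMangoldt n : ℂ) - 1)‖ ≤ E :=
    H 1 _ (Or.inr ⟨rfl, rfl⟩) N hN (one_le_pow₀ hlog)
  have nc0 : 0 ≤ Nc := Finset.sum_nonneg fun _ _ => vonMangoldt_nonneg
  have hnc : Nc ≤ q + 2 * Real.sqrt N * l := noncop_bound q N hq (by omega)
  -- decomposition
  have d1 : ∑ n ∈ Icc 1 N, (vonMangoldt n : ℂ) * ζ ^ n = ∑ n ∈ (Icc 1 N).filter (fun n => ¬ n.Coprime q), (vonMangoldt n : ℂ) * ζ ^ n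
      + (1 / (q.totient : ℂ)) * ∑ χ : DirichletCharacter ℂ q, GG ζ χ * ps χ := by
    have e1 : (1 / (q.totient : ℂ)) * ∑ χ : DirichletCharacter ℂ q, GG ζ χ * ps χ =
        ∑ n ∈ Icc 1 N, (vonMangoldt n : ℂ) * (if n.Coprime q then ζ ^ n else 0) := by
      simp only [← char_expand hζ, hps, Finset.mul_sum]
      rw [Finset.sum_comm]
      refine Finset.sum_congr rfl fun n _ => Finset.sum_congr rfl fun χ _ => ?_
      ring
    rw [e1, Finset.sum_filter, ← Finset.sum_add_distrib]
    refine Finset.sum_congr rfl fun n _ => ?_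
    by_cases hc : n.Coprime q <;> simp [hc]
  have d2 : ps 1 - N = ∑ n ∈ Icc 1 N, ((vonMangoldt n : ℂ) - 1) - ∑ n ∈ (Icc 1 N).filter (fun n => ¬ n.Coprime q), (vonMangoldt n : ℂ) := by
    rw [Finset.sum_filter, ← Finset.sum_sub_distrib, hps]
    have : (N:ℂ) = ∑ n ∈ Icc 1 N, (1:ℂ) := by simp
    rw [this, ← Finset.sum_sub_distrib]
    refine Finset.sum_congr rfl fun n _ => ?_
    by_cases hc : n.Coprime q
    · rw [MulChar.one_apply ((ZMod.isUnit_iff_coprime n q).2 hc)]; simp [hc]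
    · rw [MulChar.map_nonunit _ (by rwa [ZMod.isUnit_iff_coprime])]; simp [hc]
  have d3 : ∑ χ : DirichletCharacter ℂ q, GG ζ χ * ps χ = (moebius q : ℂ) * ps 1 + ∑ χ ∈ univ.erase (1 : DirichletCharacter ℂ q), GG ζ χ * ps χ := by
    rw [← GG_one hζ, Finset.add_sum_erase _ (fun χ => GG ζ χ * ps χ) (mem_univ _)]
  have n1 : ‖∑ n ∈ (Icc 1 N).filter (fun n => ¬ n.Coprime q), (vonMangoldt n : ℂ) * ζ ^ n‖ ≤ Nc := by
    refine (norm_sum_le _ _).trans (Finset.sum_le_sum fun n _ => ?_)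
    rw [norm_mul, norm_pow, hζ.norm'_eq_one (NeZero.ne q), one_pow, mul_one, norm_real, Real.norm_eq_abs, abs_of_nonneg vonMangoldt_nonneg]
  have n2 : ‖∑ n ∈ (Icc 1 N).filter (fun n => ¬ n.Coprime q), (vonMangoldt n : ℂ)‖ ≤ Nc := by
    refine (norm_sum_le _ _).trans (Finset.sum_le_sum fun n _ => ?_)
    rw [norm_real, Real.norm_eq_abs, abs_of_nonneg vonMangoldt_nonneg]
  have n3 : ‖(1 / (q.totient : ℂ)) * ∑ χ ∈ univ.erase (1 : DirichletCharacter ℂ q), GG ζ χ * ps χ‖ ≤ q * E := by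
    rw [norm_mul, norm_div, norm_one, norm_natCast]
    have : ‖∑ χ ∈ univ.erase (1 : DirichletCharacter ℂ q), GG ζ χ * ps χ‖ ≤ q.totient * (q.totient * E) := by
      refine (norm_sum_le _ _).trans ?_
      refine (Finset.sum_le_sum (g := fun _ => (q.totient:ℝ) * E) fun χ hχ => ?_).trans ?_
      · rw [norm_mul]
        exact mul_le_mul (GG_norm hζ χ) (b1 χ (Finset.ne_of_mem_erase hχ)) (norm_nonneg _) hφ.le
      · rw [Finset.sum_const, nsmul_eq_mul]
        have hc : (univ.erase (1 : DirichletCharacter ℂ q)).card ≤ q.totient := by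
          refine (Finset.card_le_univ _).trans ?_
          rw [← Nat.card_eq_fintype_card, DirichletCharacter.card_eq_totient_of_hasEnoughRootsOfUnity]
        have hc' : ((univ.erase (1 : DirichletCharacter ℂ q)).card : ℝ) ≤ q.totient := by exact_mod_cast hc
        exact mul_le_mul_of_nonneg_right hc' (by positivity)
    calc 1 / (q.totient:ℝ) * ‖∑ χ ∈ univ.erase (1 : DirichletCharacter ℂ q), GG ζ χ * ps χ‖
        ≤ 1 / (q.totient:ℝ) * (q.totient * (q.totient * E)) := by gcongr
      _ = q.totient * E := by field_simp
      _ ≤ q * E := by gcongr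
  have n4 : ‖(moebius q : ℂ) / (q.totient : ℂ) * (ps 1 - N)‖ ≤ E + Nc := by
    rw [norm_mul, norm_div, norm_natCast, norm_intCast]
    have m1 : |((moebius q : ℤ) : ℝ)| / (q.totient : ℝ) ≤ 1 := by
      rw [div_le_one hφ]
      refine le_trans ?_ hφ1
      exact_mod_cast abs_moebius_le_one
    calc _ ≤ 1 * ‖ps 1 - N‖ := by gcongr
      _ ≤ E + Nc := by
        rw [one_mul, d2]
        exact (norm_sub_le _ _).trans (add_le_add b2 n2)
  have tot : ∑ n ∈ Icc 1 N, ((vonMangoldt n : ℂ) * ζ ^ n - (moebius q : ℂ) / (q.totient : ℂ)) =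
      ∑ n ∈ (Icc 1 N).filter (fun n => ¬ n.Coprime q), (vonMangoldt n : ℂ) * ζ ^ n
      + (1 / (q.totient : ℂ)) * ∑ χ ∈ univ.erase (1 : DirichletCharacter ℂ q), GG ζ χ * ps χ
      + (moebius q : ℂ) / (q.totient : ℂ) * (ps 1 - N) := by
    rw [Finset.sum_sub_distrib, d1, d3, Finset.sum_const, nsmul_eq_mul, Nat.card_Icc]
    simp only [Nat.add_sub_cancel]
    ring
  rw [tot]
  refine (norm_add₃_le).trans ?_
  have hqE : q * E ≤ C * N / l ^ A := by
    calc (q:ℝ) * E ≤ l ^ A * E := by gcongr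
      _ = C * N / l ^ A := by rw [hE, hl2]; field_simp
  have hEE : E ≤ C * N / l ^ A := le_trans (by nlinarith) hqE
  have hsq : Real.sqrt N * Real.sqrt N = N := Real.mul_self_sqrt (by linarith)
  have hs1 : 1 ≤ Real.sqrt N := Real.one_le_sqrt.2 hN1
  have hqb : (q:ℝ) ≤ K * N / l ^ A := by
    rw [le_div_iff₀ (by positivity)]
    calc (q:ℝ) * l ^ A ≤ l ^ A * l ^ A := by gcongr
      _ = l ^ (2 * A) := hl2.symm
      _ ≤ K * Real.sqrt N := HK N hN1
      _ ≤ K * N := by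
        have : Real.sqrt N ≤ N := by nlinarith
        gcongr
  have hsb : Real.sqrt N * l ≤ K' * N / l ^ A := by
    rw [le_div_iff₀ (by positivity)]
    calc Real.sqrt N * l * l ^ A = Real.sqrt N * l ^ (A + 1) := by ring
      _ ≤ Real.sqrt N * (K' * Real.sqrt N) := by gcongr; exact HK' N hN1
      _ = K' * (Real.sqrt N * Real.sqrt N) := by ring
      _ = K' * N := by rw [hsq]
  have fin : (2 * C + 2 * K + 4 * K') * N / l ^ A = 2 * (C * N / l ^ A) + 2 * (K * N / l ^ A) + 4 * (K' * N / l ^ A) := by ring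
  rw [fin]
  linarith

end Cayley
end

section
open Complex Finset Filter Topology MeasureTheory ArithmeticFunction

namespace Cayley

/-! ### The model for the von Mangoldt function -/

def Th (Q : ℕ) : Finset (ℕ × ℕ) := ((Icc 1 Q) ×ˢ (range Q)).filter (fun p => p.2 < p.1 ∧ p.1.Coprime p.2)
noncomputable def th (p : ℕ × ℕ) : ℝ := (p.2 : ℝ) / p.1
noncomputable def wt (p : ℕ × ℕ) : ℝ := (moebius p.1 : ℝ) / p.1.totient
noncomputable def LQ (Q : ℕ) (m : ℤ) : ℂ := ∑ p ∈ Th Q, (wt p : ℂ) * ee (-(m * th p))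

lemma mem_Th {Q : ℕ} {p : ℕ × ℕ} : p ∈ Th Q ↔ 1 ≤ p.1 ∧ p.1 ≤ Q ∧ p.2 < p.1 ∧ p.1.Coprime p.2 := by
  unfold Th
  simp only [mem_filter, mem_product, mem_Icc, mem_range]
  constructor
  · rintro ⟨⟨⟨a, b⟩, c⟩, d, e⟩; exact ⟨a, b, d, e⟩
  · rintro ⟨a, b, d, e⟩; exact ⟨⟨⟨a, b⟩, by omega⟩, d, e⟩

lemma card_Th (Q : ℕ) : ((Th Q).card : ℝ) ≤ (Q:ℝ) ^ 2 := by
  have : (Th Q).card ≤ Q ^ 2 := by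
    refine (Finset.card_filter_le _ _).trans ?_
    rw [Finset.card_product]; simp [sq]
  exact_mod_cast this

lemma wt_abs (p : ℕ × ℕ) : |wt p| ≤ 1 := by
  unfold wt
  rw [abs_div, Nat.abs_cast]
  have h : |((moebius p.1 : ℤ) : ℝ)| ≤ 1 := by exact_mod_cast abs_moebius_le_one
  rcases Nat.eq_zero_or_pos p.1.totient with h0 | h0
  · rw [h0]; simp
  · have : (1:ℝ) ≤ p.1.totient := by exact_mod_cast h0
    rw [div_le_one (by linarith)]; linarith

lemma sep_gen {a a' : ℤ} {q q' : ℕ} (hq : 1 ≤ q) (hq' : 1 ≤ q') (h : IsCoprime a (q:ℤ)) (h' : IsCoprime a' (q':ℤ)) (z : ℤ)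
    (hne : q = q' → a ≠ a' + z * q) : 1 / ((q:ℝ) * q') ≤ |(a:ℝ) / q - a' / q' - z| := by
  have q0 : (0:ℝ) < q := by exact_mod_cast hq
  have q0' : (0:ℝ) < q' := by exact_mod_cast hq'
  have e : (a:ℝ) / q - a' / q' - z = ((a * q' - a' * q - z * q * q' : ℤ) : ℝ) / (q * q') := by
    push_cast; field_simp
  rw [e, abs_div, abs_of_pos (mul_pos q0 q0')]
  gcongr
  have : (a * q' - a' * q - z * q * q' : ℤ) ≠ 0 := by
    intro h0
    have d1 : (q:ℤ) ∣ q' := by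
      have : (q:ℤ) ∣ a * q' := ⟨a' + z * q', by linarith⟩
      exact h.symm.dvd_of_dvd_mul_left this
    have d2 : (q':ℤ) ∣ q := by
      have : (q':ℤ) ∣ a' * q := ⟨a - z * q, by linarith⟩
      exact h'.symm.dvd_of_dvd_mul_left this
    have hqq : q = q' := Nat.dvd_antisymm (by exact_mod_cast d1) (by exact_mod_cast d2)
    apply hne hqq
    subst hqq
    have qz : (q:ℤ) ≠ 0 := by exact_mod_cast (by omega : q ≠ 0)
    have : (q:ℤ) * (a - (a' + z * q)) = 0 := by linarith
    rcases mul_eq_zero.1 this with h1 | h1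
    · exact absurd h1 qz
    · linarith
  exact_mod_cast Int.one_le_abs this

lemma th_sep {Q : ℕ} {p p' : ℕ × ℕ} (hp : p ∈ Th Q) (hp' : p' ∈ Th Q) (hne : p ≠ p') (z : ℤ) :
    1 / (Q:ℝ) ^ 2 ≤ |th p - th p' - z| := by
  rw [mem_Th] at hp hp'
  have h := sep_gen (a := p.2) (a' := p'.2) hp.1 hp'.1 (Nat.isCoprime_iff_coprime.2 hp.2.2.2.symm) (Nat.isCoprime_iff_coprime.2 hp'.2.2.2.symm) z (by
    intro hq he
    apply hne
    have h1 : (p.2:ℤ) < p.1 := by exact_mod_cast hp.2.2.1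
    have h2 : (p'.2:ℤ) < p.1 := by rw [hq]; exact_mod_cast hp'.2.2.1
    have hz : z = 0 := by nlinarith
    rw [hz] at he
    exact Prod.ext hq (by have : (p.2:ℤ) = p'.2 := by linarith
                          exact_mod_cast this))
  refine le_trans ?_ h
  have a1 : (1:ℝ) ≤ p.1 := by exact_mod_cast hp.1
  have a2 : (1:ℝ) ≤ p'.1 := by exact_mod_cast hp'.1
  have b1 : (p.1:ℝ) ≤ Q := by exact_mod_cast hp.2.1
  have b2 : (p'.1:ℝ) ≤ Q := by exact_mod_cast hp'.2.1
  rw [sq]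
  gcongr

lemma geom_small (θ δ : ℝ) (hδ : 0 < δ) (h : ∀ z : ℤ, δ ≤ |θ - z|) (M N : ℕ) : ‖∑ m ∈ Ioc M N, ee (m * θ)‖ ≤ 1 / (2 * δ) := by
  refine (geom_bound θ M N).trans ?_
  have h1 := mn_mul (N - M : ℕ) θ
  have h2 : δ ≤ nn θ := h (round θ)
  have h3 : 0 ≤ mn (N - M : ℕ) θ := mn_nonneg (by positivity) _
  rw [le_div_iff₀ (by positivity)]
  nlinarith

lemma G_expand (Q : ℕ) (s : Finset ℕ) (α : ℝ) :
    ∑ n ∈ s, LQ Q n * ee (n * α) = ∑ p ∈ Th Q, (wt p : ℂ) * ∑ n ∈ s, ee (n * (α - th p)) := by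
  simp only [LQ, Finset.sum_mul, Finset.mul_sum]
  rw [Finset.sum_comm]
  refine Finset.sum_congr rfl fun p _ => Finset.sum_congr rfl fun n _ => ?_
  rw [mul_assoc, ← ee_add]
  congr 2
  push_cast; ring

lemma minorG {α : ℝ} {a : ℤ} {q Q : ℕ} (hQ : 1 ≤ Q) (hq : Q < q) (hc : IsCoprime a (q:ℤ)) (hb : |α - a / q| ≤ 1 / (2 * q * Q)) (M N : ℕ) :
    ‖∑ n ∈ Ioc M N, LQ Q n * ee (n * α)‖ ≤ (Q:ℝ) ^ 3 * q := by
  rw [G_expand]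
  have q0 : (0:ℝ) < q := by exact_mod_cast (by omega : 0 < q)
  have Q0 : (0:ℝ) < Q := by exact_mod_cast hQ
  refine (norm_sum_le _ _).trans ?_
  have : ∀ p ∈ Th Q, ‖(wt p : ℂ) * ∑ n ∈ Ioc M N, ee (n * (α - th p))‖ ≤ q * Q := by
    intro p hp
    rw [mem_Th] at hp
    have h1 : ‖∑ n ∈ Ioc M N, ee (n * (α - th p))‖ ≤ 1 / (2 * (1 / (2 * q * Q))) := by
      apply geom_small _ _ (by positivity)
      intro z
      have h := sep_gen (a := a) (a' := p.2) (by omega : 1 ≤ q) hp.1 hc (Nat.isCoprime_iff_coprime.2 hp.2.2.2.symm) z (by intro h; omega)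
      have b2 : (p.1:ℝ) ≤ Q := by exact_mod_cast hp.2.1
      have p0 : (0:ℝ) < p.1 := by exact_mod_cast hp.1
      have h2 : 1 / ((q:ℝ) * Q) ≤ 1 / ((q:ℝ) * p.1) := by gcongr
      have e : 1 / ((q:ℝ) * Q) = 1 / (2 * q * Q) + 1 / (2 * q * Q) := by field_simp; norm_num
      have h3 : |(a:ℝ) / q - (p.2:ℤ) / p.1 - z| ≤ |α - th p - z| + |α - a / q| := by
        have := abs_sub (α - th p - z) (α - a / q)
        refine le_trans (le_of_eq ?_) this
        congr 1; unfold th; push_cast; ring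
      linarith
    have e : 1 / (2 * (1 / (2 * (q:ℝ) * Q))) = q * Q := by field_simp
    rw [e] at h1
    rw [norm_mul, norm_real, Real.norm_eq_abs]
    calc _ ≤ 1 * (q * Q : ℝ) := mul_le_mul (wt_abs p) h1 (norm_nonneg _) zero_le_one
      _ = _ := one_mul _
  refine (Finset.sum_le_sum this).trans ?_
  rw [Finset.sum_const, nsmul_eq_mul]
  calc _ ≤ (Q:ℝ) ^ 2 * (q * Q) := by gcongr; exact card_Th Q
    _ = _ := by ring

lemma majorD {α b E : ℝ} {a : ℤ} {q Q : ℕ} (hq1 : 1 ≤ q) (hq : q ≤ Q) (hc : IsCoprime a (q:ℤ)) (hb : |α - a / q| ≤ b) (hbQ : b ≤ 1 / (2 * (Q:ℝ) ^ 2))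
    (M N : ℕ) (hMN : M < N) (hE : ∀ j, M ≤ j → j ≤ N → ‖∑ n ∈ Icc 1 j, ((vonMangoldt n : ℂ) * (ee (a / q)) ^ n - (moebius q : ℂ) / (q.totient : ℂ))‖ ≤ E) :
    ‖∑ n ∈ Ioc M N, ((vonMangoldt n : ℂ) - LQ Q n) * ee (n * α)‖ ≤ 2 * E * (1 + 7 * b * N) + (Q:ℝ) ^ 4 := by
  have q0 : (0:ℝ) < q := by exact_mod_cast (by omega : 0 < q)
  have Q0 : (0:ℝ) < Q := by exact_mod_cast (by omega : 0 < Q)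
  have b0 : 0 ≤ b := (abs_nonneg _).trans hb
  have E0 : 0 ≤ E := (norm_nonneg _).trans (hE M le_rfl hMN.le)
  set β := α - a / q with hβ
  set p0 : ℕ × ℕ := (q, (a % q).toNat) with hp0
  have qz : (q:ℤ) ≠ 0 := by exact_mod_cast (by omega : q ≠ 0)
  have ham : (((a % q).toNat : ℕ) : ℤ) = a % q := Int.toNat_of_nonneg (Int.emod_nonneg _ qz)
  have hp0m : p0 ∈ Th Q := by
    rw [mem_Th]
    refine ⟨hq1, hq, ?_, ?_⟩
    · have : (((a % q).toNat : ℕ) : ℤ) < q := by rw [ham]; exact Int.emod_lt_of_pos _ (by omega)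
      exact_mod_cast this
    · rw [← Nat.isCoprime_iff_coprime, hp0]
      simp only
      rw [ham, Int.emod_def]
      have := hc.symm.add_mul_left_right (-(a / q))
      rwa [show a - q * (a / q) = a + q * -(a / q) by rw [mul_neg, sub_eq_add_neg]]
  have hth : α - th p0 = β + (a / q : ℤ) := by
    have : (a:ℝ) = ((a % q).toNat : ℝ) + q * (a / q : ℤ) := by
      have h := Int.emod_add_mul_ediv a q
      rw [← ham] at h
      exact_mod_cast h.symm
    rw [hβ, th, hp0, this]
    field_simp; ring
  have hmain : ∀ n : ℕ, ee (n * (α - th p0)) = ee (n * β) := by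
    intro n
    rw [hth, mul_add, ee_add]
    have : (n:ℝ) * (a / q : ℤ) = ((n * (a / q) : ℤ) : ℝ) := by push_cast; ring
    rw [this, ee_int, mul_one]
  have hsplit : ∑ n ∈ Ioc M N, ((vonMangoldt n : ℂ) - LQ Q n) * ee (n * α) =
      ∑ n ∈ Ioc M N, ee (n * β) * ((vonMangoldt n : ℂ) * (ee (a / q)) ^ n - (moebius q : ℂ) / (q.totient : ℂ))
      - ∑ p ∈ (Th Q).erase p0, (wt p : ℂ) * ∑ n ∈ Ioc M N, ee (n * (α - th p)) := by
    simp only [sub_mul]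
    rw [Finset.sum_sub_distrib, G_expand, ← Finset.add_sum_erase _ _ hp0m]
    simp only [hmain]
    rw [← sub_sub]
    congr 1
    rw [Finset.mul_sum, ← Finset.sum_sub_distrib]
    refine Finset.sum_congr rfl fun n _ => ?_
    have : ee (n * α) = ee (a / q) ^ n * ee (n * β) := by
      rw [← ee_natmul, ← ee_add]; congr 1; rw [hβ]; ring
    rw [this, wt, hp0]
    push_cast; ring
  rw [hsplit]
  refine (norm_sub_le _ _).trans (add_le_add ?_ ?_)
  · have hT : ∀ j, M ≤ j → j ≤ N → ‖∑ n ∈ Ioc M j, ((vonMangoldt n : ℂ) * (ee (a / q)) ^ n - (moebius q : ℂ) / (q.totient : ℂ))‖ ≤ 2 * E := by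
      intro j hj hjN
      have e : ∀ f : ℕ → ℂ, ∑ n ∈ Ioc M j, f n = ∑ n ∈ Icc 1 j, f n - ∑ n ∈ Icc 1 M, f n := by
        intro f
        have h1 : ∀ k, Icc 1 k = Ioc 0 k := fun k => by ext; simp only [mem_Icc, mem_Ioc]; omega
        rw [h1, h1, ← Finset.sum_Ioc_consecutive f (Nat.zero_le M) hj]; ring
      rw [e]
      refine (norm_sub_le _ _).trans ?_
      linarith [hE j hj hjN, hE M le_rfl hMN.le]
    refine (abel_gen (fun n => ee (n * β)) _ (2 * E) M N hMN hT).trans ?_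
    gcongr
    · rw [ee_norm]
    · have : ∀ n ∈ Ico (M + 1) N, ‖ee (((n + 1 : ℕ) : ℝ) * β) - ee (n * β)‖ ≤ 7 * b := by
        intro n _
        have : ee (((n + 1 : ℕ) : ℝ) * β) - ee (n * β) = ee (n * β) * (ee β - 1) := by
          have e : ee (((n + 1 : ℕ) : ℝ) * β) = ee (n * β) * ee β := by
            rw [← ee_add]; congr 1; push_cast; ring
          rw [e]; ring
        rw [this, norm_mul, ee_norm, one_mul]
        refine (ee_sub_one_le β).trans ?_
        have := Real.pi_lt_d2
        have : 2 * Real.pi ≤ 7 := by linarith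
        gcongr
      refine (Finset.sum_le_sum this).trans ?_
      rw [Finset.sum_const, nsmul_eq_mul, mul_comm, Nat.card_Ico]
      gcongr
      omega
  · refine (norm_sum_le _ _).trans ?_
    have : ∀ p ∈ (Th Q).erase p0, ‖(wt p : ℂ) * ∑ n ∈ Ioc M N, ee (n * (α - th p))‖ ≤ (Q:ℝ) ^ 2 := by
      intro p hp
      have h1 : ‖∑ n ∈ Ioc M N, ee (n * (α - th p))‖ ≤ 1 / (2 * (1 / (2 * (Q:ℝ) ^ 2))) := by
        apply geom_small _ _ (by positivity)
        intro z
        have h := th_sep hp0m (Finset.mem_of_mem_erase hp) (Finset.ne_of_mem_erase hp).symm (z - a / q)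
        have e : 1 / (Q:ℝ) ^ 2 = 1 / (2 * (Q:ℝ) ^ 2) + 1 / (2 * (Q:ℝ) ^ 2) := by field_simp; norm_num
        have h3 : |th p0 - th p - (z - a / q : ℤ)| ≤ |α - th p - z| + |β| := by
          have := abs_sub (α - th p - z) β
          refine le_trans (le_of_eq ?_) this
          congr 1; push_cast; linarith
        linarith
      have e : 1 / (2 * (1 / (2 * (Q:ℝ) ^ 2))) = (Q:ℝ) ^ 2 := by field_simp
      rw [e] at h1
      rw [norm_mul, norm_real, Real.norm_eq_abs]
      calc _ ≤ 1 * ((Q:ℝ) ^ 2) := mul_le_mul (wt_abs p) h1 (norm_nonneg _) zero_le_one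
        _ = _ := one_mul _
    refine (Finset.sum_le_sum this).trans ?_
    rw [Finset.sum_const, nsmul_eq_mul]
    have c1 : (((Th Q).erase p0).card : ℝ) ≤ (Q:ℝ) ^ 2 := le_trans (by exact_mod_cast Finset.card_erase_le) (card_Th Q)
    calc _ ≤ (Q:ℝ) ^ 2 * (Q:ℝ) ^ 2 := by gcongr
      _ = _ := by ring

lemma ee_prim {a : ℤ} {q : ℕ} (hq : 1 ≤ q) (hc : IsCoprime a (q:ℤ)) : IsPrimitiveRoot (ee (a / q)) q := by
  have h := Complex.isPrimitiveRoot_exp_of_isCoprime a q (by omega) hc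
  have e : ee (a / q) = cexp (2 * Real.pi * I * (a / q)) := by
    unfold ee; congr 1; push_cast; ring
  rw [e]; exact h

end Cayley
end

section
open Complex Finset Filter Topology MeasureTheory ArithmeticFunction

namespace Cayley

/-- for large X, log X dominates any constant and powers of log X are dominated by X -/
lemma large_log (L : ℝ) : ∃ X₀ : ℝ, 1 ≤ X₀ ∧ ∀ X, X₀ ≤ X → L ≤ Real.log X ∧ 4 ≤ Real.log X ∧ 4 * Real.log X ^ 200 ≤ Real.sqrt X ∧ Real.sqrt X ≤ X := by
  obtain ⟨K, hK, HK⟩ := log_pow_le 201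
  refine ⟨Real.exp (|L| + 4 + 4 * K), Real.one_le_exp (by positivity), fun X hX => ?_⟩
  have hX1 : 1 ≤ X := (Real.one_le_exp (by positivity)).trans hX
  have hl : |L| + 4 + 4 * K ≤ Real.log X := by
    rw [← Real.log_exp (|L| + 4 + 4 * K)]; exact Real.log_le_log (Real.exp_pos _) hX
  have h1 := le_abs_self L
  have h2 := abs_nonneg L
  refine ⟨by linarith, by linarith, ?_, ?_⟩
  · have h := HK X hX1
    have hl0 : 0 ≤ Real.log X := by linarith
    have : 4 * K * Real.log X ^ 200 ≤ K * Real.sqrt X := by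
      calc 4 * K * Real.log X ^ 200 ≤ Real.log X * Real.log X ^ 200 := by gcongr; linarith
        _ = Real.log X ^ 201 := by ring
        _ ≤ _ := h
    have h3 : K * (4 * Real.log X ^ 200) ≤ K * Real.sqrt X := by linarith
    exact le_of_mul_le_mul_left h3 (by linarith)
  · rw [Real.sqrt_le_left (by linarith)]; nlinarith

lemma minor_num {κ X l : ℝ} {Q q : ℕ} (hκ : 1 ≤ κ) (hl : 4 ≤ l) (hX : 4 * l ^ 200 ≤ X) (hlZ : Real.log (κ * X) ≤ 2 * l) (hZ0 : 0 ≤ Real.log (κ * X))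
    (hQ : (Q:ℝ) ≤ l ^ 24) (hQ' : l ^ 24 < Q + 1) (hq : Q < q) (hqR : (q:ℝ) ≤ X / l ^ 96) :
    25 * (1 + Real.log (κ * X)) ^ 4 * (κ * X / Real.sqrt ((Q + 1 : ℕ) : ℝ) + κ * X / Real.sqrt q + Real.sqrt (κ * X * q) + ((Q + 1 : ℕ) : ℝ) ^ 2) ≤
      2025 * (3 * κ + 1) * (X / l ^ 8) := by
  have l0 : 0 < l := by linarith
  have X0 : 0 < X := lt_of_lt_of_le (by positivity) hX
  have hqQ : (Q:ℝ) + 1 ≤ q := by exact_mod_cast hq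
  have s1 : l ^ 12 ≤ Real.sqrt ((Q + 1 : ℕ) : ℝ) := by
    apply Real.le_sqrt_of_sq_le; push_cast; rw [← pow_mul, show 12 * 2 = 24 from rfl]; linarith
  have s2 : l ^ 12 ≤ Real.sqrt q := by
    apply Real.le_sqrt_of_sq_le; rw [← pow_mul, show 12 * 2 = 24 from rfl]; linarith
  have t1 : κ * X / Real.sqrt ((Q + 1 : ℕ) : ℝ) ≤ κ * (X / l ^ 12) := by rw [← mul_div_assoc]; gcongr
  have t2 : κ * X / Real.sqrt q ≤ κ * (X / l ^ 12) := by rw [← mul_div_assoc]; gcongr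
  have t3 : Real.sqrt (κ * X * q) ≤ κ * (X / l ^ 12) := by
    rw [Real.sqrt_le_left (by positivity)]
    calc κ * X * q ≤ κ * X * (X / l ^ 96) := by gcongr
      _ ≤ κ ^ 2 * X * (X / l ^ 24) := by
        have : κ ≤ κ ^ 2 := by nlinarith
        have : l ^ 24 ≤ l ^ 96 := pow_le_pow_right₀ (by linarith) (by norm_num)
        gcongr
      _ = _ := by field_simp
  have t4 : ((Q + 1 : ℕ) : ℝ) ^ 2 ≤ X / l ^ 12 := by
    rw [le_div_iff₀ (by positivity)]
    push_cast
    have h1 : (1:ℝ) ≤ l ^ 24 := one_le_pow₀ (by linarith)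
    calc ((Q:ℝ) + 1) ^ 2 * l ^ 12 ≤ (l ^ 24 + l ^ 24) ^ 2 * l ^ 12 := by gcongr
      _ = 4 * l ^ 60 := by ring
      _ ≤ 4 * l ^ 200 := by
        have : l ^ 60 ≤ l ^ 200 := pow_le_pow_right₀ (by linarith) (by norm_num)
        linarith
      _ ≤ X := hX
  calc _ ≤ 25 * (3 * l) ^ 4 * (κ * (X / l ^ 12) + κ * (X / l ^ 12) + κ * (X / l ^ 12) + X / l ^ 12) := by
        gcongr; linarith
    _ = 2025 * (3 * κ + 1) * (X / l ^ 8) := by field_simp; ring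

lemma major_num {κ X l C : ℝ} {Q N : ℕ} (hC : 0 < C) (hκ : 1 ≤ κ) (hl : 4 ≤ l) (hX : 4 * l ^ 200 ≤ X) (hQ : (Q:ℝ) ≤ l ^ 24) (hN : (N:ℝ) ≤ κ * X) :
    2 * (C * (κ * X) / (l / 2) ^ 150) * (1 + 7 * (l ^ 96 / X) * N) + (Q:ℝ) ^ 4 ≤ (16 * C * κ ^ 2 * 2 ^ 150 + 1) * (X / l ^ 8) := by
  have l0 : 0 < l := by linarith
  have l1 : 1 ≤ l := by linarith
  have X0 : 0 < X := lt_of_lt_of_le (by positivity) hX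
  have h1 : 1 + 7 * (l ^ 96 / X) * N ≤ 8 * κ * l ^ 96 := by
    have a1 : (1:ℝ) ≤ l ^ 96 := one_le_pow₀ l1
    have a2 : 7 * (l ^ 96 / X) * N ≤ 7 * (l ^ 96 / X) * (κ * X) := by gcongr
    have a3 : 7 * (l ^ 96 / X) * (κ * X) = 7 * κ * l ^ 96 := by field_simp
    nlinarith
  have h2 : (Q:ℝ) ^ 4 ≤ X / l ^ 8 := by
    rw [le_div_iff₀ (by positivity)]
    calc (Q:ℝ) ^ 4 * l ^ 8 ≤ (l ^ 24) ^ 4 * l ^ 8 := by gcongr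
      _ = l ^ 104 := by ring
      _ ≤ l ^ 200 := pow_le_pow_right₀ l1 (by norm_num)
      _ ≤ X := by linarith [pow_pos l0 200]
  have h3 : 2 * (C * (κ * X) / (l / 2) ^ 150) * (8 * κ * l ^ 96) = 16 * C * κ ^ 2 * 2 ^ 150 * (X / l ^ 54) := by
    rw [div_pow]; field_simp; ring
  have h4 : X / l ^ 54 ≤ X / l ^ 8 := by
    have : l ^ 8 ≤ l ^ 54 := pow_le_pow_right₀ l1 (by norm_num)
    gcongr
  calc _ ≤ 2 * (C * (κ * X) / (l / 2) ^ 150) * (8 * κ * l ^ 96) + X / l ^ 8 := by gcongr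
    _ = 16 * C * κ ^ 2 * 2 ^ 150 * (X / l ^ 54) + X / l ^ 8 := by rw [h3]
    _ ≤ 16 * C * κ ^ 2 * 2 ^ 150 * (X / l ^ 8) + X / l ^ 8 := by gcongr
    _ = _ := by ring

set_option maxHeartbeats 1000000 in
theorem sup_D (κ : ℝ) (hκ : 1 ≤ κ) : ∃ C : ℝ, 0 < C ∧ ∃ X₀ : ℝ, ∀ X, X₀ ≤ X → ∀ M N : ℕ, X / κ ≤ M → M ≤ N → (N:ℝ) ≤ κ * X → ∀ α : ℝ,
    ‖∑ n ∈ Ioc M N, ((vonMangoldt n : ℂ) - LQ ⌊Real.log X ^ 24⌋₊ n) * ee (n * α)‖ ≤ C * (X / Real.log X ^ 8) := by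
  obtain ⟨C, hC, HC⟩ := sw_ap 150 (by norm_num)
  obtain ⟨X₀, hX₀, HX⟩ := large_log (2 * Real.log κ)
  refine ⟨(16 * C * κ ^ 2 * 2 ^ 150 + 1) + (4050 * (3 * κ + 1) + 1), by positivity, max X₀ (4 * κ ^ 2), ?_⟩
  intro X hX M N hM hMN hN α
  obtain ⟨hlκ, hl4, hlX, hsX⟩ := HX X ((le_max_left _ _).trans hX)
  have hX1 : 1 ≤ X := hX₀.trans ((le_max_left _ _).trans hX)
  have hXκ : 4 * κ ^ 2 ≤ X := (le_max_right _ _).trans hX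
  set l := Real.log X with hl
  have l0 : 0 < l := by linarith
  have l1 : 1 ≤ l := by linarith
  have X0 : 0 < X := by linarith
  have hX4 : 4 * l ^ 200 ≤ X := hlX.trans hsX
  set Q := ⌊l ^ 24⌋₊ with hQdef
  have hQ : (Q:ℝ) ≤ l ^ 24 := Nat.floor_le (by positivity)
  have hQ' : l ^ 24 < Q + 1 := Nat.lt_floor_add_one _
  have hQ1 : 1 ≤ Q := Nat.le_floor (by push_cast; exact one_le_pow₀ l1)
  set R := ⌊X / l ^ 96⌋₊ with hRdef
  have hR : (R:ℝ) ≤ X / l ^ 96 := Nat.floor_le (by positivity)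
  have hR' : X / l ^ 96 < R + 1 := Nat.lt_floor_add_one _
  have hXl : 4 * l ^ 104 ≤ X / l ^ 96 := by
    rw [le_div_iff₀ (by positivity)]
    calc 4 * l ^ 104 * l ^ 96 = 4 * l ^ 200 := by ring
      _ ≤ X := hX4
  have hR1 : 1 ≤ R := by
    apply Nat.le_floor
    push_cast
    have : 1 ≤ l ^ 104 := one_le_pow₀ l1
    linarith
  have hXp : 0 ≤ X / l ^ 8 := by positivity
  rcases hMN.eq_or_lt with rfl | hMN
  · rw [Finset.Ioc_self, Finset.sum_empty, norm_zero]; positivity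
  obtain ⟨r, hr, hrR⟩ := Real.exists_rat_abs_sub_le_and_den_le α (n := R) (by omega)
  set q := r.den with hqd
  set a := r.num with had
  have hra : (r:ℝ) = a / q := by rw [Rat.cast_def]
  rw [hra] at hr
  have hq1 : 1 ≤ q := r.den_pos
  have q0 : (0:ℝ) < q := by exact_mod_cast hq1
  have hc : IsCoprime a (q:ℤ) := Int.isCoprime_iff_nat_coprime.2 (by simpa using r.reduced)
  have hqR : (q:ℝ) ≤ R := by exact_mod_cast hrR
  have hlogj : ∀ j : ℕ, M ≤ j → l / 2 ≤ Real.log j := by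
    intro j hj
    have h1 : X / κ ≤ j := hM.trans (by exact_mod_cast hj)
    have h2 := Real.log_le_log (by positivity) h1
    rw [Real.log_div (by positivity) (by positivity)] at h2
    linarith
  have hM2 : 2 ≤ M := by
    have : (2:ℝ) ≤ M := by
      refine le_trans ?_ hM
      rw [le_div_iff₀ (by positivity)]
      nlinarith
    exact_mod_cast this
  rcases le_or_gt q Q with hqQ | hqQ
  · -- major arcs
    have hqQr : (q:ℝ) ≤ Q := by exact_mod_cast hqQ
    have hb : |α - a / q| ≤ l ^ 96 / X := by
      refine hr.trans ?_
      rw [div_le_div_iff₀ (by positivity) X0, one_mul]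
      have h1 : X < (R + 1) * l ^ 96 := by rwa [div_lt_iff₀ (by positivity)] at hR'
      have hq1r : (1:ℝ) ≤ q := by exact_mod_cast hq1
      have h2 : (R + 1) * l ^ 96 * 1 ≤ (R + 1) * l ^ 96 * q := by gcongr
      nlinarith
    have hbQ : l ^ 96 / X ≤ 1 / (2 * (Q:ℝ) ^ 2) := by
      have Q0 : (0:ℝ) < Q := by exact_mod_cast hQ1
      rw [div_le_div_iff₀ X0 (by positivity), one_mul]
      calc l ^ 96 * (2 * (Q:ℝ) ^ 2) ≤ l ^ 96 * (2 * (l ^ 24) ^ 2) := by gcongr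
        _ = 2 * l ^ 144 := by ring
        _ ≤ 4 * l ^ 200 := by
          have : l ^ 144 ≤ l ^ 200 := pow_le_pow_right₀ l1 (by norm_num)
          have : 0 < l ^ 144 := by positivity
          linarith
        _ ≤ X := hX4
    have hE : ∀ j, M ≤ j → j ≤ N → ‖∑ n ∈ Icc 1 j, ((vonMangoldt n : ℂ) * (ee (a / q)) ^ n - (moebius q : ℂ) / (q.totient : ℂ))‖ ≤ C * (κ * X) / (l / 2) ^ 150 := by
      intro j hj hjN
      have hlj := hlogj j hj
      refine (HC q j (ee (a / q)) hq1 (ee_prim hq1 hc) (by omega) ?_).trans ?_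
      · calc (q:ℝ) ≤ l ^ 24 := hqQr.trans hQ
          _ ≤ ((l / 2) ^ 2) ^ 24 := by gcongr; nlinarith
          _ = (l / 2) ^ 48 := by ring
          _ ≤ (l / 2) ^ 150 := pow_le_pow_right₀ (by linarith) (by norm_num)
          _ ≤ _ := by gcongr
      · have : (j:ℝ) ≤ κ * X := le_trans (by exact_mod_cast hjN) hN
        gcongr
    refine (majorD hq1 hqQ hc hb hbQ M N hMN hE).trans ((major_num hC hκ hl4 hX4 hQ hN).trans ?_)
    have : 0 ≤ 4050 * (3 * κ + 1) + 1 := by positivity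
    exact mul_le_mul_of_nonneg_right (by linarith) hXp
  · -- minor arcs
    have hqX : (q:ℝ) ≤ X / l ^ 96 := hqR.trans hR
    have hAp : Appr α a q := ⟨hq1, hc, hr.trans (by
      rw [sq]; gcongr; linarith)⟩
    have hlX0 : 0 ≤ Real.log κ := Real.log_nonneg hκ
    have hlκX : Real.log (κ * X) = Real.log κ + l := Real.log_mul (by positivity) (by positivity)
    have hqκ : (q:ℝ) ≤ κ * X := by
      have : X / l ^ 96 ≤ X := div_le_self X0.le (one_le_pow₀ l1)
      nlinarith
    have vb : ∀ j : ℕ, j ≤ N → ‖∑ n ∈ Ioc 0 j, (vonMangoldt n : ℂ) * ee (n * α)‖ ≤ 2025 * (3 * κ + 1) * (X / l ^ 8) := by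
      intro j hj
      refine (vaughan hAp (κ * X) (by nlinarith) j (Q + 1) (by omega) (le_trans (by exact_mod_cast hj) hN) hqκ).trans ?_
      exact minor_num hκ hl4 hX4 (by linarith) (by linarith) hQ hQ' hqQ hqX
    have hG : ‖∑ n ∈ Ioc M N, LQ Q n * ee (n * α)‖ ≤ X / l ^ 8 := by
      refine (minorG hQ1 hqQ hc (hr.trans ?_) M N).trans ?_
      · have Q0 : (0:ℝ) < Q := by exact_mod_cast hQ1
        apply one_div_le_one_div_of_le (by positivity)
        have : 2 * (Q:ℝ) ≤ R + 1 := by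
          have : l ^ 24 ≤ l ^ 104 := pow_le_pow_right₀ l1 (by norm_num)
          have : 0 < l ^ 24 := by positivity
          linarith
        calc 2 * (q:ℝ) * Q = (2 * Q) * q := by ring
          _ ≤ (R + 1) * q := by gcongr
      · calc (Q:ℝ) ^ 3 * q ≤ (l ^ 24) ^ 3 * (X / l ^ 96) := by gcongr
          _ = X / l ^ 24 := by field_simp
          _ ≤ X / l ^ 8 := by
            have : l ^ 8 ≤ l ^ 24 := pow_le_pow_right₀ l1 (by norm_num)
            gcongr
    have e : ∑ n ∈ Ioc M N, ((vonMangoldt n : ℂ) - LQ Q n) * ee (n * α) =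
        ∑ n ∈ Ioc 0 N, (vonMangoldt n : ℂ) * ee (n * α) - ∑ n ∈ Ioc 0 M, (vonMangoldt n : ℂ) * ee (n * α) - ∑ n ∈ Ioc M N, LQ Q n * ee (n * α) := by
      simp only [sub_mul]
      rw [Finset.sum_sub_distrib, ← Finset.sum_Ioc_consecutive (fun n : ℕ => (vonMangoldt n : ℂ) * ee (n * α)) (Nat.zero_le M) hMN.le]
      ring
    rw [e]
    refine (norm_sub_le _ _).trans ((add_le_add_left (norm_sub_le _ _) _).trans ?_)
    have v1 := vb N le_rfl
    have v2 := vb M hMN.le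
    have : 0 ≤ (16 * C * κ ^ 2 * 2 ^ 150 + 1) * (X / l ^ 8) := by positivity
    have e2 : ((16 * C * κ ^ 2 * 2 ^ 150 + 1) + (4050 * (3 * κ + 1) + 1)) * (X / l ^ 8) = (16 * C * κ ^ 2 * 2 ^ 150 + 1) * (X / l ^ 8) + 2 * (2025 * (3 * κ + 1) * (X / l ^ 8)) + X / l ^ 8 := by ring
    rw [e2]
    linarith

end Cayley
end

section
open Complex Finset Filter Topology MeasureTheory ArithmeticFunction

namespace Cayley

/-! ### Discrete Fourier analysis -/

noncomputable def FT (J : Finset ℤ) (u : ℤ → ℂ) (α : ℝ) : ℂ := ∑ m ∈ J, u m * ee (m * α)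

lemma orth (T : ℕ) (hT : 0 < T) (k : ℤ) : ∑ t ∈ range T, ee (k * ((t:ℝ) / T)) = if (T:ℤ) ∣ k then (T:ℂ) else 0 := by
  have T0 : (0:ℝ) < T := by exact_mod_cast hT
  have e : ∀ t : ℕ, ee (k * ((t:ℝ) / T)) = ee (k / T) ^ t := by
    intro t; rw [← ee_natmul]; congr 1; ring
  simp only [e]
  split_ifs with h
  · obtain ⟨j, rfl⟩ := h
    have : ee (((T * j : ℤ) : ℝ) / T) = 1 := by
      rw [← ee_int j]; congr 1; push_cast; field_simp
    rw [this]; simp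
  · have hne : ee (k / T) ≠ 1 := by
      intro h1
      have h2 := ee_sub_one_ge (k / T : ℝ)
      rw [h1, sub_self, norm_zero] at h2
      have h3 := nn_nonneg (k / T : ℝ)
      have h4 : nn (k / T : ℝ) = 0 := by linarith
      rw [nn, abs_eq_zero, sub_eq_zero, div_eq_iff T0.ne'] at h4
      apply h
      refine ⟨round (k / T : ℝ), ?_⟩
      have : (k:ℝ) = ((T * round (k / T : ℝ) : ℤ) : ℝ) := by
        push_cast; linarith
      exact_mod_cast this
    rw [geom_sum_eq hne, ← ee_natmul]
    have : (T:ℝ) * (k / T) = (k:ℤ) := by field_simp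
    rw [this, ee_int, sub_self, zero_div]

lemma parseval (T : ℕ) (hT : 0 < T) (J : Finset ℤ) (hJ : ∀ m ∈ J, ∀ m' ∈ J, (T:ℤ) ∣ m - m' → m = m') (u : ℤ → ℂ) :
    ∑ t ∈ range T, ‖FT J u ((t:ℝ) / T)‖ ^ 2 = T * ∑ m ∈ J, ‖u m‖ ^ 2 := by
  have h : ∑ t ∈ range T, ((‖FT J u ((t:ℝ) / T)‖ ^ 2 : ℝ) : ℂ) = T * ∑ m ∈ J, ((‖u m‖ ^ 2 : ℝ) : ℂ) := by
    have e : ∀ t : ℕ, ((‖FT J u ((t:ℝ) / T)‖ ^ 2 : ℝ) : ℂ) =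
        ∑ m ∈ J, ∑ m' ∈ J, u m * (starRingEnd ℂ) (u m') * ee (((m - m' : ℤ) : ℝ) * ((t:ℝ) / T)) := by
      intro t
      push_cast
      rw [← Complex.mul_conj', FT, map_sum, Finset.sum_mul_sum]
      refine Finset.sum_congr rfl fun m _ => Finset.sum_congr rfl fun m' _ => ?_
      have : ee ((((m:ℝ) - m' )) * ((t:ℝ) / T)) = ee (m * ((t:ℝ) / T)) * (starRingEnd ℂ) (ee (m' * ((t:ℝ) / T))) := by
        rw [← ee_neg, ← ee_add]; congr 1; ring
      rw [this, map_mul]; ring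
    simp only [e]
    rw [Finset.sum_comm, Finset.mul_sum]
    refine Finset.sum_congr rfl fun m hm => ?_
    rw [Finset.sum_comm]
    have : ∀ m' ∈ J, ∑ t ∈ range T, u m * (starRingEnd ℂ) (u m') * ee (((m - m' : ℤ) : ℝ) * ((t:ℝ) / T)) = if m' = m then T * ((‖u m‖ ^ 2 : ℝ) : ℂ) else 0 := by
      intro m' hm'
      rw [← Finset.mul_sum, orth T hT]
      by_cases hmm : m' = m
      · subst hmm
        rw [sub_self, if_pos (dvd_zero _), if_pos rfl, Complex.mul_conj']; push_cast; ring
      · rw [if_neg hmm, if_neg, mul_zero]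
        intro hd; exact hmm (hJ m hm m' hm' hd).symm
    rw [Finset.sum_congr rfl this, Finset.sum_ite_eq' J m, if_pos hm]
  exact_mod_cast h

noncomputable def Sol (J : Fin 4 → Finset ℤ) : Finset (Fin 4 → ℤ) := (Fintype.piFinset J).filter (fun m => ∑ i, m i = 0)
noncomputable def Cnt (J : Fin 4 → Finset ℤ) (u : Fin 4 → ℤ → ℂ) : ℂ := ∑ m ∈ Sol J, ∏ i, u i (m i)

lemma cnt_fourier (T : ℕ) (J : Fin 4 → Finset ℤ) (hJ : ∀ i, ∀ m ∈ J i, 4 * |m| < T) (hT : 0 < T) (u : Fin 4 → ℤ → ℂ) :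
    ∑ t ∈ range T, ∏ i, FT (J i) (u i) ((t:ℝ) / T) = T * Cnt J u := by
  have e : ∀ t : ℕ, ∏ i, FT (J i) (u i) ((t:ℝ) / T) = ∑ m ∈ Fintype.piFinset J, (∏ i, u i (m i)) * ee (((∑ i, m i : ℤ) : ℝ) * ((t:ℝ) / T)) := by
    intro t
    simp only [FT]
    rw [Finset.prod_univ_sum]
    refine Finset.sum_congr rfl fun m _ => ?_
    rw [Finset.prod_mul_distrib]
    congr 1
    simp only [Fin.prod_univ_four, Fin.sum_univ_four]
    rw [← ee_add, ← ee_add, ← ee_add]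
    congr 1; push_cast; ring
  simp only [e]
  rw [Finset.sum_comm, Cnt, Sol, Finset.sum_filter, Finset.mul_sum]
  refine Finset.sum_congr rfl fun m hm => ?_
  rw [← Finset.mul_sum, orth T hT]
  have hd : (T:ℤ) ∣ ∑ i, m i ↔ ∑ i, m i = 0 := by
    constructor
    · intro h
      apply Int.eq_zero_of_abs_lt_dvd h
      rw [Fintype.mem_piFinset] at hm
      have h0 := hJ 0 _ (hm 0)
      have h1 := hJ 1 _ (hm 1)
      have h2 := hJ 2 _ (hm 2)
      have h3 := hJ 3 _ (hm 3)
      rw [Fin.sum_univ_four]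
      have a1 := abs_add_le (m 0 + m 1 + m 2) (m 3)
      have a2 := abs_add_le (m 0 + m 1) (m 2)
      have a3 := abs_add_le (m 0) (m 1)
      omega
    · intro h; rw [h]; exact dvd_zero _
  simp only [hd]
  split_ifs <;> ring

lemma four_prod (a : Fin 4 → ℝ) (ha : ∀ i, 0 ≤ a i) (i j : Fin 4) (hij : i ≠ j) : ∏ k, a k ≤ (a i * a j) * ∑ k, a k ^ 2 := by
  have key : ∀ x y z w : ℝ, 0 ≤ x → 0 ≤ y → 0 ≤ z → 0 ≤ w → z * w ≤ x ^ 2 + y ^ 2 + z ^ 2 + w ^ 2 := by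
    intro x y z w _ _ hz hw
    nlinarith [sq_nonneg (z - w), sq_nonneg x, sq_nonneg y, mul_nonneg hz hw]
  have h0 := ha 0
  have h1 := ha 1
  have h2 := ha 2
  have h3 := ha 3
  have gen : ∀ x y z w : ℝ, 0 ≤ x → 0 ≤ y → 0 ≤ z → 0 ≤ w → ∀ P S : ℝ, P = (x * y) * (z * w) → S = x ^ 2 + y ^ 2 + z ^ 2 + w ^ 2 → P ≤ (x * y) * S := by
    intro x y z w hx hy hz hw P S hP hS
    rw [hP, hS]
    exact mul_le_mul_of_nonneg_left (key x y z w hx hy hz hw) (mul_nonneg hx hy)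
  rw [Fin.prod_univ_four, Fin.sum_univ_four]
  fin_cases i <;> fin_cases j <;> first | exact absurd rfl hij | skip
  · exact gen (a 0) (a 1) (a 2) (a 3) h0 h1 h2 h3 _ _ (by ring) (by ring)
  · exact gen (a 0) (a 2) (a 1) (a 3) h0 h2 h1 h3 _ _ (by ring) (by ring)
  · exact gen (a 0) (a 3) (a 1) (a 2) h0 h3 h1 h2 _ _ (by ring) (by ring)
  · exact gen (a 1) (a 0) (a 2) (a 3) h1 h0 h2 h3 _ _ (by ring) (by ring)
  · exact gen (a 1) (a 2) (a 0) (a 3) h1 h2 h0 h3 _ _ (by ring) (by ring)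
  · exact gen (a 1) (a 3) (a 0) (a 2) h1 h3 h0 h2 _ _ (by ring) (by ring)
  · exact gen (a 2) (a 0) (a 1) (a 3) h2 h0 h1 h3 _ _ (by ring) (by ring)
  · exact gen (a 2) (a 1) (a 0) (a 3) h2 h1 h0 h3 _ _ (by ring) (by ring)
  · exact gen (a 2) (a 3) (a 0) (a 1) h2 h3 h0 h1 _ _ (by ring) (by ring)
  · exact gen (a 3) (a 0) (a 1) (a 2) h3 h0 h1 h2 _ _ (by ring) (by ring)
  · exact gen (a 3) (a 1) (a 0) (a 2) h3 h1 h0 h2 _ _ (by ring) (by ring)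
  · exact gen (a 3) (a 2) (a 0) (a 1) h3 h2 h0 h1 _ _ (by ring) (by ring)

lemma cnt_bound (J : Fin 4 → Finset ℤ) (u : Fin 4 → ℤ → ℂ) (S : ℝ)
    (h : ∀ α : ℝ, ∃ i j, i ≠ j ∧ ‖FT (J i) (u i) α‖ * ‖FT (J j) (u j) α‖ ≤ S) :
    ‖Cnt J u‖ ≤ S * ∑ i, ∑ m ∈ J i, ‖u i m‖ ^ 2 := by
  obtain ⟨T, hT, hJ⟩ : ∃ T : ℕ, 0 < T ∧ ∀ i, ∀ m ∈ J i, 4 * |m| < T := by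
    refine ⟨1 + 4 * ∑ i, ∑ m ∈ J i, m.natAbs, by omega, fun i m hm => ?_⟩
    have h1 : m.natAbs ≤ ∑ m ∈ J i, m.natAbs := Finset.single_le_sum (f := fun m : ℤ => m.natAbs) (fun _ _ => Nat.zero_le _) hm
    have h2 : ∑ m ∈ J i, m.natAbs ≤ ∑ i, ∑ m ∈ J i, m.natAbs := Finset.single_le_sum (f := fun i => ∑ m ∈ J i, m.natAbs) (fun _ _ => Nat.zero_le _) (mem_univ i)
    have h3 : m.natAbs ≤ ∑ i, ∑ m ∈ J i, m.natAbs := h1.trans h2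
    rw [Int.abs_eq_natAbs]
    have h4 : 4 * m.natAbs < 1 + 4 * ∑ i, ∑ m ∈ J i, m.natAbs := by omega
    exact_mod_cast h4
  have T0 : (0:ℝ) < T := by exact_mod_cast hT
  have hc := cnt_fourier T J hJ hT u
  have h1 : (T:ℝ) * ‖Cnt J u‖ ≤ T * (S * ∑ i, ∑ m ∈ J i, ‖u i m‖ ^ 2) := by
    have : (T:ℝ) * ‖Cnt J u‖ = ‖(T:ℂ) * Cnt J u‖ := by rw [norm_mul, Complex.norm_natCast]
    rw [this, ← hc]
    calc _ ≤ ∑ t ∈ range T, ‖∏ i, FT (J i) (u i) ((t:ℝ) / T)‖ := norm_sum_le _ _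
      _ ≤ ∑ t ∈ range T, S * ∑ k, ‖FT (J k) (u k) ((t:ℝ) / T)‖ ^ 2 := by
        refine Finset.sum_le_sum fun t _ => ?_
        obtain ⟨i, j, hij, hS⟩ := h ((t:ℝ) / T)
        rw [norm_prod]
        refine (four_prod _ (fun i => norm_nonneg _) i j hij).trans ?_
        gcongr
      _ = S * ∑ k, ∑ t ∈ range T, ‖FT (J k) (u k) ((t:ℝ) / T)‖ ^ 2 := by rw [← Finset.mul_sum, Finset.sum_comm]
      _ = S * ∑ k, T * ∑ m ∈ J k, ‖u k m‖ ^ 2 := by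
        congr 1
        refine Finset.sum_congr rfl fun k _ => parseval T hT (J k) ?_ (u k)
        intro m hm m' hm' hd
        have b1 := hJ k m hm
        have b2 := hJ k m' hm'
        have : m - m' = 0 := by
          apply Int.eq_zero_of_abs_lt_dvd hd
          have := abs_sub m m'
          omega
        linarith
      _ = _ := by rw [← Finset.mul_sum]; ring
  exact le_of_mul_le_mul_left h1 T0

/-- comparison of counts -/
lemma cnt_compare (J : Fin 4 → Finset ℤ) (f g : ℤ → ℂ) (D S W : ℝ) (hD0 : 0 ≤ D)
    (hD : ∀ i α, ‖FT (J i) (fun m => f m - g m) α‖ ≤ D) (hf : ∀ i α, ‖FT (J i) f α‖ ≤ S) (hg : ∀ i α, ‖FT (J i) g α‖ ≤ S)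
    (hf2 : ∀ i, ∑ m ∈ J i, ‖f m‖ ^ 2 ≤ W) (hg2 : ∀ i, ∑ m ∈ J i, ‖g m‖ ^ 2 ≤ W) :
    ‖Cnt J (fun _ => f) - Cnt J (fun _ => g)‖ ≤ 64 * D * S * W := by
  set d : ℤ → ℂ := fun m => f m - g m with hd
  have S0 : 0 ≤ S := (norm_nonneg _).trans (hf 0 0)
  have hW0 : 0 ≤ W := le_trans (Finset.sum_nonneg fun _ _ => by positivity) (hf2 0)
  have hd2 : ∀ i, ∑ m ∈ J i, ‖d m‖ ^ 2 ≤ 4 * W := by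
    intro i
    have : ∀ m ∈ J i, ‖d m‖ ^ 2 ≤ 2 * ‖f m‖ ^ 2 + 2 * ‖g m‖ ^ 2 := by
      intro m _
      have := norm_sub_le (f m) (g m)
      have h0 := norm_nonneg (f m - g m)
      have : ‖d m‖ ^ 2 ≤ (‖f m‖ + ‖g m‖) ^ 2 := by simp only [hd]; gcongr
      nlinarith [sq_nonneg (‖f m‖ - ‖g m‖)]
    refine (Finset.sum_le_sum this).trans ?_
    rw [Finset.sum_add_distrib, ← Finset.mul_sum, ← Finset.mul_sum]
    linarith [hf2 i, hg2 i]
  have gen : ∀ (u : Fin 4 → ℤ → ℂ) (i j : Fin 4), i ≠ j → u i = d → (u j = f ∨ u j = g) → (∀ k, u k = d ∨ u k = f ∨ u k = g) →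
      ‖Cnt J u‖ ≤ 16 * D * S * W := by
    intro u i j hij hi hj hk
    have h1 := cnt_bound J u (D * S) (fun α => ⟨i, j, hij, mul_le_mul (by rw [hi]; exact hD i α) (by
      rcases hj with h | h <;> rw [h]; exacts [hf j α, hg j α]) (norm_nonneg _) hD0⟩)
    have h2 : ∑ i, ∑ m ∈ J i, ‖u i m‖ ^ 2 ≤ 16 * W := by
      have : ∀ k ∈ (univ : Finset (Fin 4)), ∑ m ∈ J k, ‖u k m‖ ^ 2 ≤ 4 * W := by
        intro k _
        rcases hk k with h | h | h <;> rw [h]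
        · exact hd2 k
        · linarith [hf2 k]
        · linarith [hg2 k]
      refine (Finset.sum_le_sum this).trans (le_of_eq ?_)
      simp; ring
    calc _ ≤ _ := h1
      _ ≤ D * S * (16 * W) := by gcongr
      _ = _ := by ring
  have e : Cnt J (fun _ => f) - Cnt J (fun _ => g) = Cnt J ![d, f, f, f] + Cnt J ![g, d, f, f] + Cnt J ![g, g, d, f] + Cnt J ![g, g, g, d] := by
    simp only [Cnt]
    rw [← Finset.sum_sub_distrib, ← Finset.sum_add_distrib, ← Finset.sum_add_distrib, ← Finset.sum_add_distrib]
    refine Finset.sum_congr rfl fun m _ => ?_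
    simp only [Fin.prod_univ_four, Matrix.cons_val, hd]
    ring
  rw [e]
  have g1 := gen ![d, f, f, f] 0 1 (by decide) rfl (Or.inl rfl) (by intro k; fin_cases k <;> simp)
  have g2 := gen ![g, d, f, f] 1 2 (by decide) rfl (Or.inl rfl) (by intro k; fin_cases k <;> simp)
  have g3 := gen ![g, g, d, f] 2 3 (by decide) rfl (Or.inl rfl) (by intro k; fin_cases k <;> simp)
  have g4 := gen ![g, g, g, d] 3 0 (by decide) rfl (Or.inr rfl) (by intro k; fin_cases k <;> simp)
  refine (norm_add_le _ _).trans ?_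
  have n3 := norm_add₃_le (a := Cnt J ![d, f, f, f]) (b := Cnt J ![g, d, f, f]) (c := Cnt J ![g, g, d, f])
  linarith

end Cayley
end

section
open Complex Finset Filter Topology MeasureTheory ArithmeticFunction

namespace Cayley

/-! ### The model count -/

noncomputable def JJ (b : ℤ) (K : ℕ) : Finset ℤ := Finset.Icc (b - K) (b + K)

lemma card_JJ (b : ℤ) (K : ℕ) : (JJ b K).card = 2 * K + 1 := by
  unfold JJ; rw [Int.card_Icc]; omega

lemma sum_JJ (b : ℤ) (K : ℕ) (f : ℤ → ℂ) : ∑ m ∈ JJ b K, f m = ∑ n ∈ Ioc 0 (2 * K + 1), f ((n:ℤ) + (b - K - 1)) := by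
  unfold JJ
  refine Finset.sum_nbij' (fun m => (m - (b - K - 1)).toNat) (fun n => (n:ℤ) + (b - K - 1)) ?_ ?_ ?_ ?_ ?_
  · intro m hm; simp only [mem_Icc, mem_Ioc] at *; omega
  · intro m hm; simp only [mem_Icc, mem_Ioc] at *; omega
  · intro m hm; simp only [mem_Icc, mem_Ioc] at *; omega
  · intro m hm; simp only [mem_Icc, mem_Ioc] at *; omega
  · intro m hm
    simp only [mem_Icc] at hm
    congr 1; omega

lemma geom_JJ_triv (b : ℤ) (K : ℕ) (θ : ℝ) : ‖∑ m ∈ JJ b K, ee (m * θ)‖ ≤ 2 * K + 1 := by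
  refine (norm_sum_le _ _).trans ?_
  simp_rw [ee_norm]
  rw [Finset.sum_const, card_JJ]; simp

lemma geom_JJ (b : ℤ) (K : ℕ) (θ δ : ℝ) (hδ : 0 < δ) (h : ∀ z : ℤ, δ ≤ |θ - z|) : ‖∑ m ∈ JJ b K, ee (m * θ)‖ ≤ 1 / (2 * δ) := by
  rw [sum_JJ]
  have : ∀ n : ℕ, ee ((((n:ℤ) + (b - K - 1) : ℤ) : ℝ) * θ) = ee (((b - K - 1 : ℤ) : ℝ) * θ) * ee (n * θ) := by
    intro n; rw [← ee_add]; congr 1; push_cast; ring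
  simp only [this]
  rw [← Finset.mul_sum, norm_mul, ee_norm, one_mul]
  exact geom_small θ δ hδ h _ _

lemma nonconst_bound (Q K : ℕ) (hQ : 1 ≤ Q) (b : Fin 4 → ℤ) (pp : Fin 4 → ℕ × ℕ) (hpp : ∀ i, pp i ∈ Th Q) (i j : Fin 4) (hij : pp i ≠ pp j) :
    ‖Cnt (fun i => JJ (b i) K) (fun i m => ee (-(m * th (pp i))))‖ ≤ 4 * (Q:ℝ) ^ 2 * (2 * K + 1) ^ 2 := by
  have Q0 : (0:ℝ) < Q := by exact_mod_cast hQ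
  have hne : i ≠ j := fun h => hij (by rw [h])
  have eFT : ∀ k α, FT (JJ (b k) K) (fun m => ee (-(m * th (pp k)))) α = ∑ m ∈ JJ (b k) K, ee (m * (α - th (pp k))) := by
    intro k α
    unfold FT
    refine Finset.sum_congr rfl fun m _ => ?_
    rw [← ee_add]; congr 1; ring
  have small : ∀ k α, (∀ z : ℤ, 1 / (2 * (Q:ℝ) ^ 2) ≤ |α - th (pp k) - z|) → ‖FT (JJ (b k) K) (fun m => ee (-(m * th (pp k)))) α‖ ≤ (Q:ℝ) ^ 2 := by
    intro k α h
    rw [eFT]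
    refine (geom_JJ _ _ _ _ (by positivity) h).trans (le_of_eq ?_)
    field_simp
  have triv : ∀ k α, ‖FT (JJ (b k) K) (fun m => ee (-(m * th (pp k)))) α‖ ≤ 2 * K + 1 := by
    intro k α; rw [eFT]; exact geom_JJ_triv _ _ _
  have h := cnt_bound (fun i => JJ (b i) K) (fun i m => ee (-(m * th (pp i)))) ((Q:ℝ) ^ 2 * (2 * K + 1)) (by
    intro α
    refine ⟨i, j, hne, ?_⟩
    by_cases h1 : ∀ z : ℤ, 1 / (2 * (Q:ℝ) ^ 2) ≤ |α - th (pp i) - z|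
    · exact mul_le_mul (small i α h1) (triv j α) (norm_nonneg _) (by positivity)
    · have h2 : ∀ z : ℤ, 1 / (2 * (Q:ℝ) ^ 2) ≤ |α - th (pp j) - z| := by
        by_contra h2
        push Not at h1 h2
        obtain ⟨z, hz⟩ := h1
        obtain ⟨w, hw⟩ := h2
        have hs := th_sep (hpp i) (hpp j) hij (w - z)
        have e : th (pp i) - th (pp j) - ((w - z : ℤ) : ℝ) = (α - th (pp j) - w) - (α - th (pp i) - z) := by push_cast; ring
        rw [e] at hs
        have h3 := abs_sub (α - th (pp j) - w) (α - th (pp i) - z)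
        have h4 : 1 / (2 * (Q:ℝ) ^ 2) + 1 / (2 * (Q:ℝ) ^ 2) = 1 / (Q:ℝ) ^ 2 := by field_simp; norm_num
        linarith
      rw [mul_comm ((Q:ℝ) ^ 2)]
      exact mul_le_mul (triv i α) (small j α h2) (norm_nonneg _) (by positivity))
  refine h.trans (le_of_eq ?_)
  simp only [ee_norm, one_pow, Finset.sum_const, card_JJ, Finset.card_univ, Fintype.card_fin]
  simp
  ring

lemma model_count (Q K : ℕ) (hQ : 1 ≤ Q) (b : Fin 4 → ℤ) :
    ((Sol (fun i => JJ (b i) K)).card : ℝ) - 4 * (Q:ℝ) ^ 10 * (2 * K + 1) ^ 2 ≤ (Cnt (fun i => JJ (b i) K) (fun _ => LQ Q)).re := by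
  set J := fun i => JJ (b i) K with hJ
  have Q0 : (0:ℝ) < Q := by exact_mod_cast hQ
  have e : Cnt J (fun _ => LQ Q) = ∑ pp ∈ Fintype.piFinset (fun _ : Fin 4 => Th Q), ((∏ i, wt (pp i) : ℝ) : ℂ) * Cnt J (fun i m => ee (-(m * th (pp i)))) := by
    simp only [Cnt, Finset.mul_sum]
    rw [Finset.sum_comm]
    refine Finset.sum_congr rfl fun m _ => ?_
    simp only [LQ]
    rw [Finset.prod_univ_sum]
    refine Finset.sum_congr rfl fun pp _ => ?_
    rw [Finset.prod_mul_distrib]; push_cast; rfl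
  have const : ∀ p : ℕ × ℕ, Cnt J (fun i m => ee (-(m * th p))) = ((Sol J).card : ℝ) := by
    intro p
    unfold Cnt
    have : ∀ m ∈ Sol J, ∏ i, ee (-((m i : ℝ) * th p)) = 1 := by
      intro m hm
      have hs : ∑ i, m i = 0 := (Finset.mem_filter.1 hm).2
      rw [Fin.sum_univ_four] at hs
      have hs' : (m 0 : ℝ) + m 1 + m 2 + m 3 = 0 := by exact_mod_cast hs
      rw [Fin.prod_univ_four, ← ee_add, ← ee_add, ← ee_add, ← ee_zero]
      congr 1
      linear_combination (-th p) * hs'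
    rw [Finset.sum_congr rfl this]; simp
  set E : ℝ := 4 * (Q:ℝ) ^ 2 * (2 * K + 1) ^ 2 with hE
  have E0 : 0 ≤ E := by positivity
  set p0 : Fin 4 → ℕ × ℕ := fun _ => (1, 0) with hp0
  have hmem : p0 ∈ Fintype.piFinset (fun _ : Fin 4 => Th Q) := by
    rw [Fintype.mem_piFinset]; intro i
    rw [mem_Th]; simp only [hp0]; exact ⟨le_rfl, hQ, Nat.zero_lt_one, Nat.coprime_one_left _⟩
  have term : ∀ pp ∈ (Fintype.piFinset (fun _ : Fin 4 => Th Q)).erase p0, -E ≤ (((∏ i, wt (pp i) : ℝ) : ℂ) * Cnt J (fun i m => ee (-(m * th (pp i))))).re := by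
    intro pp hpp
    have hpp' := Fintype.mem_piFinset.1 (Finset.mem_of_mem_erase hpp)
    by_cases hc : ∀ i, pp i = pp 0
    · have e2 : pp = fun _ => pp 0 := funext hc
      rw [e2]
      simp only
      rw [const, Complex.re_ofReal_mul, Complex.ofReal_re, Finset.prod_const]
      have : (0:ℝ) ≤ wt (pp 0) ^ (univ : Finset (Fin 4)).card := by
        rw [Finset.card_univ, Fintype.card_fin]; exact Even.pow_nonneg (by decide) _
      have : 0 ≤ wt (pp 0) ^ (univ : Finset (Fin 4)).card * ((Sol J).card : ℝ) := mul_nonneg this (Nat.cast_nonneg _)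
      linarith
    · push Not at hc
      obtain ⟨i, hi⟩ := hc
      have h1 := nonconst_bound Q K hQ b pp hpp' i 0 hi
      have h2 : ‖((∏ i, wt (pp i) : ℝ) : ℂ) * Cnt J (fun i m => ee (-(m * th (pp i))))‖ ≤ 1 * E := by
        rw [norm_mul]
        refine mul_le_mul ?_ h1 (norm_nonneg _) zero_le_one
        rw [Complex.norm_real, Real.norm_eq_abs, Finset.abs_prod]
        exact Finset.prod_le_one (fun _ _ => abs_nonneg _) (fun _ _ => wt_abs _)
      have h3 := (abs_le.1 (Complex.abs_re_le_norm (((∏ i, wt (pp i) : ℝ) : ℂ) * Cnt J (fun i m => ee (-(m * th (pp i))))))).1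
      linarith
  rw [e, Complex.re_sum, ← Finset.add_sum_erase _ _ hmem]
  have h1 : (((∏ i, wt (p0 i) : ℝ) : ℂ) * Cnt J (fun i m => ee (-(m * th (p0 i))))).re = (Sol J).card := by
    simp only [hp0]
    rw [const]
    simp [wt]
  rw [h1]
  have h2 := Finset.sum_le_sum term
  rw [Finset.sum_const, nsmul_eq_mul] at h2
  have hcard : (((Fintype.piFinset (fun _ : Fin 4 => Th Q)).erase p0).card : ℝ) ≤ (Q:ℝ) ^ 8 := by
    calc (((Fintype.piFinset (fun _ : Fin 4 => Th Q)).erase p0).card : ℝ) ≤ ((Fintype.piFinset (fun _ : Fin 4 => Th Q)).card : ℝ) := by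
          exact_mod_cast Finset.card_erase_le
      _ = ((Th Q).card : ℝ) ^ 4 := by rw [Fintype.card_piFinset]; simp
      _ ≤ ((Q:ℝ) ^ 2) ^ 4 := by gcongr; exact card_Th Q
      _ = _ := by ring
  have h3 : (((Fintype.piFinset (fun _ : Fin 4 => Th Q)).erase p0).card : ℝ) * E ≤ (Q:ℝ) ^ 8 * E := by gcongr
  have h4 : (Q:ℝ) ^ 8 * E = 4 * (Q:ℝ) ^ 10 * (2 * K + 1) ^ 2 := by rw [hE]; ring
  linarith

lemma card_Sol (b : Fin 4 → ℤ) (K k : ℕ) (hb1 : -3 ≤ ∑ i, b i) (hb2 : ∑ i, b i ≤ 0) (hk : 3 * k + 3 ≤ K) :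
    (k + 1) ^ 3 ≤ (Sol (fun i => JJ (b i) K)).card := by
  have e : (k + 1) ^ 3 = ((range (k + 1)) ×ˢ ((range (k + 1)) ×ˢ (range (k + 1)))).card := by
    rw [Finset.card_product, Finset.card_product, Finset.card_range]; ring
  rw [Fin.sum_univ_four] at hb1 hb2
  rw [e]
  refine Finset.card_le_card_of_injOn (fun h => ![b 0 + h.1, b 1 + h.2.1, b 2 + h.2.2, -(b 0 + b 1 + b 2 + h.1 + h.2.1 + h.2.2)]) ?_ ?_
  · rintro ⟨x, y, z⟩ hxyz
    simp only [Finset.coe_product, Set.mem_prod, Finset.mem_coe, mem_range] at hxyz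
    simp only [Finset.mem_coe, Sol, mem_filter, Fintype.mem_piFinset, JJ, mem_Icc, Fin.sum_univ_four, Matrix.cons_val]
    refine ⟨?_, by ring⟩
    intro i
    fin_cases i <;> simp <;> omega
  · rintro ⟨x, y, z⟩ _ ⟨x', y', z'⟩ _ h
    have h0 := congrFun h 0
    have h1 := congrFun h 1
    have h2 := congrFun h 2
    simp at h0 h1 h2
    simp [h0, h1, h2]

lemma sum_wt_sq (Q : ℕ) (hQ : 1 ≤ Q) : ∑ p ∈ Th Q, wt p ^ 2 ≤ (1 + 2 * Real.log Q) * (1 + Real.log Q) := by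
  have Q1 : (1:ℝ) ≤ Q := by exact_mod_cast hQ
  have hfib : ∑ p ∈ Th Q, wt p ^ 2 = ∑ q ∈ Icc 1 Q, ∑ p ∈ (Th Q).filter (fun p => p.1 = q), wt p ^ 2 := by
    rw [Finset.sum_fiberwise_of_maps_to]
    intro p hp; rw [mem_Th] at hp; exact mem_Icc.2 ⟨hp.1, hp.2.1⟩
  rw [hfib]
  have : ∀ q ∈ Icc 1 Q, ∑ p ∈ (Th Q).filter (fun p => p.1 = q), wt p ^ 2 ≤ (1 + 2 * Real.log Q) * (1 / q) := by
    intro q hq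
    rw [mem_Icc] at hq
    have q0 : (0:ℝ) < q := by exact_mod_cast hq.1
    have φ0 : (0:ℝ) < q.totient := by exact_mod_cast Nat.totient_pos.2 hq.1
    have h1 : ∀ p ∈ (Th Q).filter (fun p => p.1 = q), wt p ^ 2 ≤ 1 / (q.totient : ℝ) ^ 2 := by
      intro p hp
      rw [wt, (mem_filter.1 hp).2, div_pow]
      gcongr
      have : |((moebius q : ℤ) : ℝ)| ≤ 1 := by exact_mod_cast abs_moebius_le_one
      rw [← sq_abs]; exact pow_le_one₀ (abs_nonneg _) this
    have hcard : ((Th Q).filter (fun p => p.1 = q)).card ≤ q.totient := by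
      rw [Nat.totient_eq_card_coprime]
      refine Finset.card_le_card_of_injOn (fun p => p.2) ?_ ?_
      · intro p hp
        simp only [Finset.mem_coe, mem_filter, mem_Th, mem_range] at hp ⊢
        obtain ⟨⟨_, _, h3, h4⟩, h5⟩ := hp
        rw [h5] at h3 h4; exact ⟨h3, h4⟩
      · intro p hp p' hp' h
        simp only [Finset.mem_coe, mem_filter] at hp hp'
        exact Prod.ext (hp.2.trans hp'.2.symm) h
    have hcard' : (((Th Q).filter (fun p => p.1 = q)).card : ℝ) ≤ q.totient := by exact_mod_cast hcard
    have hφ : (q:ℝ) ≤ q.totient * (1 + 2 * Real.log Q) := by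
      have h2 := prod_one_sub_inv q.primeFactors (fun p hp => (Nat.prime_of_mem_primeFactors hp).two_le)
      have h3 := two_pow_card_primeFactors (q := q) (by omega)
      have h4 : (q.totient : ℝ) = q * ∏ p ∈ q.primeFactors, (1 - 1 / (p:ℝ)) := by
        have := Nat.totient_eq_mul_prod_factors q
        have := congrArg (fun x : ℚ => (x:ℝ)) this
        push_cast at this
        simpa using this
      have h5 : (q.primeFactors.card : ℝ) ≤ 2 * Real.log Q := by
        have a : ((2:ℝ)) ^ q.primeFactors.card ≤ Q := by
          exact_mod_cast h3.trans hq.2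
        have b := Real.log_le_log (by positivity) a
        rw [Real.log_pow] at b
        have c := Real.log_two_gt_d9
        nlinarith [(Nat.cast_nonneg q.primeFactors.card : (0:ℝ) ≤ _)]
      have h6 : (0:ℝ) < (q.primeFactors.card : ℝ) + 1 := by positivity
      rw [h4]
      rw [div_le_iff₀ h6] at h2
      have h7 : 1 ≤ (∏ p ∈ q.primeFactors, (1 - 1 / (p:ℝ))) * (1 + 2 * Real.log Q) := by
        refine h2.trans ?_
        have : 0 ≤ ∏ p ∈ q.primeFactors, (1 - 1 / (p:ℝ)) := by
          by_contra hneg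
          push Not at hneg
          nlinarith
        exact mul_le_mul_of_nonneg_left (by linarith) this
      nlinarith
    calc _ ≤ ∑ p ∈ (Th Q).filter (fun p => p.1 = q), 1 / (q.totient : ℝ) ^ 2 := Finset.sum_le_sum h1
      _ = (((Th Q).filter (fun p => p.1 = q)).card : ℝ) * (1 / (q.totient : ℝ) ^ 2) := by rw [Finset.sum_const, nsmul_eq_mul]
      _ ≤ q.totient * (1 / (q.totient : ℝ) ^ 2) := by gcongr
      _ = 1 / (q.totient : ℝ) := by field_simp
      _ ≤ _ := by
        rw [mul_one_div, div_le_div_iff₀ φ0 q0]; linarith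
  refine (Finset.sum_le_sum this).trans ?_
  rw [← Finset.mul_sum]
  have h0 := Real.log_nonneg Q1
  gcongr
  exact harm Q Q Q1 le_rfl

lemma l2_LQ (Q K : ℕ) (hQ : 1 ≤ Q) (b : ℤ) : ∑ m ∈ JJ b K, ‖LQ Q m‖ ^ 2 ≤ (2 * K + 1) * ((1 + 2 * Real.log Q) * (1 + Real.log Q)) + (Q:ℝ) ^ 6 := by
  have Q0 : (0:ℝ) < Q := by exact_mod_cast hQ
  have e : ((∑ m ∈ JJ b K, ‖LQ Q m‖ ^ 2 : ℝ) : ℂ) = ∑ p ∈ Th Q, ∑ p' ∈ Th Q, ((wt p * wt p' : ℝ) : ℂ) * ∑ m ∈ JJ b K, ee (m * (th p' - th p)) := by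
    push_cast
    have : ∀ m : ℤ, ((‖LQ Q m‖ : ℂ)) ^ 2 = ∑ p ∈ Th Q, ∑ p' ∈ Th Q, ((wt p * wt p' : ℝ) : ℂ) * ee (m * (th p' - th p)) := by
      intro m
      rw [← Complex.mul_conj', LQ, map_sum, Finset.sum_mul_sum]
      refine Finset.sum_congr rfl fun p _ => Finset.sum_congr rfl fun p' _ => ?_
      rw [map_mul, ← ee_neg, Complex.conj_ofReal]
      have : ee ((m:ℝ) * (th p' - th p)) = ee (-(m * th p)) * ee (- -(m * th p')) := by
        rw [← ee_add]; congr 1; ring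
      rw [this]; push_cast; ring
    simp only [this]
    rw [Finset.sum_comm]
    refine Finset.sum_congr rfl fun p _ => ?_
    rw [Finset.sum_comm]
    refine Finset.sum_congr rfl fun p' _ => ?_
    rw [Finset.mul_sum]; push_cast; rfl
  have h1 : ∑ m ∈ JJ b K, ‖LQ Q m‖ ^ 2 = ‖((∑ m ∈ JJ b K, ‖LQ Q m‖ ^ 2 : ℝ) : ℂ)‖ := by
    rw [Complex.norm_real, Real.norm_of_nonneg]
    exact Finset.sum_nonneg fun _ _ => by positivity
  rw [h1, e]
  have inner : ∀ p ∈ Th Q, ‖∑ p' ∈ Th Q, ((wt p * wt p' : ℝ) : ℂ) * ∑ m ∈ JJ b K, ee (m * (th p' - th p))‖ ≤ wt p ^ 2 * (2 * K + 1) + (Q:ℝ) ^ 4 := by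
    intro p hp
    rw [← Finset.add_sum_erase _ _ hp]
    refine (norm_add_le _ _).trans (add_le_add ?_ ?_)
    · rw [norm_mul, Complex.norm_real, Real.norm_eq_abs, ← sq, abs_of_nonneg (sq_nonneg _)]
      gcongr
      exact geom_JJ_triv _ _ _
    · refine (norm_sum_le _ _).trans ?_
      have : ∀ p' ∈ (Th Q).erase p, ‖((wt p * wt p' : ℝ) : ℂ) * ∑ m ∈ JJ b K, ee (m * (th p' - th p))‖ ≤ (Q:ℝ) ^ 2 := by
        intro p' hp'
        have a1 : ‖∑ m ∈ JJ b K, ee (m * (th p' - th p))‖ ≤ 1 / (2 * (1 / (Q:ℝ) ^ 2)) := by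
          refine geom_JJ b K _ _ (by positivity) (fun z => ?_)
          exact th_sep (Finset.mem_of_mem_erase hp') hp (Finset.ne_of_mem_erase hp') z
        have a2 : 1 / (2 * (1 / (Q:ℝ) ^ 2)) ≤ (Q:ℝ) ^ 2 := by
          have : 1 / (2 * (1 / (Q:ℝ) ^ 2)) = (Q:ℝ) ^ 2 / 2 := by field_simp
          rw [this]; linarith [sq_nonneg (Q:ℝ)]
        have a3 : ‖((wt p * wt p' : ℝ) : ℂ)‖ ≤ 1 := by
          rw [Complex.norm_real, Real.norm_eq_abs, abs_mul]
          exact mul_le_one₀ (wt_abs _) (abs_nonneg _) (wt_abs _)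
        rw [norm_mul]
        calc _ ≤ 1 * (Q:ℝ) ^ 2 := mul_le_mul a3 (a1.trans a2) (norm_nonneg _) zero_le_one
          _ = _ := one_mul _
      refine (Finset.sum_le_sum this).trans ?_
      rw [Finset.sum_const, nsmul_eq_mul]
      have c : (((Th Q).erase p).card : ℝ) ≤ (Q:ℝ) ^ 2 := le_trans (by exact_mod_cast Finset.card_erase_le) (card_Th Q)
      calc _ ≤ (Q:ℝ) ^ 2 * (Q:ℝ) ^ 2 := by gcongr
        _ = _ := by ring
  refine (norm_sum_le _ _).trans ((Finset.sum_le_sum inner).trans ?_)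
  rw [Finset.sum_add_distrib, ← Finset.sum_mul, Finset.sum_const, nsmul_eq_mul]
  have c := card_Th Q
  have s := sum_wt_sq Q hQ
  have : ((Th Q).card : ℝ) * (Q:ℝ) ^ 4 ≤ (Q:ℝ) ^ 2 * (Q:ℝ) ^ 4 := by gcongr
  have s2 : (∑ p ∈ Th Q, wt p ^ 2) * (2 * (K:ℝ) + 1) ≤ ((1 + 2 * Real.log Q) * (1 + Real.log Q)) * (2 * K + 1) := by gcongr
  nlinarith

end Cayley
end

section
open Complex Finset Filter Topology MeasureTheory ArithmeticFunction

namespace Cayley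

/-! ### The weighted count of prime solutions -/

noncomputable def WL (m : ℤ) : ℝ := vonMangoldt m.natAbs
noncomputable def KK (X : ℝ) : ℕ := ⌊X / Real.log X⌋₊
noncomputable def QQ (X : ℝ) : ℕ := ⌊Real.log X ^ 24⌋₊

lemma FT_neg (b : ℤ) (K Q : ℕ) (α : ℝ) : ‖FT (JJ b K) (fun m => (WL m : ℂ) - LQ Q m) α‖ = ‖FT (JJ (-b) K) (fun m => (WL m : ℂ) - LQ Q m) α‖ := by
  have e : FT (JJ b K) (fun m => (WL m : ℂ) - LQ Q m) α = (starRingEnd ℂ) (FT (JJ (-b) K) (fun m => (WL m : ℂ) - LQ Q m) α) := by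
    unfold FT
    rw [map_sum]
    refine Finset.sum_nbij' (fun m => -m) (fun m => -m) ?_ ?_ ?_ ?_ ?_
    · intro m hm; simp only [JJ, mem_Icc] at *; omega
    · intro m hm; simp only [JJ, mem_Icc] at *; omega
    · intro m _; ring
    · intro m _; ring
    · intro m _
      have h1 : (starRingEnd ℂ) (LQ Q (-m)) = LQ Q m := by
        unfold LQ
        rw [map_sum]
        refine Finset.sum_congr rfl fun p _ => ?_
        rw [map_mul, ← ee_neg, Complex.conj_ofReal]
        congr 2; push_cast; ring
      have hW : WL (-m) = WL m := by unfold WL; rw [Int.natAbs_neg]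
      rw [map_mul, map_sub, h1, ← ee_neg, Complex.conj_ofReal, hW]
      congr 2; push_cast; ring
  rw [e, RCLike.norm_conj]

lemma sup_pos (η : ℝ) (hη : 0 < η) : ∃ C : ℝ, 0 < C ∧ ∃ X₀ : ℝ, ∀ X, X₀ ≤ X → ∀ b : ℤ, |(b:ℝ) - η * X| ≤ 1 → ∀ α : ℝ,
    ‖FT (JJ b (KK X)) (fun m => (WL m : ℂ) - LQ (QQ X) m) α‖ ≤ C * (X / Real.log X ^ 8) := by
  have hκ : 1 ≤ 2 + η + 2 / η := by have : 0 < 2 / η := by positivity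
                                    linarith
  obtain ⟨C, hC, X₁, HC⟩ := sup_D (2 + η + 2 / η) hκ
  obtain ⟨X₂, hX₂, H2⟩ := large_log (4 / η)
  refine ⟨C, hC, max (max X₁ X₂) (8 / η + 2), fun X hX b hb α => ?_⟩
  have hX1 : X₁ ≤ X := (le_max_left _ _).trans ((le_max_left _ _).trans hX)
  have hX2 : X₂ ≤ X := (le_max_right _ _).trans ((le_max_left _ _).trans hX)
  have hX3 : 8 / η + 2 ≤ X := (le_max_right _ _).trans hX
  obtain ⟨l1, l4, -, -⟩ := H2 X hX2
  have X0 : 0 < X := by linarith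
  have e8 : 0 < 8 / η := by positivity
  have hηX : 8 ≤ η * X := by
    have : 8 / η ≤ X := by linarith
    rw [div_le_iff₀ hη] at this; linarith
  have hl0 : 0 < Real.log X := by linarith
  have hK : (KK X : ℝ) ≤ X / Real.log X := Nat.floor_le (by positivity)
  have hKη : X / Real.log X ≤ η * X / 4 := by
    rw [div_le_iff₀ hl0]
    rw [div_le_iff₀ hη] at l1
    nlinarith
  have hK1 : X / Real.log X ≤ X / 4 := by gcongr
  obtain ⟨hb1, hb2⟩ := abs_le.1 hb
  have hlow : (2:ℝ) ≤ b - KK X - 1 := by linarith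
  have hlow' : (2:ℤ) ≤ b - KK X - 1 := by exact_mod_cast hlow
  obtain ⟨M, hM⟩ : ∃ M : ℕ, (M:ℤ) = b - KK X - 1 := ⟨(b - KK X - 1).toNat, by omega⟩
  obtain ⟨N, hN⟩ : ∃ N : ℕ, (N:ℤ) = b + KK X := ⟨(b + KK X).toNat, by omega⟩
  have hMr : (M:ℝ) = b - KK X - 1 := by exact_mod_cast hM
  have hNr : (N:ℝ) = b + KK X := by exact_mod_cast hN
  have key := HC X hX1 M N (by
    rw [hMr]
    have : X / (2 + η + 2 / η) ≤ η * X / 2 := by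
      rw [div_le_iff₀ (by linarith)]
      have : η * X / 2 * (2 + η + 2 / η) = η * X / 2 * (2 + η) + X := by field_simp
      rw [this]
      have : 0 ≤ η * X / 2 * (2 + η) := by positivity
      linarith
    linarith) (by omega) (by
    rw [hNr]
    have : 0 < 2 / η * X := by positivity
    nlinarith) α
  refine le_trans (le_of_eq ?_) key
  congr 1
  unfold FT
  refine Finset.sum_nbij' (fun m => m.toNat) (fun n => (n:ℤ)) ?_ ?_ ?_ ?_ ?_
  · intro m hm; simp only [JJ, mem_Icc, mem_Ioc] at *; omega
  · intro m hm; simp only [JJ, mem_Icc, mem_Ioc] at *; omega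
  · intro m hm; simp only [JJ, mem_Icc, mem_Ioc] at *; omega
  · intro m hm; simp only [JJ, mem_Icc, mem_Ioc] at *; omega
  · intro m hm
    simp only [JJ, mem_Icc] at hm
    obtain ⟨n, rfl⟩ : ∃ n : ℕ, m = n := ⟨m.toNat, by omega⟩
    simp [WL, QQ]

lemma sup_all (η : ℝ) (hη : η ≠ 0) : ∃ C : ℝ, 0 < C ∧ ∃ X₀ : ℝ, ∀ X, X₀ ≤ X → ∀ α : ℝ,
    ‖FT (JJ ⌊η * X⌋ (KK X)) (fun m => (WL m : ℂ) - LQ (QQ X) m) α‖ ≤ C * (X / Real.log X ^ 8) := by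
  have hfl : ∀ X : ℝ, |((⌊η * X⌋ : ℤ) : ℝ) - η * X| ≤ 1 := by
    intro X; rw [abs_le]
    have := Int.floor_le (η * X)
    have := Int.lt_floor_add_one (η * X)
    constructor <;> linarith
  rcases lt_or_gt_of_ne hη with h | h
  · obtain ⟨C, hC, X₀, H⟩ := sup_pos (-η) (by linarith)
    refine ⟨C, hC, X₀, fun X hX α => ?_⟩
    rw [FT_neg]
    refine H X hX _ ?_ α
    have e : ((-⌊η * X⌋ : ℤ) : ℝ) - -η * X = -(((⌊η * X⌋ : ℤ) : ℝ) - η * X) := by push_cast; ring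
    rw [e, abs_neg]; exact hfl X
  · obtain ⟨C, hC, X₀, H⟩ := sup_pos η h
    exact ⟨C, hC, X₀, fun X hX α => H X hX _ (hfl X) α⟩

lemma sup_four (η : Fin 4 → ℝ) (hη : ∀ i, η i ≠ 0) : ∃ C : ℝ, 0 < C ∧ ∃ X₀ : ℝ, ∀ X, X₀ ≤ X → ∀ i, ∀ α : ℝ,
    ‖FT (JJ ⌊η i * X⌋ (KK X)) (fun m => (WL m : ℂ) - LQ (QQ X) m) α‖ ≤ C * (X / Real.log X ^ 8) := by
  choose C hC X₀ H using fun i => sup_all (η i) (hη i)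
  refine ⟨∑ i, C i, Finset.sum_pos (fun i _ => hC i) univ_nonempty, 1 + ∑ i, |X₀ i|, fun X hX i α => ?_⟩
  have h1 : |X₀ i| ≤ ∑ i, |X₀ i| := Finset.single_le_sum (f := fun i => |X₀ i|) (fun _ _ => abs_nonneg _) (mem_univ i)
  have h2 : C i ≤ ∑ i, C i := Finset.single_le_sum (f := C) (fun i _ => (hC i).le) (mem_univ i)
  have h3 := le_abs_self (X₀ i)
  have h4 : 0 ≤ ∑ i, |X₀ i| := (abs_nonneg _).trans h1
  refine (H i X (by linarith) α).trans ?_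
  have : 0 ≤ Real.log X := Real.log_nonneg (by linarith)
  have : 0 ≤ X := by linarith
  gcongr

/-- basic facts for large `X` -/
lemma basic_large (η : Fin 4 → ℝ) (L : ℝ) : ∃ X₀ : ℝ, 1 ≤ X₀ ∧ ∀ X, X₀ ≤ X → L ≤ Real.log X ∧ 4 ≤ Real.log X ∧ 4 * Real.log X ^ 200 ≤ Real.sqrt X ∧
    X / (2 * Real.log X) ≤ KK X ∧ (KK X : ℝ) ≤ X / Real.log X ∧ (2 * KK X + 1 : ℝ) ≤ 3 * X / Real.log X ∧
    (∀ i, ∀ m ∈ JJ ⌊η i * X⌋ (KK X), |(m:ℝ) - η i * X| ≤ 2 * X / Real.log X ∧ |(m:ℝ)| ≤ X ^ 2) := by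
  obtain ⟨X₂, hX₂, H2⟩ := large_log L
  refine ⟨max X₂ (1 + (1 + ∑ i, |η i|)), hX₂.trans (le_max_left _ _), fun X hX => ?_⟩
  obtain ⟨l1, l4, l200, hs⟩ := H2 X ((le_max_left _ _).trans hX)
  have hXη : 1 + (1 + ∑ i, |η i|) ≤ X := (le_max_right _ _).trans hX
  have X1 : 1 ≤ X := hX₂.trans ((le_max_left _ _).trans hX)
  set l := Real.log X
  have hl2 : 2 * l ≤ X := by
    have : l ^ 1 ≤ l ^ 200 := pow_le_pow_right₀ (by linarith) (by norm_num)
    linarith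
  have l0 : 0 < l := by linarith
  have hXl : 2 ≤ X / l := by rw [le_div_iff₀ l0]; linarith
  have k1 : (KK X : ℝ) ≤ X / l := Nat.floor_le (by positivity)
  have k2 : X / l < KK X + 1 := Nat.lt_floor_add_one _
  have e1 : X / (2 * l) = X / l / 2 := by field_simp
  have e2 : 3 * X / l = 3 * (X / l) := by ring
  have e3 : 2 * X / l = 2 * (X / l) := by ring
  refine ⟨l1, l4, l200, by rw [e1]; linarith, k1, by rw [e2]; linarith, fun i m hm => ?_⟩
  simp only [JJ, mem_Icc] at hm
  obtain ⟨m1, m2⟩ := hm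
  have m1' : ((⌊η i * X⌋ : ℤ) : ℝ) - KK X ≤ m := by exact_mod_cast m1
  have m2' : (m:ℝ) ≤ ((⌊η i * X⌋ : ℤ) : ℝ) + KK X := by exact_mod_cast m2
  have f1 := Int.floor_le (η i * X)
  have f2 := Int.lt_floor_add_one (η i * X)
  have hd : |(m:ℝ) - η i * X| ≤ 2 * X / l := by
    rw [e3, abs_le]; constructor <;> linarith
  refine ⟨hd, ?_⟩
  have h1 : |η i| ≤ ∑ i, |η i| := Finset.single_le_sum (f := fun i => |η i|) (fun _ _ => abs_nonneg _) (mem_univ i)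
  have h2 : |(m:ℝ)| ≤ |(m:ℝ) - η i * X| + |η i * X| := by
    have := abs_add_le ((m:ℝ) - η i * X) (η i * X)
    rwa [sub_add_cancel] at this
  rw [abs_mul, abs_of_pos (by linarith : 0 < X)] at h2
  have h3 : 2 * X / l ≤ X := by rw [div_le_iff₀ l0]; nlinarith
  nlinarith

theorem weighted_count (η : Fin 4 → ℝ) (hη : ∀ i, η i ≠ 0) (hs : ∑ i, η i = 0) : ∃ X₀ : ℝ, ∀ X, X₀ ≤ X →
    X ^ 3 / (4000 * Real.log X ^ 3) ≤ ∑ m ∈ Sol (fun i => JJ ⌊η i * X⌋ (KK X)), ∏ i, WL (m i) := by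
  obtain ⟨C, hC, X₁, HC⟩ := sup_four η hη
  obtain ⟨X₂, hX₂, H2⟩ := basic_large η (10000 + 10000 * (64 * C * (6 + C) * 4000))
  refine ⟨max X₁ X₂, fun X hX => ?_⟩
  obtain ⟨lL, l4, l200, kl, ku, k3, hm⟩ := H2 X ((le_max_right _ _).trans hX)
  have hD := HC X ((le_max_left _ _).trans hX)
  have X1 : 1 ≤ X := hX₂.trans ((le_max_right _ _).trans hX)
  have X0 : 0 < X := by linarith
  set l := Real.log X with hl
  have l0 : 0 < l := by linarith
  have l1 : 1 ≤ l := by linarith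
  set K := KK X
  set Q := QQ X with hQdef
  set J : Fin 4 → Finset ℤ := fun i => JJ ⌊η i * X⌋ K with hJ
  have hl400 : 16 * l ^ 400 ≤ X := by
    have h1 : (4 * l ^ 200) ^ 2 ≤ Real.sqrt X ^ 2 := by gcongr
    rw [Real.sq_sqrt X0.le] at h1
    calc 16 * l ^ 400 = (4 * l ^ 200) ^ 2 := by ring
      _ ≤ X := h1
  have hQ1 : 1 ≤ Q := by
    apply Nat.le_floor
    push_cast; exact one_le_pow₀ l1
  have hQl : (Q:ℝ) ≤ l ^ 24 := Nat.floor_le (by positivity)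
  have Q0 : (0:ℝ) < Q := by exact_mod_cast hQ1
  have hlogQ : Real.log Q ≤ 24 * l := by
    have h1 := Real.log_le_log Q0 hQl
    rw [Real.log_pow] at h1
    have h2 := Real.log_le_self l0.le
    push_cast at h1; linarith
  have hlogQ0 : 0 ≤ Real.log Q := Real.log_nonneg (by exact_mod_cast hQ1)
  have hWL : ∀ i, ∀ m ∈ J i, ‖(WL m : ℂ)‖ ≤ 2 * l := by
    intro i m hmi
    have h1 := (hm i m hmi).2
    rw [Complex.norm_real, WL, Real.norm_of_nonneg vonMangoldt_nonneg]
    refine vonMangoldt_le_log.trans ?_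
    rcases Nat.eq_zero_or_pos m.natAbs with h0 | h0
    · rw [h0]; simp; linarith
    · have h2 : ((m.natAbs : ℕ) : ℝ) ≤ X ^ 2 := by rw [Nat.cast_natAbs]; exact_mod_cast h1
      have h3 := Real.log_le_log (by exact_mod_cast h0) h2
      rw [Real.log_pow] at h3; exact_mod_cast h3
  have cardJ : ∀ i, ((J i).card : ℝ) ≤ 3 * X / l := by
    intro i; simp only [hJ]; rw [card_JJ]; push_cast; exact k3
  have Xl8 : X / l ^ 8 ≤ X := div_le_self X0.le (one_le_pow₀ l1)
  have hf : ∀ i α, ‖FT (J i) (fun m => (WL m : ℂ)) α‖ ≤ 6 * X := by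
    intro i α
    unfold FT
    refine (norm_sum_le _ _).trans ?_
    have : ∀ m ∈ J i, ‖(WL m : ℂ) * ee (m * α)‖ ≤ 2 * l := by
      intro m hmi; rw [norm_mul, ee_norm, mul_one]; exact hWL i m hmi
    refine (Finset.sum_le_sum this).trans ?_
    rw [Finset.sum_const, nsmul_eq_mul]
    calc ((J i).card : ℝ) * (2 * l) ≤ 3 * X / l * (2 * l) := by gcongr; exact cardJ i
      _ = 6 * X := by field_simp; norm_num
  have hg : ∀ i α, ‖FT (J i) (LQ Q) α‖ ≤ (6 + C) * X := by
    intro i α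
    have e : FT (J i) (LQ Q) α = FT (J i) (fun m => (WL m : ℂ)) α - FT (J i) (fun m => (WL m : ℂ) - LQ Q m) α := by
      unfold FT
      rw [← Finset.sum_sub_distrib]
      refine Finset.sum_congr rfl fun m _ => by ring
    rw [e]
    refine (norm_sub_le _ _).trans ?_
    have h1 := hf i α
    have h2 := hD i α
    have h3 : C * (X / l ^ 8) ≤ C * X := by gcongr
    have : (6 + C) * X = 6 * X + C * X := by ring
    rw [this]; exact add_le_add h1 (h2.trans h3)
  have hf2 : ∀ i, ∑ m ∈ J i, ‖(WL m : ℂ)‖ ^ 2 ≤ 4000 * X * l := by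
    intro i
    have : ∀ m ∈ J i, ‖(WL m : ℂ)‖ ^ 2 ≤ (2 * l) ^ 2 := by
      intro m hmi
      have := hWL i m hmi
      gcongr
    refine (Finset.sum_le_sum this).trans ?_
    rw [Finset.sum_const, nsmul_eq_mul]
    calc ((J i).card : ℝ) * (2 * l) ^ 2 ≤ 3 * X / l * (2 * l) ^ 2 := by gcongr; exact cardJ i
      _ = 12 * X * l := by field_simp; norm_num
      _ ≤ _ := by gcongr; norm_num
  have pw : ∀ n : ℕ, n ≤ 400 → l ^ n ≤ X := by
    intro n hn
    have : l ^ n ≤ l ^ 400 := pow_le_pow_right₀ l1 hn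
    have : 0 < l ^ 400 := by positivity
    linarith
  have hg2 : ∀ i, ∑ m ∈ J i, ‖LQ Q m‖ ^ 2 ≤ 4000 * X * l := by
    intro i
    refine (l2_LQ Q K hQ1 _).trans ?_
    have h1 : (2 * (K:ℝ) + 1) * ((1 + 2 * Real.log Q) * (1 + Real.log Q)) ≤ 3 * X / l * ((49 * l) * (25 * l)) := by
      gcongr <;> linarith
    have h2 : 3 * X / l * ((49 * l) * (25 * l)) = 3675 * X * l := by field_simp; norm_num
    have h3 : (Q:ℝ) ^ 6 ≤ X := by
      calc (Q:ℝ) ^ 6 ≤ (l ^ 24) ^ 6 := by gcongr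
        _ = l ^ 144 := by ring
        _ ≤ X := pw 144 (by norm_num)
    nlinarith
  have hcmp := cnt_compare J (fun m => (WL m : ℂ)) (LQ Q) (C * (X / l ^ 8)) ((6 + C) * X) (4000 * X * l) (by positivity) hD
    (fun i α => (hf i α).trans (by nlinarith)) hg hf2 hg2
  have hmod := model_count Q K hQ1 (fun i => ⌊η i * X⌋)
  have hre : (Cnt J (fun _ m => (WL m : ℂ))).re = ∑ m ∈ Sol J, ∏ i, WL (m i) := by
    unfold Cnt
    rw [Complex.re_sum]
    refine Finset.sum_congr rfl fun m _ => ?_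
    rw [← Complex.ofReal_prod, Complex.ofReal_re]
  rw [← hre]
  have h3 := (abs_le.1 (Complex.abs_re_le_norm (Cnt J (fun _ m => (WL m : ℂ)) - Cnt J (fun _ => LQ Q)))).1
  rw [Complex.sub_re] at h3
  have hK8 : (8:ℝ) ≤ K := by
    refine le_trans ?_ kl
    rw [le_div_iff₀ (by positivity)]
    have := pw 1 (by norm_num)
    have h2 : l ^ 1 ≤ l ^ 400 := pow_le_pow_right₀ l1 (by norm_num)
    rw [pow_one] at h2
    linarith
  have hK8' : 8 ≤ K := by exact_mod_cast hK8
  have hsol := card_Sol (fun i => ⌊η i * X⌋) K (K / 3 - 1) (by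
      rw [Fin.sum_univ_four]
      rw [Fin.sum_univ_four] at hs
      have a0 := Int.lt_floor_add_one (η 0 * X)
      have a1 := Int.lt_floor_add_one (η 1 * X)
      have a2 := Int.lt_floor_add_one (η 2 * X)
      have a3 := Int.lt_floor_add_one (η 3 * X)
      have : η 0 * X + η 1 * X + η 2 * X + η 3 * X = 0 := by rw [← add_mul, ← add_mul, ← add_mul, hs, zero_mul]
      have : (-4:ℝ) < ((⌊η 0 * X⌋ + ⌊η 1 * X⌋ + ⌊η 2 * X⌋ + ⌊η 3 * X⌋ : ℤ) : ℝ) := by push_cast; linarith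
      have : (-4:ℤ) < ⌊η 0 * X⌋ + ⌊η 1 * X⌋ + ⌊η 2 * X⌋ + ⌊η 3 * X⌋ := by exact_mod_cast this
      omega) (by
      rw [Fin.sum_univ_four]
      rw [Fin.sum_univ_four] at hs
      have a0 := Int.floor_le (η 0 * X)
      have a1 := Int.floor_le (η 1 * X)
      have a2 := Int.floor_le (η 2 * X)
      have a3 := Int.floor_le (η 3 * X)
      have : η 0 * X + η 1 * X + η 2 * X + η 3 * X = 0 := by rw [← add_mul, ← add_mul, ← add_mul, hs, zero_mul]
      have : ((⌊η 0 * X⌋ + ⌊η 1 * X⌋ + ⌊η 2 * X⌋ + ⌊η 3 * X⌋ : ℤ) : ℝ) ≤ 0 := by push_cast; linarith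
      exact_mod_cast this) (by omega)
  have hsol' : (X / (12 * l)) ^ 3 ≤ ((Sol J).card : ℝ) := by
    have h1 : ((K / 3 - 1 + 1 : ℕ) : ℝ) ^ 3 ≤ ((Sol J).card : ℝ) := by exact_mod_cast hsol
    refine le_trans ?_ h1
    have h2 : K ≤ 6 * (K / 3 - 1 + 1) := by omega
    have h2' : (K:ℝ) ≤ 6 * ((K / 3 - 1 + 1 : ℕ) : ℝ) := by exact_mod_cast h2
    have h4 : X / (12 * l) = X / (2 * l) / 6 := by field_simp; norm_num
    have : X / (12 * l) ≤ ((K / 3 - 1 + 1 : ℕ) : ℝ) := by rw [h4]; linarith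
    gcongr
  have hE1 : 4 * (Q:ℝ) ^ 10 * (2 * K + 1) ^ 2 ≤ X ^ 3 / l ^ 3 * (1 / 10000) := by
    have h1 : 4 * (Q:ℝ) ^ 10 * (2 * K + 1) ^ 2 ≤ 4 * (l ^ 24) ^ 10 * (3 * X / l) ^ 2 := by gcongr
    refine h1.trans ?_
    have h2 : 4 * (l ^ 24) ^ 10 * (3 * X / l) ^ 2 = X ^ 2 / l ^ 3 * (36 * l ^ 241) := by field_simp; norm_num
    have h5 : X ^ 3 / l ^ 3 * (1 / 10000) = X ^ 2 / l ^ 3 * (X / 10000) := by field_simp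
    rw [h2, h5]
    have h6 : 36 * l ^ 241 ≤ X / 10000 := by
      have h7 : l ^ 243 ≤ l ^ 400 := pow_le_pow_right₀ l1 (by norm_num)
      have hl10 : 10000 ≤ l := by
        have : 0 < 10000 * (64 * C * (6 + C) * 4000) := by positivity
        linarith
      have h8 : 10000 * 10000 * l ^ 241 ≤ l ^ 243 := by
        have : l ^ 243 = l * l * l ^ 241 := by ring
        rw [this]; gcongr
      have : 0 < l ^ 241 := by positivity
      linarith
    gcongr
  have hE2 : 64 * (C * (X / l ^ 8)) * ((6 + C) * X) * (4000 * X * l) ≤ X ^ 3 / l ^ 3 * (1 / 10000) := by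
    have h1 : 64 * (C * (X / l ^ 8)) * ((6 + C) * X) * (4000 * X * l) = X ^ 3 / l ^ 3 * ((64 * C * (6 + C) * 4000) / l ^ 4) := by
      field_simp
    rw [h1]
    gcongr ?_ * ?_
    rw [div_le_div_iff₀ (by positivity) (by norm_num)]
    have : l ^ 1 ≤ l ^ 4 := pow_le_pow_right₀ l1 (by norm_num)
    linarith
  have hfin : X ^ 3 / (4000 * l ^ 3) + X ^ 3 / l ^ 3 * (1 / 10000) + X ^ 3 / l ^ 3 * (1 / 10000) ≤ (X / (12 * l)) ^ 3 := by
    have h1 : X ^ 3 / (4000 * l ^ 3) + X ^ 3 / l ^ 3 * (1 / 10000) + X ^ 3 / l ^ 3 * (1 / 10000) = X ^ 3 / l ^ 3 * (9 / 20000) := by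
      field_simp; norm_num
    have h2 : (X / (12 * l)) ^ 3 = X ^ 3 / l ^ 3 * (1 / 1728) := by field_simp; norm_num
    rw [h1, h2]
    gcongr ?_ * ?_
    norm_num
  have hmod' : ((Sol J).card : ℝ) - 4 * (Q:ℝ) ^ 10 * (2 * K + 1) ^ 2 ≤ (Cnt J (fun _ => LQ Q)).re := hmod
  linarith

end Cayley
end

section
open Complex Finset Filter Topology MeasureTheory ArithmeticFunction

namespace Cayley

/-! ### Passing to primes -/

lemma np_half (A : Finset ℤ) (x : ℝ) (hA : ∀ m ∈ A, ¬ m.natAbs.Prime ∧ |(m:ℝ)| ≤ x) (hinj : Set.InjOn Int.natAbs A) :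
    ∑ m ∈ A, WL m ≤ Chebyshev.psi x - Chebyshev.theta x := by
  rw [Chebyshev.psi_sub_theta_eq_sum_not_prime]
  have e : ∑ m ∈ A, WL m = ∑ n ∈ A.image Int.natAbs, vonMangoldt n := by
    rw [Finset.sum_image hinj]; rfl
  rw [e]
  have e2 : ∑ n ∈ A.image Int.natAbs, vonMangoldt n = ∑ n ∈ (A.image Int.natAbs).filter (fun n => 0 < n), vonMangoldt n := by
    rw [Finset.sum_filter]
    refine Finset.sum_congr rfl fun n _ => ?_
    split_ifs with h
    · rfl
    · have : n = 0 := by omega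
      rw [this]; simp
  rw [e2]
  refine Finset.sum_le_sum_of_subset_of_nonneg ?_ (fun _ _ _ => vonMangoldt_nonneg)
  intro n hn
  simp only [mem_filter, mem_image] at hn
  obtain ⟨⟨m, hm, rfl⟩, h0⟩ := hn
  obtain ⟨h1, h2⟩ := hA m hm
  rw [mem_filter, mem_Ioc]
  refine ⟨⟨h0, Nat.le_floor ?_⟩, h1⟩
  rw [Nat.cast_natAbs]; exact_mod_cast h2

lemma np_sum (A : Finset ℤ) (x : ℝ) (hx : 1 ≤ x) (hA : ∀ m ∈ A, ¬ m.natAbs.Prime ∧ |(m:ℝ)| ≤ x) :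
    ∑ m ∈ A, WL m ≤ 4 * Real.sqrt x * Real.log x := by
  have h1 := np_half (A.filter (fun m => 0 ≤ m)) x (fun m hm => hA m (mem_filter.1 hm).1) (by
    intro a ha b hb h
    simp only [Finset.mem_coe, mem_filter] at ha hb
    omega)
  have h2 := np_half (A.filter (fun m => ¬ 0 ≤ m)) x (fun m hm => hA m (mem_filter.1 hm).1) (by
    intro a ha b hb h
    simp only [Finset.mem_coe, mem_filter] at ha hb
    omega)
  have h3 := Chebyshev.psi_sub_theta_le hx
  rw [← Finset.sum_filter_add_sum_filter_not A (fun m => 0 ≤ m)]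
  linarith

lemma sum_rot (m : Fin 4 → ℤ) (i : Fin 4) : ∑ j, m j = m i + m (i + 1) + m (i + 2) + m (i + 3) := by
  fin_cases i <;> simp [Fin.sum_univ_four] <;> ring

lemma prod_rot (m : Fin 4 → ℝ) (i : Fin 4) : ∏ j, m j = m i * m (i + 1) * m (i + 2) * m (i + 3) := by
  fin_cases i <;> simp [Fin.prod_univ_four] <;> ring

lemma rot_cases : ∀ i j : Fin 4, j = i ∨ j = i + 1 ∨ j = i + 2 ∨ j = i + 3 := by decide

lemma pair_compl : ∀ i j : Fin 4, i ≠ j → ∃ k l : Fin 4, (univ : Finset (Fin 4)) = {i, j, k, l} ∧ i ∉ ({j, k, l} : Finset (Fin 4)) ∧ j ∉ ({k, l} : Finset (Fin 4)) ∧ k ≠ l := by decide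

lemma funext_rot {m m' : Fin 4 → ℤ} (i : Fin 4) (h0 : m i = m' i) (h1 : m (i + 1) = m' (i + 1)) (h2 : m (i + 2) = m' (i + 2))
    (h3 : m (i + 3) = m' (i + 3)) : m = m' := by
  funext j
  have : j = i ∨ j = i + 1 ∨ j = i + 2 ∨ j = i + 3 := rot_cases i j
  rcases this with h | h | h | h <;> rw [h] <;> assumption

lemma WL_nonneg (m : ℤ) : 0 ≤ WL m := vonMangoldt_nonneg

lemma bad_np (J : Fin 4 → Finset ℤ) (U V R : ℝ) (hU : ∀ i, ∀ m ∈ J i, WL m ≤ U) (hU0 : 0 ≤ U) (hcard : ∀ i, ((J i).card : ℝ) ≤ V) (i : Fin 4)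
    (hR : ∑ m ∈ (J i).filter (fun m => ¬ m.natAbs.Prime), WL m ≤ R) :
    ∑ m ∈ (Sol J).filter (fun m => ¬ (m i).natAbs.Prime), ∏ j, WL (m j) ≤ U ^ 3 * (R * V ^ 2) := by
  have V0 : 0 ≤ V := (Nat.cast_nonneg _).trans (hcard 0)
  have hmemJ : ∀ m ∈ (Sol J).filter (fun m => ¬ (m i).natAbs.Prime), (∀ j, m j ∈ J j) ∧ ∑ j, m j = 0 ∧ ¬ (m i).natAbs.Prime := by
    intro m hm
    simp only [mem_filter, Sol, Fintype.mem_piFinset] at hm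
    exact ⟨hm.1.1, hm.1.2, hm.2⟩
  set T := ((J i).filter (fun m => ¬ m.natAbs.Prime)) ×ˢ ((J (i + 1)) ×ˢ (J (i + 2))) with hT
  have h1 : ∑ m ∈ (Sol J).filter (fun m => ¬ (m i).natAbs.Prime), ∏ j, WL (m j) ≤ ∑ m ∈ (Sol J).filter (fun m => ¬ (m i).natAbs.Prime), U ^ 3 * WL (m i) := by
    refine Finset.sum_le_sum fun m hm => ?_
    obtain ⟨hj, -, -⟩ := hmemJ m hm
    rw [prod_rot (fun j => WL (m j)) i]
    have a1 := hU _ _ (hj (i + 1))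
    have a2 := hU _ _ (hj (i + 2))
    have a3 := hU _ _ (hj (i + 3))
    calc WL (m i) * WL (m (i + 1)) * WL (m (i + 2)) * WL (m (i + 3)) ≤ WL (m i) * U * U * U := by
          gcongr
          any_goals apply_rules [mul_nonneg, WL_nonneg]
      _ = _ := by ring
  have h2 : ∑ m ∈ (Sol J).filter (fun m => ¬ (m i).natAbs.Prime), WL (m i) ≤ ∑ t ∈ T, WL t.1 := by
    have hinj : Set.InjOn (fun m : Fin 4 → ℤ => (m i, m (i + 1), m (i + 2))) ((Sol J).filter (fun m => ¬ (m i).natAbs.Prime)) := by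
      intro m hm m' hm' h
      obtain ⟨-, s, -⟩ := hmemJ m hm
      obtain ⟨-, s', -⟩ := hmemJ m' hm'
      simp only [Prod.mk.injEq] at h
      rw [sum_rot m i] at s
      rw [sum_rot m' i] at s'
      exact funext_rot i h.1 h.2.1 h.2.2 (by omega)
    rw [← Finset.sum_image (f := fun t : ℤ × ℤ × ℤ => WL t.1) hinj]
    refine Finset.sum_le_sum_of_subset_of_nonneg ?_ (fun _ _ _ => WL_nonneg _)
    intro t ht
    obtain ⟨m, hm, rfl⟩ := mem_image.1 ht
    obtain ⟨hj, -, hp⟩ := hmemJ m hm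
    simp only [hT, mem_product, mem_filter]
    exact ⟨⟨hj _, hp⟩, hj _, hj _⟩
  have h3 : ∑ t ∈ T, WL t.1 = (∑ m ∈ (J i).filter (fun m => ¬ m.natAbs.Prime), WL m) * ((J (i + 1)).card * (J (i + 2)).card) := by
    rw [hT, Finset.sum_product, Finset.sum_mul]
    refine Finset.sum_congr rfl fun m _ => ?_
    simp only
    rw [Finset.sum_const, nsmul_eq_mul, Finset.card_product]; push_cast; ring
  refine h1.trans ?_
  rw [← Finset.mul_sum]
  have R0 : 0 ≤ R := le_trans (Finset.sum_nonneg fun _ _ => WL_nonneg _) hR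
  refine mul_le_mul_of_nonneg_left (h2.trans ?_) (by positivity)
  rw [h3, sq]
  have c1 := hcard (i + 1)
  have c2 := hcard (i + 2)
  gcongr

lemma bad_eq (J : Fin 4 → Finset ℤ) (U V : ℝ) (hU : ∀ i, ∀ m ∈ J i, WL m ≤ U) (hU0 : 0 ≤ U) (hcard : ∀ i, ((J i).card : ℝ) ≤ V) (i j : Fin 4) (hij : i ≠ j) :
    ∑ m ∈ (Sol J).filter (fun m => m i = m j), ∏ j, WL (m j) ≤ U ^ 4 * V ^ 2 := by
  have V0 : 0 ≤ V := (Nat.cast_nonneg _).trans (hcard 0)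
  have hmemJ : ∀ m ∈ (Sol J).filter (fun m => m i = m j), (∀ j, m j ∈ J j) ∧ ∑ j, m j = 0 ∧ m i = m j := by
    intro m hm
    simp only [mem_filter, Sol, Fintype.mem_piFinset] at hm
    exact ⟨hm.1.1, hm.1.2, hm.2⟩
  obtain ⟨k, l, hkl, hsum⟩ : ∃ k l : Fin 4, (∀ a : Fin 4, a = i ∨ a = j ∨ a = k ∨ a = l) ∧ ∀ m : Fin 4 → ℤ, ∑ a, m a = m i + m j + m k + m l := by
    have gen : ∀ k l : Fin 4, (univ : Finset (Fin 4)) = {i, j, k, l} → i ∉ ({j, k, l} : Finset (Fin 4)) → j ∉ ({k, l} : Finset (Fin 4)) → k ≠ l →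
        (∀ a : Fin 4, a = i ∨ a = j ∨ a = k ∨ a = l) ∧ ∀ m : Fin 4 → ℤ, ∑ a, m a = m i + m j + m k + m l := by
      intro k l hu h1 h2 h3
      refine ⟨fun a => ?_, fun m => ?_⟩
      · have := mem_univ a; rw [hu] at this; simpa using this
      · rw [hu, Finset.sum_insert h1, Finset.sum_insert h2, Finset.sum_pair h3]; ring
    obtain ⟨k, l, a, b, c, d⟩ := pair_compl i j hij
    exact ⟨k, l, gen k l a b c d⟩
  have h1 : ∀ m ∈ (Sol J).filter (fun m => m i = m j), ∏ j, WL (m j) ≤ U ^ 4 := by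
    intro m hm
    obtain ⟨hj, -, -⟩ := hmemJ m hm
    calc ∏ j, WL (m j) ≤ ∏ _j : Fin 4, U := Finset.prod_le_prod (fun _ _ => WL_nonneg _) (fun a _ => hU a _ (hj a))
      _ = U ^ 4 := by simp
  have h2 : ((Sol J).filter (fun m => m i = m j)).card ≤ ((J i) ×ˢ (J k)).card := by
    refine Finset.card_le_card_of_injOn (fun m => (m i, m k)) ?_ ?_
    · intro m hm
      obtain ⟨hj, -, -⟩ := hmemJ m hm
      simp only [Finset.mem_coe, mem_product]; exact ⟨hj _, hj _⟩
    · intro m hm m' hm' h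
      obtain ⟨-, s, e⟩ := hmemJ m hm
      obtain ⟨-, s', e'⟩ := hmemJ m' hm'
      simp only [Prod.mk.injEq] at h
      rw [hsum m] at s
      rw [hsum m'] at s'
      funext a
      rcases hkl a with r | r | r | r <;> rw [r] <;> omega
  have h3 : (((Sol J).filter (fun m => m i = m j)).card : ℝ) ≤ V ^ 2 := by
    calc (((Sol J).filter (fun m => m i = m j)).card : ℝ) ≤ (((J i) ×ˢ (J k)).card : ℝ) := by exact_mod_cast h2
      _ = ((J i).card : ℝ) * (J k).card := by rw [Finset.card_product]; push_cast; rfl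
      _ ≤ V * V := by gcongr <;> apply hcard
      _ = V ^ 2 := by ring
  refine (Finset.sum_le_sum h1).trans ?_
  rw [Finset.sum_const, nsmul_eq_mul, mul_comm]
  gcongr

def Good (m : Fin 4 → ℤ) : Prop := (∀ i, (m i).natAbs.Prime) ∧ ∀ i j, i ≠ j → m i ≠ m j

open Classical in
lemma split_good (J : Fin 4 → Finset ℤ) (U V R : ℝ) (hU : ∀ i, ∀ m ∈ J i, WL m ≤ U) (hU0 : 0 ≤ U) (hcard : ∀ i, ((J i).card : ℝ) ≤ V)
    (hR : ∀ i, ∑ m ∈ (J i).filter (fun m => ¬ m.natAbs.Prime), WL m ≤ R) :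
    ∑ m ∈ Sol J, ∏ j, WL (m j) ≤ U ^ 4 * ((Sol J).filter Good).card + 4 * (U ^ 3 * (R * V ^ 2)) + 16 * (U ^ 4 * V ^ 2) := by
  set w : (Fin 4 → ℤ) → ℝ := fun m => ∏ j, WL (m j) with hw
  have w0 : ∀ m, 0 ≤ w m := fun m => Finset.prod_nonneg fun _ _ => WL_nonneg _
  have h1 : ∀ m ∈ Sol J, w m ≤ (if Good m then w m else 0) + ∑ i, (if ¬ (m i).natAbs.Prime then w m else 0) +
      ∑ i, ∑ j, (if i ≠ j ∧ m i = m j then w m else 0) := by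
    intro m _
    have n1 : 0 ≤ ∑ i, (if ¬ (m i).natAbs.Prime then w m else 0) := Finset.sum_nonneg fun i _ => by split_ifs; exacts [le_rfl, w0 m]
    have n2 : 0 ≤ ∑ i, ∑ j, (if i ≠ j ∧ m i = m j then w m else 0) := Finset.sum_nonneg fun i _ => Finset.sum_nonneg fun j _ => by
      split_ifs; exacts [w0 m, le_rfl]
    by_cases hg : Good m
    · rw [if_pos hg]; linarith
    · rw [if_neg hg]
      unfold Good at hg
      by_cases hp : ∀ i, (m i).natAbs.Prime
      · have : ∃ i j, i ≠ j ∧ m i = m j := by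
          by_contra hc
          push Not at hc
          exact hg ⟨hp, hc⟩
        obtain ⟨i, j, hij⟩ := this
        have a1 : (if i ≠ j ∧ m i = m j then w m else 0) ≤ ∑ j, (if i ≠ j ∧ m i = m j then w m else 0) :=
          Finset.single_le_sum (f := fun j => if i ≠ j ∧ m i = m j then w m else 0) (fun j _ => by split_ifs; exacts [w0 m, le_rfl]) (mem_univ j)
        have a2 : ∑ j, (if i ≠ j ∧ m i = m j then w m else 0) ≤ ∑ i, ∑ j, (if i ≠ j ∧ m i = m j then w m else 0) :=
          Finset.single_le_sum (f := fun i => ∑ j, if i ≠ j ∧ m i = m j then w m else 0)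
            (fun i _ => Finset.sum_nonneg fun j _ => by split_ifs; exacts [w0 m, le_rfl]) (mem_univ i)
        rw [if_pos hij] at a1
        linarith
      · push Not at hp
        obtain ⟨i, hi⟩ := hp
        have a1 : (if ¬ (m i).natAbs.Prime then w m else 0) ≤ ∑ i, (if ¬ (m i).natAbs.Prime then w m else 0) :=
          Finset.single_le_sum (f := fun i => if ¬ (m i).natAbs.Prime then w m else 0) (fun j _ => by split_ifs; exacts [le_rfl, w0 m]) (mem_univ i)
        rw [if_pos hi] at a1
        linarith
  refine (Finset.sum_le_sum h1).trans ?_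
  rw [Finset.sum_add_distrib, Finset.sum_add_distrib]
  have V0 : 0 ≤ V := (Nat.cast_nonneg _).trans (hcard 0)
  refine add_le_add (add_le_add ?_ ?_) ?_
  · rw [← Finset.sum_filter]
    have : ∀ m ∈ (Sol J).filter Good, w m ≤ U ^ 4 := by
      intro m hm
      simp only [mem_filter, Sol, Fintype.mem_piFinset] at hm
      calc ∏ j, WL (m j) ≤ ∏ _j : Fin 4, U := Finset.prod_le_prod (fun _ _ => WL_nonneg _) (fun a _ => hU a _ (hm.1.1 a))
        _ = U ^ 4 := by simp
    refine (Finset.sum_le_sum this).trans (le_of_eq ?_)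
    rw [Finset.sum_const, nsmul_eq_mul, mul_comm]
  · rw [Finset.sum_comm]
    have : ∀ i ∈ (univ : Finset (Fin 4)), ∑ m ∈ Sol J, (if ¬ (m i).natAbs.Prime then w m else 0) ≤ U ^ 3 * (R * V ^ 2) := by
      intro i _
      rw [← Finset.sum_filter]
      exact bad_np J U V R hU hU0 hcard i (hR i)
    refine (Finset.sum_le_sum this).trans (le_of_eq ?_)
    simp
  · rw [Finset.sum_comm]
    have : ∀ i ∈ (univ : Finset (Fin 4)), ∑ m ∈ Sol J, ∑ j, (if i ≠ j ∧ m i = m j then w m else 0) ≤ 4 * (U ^ 4 * V ^ 2) := by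
      intro i _
      rw [Finset.sum_comm]
      have : ∀ j ∈ (univ : Finset (Fin 4)), ∑ m ∈ Sol J, (if i ≠ j ∧ m i = m j then w m else 0) ≤ U ^ 4 * V ^ 2 := by
        intro j _
        by_cases hij : i = j
        · simp [hij]; positivity
        · simp only [ne_eq, hij, not_false_iff, true_and]
          rw [← Finset.sum_filter]
          exact bad_eq J U V hU hU0 hcard i j hij
      refine (Finset.sum_le_sum this).trans (le_of_eq ?_)
      simp
    refine (Finset.sum_le_sum this).trans (le_of_eq ?_)
    simp; ring

open Classical in
theorem good_count (η : Fin 4 → ℝ) (hη : ∀ i, η i ≠ 0) (hs : ∑ i, η i = 0) : ∃ X₀ : ℝ, ∀ X, X₀ ≤ X →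
    X ^ 3 / (200000 * Real.log X ^ 7) ≤ ((Sol (fun i => JJ ⌊η i * X⌋ (KK X))).filter Good).card := by
  obtain ⟨X₁, H1⟩ := weighted_count η hη hs
  set κ : ℝ := 1 + ∑ i, |η i| with hκ
  have κ1 : 1 ≤ κ := by rw [hκ]; have : 0 ≤ ∑ i, |η i| := Finset.sum_nonneg fun _ _ => abs_nonneg _
                        linarith
  obtain ⟨X₂, hX₂, H2⟩ := basic_large η (100000000 * κ)
  refine ⟨max X₁ (max X₂ κ), fun X hX => ?_⟩
  have hX2 : X₂ ≤ X := (le_max_left _ _).trans ((le_max_right _ _).trans hX)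
  have hXκ : κ ≤ X := (le_max_right _ _).trans ((le_max_right _ _).trans hX)
  obtain ⟨lL, l4, l200, kl, ku, k3, hm⟩ := H2 X hX2
  have hw := H1 X ((le_max_left _ _).trans hX)
  have X1 : 1 ≤ X := hX₂.trans hX2
  have X0 : 0 < X := by linarith
  set l := Real.log X with hl
  have l0 : 0 < l := by linarith
  have l1 : 1 ≤ l := by linarith
  set J : Fin 4 → Finset ℤ := fun i => JJ ⌊η i * X⌋ (KK X) with hJ
  have hU : ∀ i, ∀ m ∈ J i, WL m ≤ 2 * l := by
    intro i m hmi
    have h1 := (hm i m hmi).2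
    rw [WL]
    refine vonMangoldt_le_log.trans ?_
    rcases Nat.eq_zero_or_pos m.natAbs with h0 | h0
    · rw [h0]; simp; linarith
    · have h2 : ((m.natAbs : ℕ) : ℝ) ≤ X ^ 2 := by rw [Nat.cast_natAbs]; exact_mod_cast h1
      have h3 := Real.log_le_log (by exact_mod_cast h0) h2
      rw [Real.log_pow] at h3; exact_mod_cast h3
  have cardJ : ∀ i, ((J i).card : ℝ) ≤ 3 * X / l := by
    intro i; simp only [hJ]; rw [card_JJ]; push_cast; exact k3
  have κX : 1 ≤ κ * X := by nlinarith
  have hR : ∀ i, ∑ m ∈ (J i).filter (fun m => ¬ m.natAbs.Prime), WL m ≤ 8 * κ * Real.sqrt X * l := by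
    intro i
    have h1 := np_sum ((J i).filter (fun m => ¬ m.natAbs.Prime)) (κ * X) κX (by
      intro m hmi
      obtain ⟨hmi, hp⟩ := mem_filter.1 hmi
      refine ⟨hp, ?_⟩
      have h1 : |η i| ≤ ∑ i, |η i| := Finset.single_le_sum (f := fun i => |η i|) (fun _ _ => abs_nonneg _) (mem_univ i)
      have h2 : |(m:ℝ)| ≤ |(m:ℝ) - η i * X| + |η i * X| := by
        have := abs_add_le ((m:ℝ) - η i * X) (η i * X)
        rwa [sub_add_cancel] at this
      rw [abs_mul, abs_of_pos X0] at h2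
      have h3 : 2 * X / l ≤ X := by rw [div_le_iff₀ l0]; nlinarith
      have h4 := (hm i m hmi).1
      have h5 : |η i| * X ≤ (∑ i, |η i|) * X := by gcongr
      have : κ * X = X + (∑ i, |η i|) * X := by rw [hκ]; ring
      linarith)
    refine h1.trans ?_
    have s1 : Real.sqrt (κ * X) ≤ κ * Real.sqrt X := by
      rw [Real.sqrt_mul (by linarith)]
      gcongr
      rw [Real.sqrt_le_left (by linarith)]; nlinarith
    have s2 : Real.log (κ * X) ≤ 2 * l := by
      rw [Real.log_mul (by linarith) (by linarith)]
      have := Real.log_le_log (by linarith) hXκ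
      linarith
    have s3 : 0 ≤ Real.log (κ * X) := Real.log_nonneg κX
    calc 4 * Real.sqrt (κ * X) * Real.log (κ * X) ≤ 4 * (κ * Real.sqrt X) * (2 * l) := by gcongr
      _ = _ := by ring
  have key := split_good J (2 * l) (3 * X / l) (8 * κ * Real.sqrt X * l) hU (by linarith) cardJ hR
  set N : ℝ := (((Sol J).filter Good).card : ℝ) with hN
  have hsq : Real.sqrt X * Real.sqrt X = X := Real.mul_self_sqrt X0.le
  have s0 : 0 < Real.sqrt X := Real.sqrt_pos.2 X0
  have hl6 : l ^ 6 ≤ Real.sqrt X := by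
    have : l ^ 6 ≤ l ^ 200 := pow_le_pow_right₀ l1 (by norm_num)
    have : 0 < l ^ 200 := by positivity
    linarith
  have E1 : 4 * ((2 * l) ^ 3 * (8 * κ * Real.sqrt X * l * (3 * X / l) ^ 2)) ≤ X ^ 3 / l ^ 3 * (1 / 16000) := by
    have e1 : 4 * ((2 * l) ^ 3 * (8 * κ * Real.sqrt X * l * (3 * X / l) ^ 2)) = X ^ 2 / l ^ 3 * (Real.sqrt X * (2304 * κ * l ^ 5)) := by
      field_simp; norm_num
    have e2 : X ^ 3 / l ^ 3 * (1 / 16000) = X ^ 2 / l ^ 3 * (X / 16000) := by field_simp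
    rw [e1, e2]
    have : Real.sqrt X * (2304 * κ * l ^ 5) ≤ X / 16000 := by
      have h1 : 2304 * κ * l ^ 5 ≤ Real.sqrt X / 16000 := by
        have : 100000000 * κ * l ^ 5 ≤ l * l ^ 5 := by gcongr
        have e : l * l ^ 5 = l ^ 6 := by ring
        have : 0 < κ * l ^ 5 := by positivity
        linarith
      calc _ ≤ Real.sqrt X * (Real.sqrt X / 16000) := by gcongr
        _ = X / 16000 := by rw [← mul_div_assoc, hsq]
    gcongr
  have E2 : 16 * ((2 * l) ^ 4 * (3 * X / l) ^ 2) ≤ X ^ 3 / l ^ 3 * (1 / 16000) := by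
    have e1 : 16 * ((2 * l) ^ 4 * (3 * X / l) ^ 2) = X ^ 2 / l ^ 3 * (2304 * l ^ 5) := by
      field_simp; norm_num
    have e2 : X ^ 3 / l ^ 3 * (1 / 16000) = X ^ 2 / l ^ 3 * (X / 16000) := by field_simp
    rw [e1, e2]
    have : 2304 * l ^ 5 ≤ X / 16000 := by
      have a1 : 100000000 * l ^ 5 ≤ l * l ^ 5 := by gcongr; linarith
      have e : l * l ^ 5 = l ^ 6 := by ring
      have a2 : 0 < l ^ 5 := by positivity
      have : Real.sqrt X ≤ X := by rw [Real.sqrt_le_left X0.le]; nlinarith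
      linarith
    gcongr
  have hmain : X ^ 3 / (4000 * l ^ 3) = X ^ 3 / l ^ 3 * (4 / 16000) := by field_simp; norm_num
  have hfin : X ^ 3 / l ^ 3 * (2 / 16000) ≤ (2 * l) ^ 4 * N := by
    rw [hmain] at hw
    linarith
  have l4p : 0 < (2 * l) ^ 4 := by positivity
  refine le_of_mul_le_mul_left (le_trans ?_ hfin) l4p
  have e : (2 * l) ^ 4 * (X ^ 3 / (200000 * l ^ 7)) = X ^ 3 / l ^ 3 * (16 / 200000) := by field_simp; norm_num
  rw [e]
  gcongr ?_ * ?_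
  norm_num

end Cayley
end

section
open Complex Finset Filter Topology MeasureTheory ArithmeticFunction

namespace Cayley

/-! ### From prime solutions of the linear equation to points on the surface -/

def pt (m : Fin 4 → ℤ) : Fin 4 → ℤ := ![m 1 * m 2 * m 3, m 0 * m 2 * m 3, m 0 * m 1 * m 3, m 0 * m 1 * m 2]

lemma cbrt (a : ℝ) : ∃ P : ℝ, P ^ 3 = a := by
  have pos : ∀ a : ℝ, 0 ≤ a → ∃ P : ℝ, P ^ 3 = a := by
    intro a ha
    refine ⟨a ^ ((1:ℝ) / 3), ?_⟩
    rw [← Real.rpow_natCast, ← Real.rpow_mul ha]; norm_num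
  rcases le_total 0 a with h | h
  · exact pos a h
  · obtain ⟨P, hP⟩ := pos (-a) (by linarith)
    exact ⟨-P, by rw [Odd.neg_pow (by decide), hP, neg_neg]⟩

lemma pt_inj (m m' : Fin 4 → ℤ) (h : ∀ i, m i ≠ 0) (e : pt m = pt m') : m = m' := by
  have e0 : m 1 * m 2 * m 3 = m' 1 * m' 2 * m' 3 := congrFun e 0
  have e1 : m 0 * m 2 * m 3 = m' 0 * m' 2 * m' 3 := congrFun e 1
  have e2 : m 0 * m 1 * m 3 = m' 0 * m' 1 * m' 3 := congrFun e 2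
  have e3 : m 0 * m 1 * m 2 = m' 0 * m' 1 * m' 2 := congrFun e 3
  have hM : (m 0 * m 1 * m 2 * m 3) ^ 3 = (m' 0 * m' 1 * m' 2 * m' 3) ^ 3 := by
    calc (m 0 * m 1 * m 2 * m 3) ^ 3 = (m 1 * m 2 * m 3) * (m 0 * m 2 * m 3) * (m 0 * m 1 * m 3) * (m 0 * m 1 * m 2) := by ring
      _ = (m' 1 * m' 2 * m' 3) * (m' 0 * m' 2 * m' 3) * (m' 0 * m' 1 * m' 3) * (m' 0 * m' 1 * m' 2) := by rw [e0, e1, e2, e3]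
      _ = _ := by ring
  have hM' : m 0 * m 1 * m 2 * m 3 = m' 0 * m' 1 * m' 2 * m' 3 := Odd.pow_injective (by decide) hM
  have h0 := h 0
  have h1 := h 1
  have h2 := h 2
  have h3 := h 3
  have f0 : m 0 = m' 0 := by
    have : (m 0 - m' 0) * (m 1 * m 2 * m 3) = 0 := by linear_combination hM' - m' 0 * e0
    rcases mul_eq_zero.1 this with t | t
    · linarith
    · exact absurd t (by positivity)
  have f1 : m 1 = m' 1 := by
    have : (m 1 - m' 1) * (m 0 * m 2 * m 3) = 0 := by linear_combination hM' - m' 1 * e1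
    rcases mul_eq_zero.1 this with t | t
    · linarith
    · exact absurd t (by positivity)
  have f2 : m 2 = m' 2 := by
    have : (m 2 - m' 2) * (m 0 * m 1 * m 3) = 0 := by linear_combination hM' - m' 2 * e2
    rcases mul_eq_zero.1 this with t | t
    · linarith
    · exact absurd t (by positivity)
  have f3 : m 3 = m' 3 := by
    have : (m 3 - m' 3) * (m 0 * m 1 * m 2) = 0 := by linear_combination hM' - m' 3 * e3
    rcases mul_eq_zero.1 this with t | t
    · linarith
    · exact absurd t (by positivity)
  funext i
  fin_cases i <;> assumption

lemma pt_arith (m : Fin 4 → ℤ) (hp : ∀ i, (m i).natAbs.Prime) (hne : ∀ i j, i ≠ j → m i ≠ m j) (hne' : ∀ i j, i ≠ j → m i + m j ≠ 0)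
    (hs : ∑ i, m i = 0) :
    Int.gcd (Int.gcd (pt m 0) (pt m 1)) (Int.gcd (pt m 2) (pt m 3)) = 1 ∧
    pt m 1 * pt m 2 * pt m 3 + pt m 0 * pt m 2 * pt m 3 + pt m 0 * pt m 1 * pt m 3 + pt m 0 * pt m 1 * pt m 2 = 0 ∧
    pt m 0 * pt m 1 * pt m 2 * pt m 3 ≠ 0 ∧ (∀ i j, i ≠ j → pt m i + pt m j ≠ 0) ∧
    (pt m 0 * pt m 1 * pt m 2 * pt m 3).natAbs.primeFactors.card ≤ 4 := by
  have hz : ∀ i, m i ≠ 0 := by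
    intro i h; have := (hp i).ne_zero; rw [h] at this; exact this rfl
  have p0 : pt m 0 = m 1 * m 2 * m 3 := rfl
  have p1 : pt m 1 = m 0 * m 2 * m 3 := rfl
  have p2 : pt m 2 = m 0 * m 1 * m 3 := rfl
  have p3 : pt m 3 = m 0 * m 1 * m 2 := rfl
  have z0 := hz 0
  have z1 := hz 1
  have z2 := hz 2
  have z3 := hz 3
  have hM : pt m 0 * pt m 1 * pt m 2 * pt m 3 = (m 0 * m 1 * m 2 * m 3) ^ 3 := by rw [p0, p1, p2, p3]; ring
  have cop : ∀ i j, i ≠ j → (m i).natAbs.Coprime (m j).natAbs := by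
    intro i j hij
    rw [Nat.coprime_primes (hp i) (hp j)]
    intro h
    rcases Int.natAbs_eq_natAbs_iff.1 h with h | h
    · exact hne i j hij h
    · exact hne' i j hij (by linarith)
  have c01 := cop 0 1 (by decide)
  have c02 := cop 0 2 (by decide)
  have c03 := cop 0 3 (by decide)
  have c12 := cop 1 2 (by decide)
  have c13 := cop 1 3 (by decide)
  have c23 := cop 2 3 (by decide)
  refine ⟨?_, ?_, ?_, ?_, ?_⟩
  · have g1 : Int.gcd (pt m 0) (pt m 1) = (m 2).natAbs * (m 3).natAbs := by
      rw [p0, p1, Int.gcd_mul_right, Int.gcd_mul_right, show Int.gcd (m 1) (m 0) = 1 from c01.symm, one_mul]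
    have g2 : Int.gcd (pt m 2) (pt m 3) = (m 0).natAbs * (m 1).natAbs := by
      rw [p2, p3, Int.gcd_mul_left, show Int.gcd (m 3) (m 2) = 1 from c23.symm, mul_one, Int.natAbs_mul]
    rw [g1, g2]
    rw [Int.gcd_natCast_natCast]
    exact Nat.Coprime.mul_left (Nat.Coprime.mul_right c02.symm c12.symm) (Nat.Coprime.mul_right c03.symm c13.symm)
  · rw [Fin.sum_univ_four] at hs
    rw [p0, p1, p2, p3]
    linear_combination (m 0 * m 1 * m 2 * m 3) ^ 2 * hs
  · rw [hM]; positivity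
  · have gen : ∀ a b c d : Fin 4, a ≠ b → (m a + m b) * (m c * m d) ≠ 0 := by
      intro a b c d hab
      exact mul_ne_zero (hne' a b hab) (mul_ne_zero (hz c) (hz d))
    have q01 : pt m 0 + pt m 1 ≠ 0 := by rw [p0, p1]; convert gen 0 1 2 3 (by decide) using 1; ring
    have q02 : pt m 0 + pt m 2 ≠ 0 := by rw [p0, p2]; convert gen 0 2 1 3 (by decide) using 1; ring
    have q03 : pt m 0 + pt m 3 ≠ 0 := by rw [p0, p3]; convert gen 0 3 1 2 (by decide) using 1; ring
    have q12 : pt m 1 + pt m 2 ≠ 0 := by rw [p1, p2]; convert gen 1 2 0 3 (by decide) using 1; ring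
    have q13 : pt m 1 + pt m 3 ≠ 0 := by rw [p1, p3]; convert gen 1 3 0 2 (by decide) using 1; ring
    have q23 : pt m 2 + pt m 3 ≠ 0 := by rw [p2, p3]; convert gen 2 3 0 1 (by decide) using 1; ring
    intro i j hij
    fin_cases i <;> fin_cases j <;> first | exact absurd rfl hij | assumption | (rw [add_comm]; assumption)
  · rw [hM, Int.natAbs_pow, Nat.primeFactors_pow _ (by norm_num), Int.natAbs_mul, Int.natAbs_mul, Int.natAbs_mul]
    have n0 := (hp 0).ne_zero
    have n1 := (hp 1).ne_zero
    have n2 := (hp 2).ne_zero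
    have n3 := (hp 3).ne_zero
    rw [Nat.primeFactors_mul (by positivity) n3, Nat.primeFactors_mul (by positivity) n2, Nat.primeFactors_mul n0 n1,
      (hp 0).primeFactors, (hp 1).primeFactors, (hp 2).primeFactors, (hp 3).primeFactors]
    refine (Finset.card_union_le _ _).trans ?_
    have a1 := Finset.card_union_le ({(m 0).natAbs} ∪ {(m 1).natAbs}) ({(m 2).natAbs} : Finset ℕ)
    have a2 := Finset.card_union_le ({(m 0).natAbs}) ({(m 1).natAbs} : Finset ℕ)
    simp only [Finset.card_singleton] at *
    omega

lemma triple_close (a b c a' b' c' H δ : ℝ) (hδ : 0 ≤ δ) (ha : |a - a'| ≤ δ) (hb : |b - b'| ≤ δ) (hc : |c - c'| ≤ δ)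
    (hb1 : |b| ≤ H) (hc1 : |c| ≤ H) (ha2 : |a'| ≤ H) (hb2 : |b'| ≤ H) : |a * b * c - a' * b' * c'| ≤ 3 * H ^ 2 * δ := by
  have H0 : 0 ≤ H := (abs_nonneg _).trans hb1
  have e : a * b * c - a' * b' * c' = (a - a') * (b * c) + (b - b') * (a' * c) + (c - c') * (a' * b') := by ring
  rw [e]
  have t1 : |(a - a') * (b * c)| ≤ δ * (H * H) := by rw [abs_mul, abs_mul]; gcongr
  have t2 : |(b - b') * (a' * c)| ≤ δ * (H * H) := by rw [abs_mul, abs_mul]; gcongr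
  have t3 : |(c - c') * (a' * b')| ≤ δ * (H * H) := by rw [abs_mul, abs_mul]; gcongr
  have := abs_add_three ((a - a') * (b * c)) ((b - b') * (a' * c)) ((c - c') * (a' * b'))
  nlinarith

lemma pt_close (η : Fin 4 → ℝ) (m : Fin 4 → ℤ) (X δ : ℝ) (hX : 0 < X) (hδ : 0 ≤ δ) (hδ1 : δ ≤ 1) (hm : ∀ i, |(m i:ℝ) - η i * X| ≤ δ * X) (ξ : Fin 4 → ℝ)
    (h0 : ξ 0 = η 1 * η 2 * η 3) (h1 : ξ 1 = η 0 * η 2 * η 3) (h2 : ξ 2 = η 0 * η 1 * η 3) (h3 : ξ 3 = η 0 * η 1 * η 2) (i : Fin 4) :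
    |(pt m i : ℝ) / X ^ 3 - ξ i| ≤ 3 * (1 + ∑ i, |η i|) ^ 2 * δ := by
  have hμ : ∀ i, |(m i:ℝ) / X - η i| ≤ δ := by
    intro i
    have e : (m i:ℝ) / X - η i = ((m i:ℝ) - η i * X) / X := by field_simp
    rw [e, abs_div, abs_of_pos hX, div_le_iff₀ hX]; exact hm i
  have hη : ∀ i, |η i| ≤ 1 + ∑ i, |η i| := by
    intro i
    have := Finset.single_le_sum (f := fun i => |η i|) (fun _ _ => abs_nonneg _) (mem_univ i)
    linarith
  have hμ' : ∀ i, |(m i:ℝ) / X| ≤ 1 + ∑ i, |η i| := by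
    intro i
    have h1 := Finset.single_le_sum (f := fun i => |η i|) (fun _ _ => abs_nonneg _) (mem_univ i)
    have h2 := abs_add_le ((m i:ℝ) / X - η i) (η i)
    rw [sub_add_cancel] at h2
    have := hμ i
    linarith
  have gen : ∀ i j k : Fin 4, |((m i * m j * m k : ℤ) : ℝ) / X ^ 3 - η i * η j * η k| ≤ 3 * (1 + ∑ i, |η i|) ^ 2 * δ := by
    intro i j k
    have e : ((m i * m j * m k : ℤ) : ℝ) / X ^ 3 = (m i:ℝ) / X * ((m j:ℝ) / X) * ((m k:ℝ) / X) := by push_cast; field_simp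
    rw [e]
    exact triple_close _ _ _ _ _ _ _ δ hδ (hμ i) (hμ j) (hμ k) (hμ' j) (hμ' k) (hη i) (hη j)
  fin_cases i
  · have := gen 1 2 3; rw [← h0] at this; exact this
  · have := gen 0 2 3; rw [← h1] at this; exact this
  · have := gen 0 1 3; rw [← h2] at this; exact this
  · have := gen 0 1 2; rw [← h3] at this; exact this

lemma fin_box (ξ : Fin 4 → ℝ) (B r : ℝ) (hB : 0 < B) : {x : Fin 4 → ℤ | ∀ i, |(x i : ℝ) / B - ξ i| ≤ r}.Finite := by
  set N : ℤ := ⌈B * (r + ∑ i, |ξ i|)⌉ with hN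
  refine (Set.finite_Icc (fun _ : Fin 4 => -N) (fun _ => N)).subset ?_
  intro x hx
  have key : ∀ i, |(x i : ℝ)| ≤ N := by
    intro i
    have h1 := Finset.single_le_sum (f := fun i => |ξ i|) (fun _ _ => abs_nonneg _) (mem_univ i)
    have h2 := abs_add_le ((x i:ℝ) / B - ξ i) (ξ i)
    rw [sub_add_cancel, abs_div, abs_of_pos hB] at h2
    have h3 := hx i
    have h4 : |(x i:ℝ)| / B ≤ r + ∑ i, |ξ i| := by linarith
    rw [div_le_iff₀ hB] at h4
    have := Int.le_ceil (B * (r + ∑ i, |ξ i|))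
    rw [← hN] at this
    linarith
  constructor
  · intro i
    have := (abs_le.1 (key i)).1
    show -N ≤ x i
    exact_mod_cast this
  · intro i
    have := (abs_le.1 (key i)).2
    show x i ≤ N
    exact_mod_cast this

open Classical in
theorem main (ξ : Fin 4 → ℝ)
    (hsurf : ξ 1 * ξ 2 * ξ 3 + ξ 0 * ξ 2 * ξ 3 + ξ 0 * ξ 1 * ξ 3 + ξ 0 * ξ 1 * ξ 2 = 0)
    (hnz : ξ 0 * ξ 1 * ξ 2 * ξ 3 ≠ 0)
    (hln : ∀ i j, i ≠ j → ξ i + ξ j ≠ 0) :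
    ∃ C : ℝ, 0 < C ∧ ∃ c : ℝ, 0 < c ∧ ∃ B₀ : ℝ, ∀ B : ℝ, B₀ ≤ B →
      c * B / (Real.log B) ^ 7 ≤
        (Set.ncard {x : Fin 4 → ℤ |
          Int.gcd (Int.gcd (x 0) (x 1)) (Int.gcd (x 2) (x 3)) = 1 ∧
          x 1 * x 2 * x 3 + x 0 * x 2 * x 3 + x 0 * x 1 * x 3 + x 0 * x 1 * x 2 = 0 ∧
          x 0 * x 1 * x 2 * x 3 ≠ 0 ∧
          (∀ i j, i ≠ j → x i + x j ≠ 0) ∧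
          (∀ i, |(x i : ℝ) / B - ξ i| ≤ C / Real.log B) ∧
          (x 0 * x 1 * x 2 * x 3).natAbs.primeFactors.card ≤ 4} : ℝ) := by
  obtain ⟨P, hP⟩ := cbrt (ξ 0 * ξ 1 * ξ 2 * ξ 3)
  have hP0 : P ≠ 0 := by intro h; rw [h] at hP; apply hnz; rw [← hP]; norm_num
  have x0 : ξ 0 ≠ 0 := by intro h; apply hnz; rw [h]; ring
  have x1 : ξ 1 ≠ 0 := by intro h; apply hnz; rw [h]; ring
  have x2 : ξ 2 ≠ 0 := by intro h; apply hnz; rw [h]; ring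
  have x3 : ξ 3 ≠ 0 := by intro h; apply hnz; rw [h]; ring
  have xi : ∀ i, ξ i ≠ 0 := by intro i; fin_cases i <;> assumption
  set η : Fin 4 → ℝ := fun i => P / ξ i with hη
  have η0 : ∀ i, η i ≠ 0 := fun i => div_ne_zero hP0 (xi i)
  have hs : ∑ i, η i = 0 := by
    rw [Fin.sum_univ_four]
    simp only [hη]
    field_simp
    linear_combination P * hsurf
  have ηs : ∀ i j, i ≠ j → η i + η j ≠ 0 := by
    intro i j hij h
    have e : η i + η j = P * (ξ i + ξ j) / (ξ i * ξ j) := by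
      simp only [hη]; have := xi i; have := xi j; field_simp; ring
    rw [e] at h
    exact div_ne_zero (mul_ne_zero hP0 (hln i j hij)) (mul_ne_zero (xi i) (xi j)) h
  have h0 : ξ 0 = η 1 * η 2 * η 3 := by simp only [hη]; field_simp; linear_combination -hP
  have h1 : ξ 1 = η 0 * η 2 * η 3 := by simp only [hη]; field_simp; linear_combination -hP
  have h2 : ξ 2 = η 0 * η 1 * η 3 := by simp only [hη]; field_simp; linear_combination -hP
  have h3 : ξ 3 = η 0 * η 1 * η 2 := by simp only [hη]; field_simp; linear_combination -hP
  obtain ⟨X₁, H1⟩ := good_count η η0 hs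
  set L : ℝ := 1 + ∑ i, ∑ j, 8 / |η i + η j| with hL
  obtain ⟨X₂, hX₂, H2⟩ := basic_large η L
  set H : ℝ := 1 + ∑ i, |η i| with hH
  have Hpos : 0 < H := by rw [hH]; have : 0 ≤ ∑ i, |η i| := Finset.sum_nonneg fun _ _ => abs_nonneg _
                          linarith
  refine ⟨18 * H ^ 2, by positivity, 1 / 200000, by norm_num, (max X₁ X₂) ^ 3, fun B hB => ?_⟩
  have hmax : 1 ≤ max X₁ X₂ := hX₂.trans (le_max_right _ _)
  have B1 : 1 ≤ B := (one_le_pow₀ hmax).trans hB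
  have B0 : 0 < B := by linarith
  set X : ℝ := B ^ ((1:ℝ) / 3) with hXdef
  have X0 : 0 < X := Real.rpow_pos_of_pos B0 _
  have hX3 : X ^ 3 = B := by
    rw [hXdef, ← Real.rpow_natCast, ← Real.rpow_mul B0.le]; norm_num
  have hXge : max X₁ X₂ ≤ X := by
    rw [← hX3] at hB
    exact le_of_pow_le_pow_left₀ (by norm_num) X0.le hB
  have hlog : Real.log B = 3 * Real.log X := by rw [← hX3, Real.log_pow]; norm_num
  obtain ⟨lL, l4, l200, kl, ku, k3, hm⟩ := H2 X ((le_max_right _ _).trans hXge)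
  have hcount := H1 X ((le_max_left _ _).trans hXge)
  set l := Real.log X with hl
  have l0 : 0 < l := by linarith
  set A := (Sol (fun i => JJ ⌊η i * X⌋ (KK X))).filter Good with hA
  set T := {x : Fin 4 → ℤ |
          Int.gcd (Int.gcd (x 0) (x 1)) (Int.gcd (x 2) (x 3)) = 1 ∧
          x 1 * x 2 * x 3 + x 0 * x 2 * x 3 + x 0 * x 1 * x 3 + x 0 * x 1 * x 2 = 0 ∧
          x 0 * x 1 * x 2 * x 3 ≠ 0 ∧
          (∀ i j, i ≠ j → x i + x j ≠ 0) ∧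
          (∀ i, |(x i : ℝ) / B - ξ i| ≤ 18 * H ^ 2 / Real.log B) ∧
          (x 0 * x 1 * x 2 * x 3).natAbs.primeFactors.card ≤ 4} with hT
  have Tfin : T.Finite := (fin_box ξ B _ B0).subset (fun x hx => hx.2.2.2.2.1)
  have hAm : ∀ m ∈ A, (∀ i, m i ∈ JJ ⌊η i * X⌋ (KK X)) ∧ ∑ i, m i = 0 ∧ Good m := by
    intro m hmA
    simp only [hA, mem_filter, Sol, Fintype.mem_piFinset] at hmA
    exact ⟨hmA.1.1, hmA.1.2, hmA.2⟩
  have hsub : ((A.image pt : Finset (Fin 4 → ℤ)) : Set (Fin 4 → ℤ)) ⊆ T := by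
    intro x hx
    rw [Finset.mem_coe, mem_image] at hx
    obtain ⟨m, hmA, rfl⟩ := hx
    obtain ⟨hmJ, hms, hp, hne⟩ := hAm m hmA
    have hcl : ∀ i, |(m i:ℝ) - η i * X| ≤ 2 / l * X := by
      intro i
      have := (hm i (m i) (hmJ i)).1
      have e : 2 / l * X = 2 * X / l := by ring
      rw [e]; exact this
    have hne' : ∀ i j, i ≠ j → m i + m j ≠ 0 := by
      intro i j hij h
      have hr : (m i:ℝ) + m j = 0 := by exact_mod_cast h
      have a1 : |(η i + η j) * X| ≤ 4 / l * X := by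
        have e : (η i + η j) * X = -((m i:ℝ) - η i * X) - ((m j:ℝ) - η j * X) := by linear_combination hr
        rw [e]
        have b1 := abs_sub (-((m i:ℝ) - η i * X)) ((m j:ℝ) - η j * X)
        rw [abs_neg] at b1
        have b2 := hcl i
        have b3 := hcl j
        have e2 : 4 / l * X = 2 / l * X + 2 / l * X := by ring
        rw [e2]; linarith
      rw [abs_mul, abs_of_pos X0] at a1
      have a2 := le_of_mul_le_mul_right a1 X0
      have s0 : 0 < |η i + η j| := abs_pos.2 (ηs i j hij)
      rw [le_div_iff₀ l0] at a2
      have c1 : 8 / |η i + η j| ≤ ∑ j, 8 / |η i + η j| :=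
        Finset.single_le_sum (f := fun j => 8 / |η i + η j|) (fun j _ => by positivity) (mem_univ j)
      have c2 : ∑ j, 8 / |η i + η j| ≤ ∑ i, ∑ j, 8 / |η i + η j| :=
        Finset.single_le_sum (f := fun i => ∑ j, 8 / |η i + η j|) (fun i _ => Finset.sum_nonneg fun j _ => by positivity) (mem_univ i)
      have c3 : 8 / |η i + η j| ≤ l := by linarith
      rw [div_le_iff₀ s0] at c3
      linarith
    obtain ⟨r1, r2, r3, r4, r5⟩ := pt_arith m hp hne hne' hms
    refine ⟨r1, r2, r3, r4, fun i => ?_, r5⟩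
    have hc := pt_close η m X (2 / l) X0 (by positivity) (by rw [div_le_one l0]; linarith) hcl ξ h0 h1 h2 h3 i
    rw [hX3] at hc
    refine hc.trans (le_of_eq ?_)
    rw [hlog, ← hH]; field_simp; norm_num
  have hcard : A.card ≤ T.ncard := by
    have h5 := Set.ncard_le_ncard hsub Tfin
    rw [Set.ncard_coe_finset, Finset.card_image_of_injOn] at h5
    · exact h5
    · intro m hmA m' _ e
      obtain ⟨-, -, hp, -⟩ := hAm m hmA
      exact pt_inj m m' (fun i h => by have := (hp i).ne_zero; rw [h] at this; exact this rfl) e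
  calc 1 / 200000 * B / Real.log B ^ 7 ≤ X ^ 3 / (200000 * l ^ 7) := by
        rw [hlog, hX3]
        have e : 1 / 200000 * B / (3 * l) ^ 7 = B / (200000 * l ^ 7) * (1 / 2187) := by field_simp; norm_num
        rw [e]
        have : 0 ≤ B / (200000 * l ^ 7) := by positivity
        linarith
    _ ≤ (A.card : ℝ) := hcount
    _ ≤ _ := by exact_mod_cast hcard

end Cayley
end

/-- The remark after the Theorem: the modified saturation number `r̃(S₀)` of Cayley's cubic
surface is at most 4. Given a real point `ξ` on the open subset `U₀`, the number of primitive
integral points on `U₀` close to `B • ξ` whose coordinate product has at most 4 distinct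
prime factors is `≫ B (log B)⁻⁷`. -/
theorem cayley_saturation_distinct_four
    (ξ : Fin 4 → ℝ)
    (hsurf : ξ 1 * ξ 2 * ξ 3 + ξ 0 * ξ 2 * ξ 3 + ξ 0 * ξ 1 * ξ 3 + ξ 0 * ξ 1 * ξ 2 = 0)
    (hnz : ξ 0 * ξ 1 * ξ 2 * ξ 3 ≠ 0)
    (hln : ∀ i j, i ≠ j → ξ i + ξ j ≠ 0) :
    ∃ C : ℝ, 0 < C ∧ ∃ c : ℝ, 0 < c ∧ ∃ B₀ : ℝ, ∀ B : ℝ, B₀ ≤ B →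
      c * B / (Real.log B) ^ 7 ≤
        (Set.ncard {x : Fin 4 → ℤ |
          Int.gcd (Int.gcd (x 0) (x 1)) (Int.gcd (x 2) (x 3)) = 1 ∧
          x 1 * x 2 * x 3 + x 0 * x 2 * x 3 + x 0 * x 1 * x 3 + x 0 * x 1 * x 2 = 0 ∧
          x 0 * x 1 * x 2 * x 3 ≠ 0 ∧
          (∀ i j, i ≠ j → x i + x j ≠ 0) ∧
          (∀ i, |(x i : ℝ) / B - ξ i| ≤ C / Real.log B) ∧
          (x 0 * x 1 * x 2 * x 3).natAbs.primeFactors.card ≤ 4} : ℝ) := by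
  exact Cayley.main ξ hsurf hnz hln
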